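/- There exist a universal constant C > 0, a universal ε₀ > 0, and for each M ≥ 1 a constant c(M) > 0 with the following property. Let 0 < ε ≤ ε₀, let 0 < T ≤ c(M)·ε^{-3}, and let u be a KdV solution on [0,T] whose initial data satisfies ‖u(0,·)‖_{Ḃ^{-1/2}_{2,∞}} + ‖x·u(0,·)‖_{Ḣ^{1/2}} ≤ ε, and which satisfies the bootstrap bounds with constants M, ε for every t ∈ (0,T]. Then for every t ∈ (0,T]: ‖L^{NL}u(t)‖_{Ḣ^{1/2}} ≤ C·ε. -/

import Mathlib

open MeasureTheory Real SchwartzMap Set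
open scoped FourierTransform

noncomputable section

/-- Fourier transform of a real-valued function on `ℝ`. -/
def FT (u : ℝ → ℝ) : ℝ → ℂ := 𝓕 (fun x => (u x : ℂ))

/-- Homogeneous Sobolev norm `‖u‖_{Ḣˢ}`. -/
def HsNorm (s : ℝ) (u : ℝ → ℝ) : ℝ :=
  (∫ ξ : ℝ, |ξ| ^ (2 * s) * ‖FT u ξ‖ ^ 2) ^ (1/2 : ℝ)

/-- Homogeneous Besov norm `‖u‖_{Ḃ^{-1/2}_{2,∞}}`. -/
def BesovNorm (u : ℝ → ℝ) : ℝ :=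
  ⨆ j : ℤ, (2:ℝ) ^ (-(j:ℝ)/2) *
    (∫ ξ in {ξ : ℝ | (2:ℝ)^j ≤ |ξ| ∧ |ξ| < (2:ℝ)^(j+1)}, ‖FT u ξ‖^2) ^ (1/2:ℝ)

/-- `L²` norm. -/
def L2Norm (u : ℝ → ℝ) : ℝ := (∫ x : ℝ, u x ^ 2) ^ (1/2:ℝ)

/-- `L²` norm restricted to a set. -/
def L2NormOn (A : Set ℝ) (u : ℝ → ℝ) : ℝ := (∫ x in A, u x ^ 2) ^ (1/2:ℝ)

/-- The time-dependent japanese bracket `⟨x⟩ = (x² + t^{2/3})^{1/2}`. -/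
def jb (t x : ℝ) : ℝ := (x^2 + t ^ ((2:ℝ)/3)) ^ (1/2:ℝ)

/-- `u` is a KdV solution on the time interval `I`: it is smooth on `I × ℝ`,
Schwartz in `x` for each `t ∈ I`, and satisfies `∂ₜu + ∂ₓ³u - 6u∂ₓu = 0` on `I × ℝ`. -/
def IsKdVOn (I : Set ℝ) (u : ℝ → ℝ → ℝ) : Prop :=
  ContDiffOn ℝ (⊤ : ℕ∞) (fun p : ℝ × ℝ => u p.1 p.2) (I ×ˢ (Set.univ : Set ℝ)) ∧
  (∀ t ∈ I, ∃ f : 𝓢(ℝ, ℝ), ∀ x, u t x = f x) ∧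
  (∀ t ∈ I, ∀ x : ℝ,
    deriv (fun s => u s x) t + iteratedDeriv 3 (u t) x - 6 * u t x * deriv (u t) x = 0)

/-- The bootstrap bounds with constants `M`, `ε` at time `t`. -/
def Bootstrap (M ε t : ℝ) (u : ℝ → ℝ) : Prop :=
  ∀ x : ℝ, |u x| ≤ M * ε * t ^ (-(1:ℝ)/4) * jb t x ^ (-(1:ℝ)/4) ∧
    |deriv u x| ≤ M * ε * t ^ (-(3:ℝ)/4) * jb t x ^ ((1:ℝ)/4)

/-- The nonlinear operator `L^{NL}u(t)(x) = x·u(x) - 3t·u''(x) + 9t·u(x)²`. -/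
def LNL (t : ℝ) (u : ℝ → ℝ) : ℝ → ℝ :=
  fun x => x * u x - 3 * t * iteratedDeriv 2 u x + 9 * t * u x ^ 2

open scoped ENNReal

/-- The weight `(1 + |x|)^(-q)` as an extended nonnegative real. -/
def wt (q x : ℝ) : ℝ≥0∞ := ENNReal.ofReal ((1 + |x|) ^ (-q))

theorem one_add_abs_pos (x : ℝ) : 0 < 1 + |x| := by positivity

@[fun_prop]
theorem measurable_wt (q : ℝ) : Measurable (wt q) := by
  unfold wt; fun_prop

theorem wt_mul_wt (a b x : ℝ) : wt a x * wt b x = wt (a + b) x := by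
  unfold wt
  rw [← ENNReal.ofReal_mul (by positivity), ← Real.rpow_add (one_add_abs_pos x)]
  ring_nf

theorem wt_zero (x : ℝ) : wt 0 x = 1 := by simp [wt]

theorem wt_neg (q x : ℝ) : wt q (-x) = wt q x := by simp [wt]

theorem wt_sub_comm (q x y : ℝ) : wt q (x - y) = wt q (y - x) := by
  rw [← wt_neg, neg_sub]

theorem wt_anti {p q : ℝ} (h : p ≤ q) (x : ℝ) : wt q x ≤ wt p x := by
  unfold wt
  apply ENNReal.ofReal_le_ofReal
  apply Real.rpow_le_rpow_of_exponent_le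
  · linarith [abs_nonneg x]
  · linarith

theorem wt_le_one {q : ℝ} (h : 0 ≤ q) (x : ℝ) : wt q x ≤ 1 :=
  (wt_anti h x).trans_eq (wt_zero x)

theorem wt_ne_top (q x : ℝ) : wt q x ≠ ⊤ := ENNReal.ofReal_ne_top

/-- The total mass of the weight. -/
def wtMass (q : ℝ) : ℝ≥0∞ := ∫⁻ x, wt q x

theorem wtMass_lt_top {q : ℝ} (h : 1 < q) : wtMass q < ⊤ := by
  have := finite_integral_one_add_norm (E := ℝ) (μ := volume) (r := q) (by simpa using h)
  simpa [wtMass, wt] using this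

theorem lintegral_comp_const_sub (f : ℝ → ℝ≥0∞) (c : ℝ) :
    ∫⁻ x, f (c - x) = ∫⁻ x, f x :=
  lintegral_sub_left_eq_self f c

theorem lintegral_wt_sub (q c : ℝ) : ∫⁻ x, wt q (c - x) = wtMass q :=
  lintegral_comp_const_sub (wt q) c

theorem lintegral_wt_sub' (q c : ℝ) : ∫⁻ x, wt q (x - c) = wtMass q := by
  simp_rw [wt_sub_comm q _ c]; exact lintegral_wt_sub q c

/-- The mixed product of weights is bounded by the sum of the pure ones. -/
theorem wt_mul_wt_le {α β : ℝ} (hα : 0 ≤ α) (hβ : 0 ≤ β) (x y : ℝ) :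
    wt α x * wt β y ≤ wt (α + β) x + wt (α + β) y := by
  rcases le_total |x| |y| with h | h
  · have : wt β y ≤ wt β x := by
      unfold wt
      apply ENNReal.ofReal_le_ofReal
      apply Real.rpow_le_rpow_of_nonpos (one_add_abs_pos x) (by linarith) (by linarith)
    calc wt α x * wt β y ≤ wt α x * wt β x := by gcongr
      _ = wt (α + β) x := wt_mul_wt _ _ _
      _ ≤ _ := le_self_add
  · have : wt α x ≤ wt α y := by
      unfold wt
      apply ENNReal.ofReal_le_ofReal
      apply Real.rpow_le_rpow_of_nonpos (one_add_abs_pos y) (by linarith) (by linarith)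
    calc wt α x * wt β y ≤ wt α y * wt β y := by gcongr
      _ = wt (α + β) y := wt_mul_wt _ _ _
      _ ≤ _ := le_add_self

/-- Peetre-type inequality for sums. -/
theorem wt_neg_le_add {q : ℝ} (hq : 0 ≤ q) (x y : ℝ) :
    wt (-q) x ≤ ENNReal.ofReal (2 ^ q) * (wt (-q) y + wt (-q) (x - y)) := by
  have key : (1 + |x|) ^ q ≤ 2 ^ q * ((1 + |y|) ^ q + (1 + |x - y|) ^ q) := by
    have h1 : |x| ≤ |y| + |x - y| := by
      calc |x| = |y + (x - y)| := by ring_nf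
        _ ≤ _ := abs_add_le _ _
    have py := one_add_abs_pos y
    have pz := one_add_abs_pos (x - y)
    rcases le_total |y| |x - y| with h | h
    · calc (1 + |x|) ^ q ≤ (2 * (1 + |x - y|)) ^ q := by
            apply Real.rpow_le_rpow (one_add_abs_pos x).le _ hq; linarith
        _ = 2 ^ q * (1 + |x - y|) ^ q := by rw [Real.mul_rpow (by norm_num) pz.le]
        _ ≤ _ := by gcongr; linarith [Real.rpow_pos_of_pos py q]
    · calc (1 + |x|) ^ q ≤ (2 * (1 + |y|)) ^ q := by
            apply Real.rpow_le_rpow (one_add_abs_pos x).le _ hq; linarith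
        _ = 2 ^ q * (1 + |y|) ^ q := by rw [Real.mul_rpow (by norm_num) py.le]
        _ ≤ _ := by gcongr; linarith [Real.rpow_pos_of_pos pz q]
  unfold wt
  simp only [neg_neg]
  rw [← ENNReal.ofReal_add (by positivity) (by positivity), ← ENNReal.ofReal_mul (by positivity)]
  exact ENNReal.ofReal_le_ofReal key

theorem wt_neg_mul_cancel (q x : ℝ) : wt (-q) x * wt q x = 1 := by
  rw [wt_mul_wt]; simp [wt_zero]

/-- Convolution of two equal integrable weights. -/
theorem lintegral_wt_mul_wt {q : ℝ} (hq : 0 ≤ q) (c : ℝ) :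
    ∫⁻ s, wt q s * wt q (c - s) ≤ ENNReal.ofReal (2 ^ q) * (2 * wtMass q) * wt q c := by
  have h : ∀ s, wt q s * wt q (c - s) ≤
      ENNReal.ofReal (2 ^ q) * wt q c * (wt q (c - s) + wt q s) := by
    intro s
    have h1 := wt_neg_le_add hq c s
    calc wt q s * wt q (c - s) = (wt (-q) c * wt q c) * (wt q s * wt q (c - s)) := by
          rw [wt_neg_mul_cancel, one_mul]
      _ ≤ (ENNReal.ofReal (2 ^ q) * (wt (-q) s + wt (-q) (c - s)) * wt q c) *
            (wt q s * wt q (c - s)) := by gcongr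
      _ = ENNReal.ofReal (2 ^ q) * wt q c * ((wt (-q) s * wt q s) * wt q (c - s) +
            (wt (-q) (c - s) * wt q (c - s)) * wt q s) := by ring
      _ = _ := by simp only [wt_neg_mul_cancel, one_mul]
  calc ∫⁻ s, wt q s * wt q (c - s)
      ≤ ∫⁻ s, ENNReal.ofReal (2 ^ q) * wt q c * (wt q (c - s) + wt q s) := lintegral_mono h
    _ = ENNReal.ofReal (2 ^ q) * wt q c * (wtMass q + wtMass q) := by
        rw [lintegral_const_mul _ (by fun_prop), lintegral_add_left (by fun_prop),
          lintegral_wt_sub]; rfl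
    _ = _ := by ring

/-- A weight of exponent one convolved with a nearly integrable one. -/
theorem lintegral_wt_one_mul_wt {q η : ℝ} (hη : 0 ≤ η) (hq : η ≤ q) (hq1 : q ≤ 1 + η) (c : ℝ) :
    ∫⁻ s, wt 1 (c - s) * wt q s ≤
      ENNReal.ofReal (2 ^ (q - η)) * (4 * wtMass (1 + η)) * wt (q - η) c := by
  have h : ∀ s, wt 1 (c - s) * wt q s ≤
      ENNReal.ofReal (2 ^ (q - η)) * wt (q - η) c *
        (2 * wt (1 + η) (c - s) + 2 * wt (1 + η) s) := by
    intro s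
    have h1 := wt_neg_le_add (q := q - η) (by linarith) c s
    have e1 : wt (-(q - η)) s * wt q s = wt η s := by rw [wt_mul_wt]; congr 1; ring
    have e2 : wt (-(q - η)) (c - s) * wt 1 (c - s) = wt (1 - q + η) (c - s) := by
      rw [wt_mul_wt]; congr 1; ring
    calc wt 1 (c - s) * wt q s
        = (wt (-(q - η)) c * wt (q - η) c) * (wt 1 (c - s) * wt q s) := by
          rw [wt_neg_mul_cancel, one_mul]
      _ ≤ (ENNReal.ofReal (2 ^ (q - η)) * (wt (-(q - η)) s + wt (-(q - η)) (c - s)) *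
            wt (q - η) c) * (wt 1 (c - s) * wt q s) := by gcongr
      _ = ENNReal.ofReal (2 ^ (q - η)) * wt (q - η) c *
            (wt 1 (c - s) * (wt (-(q - η)) s * wt q s) +
            (wt (-(q - η)) (c - s) * wt 1 (c - s)) * wt q s) := by ring
      _ = ENNReal.ofReal (2 ^ (q - η)) * wt (q - η) c *
            (wt 1 (c - s) * wt η s + wt (1 - q + η) (c - s) * wt q s) := by rw [e1, e2]
      _ ≤ ENNReal.ofReal (2 ^ (q - η)) * wt (q - η) c *
            ((wt (1 + η) (c - s) + wt (1 + η) s) + (wt (1 + η) (c - s) + wt (1 + η) s)) := by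
          have a1 := wt_mul_wt_le (α := 1) (β := η) (by norm_num) hη (c - s) s
          have a2 := wt_mul_wt_le (α := 1 - q + η) (β := q) (by linarith) (by linarith) (c - s) s
          rw [show 1 - q + η + q = 1 + η by ring] at a2
          gcongr
      _ = _ := by ring
  calc ∫⁻ s, wt 1 (c - s) * wt q s
      ≤ ∫⁻ s, ENNReal.ofReal (2 ^ (q - η)) * wt (q - η) c *
        (2 * wt (1 + η) (c - s) + 2 * wt (1 + η) s) := lintegral_mono h
    _ = ENNReal.ofReal (2 ^ (q - η)) * wt (q - η) c * (2 * wtMass (1 + η) + 2 * wtMass (1 + η)) := by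
        rw [lintegral_const_mul _ (by fun_prop), lintegral_add_left (by fun_prop),
          lintegral_const_mul _ (by fun_prop), lintegral_const_mul _ (by fun_prop),
          lintegral_wt_sub]; rfl
    _ = _ := by ring

theorem lintegral_wt_quadratic_half {a : ℝ} (ha : a ≠ 0) (q c : ℝ) {S : Set ℝ}
    (hS : MeasurableSet S) (hinj : InjOn (fun z : ℝ => z ^ 2) S) :
    ∫⁻ z in S, ENNReal.ofReal (|a| * |z|) * wt q (c + a * z ^ 2) ≤ wtMass q := by
  have hd : ∀ x ∈ S, HasDerivWithinAt (fun z => c + a * z ^ 2) (a * (2 * x)) S x := by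
    intro x _
    have := (((hasDerivAt_pow 2 x).const_mul a).const_add c).hasDerivWithinAt (s := S)
    simpa using this
  have hi : InjOn (fun z => c + a * z ^ 2) S := by
    intro x hx y hy h
    have : a * x ^ 2 = a * y ^ 2 := by simpa using h
    exact hinj hx hy (mul_left_cancel₀ ha this)
  have := lintegral_image_eq_lintegral_abs_deriv_mul hS hd hi (wt q)
  calc ∫⁻ z in S, ENNReal.ofReal (|a| * |z|) * wt q (c + a * z ^ 2)
      ≤ ∫⁻ z in S, ENNReal.ofReal |a * (2 * z)| * wt q (c + a * z ^ 2) := by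
        apply lintegral_mono
        intro z
        dsimp only
        gcongr
        rw [abs_mul, abs_mul]
        have := abs_nonneg a
        have := abs_nonneg z
        simp only [Nat.abs_ofNat]
        nlinarith [mul_nonneg (abs_nonneg a) (abs_nonneg z)]
    _ = ∫⁻ y in (fun z => c + a * z ^ 2) '' S, wt q y := this.symm
    _ ≤ _ := setLIntegral_le_lintegral _ _

/-- Change of variables `y = a z²` in a weight. -/
theorem lintegral_wt_quadratic (a q c : ℝ) :
    ∫⁻ z, ENNReal.ofReal (|a| * |z|) * wt q (c + a * z ^ 2) ≤ 2 * wtMass q := by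
  rcases eq_or_ne a 0 with rfl | ha
  · simp
  have h1 := lintegral_wt_quadratic_half ha q c (S := Ici 0) measurableSet_Ici
    (fun x hx y hy h => by
      have h' : x ^ 2 = y ^ 2 := h
      exact (sq_eq_sq₀ (mem_Ici.1 hx) (mem_Ici.1 hy)).1 h')
  have h2 := lintegral_wt_quadratic_half ha q c (S := Iio 0) measurableSet_Iio
    (fun x hx y hy h => by
      have h' : x ^ 2 = y ^ 2 := h
      have hx' : x < 0 := hx
      have hy' : y < 0 := hy
      rcases sq_eq_sq_iff_eq_or_eq_neg.1 h' with h | h <;> linarith)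
  rw [← lintegral_add_compl _ (measurableSet_Ici (a := (0:ℝ))), compl_Ici, two_mul]
  exact add_le_add h1 h2

/-- The Cauchy-Schwarz inequality for lower integrals. -/
theorem lintegral_mul_sq_le {α : Type*} [MeasurableSpace α] {μ : Measure α} {f g : α → ℝ≥0∞}
    (hf : AEMeasurable f μ) (hg : AEMeasurable g μ) :
    (∫⁻ a, f a * g a ∂μ) ^ 2 ≤ (∫⁻ a, f a ^ 2 ∂μ) * ∫⁻ a, g a ^ 2 ∂μ := by
  have h := ENNReal.lintegral_mul_le_Lp_mul_Lq μ Real.HolderConjugate.two_two hf hg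
  simp only [Pi.mul_apply, ENNReal.rpow_ofNat] at h
  calc (∫⁻ a, f a * g a ∂μ) ^ 2 ≤
      ((∫⁻ a, f a ^ 2 ∂μ) ^ (1 / 2 : ℝ) * (∫⁻ a, g a ^ 2 ∂μ) ^ (1 / 2 : ℝ)) ^ 2 := by gcongr
    _ = _ := by
      rw [mul_pow, ← ENNReal.rpow_natCast, ← ENNReal.rpow_natCast, ← ENNReal.rpow_mul,
        ← ENNReal.rpow_mul]
      norm_num

/-- The maximum of `|x|` and `1 / |x|`. -/
def mm (x : ℝ) : ℝ := max |x| |x|⁻¹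

/-- The largest of `1` and three frequencies. -/
def freqMax (x y z : ℝ) : ℝ := max (max 1 |x|) (max |y| |z|)

theorem one_le_freqMax (x y z : ℝ) : 1 ≤ freqMax x y z := by
  unfold freqMax; exact (le_max_left _ _).trans (le_max_left _ _)

theorem abs_mul_mm_le {x N : ℝ} (hx : |x| ≤ N) (hN : 1 ≤ N) : |x| * mm x ≤ N ^ 2 := by
  unfold mm
  rcases eq_or_ne x 0 with rfl | h
  · simp; positivity
  have hx0 : 0 < |x| := abs_pos.2 h
  rw [mul_max_of_nonneg _ _ hx0.le, mul_inv_cancel₀ hx0.ne']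
  apply max_le <;> nlinarith

theorem one_le_mm {x : ℝ} (hx : x ≠ 0) : 1 ≤ mm x := by
  unfold mm
  have hx0 : 0 < |x| := abs_pos.2 hx
  rcases le_total 1 |x| with h | h
  · exact h.trans (le_max_left _ _)
  · exact ((one_le_inv₀ hx0).2 h).trans (le_max_right _ _)

theorem mm_nonneg (x : ℝ) : 0 ≤ mm x := (abs_nonneg x).trans (le_max_left _ _)

/-- The pointwise bound for the resonant kernel in terms of the two smaller modulations. -/
theorem kernel_pointwise {x y z a b c w : ℝ} (ha : 1 ≤ a) (hb : 1 ≤ b) (hc : 1 ≤ c) (hw : 1 ≤ w)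
    (hwc : w ≤ c) (h : |x * y * z| ≤ c) :
    |x * y * z| * (mm x * mm y * mm z) ^ (1 / 24 : ℝ) *
      (a ^ (-(25 / 24) : ℝ) * b ^ (-(25 / 24) : ℝ) * c ^ (-(25 / 24) : ℝ)) * w ^ (1 / 8 : ℝ) ≤
      freqMax x y z ^ (1 / 2 : ℝ) * (a ^ (-(25 / 24) : ℝ) * b ^ (-(25 / 24) : ℝ)) := by
  set P := |x * y * z| with hP
  set M := mm x * mm y * mm z with hM
  set N := freqMax x y z with hN
  have hN1 : 1 ≤ N := one_le_freqMax x y z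
  have hx : |x| ≤ N := (le_max_right _ _).trans (le_max_left _ _)
  have hy : |y| ≤ N := (le_max_left _ _).trans (le_max_right _ _)
  have hz : |z| ≤ N := (le_max_right _ _).trans (le_max_right _ _)
  have hP0 : 0 ≤ P := abs_nonneg _
  have hM0 : 0 ≤ M := mul_nonneg (mul_nonneg (mm_nonneg x) (mm_nonneg y)) (mm_nonneg z)
  have hc0 : 0 < c := by linarith
  have hPM : P ^ 2 * M ≤ N ^ 9 := by
    have h1 : P * M ≤ N ^ 6 := by
      calc P * M = (|x| * mm x) * (|y| * mm y) * (|z| * mm z) := by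
            rw [hP, hM, abs_mul, abs_mul]; ring
        _ ≤ N ^ 2 * N ^ 2 * N ^ 2 := by
            gcongr
            · exact mul_nonneg (abs_nonneg _) (mm_nonneg _)
            · exact mul_nonneg (abs_nonneg _) (mm_nonneg _)
            · exact abs_mul_mm_le hx hN1
            · exact abs_mul_mm_le hy hN1
            · exact abs_mul_mm_le hz hN1
        _ = N ^ 6 := by ring
    have h2 : P ≤ N ^ 3 := by
      rw [hP, abs_mul, abs_mul]
      calc |x| * |y| * |z| ≤ N * N * N := by gcongr
        _ = N ^ 3 := by ring
    calc P ^ 2 * M = P * (P * M) := by ring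
      _ ≤ N ^ 3 * N ^ 6 := by gcongr
      _ = N ^ 9 := by ring
  have hcw : c ^ (-(25 / 24) : ℝ) * w ^ (1 / 8 : ℝ) ≤ c ^ (-(11 / 12) : ℝ) := by
    calc c ^ (-(25 / 24) : ℝ) * w ^ (1 / 8 : ℝ) ≤ c ^ (-(25 / 24) : ℝ) * c ^ (1 / 8 : ℝ) := by
          gcongr
      _ = c ^ (-(11 / 12) : ℝ) := by rw [← Real.rpow_add hc0]; norm_num
  have key : P * M ^ (1 / 24 : ℝ) * c ^ (-(11 / 12) : ℝ) ≤ N ^ (1 / 2 : ℝ) := by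
    rcases hP0.eq_or_lt with h0 | h0
    · rw [← h0]; simp; positivity
    calc P * M ^ (1 / 24 : ℝ) * c ^ (-(11 / 12) : ℝ)
        ≤ P * M ^ (1 / 24 : ℝ) * P ^ (-(11 / 12) : ℝ) := by
          gcongr ?_ * ?_
          exact Real.rpow_le_rpow_of_nonpos h0 h (by norm_num)
      _ = (P ^ 2 * M) ^ (1 / 24 : ℝ) := by
          rw [Real.mul_rpow (by positivity) hM0, ← Real.rpow_natCast, ← Real.rpow_mul hP0]
          have : P * P ^ (-(11 / 12) : ℝ) = P ^ (((2 : ℕ) : ℝ) * (1 / 24)) := by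
            nth_rewrite 1 [← Real.rpow_one P]
            rw [← Real.rpow_add h0]; norm_num
          rw [← this]; ring
      _ ≤ (N ^ 9) ^ (1 / 24 : ℝ) := by gcongr
      _ = N ^ (3 / 8 : ℝ) := by
          rw [← Real.rpow_natCast, ← Real.rpow_mul (by linarith)]; norm_num
      _ ≤ _ := Real.rpow_le_rpow_of_exponent_le hN1 (by norm_num)
  calc P * M ^ (1 / 24 : ℝ) *
      (a ^ (-(25 / 24) : ℝ) * b ^ (-(25 / 24) : ℝ) * c ^ (-(25 / 24) : ℝ)) * w ^ (1 / 8 : ℝ)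
      = P * M ^ (1 / 24 : ℝ) * (c ^ (-(25 / 24) : ℝ) * w ^ (1 / 8 : ℝ)) *
        (a ^ (-(25 / 24) : ℝ) * b ^ (-(25 / 24) : ℝ)) := by ring
    _ ≤ P * M ^ (1 / 24 : ℝ) * c ^ (-(11 / 12) : ℝ) *
        (a ^ (-(25 / 24) : ℝ) * b ^ (-(25 / 24) : ℝ)) := by gcongr
    _ ≤ _ := by gcongr

/-- The third point of a resonant triple on the Fourier side. -/
def third (p q : ℝ × ℝ) : ℝ × ℝ :=
  (-p.1 - q.1, 3 * p.1 * q.1 * (p.1 + q.1) - p.2 - q.2)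

theorem third_comm (p q : ℝ × ℝ) : third p q = third q p := by
  unfold third; ext <;> simp <;> ring

theorem third_third (p q : ℝ × ℝ) : third (third p q) q = p := by
  unfold third; ext <;> simp; ring

theorem measurable_third : Measurable fun x : (ℝ × ℝ) × (ℝ × ℝ) => third x.1 x.2 := by
  unfold third; fun_prop

@[fun_prop]
theorem Measurable.third {α : Type*} [MeasurableSpace α] {f g : α → ℝ × ℝ} (hf : Measurable f)
    (hg : Measurable g) : Measurable fun x => third (f x) (g x) :=
  measurable_third.comp (hf.prodMk hg)

theorem lintegral_comp_third (f : ℝ × ℝ → ℝ≥0∞) (hf : Measurable f) (q : ℝ × ℝ) :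
    ∫⁻ p, f (third p q) = ∫⁻ p, f p := by
  rw [Measure.volume_eq_prod, lintegral_prod _ (by fun_prop), lintegral_prod _ (by fun_prop)]
  have : ∀ x : ℝ, ∫⁻ s, f (third (x, s) q) = ∫⁻ s, f (-x - q.1, s) := by
    intro x
    rw [← lintegral_comp_const_sub (fun s => f (-x - q.1, s)) (3 * x * q.1 * (x + q.1) - q.2)]
    apply lintegral_congr
    intro s
    unfold third
    congr 2
    dsimp only
    ring
  simp_rw [this]
  rw [← lintegral_comp_const_sub (fun x => ∫⁻ s, f (x, s)) (-q.1)]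
  apply lintegral_congr
  intro x
  congr 1; ext s; congr 2; ring

section Schur

variable {A B D : ℝ × ℝ → ℝ≥0∞}

/-- The trilinear form over resonant triples. -/
def triForm (k : ℝ × ℝ → ℝ × ℝ → ℝ × ℝ → ℝ≥0∞) (D A B : ℝ × ℝ → ℝ≥0∞) : ℝ≥0∞ :=
  ∫⁻ p, ∫⁻ q, k (third p q) p q * (D (third p q) * A p * B q)

theorem triForm_schur {k : ℝ × ℝ → ℝ × ℝ → ℝ × ℝ → ℝ≥0∞}
    (hk : Measurable fun x : (ℝ × ℝ) × (ℝ × ℝ) × (ℝ × ℝ) => k x.1 x.2.1 x.2.2)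
    (hA : Measurable A) (hB : Measurable B) (hD : Measurable D) {S : ℝ≥0∞}
    (hS : ∀ p, ∫⁻ q, k (third p q) p q ^ 2 ≤ S) :
    triForm k D A B ^ 2 ≤ S * ((∫⁻ p, D p ^ 2) * (∫⁻ p, A p ^ 2) * ∫⁻ p, B p ^ 2) := by
  have mk : Measurable fun x : (ℝ × ℝ) × (ℝ × ℝ) => k (third x.1 x.2) x.1 x.2 :=
    hk.comp (by fun_prop : Measurable fun x : (ℝ × ℝ) × (ℝ × ℝ) => (third x.1 x.2, x.1, x.2))
  have m1 : Measurable fun p => ∫⁻ q, k (third p q) p q * (D (third p q) * B q) := by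
    apply Measurable.lintegral_prod_right' (f := fun x : (ℝ × ℝ) × (ℝ × ℝ) =>
      k (third x.1 x.2) x.1 x.2 * (D (third x.1 x.2) * B x.2))
    exact mk.mul (by fun_prop)
  have e1 : triForm k D A B =
      ∫⁻ p, A p * ∫⁻ q, k (third p q) p q * (D (third p q) * B q) := by
    unfold triForm
    apply lintegral_congr
    intro p
    have mk1 : Measurable fun q => k (third p q) p q := mk.comp measurable_prodMk_left
    rw [← lintegral_const_mul _ (by fun_prop)]
    apply lintegral_congr
    intro q
    ring
  calc triForm k D A B ^ 2
      ≤ (∫⁻ p, A p ^ 2) * ∫⁻ p, (∫⁻ q, k (third p q) p q * (D (third p q) * B q)) ^ 2 := by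
        rw [e1]; exact lintegral_mul_sq_le hA.aemeasurable m1.aemeasurable
    _ ≤ (∫⁻ p, A p ^ 2) * ∫⁻ p, S * ∫⁻ q, (D (third p q) * B q) ^ 2 := by
        gcongr with p
        refine (lintegral_mul_sq_le (mk.comp measurable_prodMk_left).aemeasurable
          (by fun_prop)).trans ?_
        gcongr
        exact hS p
    _ = (∫⁻ p, A p ^ 2) * (S * ∫⁻ q, ∫⁻ p, (D (third p q) * B q) ^ 2) := by
        rw [lintegral_const_mul, lintegral_lintegral_swap]
        · fun_prop
        · apply Measurable.lintegral_prod_right' (f := fun x : (ℝ × ℝ) × (ℝ × ℝ) =>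
            (D (third x.1 x.2) * B x.2) ^ 2)
          fun_prop
    _ = (∫⁻ p, A p ^ 2) * (S * ((∫⁻ p, D p ^ 2) * ∫⁻ q, B q ^ 2)) := by
        congr 2
        rw [← lintegral_const_mul _ (by fun_prop)]
        apply lintegral_congr
        intro q
        simp_rw [mul_pow]
        rw [lintegral_mul_const _ (by fun_prop),
          lintegral_comp_third (fun p => D p ^ 2) (by fun_prop)]
    _ = _ := by ring

theorem triForm_swap_right {k : ℝ × ℝ → ℝ × ℝ → ℝ × ℝ → ℝ≥0∞}
    (hk : Measurable fun x : (ℝ × ℝ) × (ℝ × ℝ) × (ℝ × ℝ) => k x.1 x.2.1 x.2.2)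
    (hA : Measurable A) (hB : Measurable B) (hD : Measurable D) :
    triForm k D A B = triForm (fun a b c => k a c b) D B A := by
  have mk : Measurable fun x : (ℝ × ℝ) × (ℝ × ℝ) => k (third x.1 x.2) x.1 x.2 :=
    hk.comp (by fun_prop : Measurable fun x : (ℝ × ℝ) × (ℝ × ℝ) => (third x.1 x.2, x.1, x.2))
  unfold triForm
  rw [lintegral_lintegral_swap]
  · apply lintegral_congr; intro p
    apply lintegral_congr; intro q
    rw [third_comm q p]; ring
  · exact (mk.mul (by fun_prop)).aemeasurable

theorem triForm_swap_left {k : ℝ × ℝ → ℝ × ℝ → ℝ × ℝ → ℝ≥0∞}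
    (hk : Measurable fun x : (ℝ × ℝ) × (ℝ × ℝ) × (ℝ × ℝ) => k x.1 x.2.1 x.2.2)
    (hA : Measurable A) (hB : Measurable B) (hD : Measurable D) :
    triForm k D A B = triForm (fun a b c => k b a c) A D B := by
  have mk : Measurable fun x : (ℝ × ℝ) × (ℝ × ℝ) => k (third x.1 x.2) x.1 x.2 :=
    hk.comp (by fun_prop : Measurable fun x : (ℝ × ℝ) × (ℝ × ℝ) => (third x.1 x.2, x.1, x.2))
  have mk' : Measurable fun x : (ℝ × ℝ) × (ℝ × ℝ) => k x.1 (third x.1 x.2) x.2 :=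
    hk.comp (by fun_prop : Measurable fun x : (ℝ × ℝ) × (ℝ × ℝ) => (x.1, third x.1 x.2, x.2))
  unfold triForm
  have n1 : Measurable fun x : (ℝ × ℝ) × (ℝ × ℝ) =>
      k (third x.1 x.2) x.1 x.2 * (D (third x.1 x.2) * A x.1 * B x.2) := mk.mul (by fun_prop)
  have n2 : Measurable fun x : (ℝ × ℝ) × (ℝ × ℝ) =>
      k x.1 (third x.1 x.2) x.2 * (A (third x.1 x.2) * D x.1 * B x.2) := mk'.mul (by fun_prop)
  refine (lintegral_lintegral_swap n1.aemeasurable).trans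
    (Eq.trans ?_ (lintegral_lintegral_swap n2.aemeasurable).symm)
  apply lintegral_congr
  intro q
  have mk1 : Measurable fun p => k p (third p q) q := mk'.comp measurable_prodMk_right
  have := lintegral_comp_third (fun p => k p (third p q) q * (A (third p q) * D p * B q))
    (by fun_prop) q
  rw [← this]
  apply lintegral_congr
  intro p
  rw [third_third]; ring

theorem triForm_schur_right {k : ℝ × ℝ → ℝ × ℝ → ℝ × ℝ → ℝ≥0∞}
    (hk : Measurable fun x : (ℝ × ℝ) × (ℝ × ℝ) × (ℝ × ℝ) => k x.1 x.2.1 x.2.2)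
    (hA : Measurable A) (hB : Measurable B) (hD : Measurable D) {S : ℝ≥0∞}
    (hS : ∀ p, ∫⁻ q, k (third p q) q p ^ 2 ≤ S) :
    triForm k D A B ^ 2 ≤ S * ((∫⁻ p, D p ^ 2) * (∫⁻ p, A p ^ 2) * ∫⁻ p, B p ^ 2) := by
  rw [triForm_swap_right hk hA hB hD]
  refine (triForm_schur ?_ hB hA hD hS).trans_eq (by ring)
  exact hk.comp (by fun_prop : Measurable fun x : (ℝ × ℝ) × (ℝ × ℝ) × (ℝ × ℝ) =>
    (x.1, x.2.2, x.2.1))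

theorem triForm_schur_left {k : ℝ × ℝ → ℝ × ℝ → ℝ × ℝ → ℝ≥0∞}
    (hk : Measurable fun x : (ℝ × ℝ) × (ℝ × ℝ) × (ℝ × ℝ) => k x.1 x.2.1 x.2.2)
    (hA : Measurable A) (hB : Measurable B) (hD : Measurable D) {S : ℝ≥0∞}
    (hS : ∀ p, ∫⁻ q, k p (third p q) q ^ 2 ≤ S) :
    triForm k D A B ^ 2 ≤ S * ((∫⁻ p, D p ^ 2) * (∫⁻ p, A p ^ 2) * ∫⁻ p, B p ^ 2) := by
  rw [triForm_swap_left hk hA hB hD]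
  refine (triForm_schur ?_ hD hB hA hS).trans_eq (by ring)
  exact hk.comp (by fun_prop : Measurable fun x : (ℝ × ℝ) × (ℝ × ℝ) × (ℝ × ℝ) =>
    (x.2.1, x.1, x.2.2))

end Schur

theorem freqMax_swap_left (x y z : ℝ) : freqMax x y z = freqMax y x z := by
  unfold freqMax; ac_rfl

theorem freqMax_swap_right (x y z : ℝ) : freqMax x y z = freqMax x z y := by
  unfold freqMax; ac_rfl

/-- All three frequencies are at least the inverse square root of the largest one. -/
def HighFreq (x y z : ℝ) : Prop :=
  freqMax x y z ^ (-(1 / 2) : ℝ) ≤ |x| ∧ freqMax x y z ^ (-(1 / 2) : ℝ) ≤ |y| ∧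
    freqMax x y z ^ (-(1 / 2) : ℝ) ≤ |z|

theorem highFreq_swap_left (x y z : ℝ) : HighFreq x y z ↔ HighFreq y x z := by
  unfold HighFreq; rw [freqMax_swap_left]; tauto

theorem highFreq_swap_right (x y z : ℝ) : HighFreq x y z ↔ HighFreq x z y := by
  unfold HighFreq; rw [freqMax_swap_right]; tauto

theorem freqMax_rpow_le_of_highFreq {x y z : ℝ} (hs : x + y + z = 0) (h : HighFreq x y z) :
    freqMax x y z ^ (1 / 2 : ℝ) ≤ |x| * |y - z| +
      if |y - z| ≤ |x| ^ (-(1 / 2) : ℝ) then |x| ^ (1 / 2 : ℝ) else 0 := by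
  set N := freqMax x y z with hN
  have hN1 : 1 ≤ N := one_le_freqMax x y z
  have hN0 : 0 < N := by linarith
  obtain ⟨hx, hy, hz⟩ := h
  rw [← hN] at hx hy hz
  have hNn : 0 < N ^ (-(1 / 2) : ℝ) := Real.rpow_pos_of_pos hN0 _
  have hx0 : 0 < |x| := hNn.trans_le hx
  have hsplit : N ^ (-(1 / 2) : ℝ) * N = N ^ (1 / 2 : ℝ) := by
    nth_rewrite 2 [← Real.rpow_one N]
    rw [← Real.rpow_add hN0]; norm_num
  have hite : (0:ℝ) ≤ if |y - z| ≤ |x| ^ (-(1 / 2) : ℝ) then |x| ^ (1 / 2 : ℝ) else 0 := by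
    split_ifs <;> positivity
  by_cases h1 : N ≤ |y - z|
  · have : N ^ (1 / 2 : ℝ) ≤ |x| * |y - z| := by
      rw [← hsplit]; gcongr
    linarith
  push Not at h1
  have hNx : N = |x| := by
    have hone : N ≠ 1 := by
      intro h1'
      rw [h1'] at hx hy hz h1
      simp only [Real.one_rpow] at hx hy hz
      have a1 : |x| ≤ N := (le_max_right _ _).trans (le_max_left _ _)
      have a2 : |y| ≤ N := (le_max_left _ _).trans (le_max_right _ _)
      have a3 : |z| ≤ N := (le_max_right _ _).trans (le_max_right _ _)
      rw [h1'] at a1 a2 a3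
      have b1 : |x| = 1 := le_antisymm a1 hx
      have b2 : |y| = 1 := le_antisymm a2 hy
      have b3 : |z| = 1 := le_antisymm a3 hz
      rcases eq_or_eq_neg_of_abs_eq b1 with c1 | c1 <;>
      rcases eq_or_eq_neg_of_abs_eq b2 with c2 | c2 <;>
      rcases eq_or_eq_neg_of_abs_eq b3 with c3 | c3 <;> (subst_vars; norm_num at hs)
    have hmem : N = 1 ∨ N = |x| ∨ N = |y| ∨ N = |z| := by
      rw [hN]; unfold freqMax
      rcases max_choice (max 1 |x|) (max |y| |z|) with h | h <;> rw [h]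
      · rcases max_choice 1 |x| with h | h <;> rw [h] <;> simp
      · rcases max_choice |y| |z| with h | h <;> rw [h] <;> simp
    have hy0 : 0 < |y| := hNn.trans_le hy
    have hz0 : 0 < |z| := hNn.trans_le hz
    have px : x = -(y + z) := by linarith
    have hxle : |x| ≤ |y| + |z| := by rw [px, abs_neg]; exact abs_add_le y z
    rcases le_total 0 (y * z) with hyz | hyz
    · have : |x| = |y| + |z| := by
        rw [px, abs_neg, abs_add_eq_add_abs_iff]
        rcases mul_nonneg_iff.1 hyz with h | h <;> tauto
      rcases hmem with h | h | h | h
      · exact absurd h hone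
      · exact h
      all_goals
        have a1 : |x| ≤ N := (le_max_right _ _).trans (le_max_left _ _)
        linarith
    · have : |y - z| = |y| + |z| := by
        rw [sub_eq_add_neg, ← abs_neg z, abs_add_eq_add_abs_iff]
        rcases mul_nonpos_iff.1 hyz with h | h
        · left; constructor <;> linarith
        · right; constructor <;> linarith
      rcases hmem with h | h | h | h
      · exact absurd h hone
      all_goals linarith
  rw [hNx]
  split_ifs with h2
  · have := mul_nonneg hx0.le (abs_nonneg (y - z)); linarith
  · push Not at h2
    rw [add_zero]
    calc |x| ^ (1 / 2 : ℝ) = |x| * |x| ^ (-(1 / 2) : ℝ) := by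
          nth_rewrite 2 [← Real.rpow_one |x|]
          rw [← Real.rpow_add hx0]; norm_num
      _ ≤ |x| * |y - z| := by gcongr
theorem lintegral_comp_two_mul_add (a q c : ℝ) :
    ∫⁻ y, ENNReal.ofReal (|a| * |2 * y + a|) * wt q (c + 3 / 4 * a * (2 * y + a) ^ 2) ≤
      2 * wtMass q := by
  have h := lintegral_add_right_eq_self (μ := (volume : Measure ℝ))
    (fun v => ENNReal.ofReal (|a| * |2 * v|) * wt q (c + 3 / 4 * a * (2 * v) ^ 2)) (a / 2)
  have e : ∀ y : ℝ, 2 * (y + a / 2) = 2 * y + a := fun y => by ring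
  simp only [e] at h
  rw [h]
  refine le_trans ?_ (lintegral_wt_quadratic (3 * a) q c)
  apply lintegral_mono
  intro v
  dsimp only
  rw [show c + 3 / 4 * a * (2 * v) ^ 2 = c + 3 * a * v ^ 2 by ring]
  have : |a| * |2 * v| ≤ |3 * a| * |v| := by
    rw [abs_mul, abs_mul]
    norm_num
    nlinarith [mul_nonneg (abs_nonneg a) (abs_nonneg v)]
  gcongr

theorem lintegral_small_ball (a : ℝ) :
    ∫⁻ y, ENNReal.ofReal (if |2 * y + a| ≤ |a| ^ (-(1 / 2) : ℝ) then |a| ^ (1 / 2 : ℝ) else 0) ≤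
      1 := by
  rcases eq_or_ne a 0 with rfl | ha
  · simp
  have ha0 : 0 < |a| := abs_pos.2 ha
  set d := |a| ^ (-(1 / 2) : ℝ) with hd
  have hd0 : 0 < d := Real.rpow_pos_of_pos ha0 _
  have : ∀ y : ℝ, ENNReal.ofReal (if |2 * y + a| ≤ d then |a| ^ (1 / 2 : ℝ) else 0) =
      (Icc (-a / 2 - d / 2) (-a / 2 + d / 2)).indicator
        (fun _ => ENNReal.ofReal (|a| ^ (1 / 2 : ℝ))) y := by
    intro y
    have : |2 * y + a| ≤ d ↔ y ∈ Icc (-a / 2 - d / 2) (-a / 2 + d / 2) := by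
      rw [abs_le, mem_Icc]
      constructor <;> rintro ⟨h1, h2⟩ <;> constructor <;> linarith
    by_cases h : |2 * y + a| ≤ d
    · rw [if_pos h, indicator_of_mem (this.1 h)]
    · rw [if_neg h, indicator_of_notMem (fun h' => h (this.2 h'))]; simp
  simp_rw [this]
  rw [lintegral_indicator_const measurableSet_Icc, Real.volume_Icc,
    ← ENNReal.ofReal_mul (by positivity)]
  rw [show -a / 2 + d / 2 - (-a / 2 - d / 2) = d by ring, hd, ← Real.rpow_add ha0]
  norm_num

/-- The constant in the fixed-point kernel bound. -/
def kerConst : ℝ≥0∞ :=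
  ENNReal.ofReal (2 ^ (25 / 24 : ℝ)) * (2 * wtMass (25 / 24)) * (2 * wtMass (25 / 24) + 1) +
    8 * wtMass (25 / 24)

theorem kerConst_lt_top : kerConst < ⊤ := by
  have := wtMass_lt_top (q := 25 / 24) (by norm_num)
  unfold kerConst
  refine ENNReal.add_lt_top.2 ⟨?_, ?_⟩
  · refine ENNReal.mul_lt_top (ENNReal.mul_lt_top ENNReal.ofReal_lt_top
      (ENNReal.mul_lt_top (by norm_num) this)) ?_
    exact ENNReal.add_lt_top.2 ⟨ENNReal.mul_lt_top (by norm_num) this, by norm_num⟩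
  · exact ENNReal.mul_lt_top (by norm_num) this

open Classical in
/-- The majorant of the squared kernel seen from the point `p`. -/
def kerMajorant (p q w : ℝ × ℝ) : ℝ≥0∞ :=
  ENNReal.ofReal (freqMax p.1 q.1 w.1 ^ (1 / 2 : ℝ)) *
    ((if HighFreq p.1 q.1 w.1 then wt (25 / 24) q.2 * wt (25 / 24) w.2 else 0) +
      if ¬ HighFreq p.1 q.1 w.1 ∧ |q.1| ≤ |p.1| ∧ |w.1| ≤ |p.1| then
        wt (25 / 24) q.2 + wt (25 / 24) w.2 else 0)

theorem lintegral_high (p : ℝ × ℝ) :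
    ∫⁻ y, ∫⁻ r, ENNReal.ofReal (|p.1| * |2 * y + p.1| +
      if |2 * y + p.1| ≤ |p.1| ^ (-(1 / 2) : ℝ) then |p.1| ^ (1 / 2 : ℝ) else 0) *
        (wt (25 / 24) r * wt (25 / 24) (third p (y, r)).2) ≤
      ENNReal.ofReal (2 ^ (25 / 24 : ℝ)) * (2 * wtMass (25 / 24)) * (2 * wtMass (25 / 24) + 1) := by
  set K := ENNReal.ofReal (2 ^ (25 / 24 : ℝ)) * (2 * wtMass (25 / 24)) with hK
  have hin : ∀ y, ∫⁻ r, wt (25 / 24) r * wt (25 / 24) (third p (y, r)).2 ≤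
      K * wt (25 / 24) (-(3 / 4 * p.1 ^ 3) - p.2 + 3 / 4 * p.1 * (2 * y + p.1) ^ 2) := by
    intro y
    refine le_trans (le_of_eq ?_) (lintegral_wt_mul_wt (q := 25 / 24) (by norm_num) _)
    apply lintegral_congr
    intro r
    unfold third
    congr 2
    dsimp only
    ring
  have hm : ∀ y : ℝ, Measurable fun r => wt (25 / 24) r * wt (25 / 24) (third p (y, r)).2 := by
    intro y; fun_prop
  calc _ ≤ ∫⁻ y, ENNReal.ofReal (|p.1| * |2 * y + p.1| +
      if |2 * y + p.1| ≤ |p.1| ^ (-(1 / 2) : ℝ) then |p.1| ^ (1 / 2 : ℝ) else 0) *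
        (K * wt (25 / 24) (-(3 / 4 * p.1 ^ 3) - p.2 + 3 / 4 * p.1 * (2 * y + p.1) ^ 2)) := by
        apply lintegral_mono
        intro y
        dsimp only
        rw [lintegral_const_mul _ (hm y)]
        gcongr
        exact hin y
    _ ≤ ∫⁻ y, K * (ENNReal.ofReal (|p.1| * |2 * y + p.1|) *
          wt (25 / 24) (-(3 / 4 * p.1 ^ 3) - p.2 + 3 / 4 * p.1 * (2 * y + p.1) ^ 2) +
        ENNReal.ofReal (if |2 * y + p.1| ≤ |p.1| ^ (-(1 / 2) : ℝ)
          then |p.1| ^ (1 / 2 : ℝ) else 0)) := by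
        apply lintegral_mono
        intro y
        dsimp only
        rw [ENNReal.ofReal_add (by positivity) (by split_ifs <;> positivity)]
        have := wt_le_one (q := 25 / 24) (by norm_num)
          (-(3 / 4 * p.1 ^ 3) - p.2 + 3 / 4 * p.1 * (2 * y + p.1) ^ 2)
        set W := wt (25 / 24) (-(3 / 4 * p.1 ^ 3) - p.2 + 3 / 4 * p.1 * (2 * y + p.1) ^ 2)
        set X := ENNReal.ofReal (|p.1| * |2 * y + p.1|)
        set Z := ENNReal.ofReal (if |2 * y + p.1| ≤ |p.1| ^ (-(1 / 2) : ℝ)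
          then |p.1| ^ (1 / 2 : ℝ) else 0)
        calc (X + Z) * (K * W) = K * (X * W + Z * W) := by ring
          _ ≤ K * (X * W + Z * 1) := by gcongr
          _ = _ := by rw [mul_one]
    _ ≤ K * (2 * wtMass (25 / 24) + 1) := by
        rw [lintegral_const_mul, lintegral_add_left (by fun_prop)]
        · gcongr
          · exact lintegral_comp_two_mul_add p.1 (25 / 24) _
          · exact lintegral_small_ball p.1
        · refine Measurable.add (by fun_prop) (Measurable.ennreal_ofReal ?_)
          refine Measurable.ite ?_ measurable_const measurable_const
          exact measurableSet_le (by fun_prop) (by fun_prop)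

theorem freqMax_eq_of_max {x y z : ℝ} (h1 : |y| ≤ |x|) (h2 : |z| ≤ |x|) :
    freqMax x y z = max 1 |x| := by
  unfold freqMax
  exact max_eq_left ((max_le h1 h2).trans (le_max_right _ _))

open Classical in
theorem lintegral_low (p : ℝ × ℝ) :
    ∫⁻ y, ∫⁻ r, ENNReal.ofReal (freqMax p.1 y (third p (y, r)).1 ^ (1 / 2 : ℝ)) *
      (if ¬ HighFreq p.1 y (third p (y, r)).1 ∧ |y| ≤ |p.1| ∧ |(third p (y, r)).1| ≤ |p.1| then
        wt (25 / 24) r + wt (25 / 24) (third p (y, r)).2 else 0) ≤ 8 * wtMass (25 / 24) := by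
  set N := max 1 |p.1| with hN
  have hN1 : 1 ≤ N := le_max_left _ _
  have hN0 : 0 < N := by linarith
  set d := N ^ (-(1 / 2) : ℝ) with hd
  have hd0 : 0 < d := Real.rpow_pos_of_pos hN0 _
  set s := Icc (-d) d ∪ Icc (-p.1 - d) (-p.1 + d) with hs
  have hsm : MeasurableSet s := measurableSet_Icc.union measurableSet_Icc
  have hpt : ∀ y r, ENNReal.ofReal (freqMax p.1 y (third p (y, r)).1 ^ (1 / 2 : ℝ)) *
      (if ¬ HighFreq p.1 y (third p (y, r)).1 ∧ |y| ≤ |p.1| ∧ |(third p (y, r)).1| ≤ |p.1| then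
        wt (25 / 24) r + wt (25 / 24) (third p (y, r)).2 else 0) ≤
      s.indicator (fun _ => ENNReal.ofReal (N ^ (1 / 2 : ℝ))) y *
        (wt (25 / 24) r + wt (25 / 24) (third p (y, r)).2) := by
    intro y r
    split_ifs with h
    · obtain ⟨h1, h2, h3⟩ := h
      have hf := freqMax_eq_of_max h2 h3
      rw [hf, ← hN]
      have : y ∈ s := by
        unfold HighFreq at h1
        rw [hf, ← hN, ← hd] at h1
        have h4 : |y| < d ∨ |(third p (y, r)).1| < d := by
          by_contra! h5
          exact h1 ⟨h5.1.trans h2, h5.1, h5.2⟩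
        rcases h4 with h4 | h4
        · left; exact ⟨(abs_lt.1 h4).1.le, (abs_lt.1 h4).2.le⟩
        · right
          have h6 : (third p (y, r)).1 = -p.1 - y := rfl
          rw [h6, abs_lt] at h4
          constructor <;> linarith [h4.1, h4.2]
      rw [indicator_of_mem this]
    · simp
  calc _ ≤ ∫⁻ y, ∫⁻ r, s.indicator (fun _ => ENNReal.ofReal (N ^ (1 / 2 : ℝ))) y *
        (wt (25 / 24) r + wt (25 / 24) (third p (y, r)).2) :=
        lintegral_mono fun y => lintegral_mono fun r => hpt y r
    _ = ∫⁻ y, s.indicator (fun _ => ENNReal.ofReal (N ^ (1 / 2 : ℝ))) y *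
        (2 * wtMass (25 / 24)) := by
        apply lintegral_congr
        intro y
        have e : ∀ r, (third p (y, r)).2 = 3 * p.1 * y * (p.1 + y) - p.2 - r := fun r => rfl
        simp_rw [e]
        rw [lintegral_const_mul _ (by fun_prop), lintegral_add_left (by fun_prop),
          lintegral_wt_sub, two_mul]
        rfl
    _ = ENNReal.ofReal (N ^ (1 / 2 : ℝ)) * volume s * (2 * wtMass (25 / 24)) := by
        rw [lintegral_mul_const _ (measurable_const.indicator hsm), lintegral_indicator_const hsm]
    _ ≤ ENNReal.ofReal (N ^ (1 / 2 : ℝ)) * ENNReal.ofReal (4 * d) * (2 * wtMass (25 / 24)) := by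
        gcongr
        refine (measure_union_le _ _).trans ?_
        rw [Real.volume_Icc, Real.volume_Icc, ← ENNReal.ofReal_add (by linarith) (by linarith)]
        apply ENNReal.ofReal_le_ofReal
        linarith
    _ = 8 * wtMass (25 / 24) := by
        rw [← ENNReal.ofReal_mul (by positivity)]
        have : N ^ (1 / 2 : ℝ) * (4 * d) = 4 := by
          rw [hd, mul_left_comm, ← Real.rpow_add hN0]; norm_num
        rw [this]
        have : ENNReal.ofReal 4 = 4 := by simp
        rw [this]; ring

theorem measurable_freqMax {α : Type*} [MeasurableSpace α] {f g h : α → ℝ} (hf : Measurable f)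
    (hg : Measurable g) (hh : Measurable h) : Measurable fun x => freqMax (f x) (g x) (h x) := by
  unfold freqMax; fun_prop

theorem measurableSet_highFreq {α : Type*} [MeasurableSpace α] {f g h : α → ℝ} (hf : Measurable f)
    (hg : Measurable g) (hh : Measurable h) :
    MeasurableSet {x | HighFreq (f x) (g x) (h x)} := by
  have := (measurable_freqMax hf hg hh).pow_const (-(1 / 2) : ℝ)
  unfold HighFreq
  exact (measurableSet_le this hf.norm).inter
    ((measurableSet_le this hg.norm).inter (measurableSet_le this hh.norm))

open Classical in
theorem lintegral_kerMajorant_le (p : ℝ × ℝ) :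
    ∫⁻ q, kerMajorant p q (third p q) ≤ kerConst := by
  have m0 : Measurable fun q => ENNReal.ofReal (freqMax p.1 q.1 (third p q).1 ^ (1 / 2 : ℝ)) := by
    have := measurable_freqMax (f := fun _ : ℝ × ℝ => p.1) (g := fun q : ℝ × ℝ => q.1)
      (h := fun q => (third p q).1) (by fun_prop) (by fun_prop) (by fun_prop)
    fun_prop
  have mH := measurableSet_highFreq (f := fun _ : ℝ × ℝ => p.1) (g := fun q : ℝ × ℝ => q.1)
      (h := fun q => (third p q).1) (by fun_prop) (by fun_prop) (by fun_prop)
  have m1 : Measurable fun q => if HighFreq p.1 q.1 (third p q).1 then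
      wt (25 / 24) q.2 * wt (25 / 24) (third p q).2 else 0 :=
    Measurable.ite mH (by fun_prop) measurable_const
  have m2 : Measurable fun q => if ¬ HighFreq p.1 q.1 (third p q).1 ∧ |q.1| ≤ |p.1| ∧
      |(third p q).1| ≤ |p.1| then wt (25 / 24) q.2 + wt (25 / 24) (third p q).2 else 0 := by
    have s1 : MeasurableSet {q : ℝ × ℝ | |q.1| ≤ |p.1|} :=
      measurableSet_le (by fun_prop) (by fun_prop)
    have s2 : MeasurableSet {q : ℝ × ℝ | |(third p q).1| ≤ |p.1|} :=
      measurableSet_le (by fun_prop) (by fun_prop)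
    exact Measurable.ite (mH.compl.inter (s1.inter s2)) (by fun_prop) measurable_const
  unfold kerMajorant
  simp_rw [mul_add]
  refine (lintegral_add_left (m0.mul m1) _).trans_le ?_
  unfold kerConst
  gcongr
  · rw [Measure.volume_eq_prod]
    refine (lintegral_prod _ (m0.mul m1).aemeasurable).trans_le ?_
    refine le_trans ?_ (lintegral_high p)
    apply lintegral_mono; intro y
    apply lintegral_mono; intro r
    dsimp only
    by_cases h : HighFreq p.1 y (third p (y, r)).1
    · simp only [Pi.mul_apply, if_pos h]
      gcongr
      have hs : p.1 + y + (third p (y, r)).1 = 0 := by simp [third]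
      refine (freqMax_rpow_le_of_highFreq hs h).trans_eq ?_
      have : y - (third p (y, r)).1 = 2 * y + p.1 := by simp [third]; ring
      rw [this]
    · simp [if_neg h]
  · rw [Measure.volume_eq_prod]
    exact (lintegral_prod _ (m0.mul m2).aemeasurable).trans_le (lintegral_low p)

/-- The reciprocal frequency weight. -/
def iw (x : ℝ) : ℝ := |x| ^ (1 / 2 : ℝ) * mm x ^ (1 / 48 : ℝ)

theorem iw_nonneg (x : ℝ) : 0 ≤ iw x :=
  mul_nonneg (Real.rpow_nonneg (abs_nonneg x) _) (Real.rpow_nonneg (mm_nonneg x) _)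

@[fun_prop]
theorem measurable_mm : Measurable mm := by unfold mm; fun_prop

@[fun_prop]
theorem measurable_iw : Measurable iw := by unfold iw; fun_prop

theorem iw_sq (x : ℝ) : iw x ^ 2 = |x| * mm x ^ (1 / 24 : ℝ) := by
  unfold iw
  rw [mul_pow, ← Real.rpow_natCast, ← Real.rpow_natCast, ← Real.rpow_mul (abs_nonneg x),
    ← Real.rpow_mul (mm_nonneg x)]
  norm_num

/-- The bilinear kernel with all Bourgain weights inserted. -/
def biKer (p q w : ℝ × ℝ) : ℝ≥0∞ :=
  ENNReal.ofReal (|p.1| ^ (1 / 2 : ℝ) * iw q.1 * iw w.1) *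
    (wt (22 / 48) p.2 * wt (25 / 48) q.2 * wt (25 / 48) w.2)

theorem biKer_sq_le (p q w : ℝ × ℝ) : biKer p q w ^ 2 ≤
    ENNReal.ofReal (|p.1 * q.1 * w.1| * (mm p.1 * mm q.1 * mm w.1) ^ (1 / 24 : ℝ) *
      ((1 + |p.2|) ^ (-(25 / 24) : ℝ) * (1 + |q.2|) ^ (-(25 / 24) : ℝ) *
        (1 + |w.2|) ^ (-(25 / 24) : ℝ)) * (1 + |p.2|) ^ (1 / 8 : ℝ)) := by
  have e : ∀ a x : ℝ, wt a x ^ 2 = wt (2 * a) x := fun a x => by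
    rw [sq, wt_mul_wt, two_mul]
  unfold biKer
  rw [mul_pow, mul_pow, mul_pow, e, e, e, ← ENNReal.ofReal_pow
    (mul_nonneg (mul_nonneg (by positivity) (iw_nonneg _)) (iw_nonneg _))]
  unfold wt
  rw [← ENNReal.ofReal_mul (by positivity), ← ENNReal.ofReal_mul (by positivity),
    ← ENNReal.ofReal_mul (by positivity)]
  apply ENNReal.ofReal_le_ofReal
  rw [mul_pow, mul_pow, iw_sq, iw_sq, ← Real.rpow_natCast, ← Real.rpow_mul (abs_nonneg _)]
  norm_num only
  rw [Real.rpow_one, Real.mul_rpow (mul_nonneg (mm_nonneg _) (mm_nonneg _)) (mm_nonneg _),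
    Real.mul_rpow (mm_nonneg _) (mm_nonneg _), abs_mul, abs_mul]
  have h1 : (1 + |p.2|) ^ (-(11 / 12) : ℝ) =
      (1 + |p.2|) ^ (-(25 / 24) : ℝ) * (1 + |p.2|) ^ (1 / 8 : ℝ) := by
    rw [← Real.rpow_add (by positivity)]; norm_num
  rw [h1]
  rcases eq_or_ne p.1 0 with h0 | h0
  · rw [h0]; simp
  have hm : 1 ≤ mm p.1 ^ (1 / 24 : ℝ) := Real.one_le_rpow (one_le_mm h0) (by norm_num)
  have hq := Real.rpow_nonneg (mm_nonneg q.1) (1 / 24)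
  have hw := Real.rpow_nonneg (mm_nonneg w.1) (1 / 24)
  set a := mm p.1 ^ (1 / 24 : ℝ)
  set b := mm q.1 ^ (1 / 24 : ℝ)
  set c := mm w.1 ^ (1 / 24 : ℝ)
  set R := |p.1| * |q.1| * |w.1| * (b * c) * ((1 + |p.2|) ^ (-(25 / 24) : ℝ) *
    (1 + |q.2|) ^ (-(25 / 24) : ℝ) * (1 + |w.2|) ^ (-(25 / 24) : ℝ) * (1 + |p.2|) ^ (1 / 8 : ℝ)) with hR
  have hR0 : 0 ≤ R := by positivity
  calc _ = 1 * R := by rw [hR]; ring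
    _ ≤ a * R := by gcongr
    _ = _ := by rw [hR]; ring

theorem abs_resonance_le {x y z a b c m : ℝ} (h : a + b + c = -(3 * x * y * z)) (ha : |a| ≤ m)
    (hb : |b| ≤ m) (hc : |c| ≤ m) : |x * y * z| ≤ m := by
  rw [abs_le] at *
  constructor <;> nlinarith [ha.1, ha.2, hb.1, hb.2, hc.1, hc.2]

theorem third_sum_snd (p q : ℝ × ℝ) :
    (third p q).2 + p.2 + q.2 = -(3 * (third p q).1 * p.1 * q.1) := by
  unfold third; ring

theorem ofReal_freq_mul_wt {N a b : ℝ} (hN : 0 ≤ N) :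
    ENNReal.ofReal (N * ((1 + |a|) ^ (-(25 / 24) : ℝ) * (1 + |b|) ^ (-(25 / 24) : ℝ))) =
      ENNReal.ofReal N * (wt (25 / 24) a * wt (25 / 24) b) := by
  unfold wt
  rw [ENNReal.ofReal_mul hN, ENNReal.ofReal_mul (by positivity)]

/-- The kernel is controlled by the two smaller modulations. -/
theorem biKer_sq_le_of_third (p q w : ℝ × ℝ) (h : p.2 + q.2 + w.2 = -(3 * p.1 * q.1 * w.1)) :
    biKer p q w ^ 2 ≤ ENNReal.ofReal (freqMax p.1 q.1 w.1 ^ (1 / 2 : ℝ)) *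
      (wt (25 / 24) q.2 * wt (25 / 24) w.2) ∨
    biKer p q w ^ 2 ≤ ENNReal.ofReal (freqMax p.1 q.1 w.1 ^ (1 / 2 : ℝ)) *
      (wt (25 / 24) p.2 * wt (25 / 24) w.2) ∨
    biKer p q w ^ 2 ≤ ENNReal.ofReal (freqMax p.1 q.1 w.1 ^ (1 / 2 : ℝ)) *
      (wt (25 / 24) p.2 * wt (25 / 24) q.2) := by
  have hN : 0 ≤ freqMax p.1 q.1 w.1 ^ (1 / 2 : ℝ) :=
    Real.rpow_nonneg (by linarith [one_le_freqMax p.1 q.1 w.1]) _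
  have o : ∀ x : ℝ, 1 ≤ 1 + |x| := fun x => by linarith [abs_nonneg x]
  have le1 : ∀ x : ℝ, |x| ≤ 1 + |x| := fun x => by linarith
  have key := biKer_sq_le p q w
  by_cases c1 : |q.2| ≤ |p.2| ∧ |w.2| ≤ |p.2|
  · left
    refine key.trans ?_
    rw [← ofReal_freq_mul_wt hN]
    apply ENNReal.ofReal_le_ofReal
    refine le_trans (le_of_eq ?_) (kernel_pointwise (o q.2) (o w.2) (o p.2) (o p.2) le_rfl
      ((abs_resonance_le h le_rfl c1.1 c1.2).trans (le1 _)))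
    ring
  by_cases c2 : |p.2| ≤ |q.2| ∧ |w.2| ≤ |q.2|
  · right; left
    refine key.trans ?_
    rw [← ofReal_freq_mul_wt hN]
    apply ENNReal.ofReal_le_ofReal
    refine le_trans (le_of_eq ?_) (kernel_pointwise (o p.2) (o w.2) (o q.2) (o p.2)
      (by linarith [c2.1]) ((abs_resonance_le h c2.1 le_rfl c2.2).trans (le1 _)))
    ring
  · right; right
    have c3 : |p.2| ≤ |w.2| ∧ |q.2| ≤ |w.2| := by
      rcases le_total |p.2| |q.2| with a | a <;> rcases le_total |q.2| |w.2| with b | b <;>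
      rcases le_total |p.2| |w.2| with d | d <;> first | exact ⟨by linarith, by linarith⟩ | (exfalso; tauto)
    refine key.trans ?_
    rw [← ofReal_freq_mul_wt hN]
    apply ENNReal.ofReal_le_ofReal
    refine le_trans (le_of_eq ?_) (kernel_pointwise (o p.2) (o q.2) (o w.2) (o p.2)
      (by linarith [c3.1]) ((abs_resonance_le h c3.1 c3.2 le_rfl).trans (le1 _)))
    ring

theorem biKer_le_majorant (p q w : ℝ × ℝ) (h : p.2 + q.2 + w.2 = -(3 * p.1 * q.1 * w.1)) :
    biKer p q w ^ 2 ≤ kerMajorant p q w ∨ biKer p q w ^ 2 ≤ kerMajorant q p w ∨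
      biKer p q w ^ 2 ≤ kerMajorant w p q := by
  classical
  have f1 : freqMax q.1 p.1 w.1 = freqMax p.1 q.1 w.1 := freqMax_swap_left _ _ _
  have f2 : freqMax w.1 p.1 q.1 = freqMax p.1 q.1 w.1 := by
    rw [freqMax_swap_left, freqMax_swap_right]
  have g1 : HighFreq q.1 p.1 w.1 ↔ HighFreq p.1 q.1 w.1 := highFreq_swap_left _ _ _
  have g2 : HighFreq w.1 p.1 q.1 ↔ HighFreq p.1 q.1 w.1 := by
    rw [highFreq_swap_left, highFreq_swap_right]
  have key := biKer_sq_le_of_third p q w h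
  unfold kerMajorant
  rw [f1, f2]
  simp only [g1, g2]
  by_cases hh : HighFreq p.1 q.1 w.1
  · simp only [hh, if_true, not_true_eq_false, false_and, if_false, add_zero]
    exact key
  · simp only [hh, if_false, not_false_eq_true, true_and, zero_add]
    have lp := wt_le_one (q := 25 / 24) (by norm_num) p.2
    have lq := wt_le_one (q := 25 / 24) (by norm_num) q.2
    have lw := wt_le_one (q := 25 / 24) (by norm_num) w.2
    generalize ENNReal.ofReal (freqMax p.1 q.1 w.1 ^ (1 / 2 : ℝ)) = N at key ⊢
    generalize wt (25 / 24) p.2 = P at key lp ⊢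
    generalize wt (25 / 24) q.2 = Q at key lq ⊢
    generalize wt (25 / 24) w.2 = W at key lw ⊢
    have l1 : ∀ {a b : ℝ≥0∞}, b ≤ 1 → a * b ≤ a := fun h => mul_le_of_le_one_right' h
    have l2 : ∀ {a b : ℝ≥0∞}, a ≤ 1 → a * b ≤ b := fun h => mul_le_of_le_one_left' h
    have fin : ∀ X Y : ℝ≥0∞, (Q * W ≤ X + Y ∧ P * W ≤ X + Y ∧ P * Q ≤ X + Y) →
        biKer p q w ^ 2 ≤ N * (X + Y) := by
      rintro X Y ⟨h1, h2, h3⟩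
      rcases key with k | k | k <;> refine k.trans ?_ <;> gcongr
    by_cases c1 : |q.1| ≤ |p.1| ∧ |w.1| ≤ |p.1|
    · left
      rw [if_pos c1]
      exact fin _ _ ⟨(l1 lw).trans le_self_add, (l2 lp).trans le_add_self,
        (l2 lp).trans le_self_add⟩
    by_cases c2 : |p.1| ≤ |q.1| ∧ |w.1| ≤ |q.1|
    · right; left
      rw [if_pos c2]
      exact fin _ _ ⟨(l2 lq).trans le_add_self, (l1 lw).trans le_self_add,
        (l1 lq).trans le_self_add⟩
    · right; right
      have c3 : |p.1| ≤ |w.1| ∧ |q.1| ≤ |w.1| := by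
        by_contra hc
        rcases le_total |p.1| |q.1| with a | a <;> rcases le_total |q.1| |w.1| with b | b <;>
        rcases le_total |p.1| |w.1| with d | d <;>
        first
          | exact c1 ⟨by linarith, by linarith⟩
          | exact c2 ⟨by linarith, by linarith⟩
          | exact hc ⟨by linarith, by linarith⟩
      rw [if_pos c3]
      exact fin _ _ ⟨(l1 lw).trans le_add_self, (l1 lw).trans le_self_add,
        (l1 lq).trans le_self_add⟩

@[fun_prop]
theorem measurable_biKer :
    Measurable fun x : (ℝ × ℝ) × (ℝ × ℝ) × (ℝ × ℝ) => biKer x.1 x.2.1 x.2.2 := by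
  unfold biKer; fun_prop

theorem measurable_kerMajorant :
    Measurable fun x : (ℝ × ℝ) × (ℝ × ℝ) × (ℝ × ℝ) => kerMajorant x.1 x.2.1 x.2.2 := by
  classical
  have mH := measurableSet_highFreq (f := fun x : (ℝ × ℝ) × (ℝ × ℝ) × (ℝ × ℝ) => x.1.1)
    (g := fun x => x.2.1.1) (h := fun x => x.2.2.1) (by fun_prop) (by fun_prop) (by fun_prop)
  have mN := measurable_freqMax (f := fun x : (ℝ × ℝ) × (ℝ × ℝ) × (ℝ × ℝ) => x.1.1)
    (g := fun x => x.2.1.1) (h := fun x => x.2.2.1) (by fun_prop) (by fun_prop) (by fun_prop)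
  have s1 : MeasurableSet {x : (ℝ × ℝ) × (ℝ × ℝ) × (ℝ × ℝ) | |x.2.1.1| ≤ |x.1.1|} :=
    measurableSet_le (by fun_prop) (by fun_prop)
  have s2 : MeasurableSet {x : (ℝ × ℝ) × (ℝ × ℝ) × (ℝ × ℝ) | |x.2.2.1| ≤ |x.1.1|} :=
    measurableSet_le (by fun_prop) (by fun_prop)
  unfold kerMajorant
  refine Measurable.mul (by fun_prop) (Measurable.add ?_ ?_)
  · exact Measurable.ite mH (by fun_prop) measurable_const
  · exact Measurable.ite (mH.compl.inter (s1.inter s2)) (by fun_prop) measurable_const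

/-- The part of a kernel where its square is controlled by a majorant. -/
def cutKer (k m : ℝ × ℝ → ℝ × ℝ → ℝ × ℝ → ℝ≥0∞) (p q w : ℝ × ℝ) : ℝ≥0∞ :=
  open Classical in if k p q w ^ 2 ≤ m p q w then k p q w else 0

theorem cutKer_sq_le (k m : ℝ × ℝ → ℝ × ℝ → ℝ × ℝ → ℝ≥0∞) (p q w : ℝ × ℝ) :
    cutKer k m p q w ^ 2 ≤ m p q w := by
  unfold cutKer
  split_ifs with h
  · exact h
  · simp

theorem cutKer_of_le {k m : ℝ × ℝ → ℝ × ℝ → ℝ × ℝ → ℝ≥0∞} {p q w : ℝ × ℝ}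
    (h : k p q w ^ 2 ≤ m p q w) : cutKer k m p q w = k p q w := by
  unfold cutKer
  rw [if_pos h]

theorem measurable_cutKer {k m : ℝ × ℝ → ℝ × ℝ → ℝ × ℝ → ℝ≥0∞}
    (hk : Measurable fun x : (ℝ × ℝ) × (ℝ × ℝ) × (ℝ × ℝ) => k x.1 x.2.1 x.2.2)
    (hm : Measurable fun x : (ℝ × ℝ) × (ℝ × ℝ) × (ℝ × ℝ) => m x.1 x.2.1 x.2.2) :
    Measurable fun x : (ℝ × ℝ) × (ℝ × ℝ) × (ℝ × ℝ) => cutKer k m x.1 x.2.1 x.2.2 := by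
  unfold cutKer
  exact Measurable.ite (measurableSet_le (hk.pow_const 2) hm) hk measurable_const

theorem kerMajorant_swap (p q w : ℝ × ℝ) : kerMajorant p w q = kerMajorant p q w := by
  unfold kerMajorant
  rw [freqMax_swap_right, highFreq_swap_right]
  congr 2
  · split_ifs <;> ring
  · split_ifs <;> first | tauto | ring

theorem lintegral_kerMajorant_le_swap (p : ℝ × ℝ) :
    ∫⁻ q, kerMajorant p (third p q) q ≤ kerConst := by
  simp_rw [kerMajorant_swap p _ (third p _)]
  exact lintegral_kerMajorant_le p

theorem triForm_le_add_three {k k1 k2 k3 : ℝ × ℝ → ℝ × ℝ → ℝ × ℝ → ℝ≥0∞}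
    {A B D : ℝ × ℝ → ℝ≥0∞} (hA : Measurable A) (hB : Measurable B) (hD : Measurable D)
    (h1 : Measurable fun x : (ℝ × ℝ) × (ℝ × ℝ) × (ℝ × ℝ) => k1 x.1 x.2.1 x.2.2)
    (h2 : Measurable fun x : (ℝ × ℝ) × (ℝ × ℝ) × (ℝ × ℝ) => k2 x.1 x.2.1 x.2.2)
    (h : ∀ p q, k (third p q) p q ≤ k1 (third p q) p q + k2 (third p q) p q +
      k3 (third p q) p q) :
    triForm k D A B ≤ triForm k1 D A B + triForm k2 D A B + triForm k3 D A B := by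
  have mT : Measurable fun x : (ℝ × ℝ) × (ℝ × ℝ) => (third x.1 x.2, x.1, x.2) := by fun_prop
  have mW : Measurable fun x : (ℝ × ℝ) × (ℝ × ℝ) => D (third x.1 x.2) * A x.1 * B x.2 := by
    fun_prop
  have c1 : Measurable fun x : (ℝ × ℝ) × (ℝ × ℝ) =>
      k1 (third x.1 x.2) x.1 x.2 * (D (third x.1 x.2) * A x.1 * B x.2) := (h1.comp mT).mul mW
  have c2 : Measurable fun x : (ℝ × ℝ) × (ℝ × ℝ) =>
      k2 (third x.1 x.2) x.1 x.2 * (D (third x.1 x.2) * A x.1 * B x.2) := (h2.comp mT).mul mW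
  have i1 : ∀ p, Measurable fun q => k1 (third p q) p q * (D (third p q) * A p * B q) :=
    fun p => c1.comp measurable_prodMk_left
  have i2 : ∀ p, Measurable fun q => k2 (third p q) p q * (D (third p q) * A p * B q) :=
    fun p => c2.comp measurable_prodMk_left
  have j1 := c1.lintegral_prod_right' (ν := volume)
  have j2 := c2.lintegral_prod_right' (ν := volume)
  unfold triForm
  rw [← lintegral_add_left j1, ← lintegral_add_left (by exact j1.add j2)]
  apply lintegral_mono
  intro p
  dsimp only
  rw [← lintegral_add_left (i1 p), ← lintegral_add_left (by exact (i1 p).add (i2 p))]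
  apply lintegral_mono
  intro q
  dsimp only
  rw [← add_mul, ← add_mul]
  gcongr
  exact h p q

theorem measurable_perm_left {k : ℝ × ℝ → ℝ × ℝ → ℝ × ℝ → ℝ≥0∞}
    (hk : Measurable fun x : (ℝ × ℝ) × (ℝ × ℝ) × (ℝ × ℝ) => k x.1 x.2.1 x.2.2) :
    Measurable fun x : (ℝ × ℝ) × (ℝ × ℝ) × (ℝ × ℝ) => k x.2.1 x.1 x.2.2 :=
  hk.comp (by fun_prop : Measurable fun x : (ℝ × ℝ) × (ℝ × ℝ) × (ℝ × ℝ) => (x.2.1, x.1, x.2.2))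

theorem measurable_perm_right {k : ℝ × ℝ → ℝ × ℝ → ℝ × ℝ → ℝ≥0∞}
    (hk : Measurable fun x : (ℝ × ℝ) × (ℝ × ℝ) × (ℝ × ℝ) => k x.1 x.2.1 x.2.2) :
    Measurable fun x : (ℝ × ℝ) × (ℝ × ℝ) × (ℝ × ℝ) => k x.2.2 x.1 x.2.1 :=
  hk.comp (by fun_prop : Measurable fun x : (ℝ × ℝ) × (ℝ × ℝ) × (ℝ × ℝ) => (x.2.2, x.1, x.2.1))

/-- The weighted trilinear estimate. -/
theorem triForm_biKer_le {A B D : ℝ × ℝ → ℝ≥0∞} (hA : Measurable A) (hB : Measurable B)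
    (hD : Measurable D) :
    triForm biKer D A B ≤ 3 * (kerConst * ((∫⁻ p, D p ^ 2) * (∫⁻ p, A p ^ 2) *
      ∫⁻ p, B p ^ 2)) ^ (1 / 2 : ℝ) := by
  have mK := measurable_kerMajorant
  have mB := measurable_biKer
  have m2 := measurable_perm_left mK
  have m3 := measurable_perm_right mK
  have mk1 := measurable_cutKer mB mK
  have mk2 := measurable_cutKer (m := fun p q w => kerMajorant q p w) mB m2
  have mk3 := measurable_cutKer (m := fun p q w => kerMajorant w p q) mB m3
  have hsum := triForm_le_add_three (k := biKer) (k3 := cutKer biKer fun p q w => kerMajorant w p q)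
    hA hB hD mk1 mk2 fun p q => by
      rcases biKer_le_majorant (third p q) p q (third_sum_snd p q) with h | h | h
      · rw [cutKer_of_le h, add_assoc]; exact le_self_add
      · rw [cutKer_of_le (m := fun p q w => kerMajorant q p w) h, add_right_comm]
        exact le_add_self
      · rw [cutKer_of_le (m := fun p q w => kerMajorant w p q) h]; exact le_add_self
  have b1 := triForm_schur_left mk1 hA hB hD fun p =>
    (lintegral_mono fun q => (cutKer_sq_le _ _ _ _ _)).trans (lintegral_kerMajorant_le_swap p)
  have b2 := triForm_schur mk2 hA hB hD fun p =>
    (lintegral_mono fun q => (cutKer_sq_le _ _ _ _ _)).trans (lintegral_kerMajorant_le_swap p)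
  have b3 := triForm_schur_right mk3 hA hB hD fun p =>
    (lintegral_mono fun q => (cutKer_sq_le _ _ _ _ _)).trans (lintegral_kerMajorant_le_swap p)
  set R := kerConst * ((∫⁻ p, D p ^ 2) * (∫⁻ p, A p ^ 2) * ∫⁻ p, B p ^ 2) with hR
  have root : ∀ {a : ℝ≥0∞}, a ^ 2 ≤ R → a ≤ R ^ (1 / 2 : ℝ) := by
    intro a h
    calc a = (a ^ 2) ^ (1 / 2 : ℝ) := by
          rw [← ENNReal.rpow_natCast, ← ENNReal.rpow_mul]; norm_num
      _ ≤ _ := by gcongr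
  calc triForm biKer D A B ≤ R ^ (1 / 2 : ℝ) + R ^ (1 / 2 : ℝ) + R ^ (1 / 2 : ℝ) :=
        hsum.trans (by gcongr <;> exact root (by assumption))
    _ = _ := by ring

/-- The effect of a sharp time cutoff on the dual modulation weight. -/
theorem lintegral_cutoff_le {D : ℝ → ℝ≥0∞} (hD : Measurable D) :
    ∫⁻ s, (wt (-(22 / 48)) s * ∫⁻ r, wt 1 (s - r) * (wt (23 / 48) r * D r)) ^ 2 ≤
      (ENNReal.ofReal (2 ^ (45 / 48 : ℝ)) * (4 * wtMass (1 + 1 / 48))) * (2 * wtMass (1 + 1 / 48)) *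
        ∫⁻ r, D r ^ 2 := by
  set C := ENNReal.ofReal (2 ^ (45 / 48 : ℝ)) * (4 * wtMass (1 + 1 / 48)) with hC
  have h1 : ∀ s, (∫⁻ r, wt 1 (s - r) * (wt (23 / 48) r * D r)) ^ 2 ≤
      C * wt (45 / 48) s * ∫⁻ r, wt 1 (s - r) * D r ^ 2 := by
    intro s
    have e : ∀ r, wt 1 (s - r) * (wt (23 / 48) r * D r) =
        (wt (1 / 2) (s - r) * wt (23 / 48) r) * (wt (1 / 2) (s - r) * D r) := by
      intro r
      have : wt 1 (s - r) = wt (1 / 2) (s - r) * wt (1 / 2) (s - r) := by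
        rw [wt_mul_wt]; norm_num
      rw [this]; ring
    simp_rw [e]
    refine (lintegral_mul_sq_le (by fun_prop) (by fun_prop)).trans ?_
    gcongr ?_ * ?_
    · refine le_trans (le_of_eq ?_) ((lintegral_wt_one_mul_wt (q := 46 / 48) (η := 1 / 48)
        (by norm_num) (by norm_num) (by norm_num) s).trans_eq ?_)
      · apply lintegral_congr
        intro r
        rw [mul_pow, sq, sq, wt_mul_wt, wt_mul_wt]; norm_num
      · rw [hC]; norm_num
    · apply le_of_eq
      apply lintegral_congr
      intro r
      rw [mul_pow, sq (wt _ _), wt_mul_wt]; norm_num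
  calc ∫⁻ s, (wt (-(22 / 48)) s * ∫⁻ r, wt 1 (s - r) * (wt (23 / 48) r * D r)) ^ 2
      ≤ ∫⁻ s, ∫⁻ r, C * (wt (1 / 48) s * wt 1 (s - r)) * D r ^ 2 := by
        apply lintegral_mono
        intro s
        dsimp only
        rw [mul_pow]
        calc wt (-(22 / 48)) s ^ 2 * (∫⁻ r, wt 1 (s - r) * (wt (23 / 48) r * D r)) ^ 2
            ≤ wt (-(22 / 48)) s ^ 2 * (C * wt (45 / 48) s * ∫⁻ r, wt 1 (s - r) * D r ^ 2) := by
              gcongr; exact h1 s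
          _ = C * wt (1 / 48) s * ∫⁻ r, wt 1 (s - r) * D r ^ 2 := by
              have : wt (1 / 48) s = wt (-(22 / 48)) s ^ 2 * wt (45 / 48) s := by
                rw [sq, wt_mul_wt, wt_mul_wt]; norm_num
              rw [this]; ring
          _ = _ := by
              rw [← lintegral_const_mul _ (by fun_prop)]
              apply lintegral_congr; intro r; ring
    _ = ∫⁻ r, ∫⁻ s, C * (wt (1 / 48) s * wt 1 (s - r)) * D r ^ 2 := by
        apply lintegral_lintegral_swap
        apply Measurable.aemeasurable
        unfold Function.uncurry
        fun_prop
    _ ≤ ∫⁻ r, C * (2 * wtMass (1 + 1 / 48)) * D r ^ 2 := by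
        apply lintegral_mono
        intro r
        dsimp only
        rw [lintegral_mul_const _ (by fun_prop), lintegral_const_mul _ (by fun_prop)]
        gcongr
        calc ∫⁻ s, wt (1 / 48) s * wt 1 (s - r)
            ≤ ∫⁻ s, (wt (1 + 1 / 48) s + wt (1 + 1 / 48) (s - r)) := by
              apply lintegral_mono; intro s
              have := wt_mul_wt_le (α := 1 / 48) (β := 1) (by norm_num) (by norm_num) s (s - r)
              rwa [show (1:ℝ) / 48 + 1 = 1 + 1 / 48 by norm_num] at this
          _ = _ := by
              rw [lintegral_add_left (by fun_prop), lintegral_wt_sub', two_mul]; rfl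
    _ = _ := by rw [lintegral_const_mul _ (by fun_prop)]

theorem integral_fourier_mul_eq {f g : ℝ → ℂ} (hf : Integrable f) (hg : Integrable g) :
    ∫ x, 𝓕 f x * g x = ∫ x, f x * 𝓕 g x := by
  have h := VectorFourier.integral_fourierIntegral_smul_eq_flip (L := innerₗ ℝ) (μ := volume)
    (ν := volume) (e := Real.fourierChar) (f := f) (g := g) Real.continuous_fourierChar
    continuous_inner hf hg
  simp only [smul_eq_mul, flip_innerₗ] at h
  exact h

theorem continuous_fourier {f : ℝ → ℂ} (hf : Integrable f) : Continuous (𝓕 f) :=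
  VectorFourier.fourierIntegral_continuous Real.continuous_fourierChar continuous_inner hf

theorem norm_fourier_le (f : ℝ → ℂ) (x : ℝ) : ‖𝓕 f x‖ ≤ ∫ v, ‖f v‖ :=
  VectorFourier.norm_fourierIntegral_le_integral_norm _ _ _ _ _

theorem gaussian_mass {δ : ℝ} (hδ : 0 < δ) :
    ∫⁻ y, ENNReal.ofReal (δ ^ (-(1 / 2) : ℝ) * Real.exp (-π / δ * y ^ 2)) = 1 := by
  have hi : Integrable fun y : ℝ => Real.exp (-(π / δ) * y ^ 2) :=
    integrable_exp_neg_mul_sq (by positivity)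
  rw [← ofReal_integral_eq_lintegral_ofReal]
  · rw [integral_const_mul]
    simp only [neg_div]
    rw [integral_gaussian (π / δ), show π / (π / δ) = δ by field_simp, Real.sqrt_eq_rpow, ← Real.rpow_add hδ]
    norm_num
  · simp only [neg_div]
    exact hi.const_mul _
  · filter_upwards with y
    positivity

theorem norm_fourier_gaussian_mul_le {g : ℝ → ℂ} (hg : Integrable g) {δ : ℝ} (hδ : 0 < δ) (x : ℝ) :
    ‖∫ σ, 𝓕 g σ * Complex.exp (-π * δ * σ ^ 2 + 2 * π * (Complex.I * x) * σ)‖ₑ ≤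
      ∫⁻ y, ‖g y‖ₑ * ENNReal.ofReal (δ ^ (-(1 / 2) : ℝ) * Real.exp (-π / δ * (y - x) ^ 2)) := by
  have hi : Integrable fun σ : ℝ =>
      Complex.exp (-π * δ * (σ : ℂ) ^ 2 + 2 * π * (Complex.I * x) * σ) := by
    have := integrable_cexp_quadratic (b := π * δ) (by simp; positivity)
      (2 * π * (Complex.I * x)) 0
    refine this.congr (Filter.Eventually.of_forall fun σ => ?_)
    dsimp only
    congr 1
    ring
  rw [integral_fourier_mul_eq hg hi]
  refine (enorm_integral_le_lintegral_enorm _).trans (lintegral_mono fun y => ?_)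
  rw [fourier_gaussian_pi' (b := (δ : ℂ)) (by simpa using hδ), enorm_mul]
  gcongr
  rw [← ofReal_norm]
  apply ENNReal.ofReal_le_ofReal
  apply le_of_eq
  rw [norm_mul, norm_div, norm_one, Complex.norm_exp]
  congr 1
  · rw [one_div, ← Complex.ofReal_one, ← Complex.ofReal_ofNat, ← Complex.ofReal_div,
      ← Complex.ofReal_cpow hδ.le, Complex.norm_real, Real.rpow_neg hδ.le, Real.norm_eq_abs,
      abs_of_nonneg (by positivity)]
  · congr 1
    rw [show (y : ℂ) + Complex.I * (Complex.I * x) = ((y - x : ℝ) : ℂ) by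
      rw [← mul_assoc, Complex.I_mul_I]; push_cast; ring]
    rw [show (-π / δ * ((y - x : ℝ) : ℂ) ^ 2 : ℂ) = ((-π / δ * (y - x) ^ 2 : ℝ) : ℂ) by
      push_cast; ring]
    exact Complex.ofReal_re _

/-- Bessel's inequality for the Fourier transform on `L¹`. -/
theorem lintegral_enorm_fourier_sq_le {g : ℝ → ℂ} (hg : Integrable g) :
    ∫⁻ σ, ‖𝓕 g σ‖ₑ ^ 2 ≤ ∫⁻ x, ‖g x‖ₑ ^ 2 := by
  have hgm : AEMeasurable fun x => ‖g x‖ₑ := hg.1.enorm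
  have hc : Continuous (𝓕 g) := continuous_fourier hg
  have key : ∀ δ : ℝ, 0 < δ → ∫⁻ σ, ENNReal.ofReal (‖𝓕 g σ‖ ^ 2 * Real.exp (-π * δ * σ ^ 2)) ≤
      ∫⁻ x, ‖g x‖ₑ ^ 2 := by
    intro δ hδ
    set γ : ℝ → ℝ≥0∞ := fun z => ENNReal.ofReal (δ ^ (-(1 / 2) : ℝ) * Real.exp (-π / δ * z ^ 2))
    have hγ : Measurable γ := by fun_prop
    have hγs : ∀ z, γ (-z) = γ z := fun z => by simp [γ]
    have hγ1 : ∫⁻ y, γ y = 1 := gaussian_mass hδ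
    have hE : Integrable fun σ : ℝ => Real.exp (-π * δ * σ ^ 2) := by
      have := integrable_exp_neg_mul_sq (b := π * δ) (by positivity)
      simpa only [neg_mul] using this
    have hb : ∀ σ, ‖𝓕 g σ‖ ≤ ∫ v, ‖g v‖ := norm_fourier_le g
    set k : ℝ → ℂ := fun σ => starRingEnd ℂ (𝓕 g σ) * (Real.exp (-π * δ * σ ^ 2) : ℝ) with hk
    have hki : Integrable k := by
      refine Integrable.bdd_mul (c := ∫ v, ‖g v‖) hE.ofReal
        (by exact (Complex.continuous_conj.comp hc).aestronglyMeasurable) ?_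
      filter_upwards with σ
      rw [RCLike.norm_conj]; exact hb σ
    have h1 : ∫ σ, 𝓕 g σ * k σ = ((∫ σ, ‖𝓕 g σ‖ ^ 2 * Real.exp (-π * δ * σ ^ 2) : ℝ) : ℂ) := by
      rw [← integral_complex_ofReal]
      congr 1; ext σ
      rw [hk]
      dsimp only
      rw [← mul_assoc, Complex.mul_conj, Complex.normSq_eq_norm_sq]
      push_cast; ring
    have h2 : ∀ x, ‖𝓕 k x‖ₑ ≤ ∫⁻ y, ‖g y‖ₑ * γ (y - x) := by
      intro x
      have e : 𝓕 k x = starRingEnd ℂ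
          (∫ σ, 𝓕 g σ * Complex.exp (-π * δ * σ ^ 2 + 2 * π * (Complex.I * x) * σ)) := by
        rw [← integral_conj, Real.fourier_eq' ]
        congr 1; ext σ
        simp only [hk, smul_eq_mul, map_mul, ← Complex.exp_conj]
        rw [mul_left_comm]
        congr 1
        rw [Complex.ofReal_exp, ← Complex.exp_add]
        congr 1
        simp only [map_add, map_mul, map_pow, map_neg, Complex.conj_ofReal, Complex.conj_I,
          map_ofNat, Complex.ofReal_mul, Complex.ofReal_neg, Complex.ofReal_pow,
          Complex.ofReal_ofNat, RCLike.inner_apply, conj_trivial]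
        ring
      rw [e, RCLike.enorm_conj]
      exact norm_fourier_gaussian_mul_le hg hδ x
    have hli : Integrable fun σ => ‖𝓕 g σ‖ ^ 2 * Real.exp (-π * δ * σ ^ 2) := by
      refine Integrable.bdd_mul (c := (∫ v, ‖g v‖) ^ 2) hE
        (by exact (hc.norm.pow 2).aestronglyMeasurable) ?_
      filter_upwards with σ
      rw [norm_pow, norm_norm]
      gcongr
      exact hb σ
    rw [← ofReal_integral_eq_lintegral_ofReal hli (by filter_upwards with σ; positivity)]
    have h3 : ENNReal.ofReal (∫ σ, ‖𝓕 g σ‖ ^ 2 * Real.exp (-π * δ * σ ^ 2)) =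
        ‖∫ σ, 𝓕 g σ * k σ‖ₑ := by
      rw [h1, ← ofReal_norm, Complex.norm_real, Real.norm_eq_abs, abs_of_nonneg]
      exact integral_nonneg fun σ => by positivity
    rw [h3, integral_fourier_mul_eq hg hki]
    have young : ∀ a b : ℝ≥0∞, a * b ≤ (a ^ 2 + b ^ 2) / 2 := by
      intro a b
      have := ENNReal.young_inequality a b Real.HolderConjugate.two_two
      rw [ENNReal.add_div]
      simpa using this
    calc ‖∫ x, g x * 𝓕 k x‖ₑ ≤ ∫⁻ x, ‖g x * 𝓕 k x‖ₑ := enorm_integral_le_lintegral_enorm _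
      _ ≤ ∫⁻ x, ∫⁻ y, (‖g x‖ₑ ^ 2 + ‖g y‖ₑ ^ 2) / 2 * γ (y - x) := by
          apply lintegral_mono
          intro x
          dsimp only
          rw [enorm_mul]
          refine (mul_le_mul_right (h2 x) _).trans ?_
          rw [← lintegral_const_mul'' _ (by fun_prop)]
          apply lintegral_mono
          intro y
          dsimp only
          rw [← mul_assoc]
          gcongr
          exact young _ _
      _ = (∫⁻ x, ∫⁻ y, ‖g x‖ₑ ^ 2 / 2 * γ (y - x)) + ∫⁻ x, ∫⁻ y, ‖g y‖ₑ ^ 2 / 2 * γ (y - x) := by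
          rw [← lintegral_add_left']
          · apply lintegral_congr; intro x
            rw [← lintegral_add_left (by fun_prop)]
            apply lintegral_congr; intro y
            rw [ENNReal.add_div, add_mul]
          · have : ∀ x, ∫⁻ y, ‖g x‖ₑ ^ 2 / 2 * γ (y - x) = ‖g x‖ₑ ^ 2 / 2 * ∫⁻ y, γ (y - x) :=
              fun x => lintegral_const_mul _ (by fun_prop)
            simp_rw [this, lintegral_sub_right_eq_self (fun y => γ y), hγ1]
            fun_prop
      _ = (∫⁻ x, ‖g x‖ₑ ^ 2 / 2) + ∫⁻ x, ‖g x‖ₑ ^ 2 / 2 := by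
          congr 1
          · apply lintegral_congr; intro x
            rw [lintegral_const_mul _ (by fun_prop), lintegral_sub_right_eq_self (fun y => γ y),
              hγ1, mul_one]
          · rw [lintegral_lintegral_swap]
            · apply lintegral_congr; intro y
              rw [lintegral_const_mul _ (by fun_prop), lintegral_sub_left_eq_self (fun y => γ y),
                hγ1, mul_one]
            · have : AEMeasurable fun p : ℝ × ℝ => ‖g p.2‖ₑ :=
                hgm.comp_quasiMeasurePreserving Measure.quasiMeasurePreserving_snd
              unfold Function.uncurry
              fun_prop
      _ = _ := by
          rw [← lintegral_add_left' (by fun_prop)]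
          apply lintegral_congr; intro x
          exact ENNReal.add_halves _
  have lim : ∀ σ, Filter.Tendsto
      (fun n : ℕ => ENNReal.ofReal (‖𝓕 g σ‖ ^ 2 * Real.exp (-π * (1 / ((n : ℝ) + 1)) * σ ^ 2)))
      Filter.atTop (nhds (‖𝓕 g σ‖ₑ ^ 2)) := by
    intro σ
    have h0 := tendsto_one_div_add_atTop_nhds_zero_nat (𝕜 := ℝ)
    have h1 : Filter.Tendsto (fun n : ℕ => ‖𝓕 g σ‖ ^ 2 *
        Real.exp (-π * (1 / ((n : ℝ) + 1)) * σ ^ 2)) Filter.atTop (nhds (‖𝓕 g σ‖ ^ 2)) := by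
      have := ((Real.continuous_exp.tendsto _).comp
        ((h0.const_mul (-π)).mul_const (σ ^ 2))).const_mul (‖𝓕 g σ‖ ^ 2)
      simpa using this
    have h2 := ENNReal.tendsto_ofReal h1
    rwa [ENNReal.ofReal_pow (norm_nonneg _), ofReal_norm] at h2
  calc ∫⁻ σ, ‖𝓕 g σ‖ₑ ^ 2 = ∫⁻ σ, Filter.liminf (fun n : ℕ =>
        ENNReal.ofReal (‖𝓕 g σ‖ ^ 2 * Real.exp (-π * (1 / ((n : ℝ) + 1)) * σ ^ 2))) Filter.atTop :=
        lintegral_congr fun σ => (lim σ).liminf_eq.symm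
    _ ≤ Filter.liminf (fun n : ℕ => ∫⁻ σ,
        ENNReal.ofReal (‖𝓕 g σ‖ ^ 2 * Real.exp (-π * (1 / ((n : ℝ) + 1)) * σ ^ 2))) Filter.atTop :=
        lintegral_liminf_le fun n => by
          have := hc.measurable
          fun_prop
    _ ≤ ∫⁻ x, ‖g x‖ₑ ^ 2 := by
        refine (Filter.liminf_le_liminf (v := fun _ => ∫⁻ x, ‖g x‖ₑ ^ 2)
          (Filter.Eventually.of_forall fun n => key _ (by positivity))).trans ?_
        simp

/-- The decaying half-exponential. -/
def expHalf (t : ℝ) : ℂ := (Ici (0 : ℝ)).indicator (fun t => (Real.exp (-t) : ℂ)) t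

@[fun_prop]
theorem measurable_expHalf : Measurable expHalf := by
  unfold expHalf
  exact Measurable.indicator (by fun_prop) measurableSet_Ici

theorem integrable_expHalf : Integrable expHalf := by
  unfold expHalf
  rw [integrable_indicator_iff measurableSet_Ici, integrableOn_Ici_iff_integrableOn_Ioi]
  exact (integrableOn_exp_neg_Ioi 0).ofReal

theorem one_add_ne_zero (σ : ℝ) : (1 + 2 * π * Complex.I * σ : ℂ) ≠ 0 := by
  intro h
  have := congrArg Complex.re h
  simp at this

theorem one_sub_ne_zero (σ : ℝ) : (1 - 2 * π * Complex.I * σ : ℂ) ≠ 0 := by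
  intro h
  have := congrArg Complex.re h
  simp at this

theorem le_two_mul_norm_one_add (σ : ℝ) : 1 + |σ| ≤ 2 * ‖(1 + 2 * π * Complex.I * σ : ℂ)‖ := by
  have h : ‖(1 + 2 * π * Complex.I * σ : ℂ)‖ ^ 2 = 1 + (2 * π * σ) ^ 2 := by
    rw [← Complex.normSq_eq_norm_sq, Complex.normSq_apply]; simp; ring
  have hp := Real.pi_gt_three
  have : |σ| ^ 2 = σ ^ 2 := sq_abs σ
  refine abs_le_of_sq_le_sq' ?_ (by positivity) |>.2
  rw [mul_pow, h]
  have : 9 * σ ^ 2 ≤ π ^ 2 * σ ^ 2 := by gcongr; nlinarith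
  nlinarith [sq_nonneg (|σ| - 1)]

theorem le_two_mul_norm_one_sub (σ : ℝ) : 1 + |σ| ≤ 2 * ‖(1 - 2 * π * Complex.I * σ : ℂ)‖ := by
  have := le_two_mul_norm_one_add (-σ)
  rw [abs_neg] at this
  convert this using 3
  push_cast; ring

theorem enorm_inv_le_wt {z : ℂ} {σ : ℝ} (h : 1 + |σ| ≤ 2 * ‖z‖) : ‖z⁻¹‖ₑ ≤ 2 * wt 1 σ := by
  unfold wt
  rw [← ofReal_norm, ← ENNReal.ofReal_ofNat, ← ENNReal.ofReal_mul (by norm_num)]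
  apply ENNReal.ofReal_le_ofReal
  have h0 : 0 < 1 + |σ| := by positivity
  have hz : 0 < ‖z‖ := by linarith
  rw [norm_inv, Real.rpow_neg_one, inv_le_comm₀ hz (by positivity), mul_inv, inv_inv]
  linarith

theorem fourier_expHalf (σ : ℝ) : 𝓕 expHalf σ = (1 + 2 * π * Complex.I * σ)⁻¹ := by
  have h : ∀ t : ℝ, Complex.exp ((-2 * π * inner ℝ t σ : ℝ) * Complex.I) • expHalf t =
      (Ici (0 : ℝ)).indicator (fun t : ℝ => Complex.exp (-(1 + 2 * π * Complex.I * σ) * t)) t := by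
    intro t
    unfold expHalf
    by_cases ht : t ∈ Ici (0 : ℝ)
    · rw [indicator_of_mem ht, indicator_of_mem ht, smul_eq_mul, Complex.ofReal_exp,
        ← Complex.exp_add]
      congr 1
      simp only [RCLike.inner_apply, conj_trivial]
      push_cast; ring
    · rw [indicator_of_notMem ht, indicator_of_notMem ht, smul_zero]
  rw [Real.fourier_eq']
  simp_rw [h]
  rw [integral_indicator measurableSet_Ici, integral_Ici_eq_integral_Ioi,
    integral_exp_mul_complex_Ioi (by simp)]
  rw [← neg_div_neg_eq, neg_neg]
  simp

/-- The causal exponential average of a source. -/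
def expAvg (g : ℝ → ℂ) (t : ℝ) : ℂ := ∫ s, g s * expHalf (t - s)

theorem expAvg_eq_convolution (g : ℝ → ℂ) :
    expAvg g = convolution g expHalf (ContinuousLinearMap.mul ℂ ℂ) := by
  ext t; rfl

theorem norm_expHalf_le (t : ℝ) : ‖expHalf t‖ ≤ 1 := by
  unfold expHalf
  by_cases ht : t ∈ Ici (0 : ℝ)
  · rw [indicator_of_mem ht, Complex.norm_real, Real.norm_eq_abs, abs_of_nonneg (by positivity)]
    exact Real.exp_le_one_iff.2 (by simpa using ht)
  · rw [indicator_of_notMem ht]; simp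

theorem continuousAt_expHalf {t : ℝ} (ht : t ≠ 0) : ContinuousAt expHalf t := by
  unfold expHalf
  rcases lt_or_gt_of_ne ht with h | h
  · refine (continuousAt_const (y := (0 : ℂ))).congr ?_
    filter_upwards [Iio_mem_nhds h] with s hs
    rw [indicator_of_notMem (by simpa using hs)]
  · have : ContinuousAt (fun t : ℝ => (Real.exp (-t) : ℂ)) t := by fun_prop
    refine this.congr ?_
    filter_upwards [Ioi_mem_nhds h] with s hs
    rw [indicator_of_mem (mem_Ici.2 (le_of_lt (mem_Ioi.1 hs)))]

theorem continuous_expAvg {g : ℝ → ℂ} (hg : Integrable g) : Continuous (expAvg g) := by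
  rw [continuous_iff_continuousAt]
  intro t
  unfold expAvg
  refine continuousAt_of_dominated (bound := fun s => ‖g s‖) ?_ ?_ hg.norm ?_
  · filter_upwards with x
    exact hg.1.mul (by fun_prop : Measurable fun s => expHalf (x - s)).aestronglyMeasurable
  · filter_upwards with x
    filter_upwards with s
    rw [norm_mul]
    exact mul_le_of_le_one_right (norm_nonneg _) (norm_expHalf_le _)
  · filter_upwards [compl_mem_ae_iff.2 (measure_singleton t)] with s hs
    refine continuousAt_const.mul ?_
    have : ContinuousAt (fun x => x - s) t := by fun_prop
    exact ContinuousAt.comp (f := fun x => x - s) (continuousAt_expHalf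
      (sub_ne_zero.2 (fun h => hs h.symm))) this

theorem lintegral_wt_one_mul_sq_le {f : ℝ → ℝ≥0∞} (hf : AEMeasurable f) :
    (∫⁻ σ, wt 1 σ * f σ) ^ 2 ≤ wtMass 2 * ∫⁻ σ, f σ ^ 2 := by
  refine (lintegral_mul_sq_le (by fun_prop) hf).trans_eq ?_
  congr 1
  apply lintegral_congr; intro σ
  rw [sq, wt_mul_wt]; norm_num

theorem integrable_fourier_div {g : ℝ → ℂ} (hg : Integrable g) (h2 : ∫⁻ s, ‖g s‖ₑ ^ 2 < ⊤) :
    Integrable fun σ : ℝ => 𝓕 g σ * (1 + 2 * π * Complex.I * σ)⁻¹ := by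
  have hc := continuous_fourier hg
  refine ⟨(hc.mul (Continuous.inv₀ (by fun_prop) one_add_ne_zero)).aestronglyMeasurable, ?_⟩
  have : (∫⁻ σ, wt 1 σ * ‖𝓕 g σ‖ₑ) ^ 2 < ⊤ :=
    (lintegral_wt_one_mul_sq_le hc.measurable.enorm.aemeasurable).trans_lt (ENNReal.mul_lt_top
      (wtMass_lt_top (by norm_num)) ((lintegral_enorm_fourier_sq_le hg).trans_lt h2))
  have h3 : ∫⁻ σ, wt 1 σ * ‖𝓕 g σ‖ₑ < ⊤ := by
    by_contra hcon
    rw [not_lt_top_iff] at hcon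
    rw [hcon] at this
    simp at this
  have hm := hc.measurable
  calc ∫⁻ σ : ℝ, ‖𝓕 g σ * (1 + 2 * π * Complex.I * σ)⁻¹‖ₑ
      ≤ ∫⁻ σ, 2 * (wt 1 σ * ‖𝓕 g σ‖ₑ) := by
        apply lintegral_mono; intro σ
        dsimp only
        rw [enorm_mul, mul_comm, ← mul_assoc]
        gcongr
        exact enorm_inv_le_wt (le_two_mul_norm_one_add σ)
    _ < ⊤ := by
        rw [lintegral_const_mul _ (by fun_prop)]
        exact ENNReal.mul_lt_top (by simp) h3

theorem expAvg_eq_integral {g : ℝ → ℂ} (hg : Integrable g) (h2 : ∫⁻ s, ‖g s‖ₑ ^ 2 < ⊤) (t : ℝ) :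
    expAvg g t = ∫ σ : ℝ, 𝓕 g σ * (1 + 2 * π * Complex.I * σ)⁻¹ *
      Complex.exp (2 * π * Complex.I * σ * t) := by
  have hF : 𝓕 (expAvg g) = fun σ : ℝ => 𝓕 g σ * (1 + 2 * π * Complex.I * σ)⁻¹ := by
    ext σ
    rw [expAvg_eq_convolution, Real.fourier_mul_convolution_eq hg integrable_expHalf,
      fourier_expHalf]
  have hi : Integrable (expAvg g) := by
    rw [expAvg_eq_convolution]
    exact hg.integrable_convolution _ integrable_expHalf
  have inv := (continuous_expAvg hg).fourierInv_fourier_eq hi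
    (by rw [hF]; exact integrable_fourier_div hg h2)
  rw [← inv, hF, Real.fourierInv_eq']
  congr 1
  ext σ
  rw [smul_eq_mul, mul_comm]
  congr 2
  simp only [RCLike.inner_apply, conj_trivial]
  push_cast; ring

/-- The source generating the constant extension of an initial value. -/
def constSrc (s : ℝ) : ℂ := 2 * expHalf (-s)

theorem integrable_constSrc : Integrable constSrc :=
  (integrable_expHalf.comp_neg).const_mul 2

theorem norm_constSrc_le (s : ℝ) : ‖constSrc s‖ ≤ 2 := by
  unfold constSrc
  rw [norm_mul]
  have := norm_expHalf_le (-s)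
  simp; linarith

theorem lintegral_sq_lt_top_of_bdd {g : ℝ → ℂ} (hg : Integrable g) {K : ℝ}
    (hK : ∀ s, ‖g s‖ ≤ K) : ∫⁻ s, ‖g s‖ₑ ^ 2 < ⊤ := by
  calc ∫⁻ s, ‖g s‖ₑ ^ 2 ≤ ∫⁻ s, ENNReal.ofReal K * ‖g s‖ₑ := by
        apply lintegral_mono; intro s
        dsimp only
        rw [sq]
        gcongr
        rw [← ofReal_norm]
        exact ENNReal.ofReal_le_ofReal (hK s)
    _ < ⊤ := by
        rw [lintegral_const_mul'' _ hg.1.enorm]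
        exact ENNReal.mul_lt_top (by simp) hg.2

theorem fourier_constSrc (σ : ℝ) : 𝓕 constSrc σ = 2 * (1 - 2 * π * Complex.I * σ)⁻¹ := by
  have h := fourier_expHalf (-σ)
  rw [Real.fourier_eq'] at h ⊢
  rw [← integral_neg_eq_self] at h
  unfold constSrc
  rw [show (1 - 2 * π * Complex.I * σ : ℂ) = 1 + 2 * π * Complex.I * ((-σ : ℝ) : ℂ) by
    push_cast; ring, ← h, ← integral_const_mul]
  congr 1; ext t
  simp only [smul_eq_mul, RCLike.inner_apply, conj_trivial, neg_mul_neg]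
  ring

theorem expAvg_constSrc {t : ℝ} (ht : 0 ≤ t) : expAvg constSrc t = (Real.exp (-t) : ℂ) := by
  unfold expAvg
  have h : ∀ s : ℝ, constSrc s * expHalf (t - s) =
      (Iic (0 : ℝ)).indicator (fun s : ℝ => 2 * (Real.exp (-t) : ℂ) * Complex.exp (2 * s)) s := by
    intro s
    unfold constSrc expHalf
    by_cases hs : s ∈ Iic (0 : ℝ)
    · have hs' : s ≤ 0 := hs
      rw [indicator_of_mem hs, indicator_of_mem (by simpa using hs),
        indicator_of_mem (by simp; linarith)]
      push_cast
      rw [mul_assoc, mul_assoc, ← Complex.exp_add, ← Complex.exp_add]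
      congr 2
      ring
    · rw [indicator_of_notMem hs, indicator_of_notMem (by simpa using hs)]
      simp
  simp_rw [h]
  rw [integral_indicator measurableSet_Iic, integral_const_mul,
    integral_exp_mul_complex_Iic (by simp)]
  simp
  field_simp

/-- The time-frequency transform of an exponentially damped source. -/
def gHat (G : ℝ → ℝ → ℂ) (ξ σ : ℝ) : ℂ := 𝓕 (fun s : ℝ => (Real.exp (-s) : ℂ) * G s ξ) σ

/-- The space-time amplitude of the profile with initial value `h` and source `G`. -/
def amp (h : ℝ → ℂ) (G : ℝ → ℝ → ℂ) (ξ σ : ℝ) : ℂ :=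
  (h ξ * (2 * (1 - 2 * π * Complex.I * σ)⁻¹) + ξ * gHat G ξ σ) * (1 + 2 * π * Complex.I * σ)⁻¹

/-- The profile with initial value `h` and source `G`. -/
def prof (h : ℝ → ℂ) (G : ℝ → ℝ → ℂ) (t ξ : ℝ) : ℂ := h ξ + ξ * ∫ s in Iic t, G s ξ

/-- Admissible sources: bounded, supported in unit time, square integrable with one derivative. -/
structure IsSrc (G : ℝ → ℝ → ℂ) : Prop where
  meas : Measurable fun p : ℝ × ℝ => G p.1 p.2
  supp : ∀ s ξ, s ∉ Icc (0 : ℝ) 1 → G s ξ = 0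
  bdd : ∃ K : ℝ, ∀ s ξ, ‖G s ξ‖ ≤ K
  sq : ∫⁻ ξ, ∫⁻ s, ‖G s ξ‖ₑ ^ 2 < ⊤
  wsq : ∫⁻ ξ, ∫⁻ s, (‖ξ‖ₑ * ‖G s ξ‖ₑ) ^ 2 < ⊤

theorem measurable_slice_left {G : ℝ → ℝ → ℂ} (h : Measurable fun p : ℝ × ℝ => G p.1 p.2)
    (ξ : ℝ) : Measurable fun s => G s ξ :=
  h.comp (by fun_prop : Measurable fun s : ℝ => (s, ξ))

theorem integrable_phase_mul {α : Type*} [MeasurableSpace α] {μ : Measure α} {f : α → ℂ}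
    (hf : Integrable f μ) {φ : α → ℝ} (hφ : Measurable φ) :
    Integrable (fun s => Complex.exp (φ s * Complex.I) * f s) μ := by
  refine hf.mono ((by fun_prop : Measurable fun s =>
    Complex.exp (φ s * Complex.I)).aestronglyMeasurable.mul hf.1)
    (Filter.Eventually.of_forall fun s => ?_)
  rw [norm_mul, Complex.norm_exp_ofReal_mul_I, one_mul]

theorem fourier_add_apply {f g : ℝ → ℂ} (hf : Integrable f) (hg : Integrable g) (ξ : ℝ) :
    𝓕 (fun s => f s + g s) ξ = 𝓕 f ξ + 𝓕 g ξ := by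
  rw [Real.fourier_eq', Real.fourier_eq', Real.fourier_eq', ← integral_add]
  · congr 1; ext s; exact smul_add _ _ _
  · exact integrable_phase_mul hf (by simp only [RCLike.inner_apply, conj_trivial]; fun_prop)
  · exact integrable_phase_mul hg (by simp only [RCLike.inner_apply, conj_trivial]; fun_prop)

theorem fourier_const_mul_apply (c : ℂ) (f : ℝ → ℂ) (ξ : ℝ) :
    𝓕 (fun s => c * f s) ξ = c * 𝓕 f ξ := by
  rw [Real.fourier_eq', Real.fourier_eq', ← integral_const_mul]
  congr 1; ext s
  simp only [smul_eq_mul]; ring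

theorem add_sq_le_two_mul (a b : ℝ≥0∞) : (a + b) ^ 2 ≤ 2 * a ^ 2 + 2 * b ^ 2 := by
  have := ENNReal.rpow_add_le_mul_rpow_add_rpow a b (p := 2) (by norm_num)
  rw [show (2 : ℝ) - 1 = 1 by norm_num, ENNReal.rpow_one] at this
  rw [← mul_add]
  exact_mod_cast this

namespace IsSrc

variable {G : ℝ → ℝ → ℂ} (hG : IsSrc G)
include hG

theorem norm_damped_le (s ξ : ℝ) : ‖(Real.exp (-s) : ℂ) * G s ξ‖ ≤ ‖G s ξ‖ := by
  by_cases hs : s ∈ Icc (0 : ℝ) 1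
  · rw [norm_mul, Complex.norm_real, Real.norm_eq_abs, abs_of_nonneg (by positivity)]
    exact mul_le_of_le_one_left (norm_nonneg _) (Real.exp_le_one_iff.2 (by linarith [hs.1]))
  · simp [hG.supp s ξ hs]

theorem meas_damped : Measurable fun p : ℝ × ℝ => (Real.exp (-p.1) : ℂ) * G p.1 p.2 := by
  have := hG.meas
  fun_prop

theorem integrable_source (ξ : ℝ) : Integrable fun s => G s ξ := by
  obtain ⟨K, hK⟩ := hG.bdd
  have h : (fun s => G s ξ) = (Icc (0 : ℝ) 1).indicator fun s => G s ξ := by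
    ext s
    by_cases hs : s ∈ Icc (0 : ℝ) 1
    · rw [indicator_of_mem hs]
    · rw [indicator_of_notMem hs, hG.supp s ξ hs]
  rw [h, integrable_indicator_iff measurableSet_Icc]
  exact IntegrableOn.of_bound (by simp) (measurable_slice_left hG.meas ξ).aestronglyMeasurable K
    (Filter.Eventually.of_forall fun s => hK s ξ)

theorem integrable_damped (ξ : ℝ) : Integrable fun s : ℝ => (Real.exp (-s) : ℂ) * G s ξ :=
  (hG.integrable_source ξ).mono (measurable_slice_left
    (G := fun s ξ => (Real.exp (-s) : ℂ) * G s ξ) hG.meas_damped ξ).aestronglyMeasurable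
    (Filter.Eventually.of_forall fun s => hG.norm_damped_le s ξ)

theorem lintegral_damped_sq_lt_top (ξ : ℝ) :
    ∫⁻ s : ℝ, ‖(Real.exp (-s) : ℂ) * G s ξ‖ₑ ^ 2 < ⊤ := by
  obtain ⟨K, hK⟩ := hG.bdd
  exact lintegral_sq_lt_top_of_bdd (hG.integrable_damped ξ)
    fun s => (hG.norm_damped_le s ξ).trans (hK s ξ)

@[fun_prop]
theorem measurable_gHat : Measurable fun p : ℝ × ℝ => gHat G p.1 p.2 := by
  have h1 : Measurable fun q : (ℝ × ℝ) × ℝ => G q.2 q.1.1 :=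
    hG.meas.comp (by fun_prop : Measurable fun q : (ℝ × ℝ) × ℝ => (q.2, q.1.1))
  have h : Measurable (Function.uncurry fun (p : ℝ × ℝ) (s : ℝ) =>
      Complex.exp ((-2 * π * (p.2 * s) : ℝ) * Complex.I) * ((Real.exp (-s) : ℂ) * G s p.1)) := by
    have e1 : Measurable fun q : (ℝ × ℝ) × ℝ =>
      Complex.exp ((-2 * π * (q.1.2 * q.2) : ℝ) * Complex.I) := by fun_prop
    exact e1.mul (Measurable.mul (by fun_prop) h1)
  convert (h.stronglyMeasurable.integral_prod_right (ν := (volume : Measure ℝ))).measurable using 1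
  ext p
  unfold gHat
  rw [Real.fourier_eq']
  simp only [RCLike.inner_apply, conj_trivial, smul_eq_mul]

theorem continuous_gHat (ξ : ℝ) : Continuous (gHat G ξ) :=
  continuous_fourier (hG.integrable_damped ξ)

theorem lintegral_gHat_sq_le (ξ : ℝ) : ∫⁻ σ, ‖gHat G ξ σ‖ₑ ^ 2 ≤ ∫⁻ s, ‖G s ξ‖ₑ ^ 2 := by
  refine (lintegral_enorm_fourier_sq_le (hG.integrable_damped ξ)).trans ?_
  gcongr with s
  exact enorm_le_iff_norm_le.2 (hG.norm_damped_le s ξ)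

@[fun_prop]
theorem measurable_amp {h : ℝ → ℂ} (hh : Measurable h) :
    Measurable fun p : ℝ × ℝ => amp h G p.1 p.2 := by
  have := hG.measurable_gHat
  unfold amp
  fun_prop

omit hG in
theorem enorm_amp_le (h : ℝ → ℂ) (G : ℝ → ℝ → ℂ) (ξ σ : ℝ) :
    ‖amp h G ξ σ‖ₑ ≤ 8 * (wt 2 σ * ‖h ξ‖ₑ) + 2 * (wt 1 σ * (‖ξ‖ₑ * ‖gHat G ξ σ‖ₑ)) := by
  have h1 := enorm_inv_le_wt (le_two_mul_norm_one_add σ)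
  have h2 := enorm_inv_le_wt (le_two_mul_norm_one_sub σ)
  have e2 : ‖(2 : ℂ)‖ₑ = 2 := by
    rw [← ofReal_norm]; simp
  have e3 : ‖(ξ : ℂ)‖ₑ = ‖ξ‖ₑ := by
    rw [← ofReal_norm, Complex.norm_real, ofReal_norm]
  have w2 : wt 2 σ = wt 1 σ * wt 1 σ := by rw [wt_mul_wt]; norm_num
  unfold amp
  rw [enorm_mul]
  calc _ ≤ (‖h ξ‖ₑ * (2 * (2 * wt 1 σ)) + ‖ξ‖ₑ * ‖gHat G ξ σ‖ₑ) * (2 * wt 1 σ) := by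
        gcongr
        refine (enorm_add_le _ _).trans ?_
        rw [enorm_mul, enorm_mul, enorm_mul, e2, e3]
        gcongr
    _ = _ := by rw [w2]; ring

theorem fourier_src (h : ℝ → ℂ) (ξ σ : ℝ) :
    𝓕 (fun s : ℝ => h ξ * constSrc s + ξ * ((Real.exp (-s) : ℂ) * G s ξ)) σ =
      h ξ * (2 * (1 - 2 * π * Complex.I * σ)⁻¹) + ξ * gHat G ξ σ := by
  rw [← fourier_constSrc, gHat, fourier_add_apply (integrable_constSrc.const_mul _)
    ((hG.integrable_damped ξ).const_mul _), fourier_const_mul_apply, fourier_const_mul_apply]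

theorem integrable_src (h : ℝ → ℂ) (ξ : ℝ) :
    Integrable fun s : ℝ => h ξ * constSrc s + ξ * ((Real.exp (-s) : ℂ) * G s ξ) :=
  (integrable_constSrc.const_mul _).add ((hG.integrable_damped ξ).const_mul _)

theorem lintegral_src_sq_lt_top (h : ℝ → ℂ) (ξ : ℝ) :
    ∫⁻ s : ℝ, ‖h ξ * constSrc s + ξ * ((Real.exp (-s) : ℂ) * G s ξ)‖ₑ ^ 2 < ⊤ := by
  obtain ⟨K, hK⟩ := hG.bdd
  refine lintegral_sq_lt_top_of_bdd (hG.integrable_src h ξ) (K := ‖h ξ‖ * 2 + |ξ| * K) fun s => ?_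
  refine (norm_add_le _ _).trans ?_
  rw [norm_mul, norm_mul, Complex.norm_real, Real.norm_eq_abs]
  gcongr
  · exact norm_constSrc_le s
  · exact (hG.norm_damped_le s ξ).trans (hK s ξ)

omit hG in
theorem expAvg_damped (t ξ : ℝ) : expAvg (fun s : ℝ => (Real.exp (-s) : ℂ) * G s ξ) t =
    (Real.exp (-t) : ℂ) * ∫ s in Iic t, G s ξ := by
  unfold expAvg
  rw [← integral_const_mul, ← integral_indicator measurableSet_Iic]
  congr 1; ext s
  unfold expHalf
  by_cases hs : s ≤ t
  · rw [indicator_of_mem (by simpa using hs), indicator_of_mem (by simpa using hs)]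
    rw [mul_right_comm, ← Complex.ofReal_mul, ← Real.exp_add]
    congr 3; ring
  · rw [indicator_of_notMem (by simpa using hs), indicator_of_notMem (by simpa using hs), mul_zero]

theorem integral_amp (h : ℝ → ℂ) {t : ℝ} (ht : 0 ≤ t) (ξ : ℝ) :
    ∫ σ : ℝ, amp h G ξ σ * Complex.exp (2 * π * Complex.I * σ * t) =
      (Real.exp (-t) : ℂ) * prof h G t ξ := by
  have e := expAvg_eq_integral (hG.integrable_src h ξ) (hG.lintegral_src_sq_lt_top h ξ) t
  simp_rw [hG.fourier_src h ξ] at e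
  unfold amp
  rw [← e]
  have e1 := expAvg_constSrc ht
  have e2 := expAvg_damped (G := G) t ξ
  unfold prof expAvg at *
  have j : ∀ {g : ℝ → ℂ}, Integrable g → Integrable fun s => g s * expHalf (t - s) := by
    intro g hg
    refine hg.mono (hg.1.mul (by fun_prop : Measurable fun s =>
      expHalf (t - s)).aestronglyMeasurable) (Filter.Eventually.of_forall fun s => ?_)
    rw [norm_mul]
    exact mul_le_of_le_one_right (norm_nonneg _) (norm_expHalf_le _)
  simp_rw [add_mul, mul_assoc (h ξ), mul_assoc (ξ : ℂ)]
  rw [integral_add ((j integrable_constSrc).const_mul _) ((j (hG.integrable_damped ξ)).const_mul _),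
    integral_const_mul, integral_const_mul, e1, e2]
  ring

theorem sq_lintegral_amp_le (h : ℝ → ℂ) (ξ : ℝ) : (∫⁻ σ, ‖amp h G ξ σ‖ₑ) ^ 2 ≤
    2 * (8 * wtMass 2 * ‖h ξ‖ₑ) ^ 2 + 8 * wtMass 2 * ∫⁻ s, (‖ξ‖ₑ * ‖G s ξ‖ₑ) ^ 2 := by
  have m := (hG.continuous_gHat ξ).measurable
  have h1 : ∫⁻ σ, ‖amp h G ξ σ‖ₑ ≤
      8 * wtMass 2 * ‖h ξ‖ₑ + 2 * ∫⁻ σ, wt 1 σ * (‖ξ‖ₑ * ‖gHat G ξ σ‖ₑ) := by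
    refine (lintegral_mono (enorm_amp_le h G ξ)).trans_eq ?_
    rw [lintegral_add_left (by fun_prop), lintegral_const_mul _ (by fun_prop),
      lintegral_const_mul _ (by fun_prop), lintegral_mul_const _ (by fun_prop), wtMass]
    ring
  have h2 : (∫⁻ σ, wt 1 σ * (‖ξ‖ₑ * ‖gHat G ξ σ‖ₑ)) ^ 2 ≤
      wtMass 2 * ∫⁻ s, (‖ξ‖ₑ * ‖G s ξ‖ₑ) ^ 2 := by
    refine (lintegral_wt_one_mul_sq_le (by fun_prop)).trans (mul_le_mul' le_rfl ?_)
    simp_rw [mul_pow]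
    rw [lintegral_const_mul _ (by fun_prop),
      lintegral_const_mul _ (by have := measurable_slice_left hG.meas ξ; fun_prop)]
    exact mul_le_mul' le_rfl (hG.lintegral_gHat_sq_le ξ)
  calc _ ≤ _ := pow_le_pow_left' h1 2
    _ ≤ _ := add_sq_le_two_mul _ _
    _ ≤ _ := by
      refine add_le_add le_rfl ?_
      rw [mul_pow]
      calc _ ≤ 2 * (2 ^ 2 * (wtMass 2 * ∫⁻ s, (‖ξ‖ₑ * ‖G s ξ‖ₑ) ^ 2)) := by gcongr
        _ = _ := by ring

theorem lintegral_sq_lintegral_amp_lt_top {h : ℝ → ℂ} (hh : Measurable h)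
    (h2 : ∫⁻ ξ, ‖h ξ‖ₑ ^ 2 < ⊤) : ∫⁻ ξ, (∫⁻ σ, ‖amp h G ξ σ‖ₑ) ^ 2 < ⊤ := by
  have hm := (wtMass_lt_top (q := 2) (by norm_num)).ne
  refine (lintegral_mono (hG.sq_lintegral_amp_le h)).trans_lt ?_
  rw [lintegral_add_left (by fun_prop), lintegral_const_mul' _ _ (ENNReal.mul_ne_top (by simp) hm)]
  refine ENNReal.add_lt_top.2 ⟨?_, ENNReal.mul_lt_top (ENNReal.mul_lt_top (by simp) hm.lt_top)
    hG.wsq⟩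
  simp_rw [mul_pow (8 * wtMass 2)]
  rw [lintegral_const_mul' _ _ (by simp), lintegral_const_mul' _ _
    (ENNReal.pow_ne_top (ENNReal.mul_ne_top (by simp) hm))]
  exact ENNReal.mul_lt_top (by simp) (ENNReal.mul_lt_top
    (ENNReal.pow_lt_top (ENNReal.mul_lt_top (by simp) hm.lt_top)) h2)

end IsSrc

/-- The quadratic interaction in the interaction picture. -/
def bil (f g : ℝ → ℝ → ℂ) (s ξ : ℝ) : ℂ :=
  ∫ η, Complex.exp ((-2 * π * s * (3 * ξ * η * (ξ - η)) : ℝ) * Complex.I) * (f s η * g s (ξ - η))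

theorem enorm_setIntegral_exp_le {τ : ℝ} (hτ : τ ∈ Icc (0 : ℝ) 1) (θ : ℝ) :
    ‖∫ s in Icc (0 : ℝ) τ, Complex.exp ((1 - 2 * π * Complex.I * θ) * s)‖ₑ ≤ 8 * wt 1 θ := by
  rw [integral_Icc_eq_integral_Ioc, ← intervalIntegral.integral_of_le hτ.1,
    integral_exp_mul_complex (one_sub_ne_zero θ), div_eq_mul_inv, enorm_mul]
  have h1 := enorm_inv_le_wt (le_two_mul_norm_one_sub θ)
  have h2 : ‖Complex.exp ((1 - 2 * π * Complex.I * θ) * τ) -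
      Complex.exp ((1 - 2 * π * Complex.I * θ) * (0 : ℝ))‖ₑ ≤ 4 := by
    rw [← ofReal_norm, ← ENNReal.ofReal_ofNat]
    apply ENNReal.ofReal_le_ofReal
    refine (norm_sub_le _ _).trans ?_
    rw [Complex.norm_exp, Complex.norm_exp]
    have : Real.exp τ ≤ Real.exp 1 := Real.exp_le_exp.2 hτ.2
    have := Real.exp_one_lt_d9
    simp
    linarith
  calc _ ≤ 4 * (2 * wt 1 θ) := by gcongr
    _ = _ := by ring

theorem measurable_mul_shift {a b : ℝ → ℝ → ℂ} (ha : Measurable fun p : ℝ × ℝ => a p.1 p.2)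
    (hb : Measurable fun p : ℝ × ℝ => b p.1 p.2) (ξ : ℝ) :
    Measurable fun x : ℝ × ℝ × ℝ => a x.1 x.2.1 * b (ξ - x.1) x.2.2 := by
  refine Measurable.mul ?_ ?_
  · exact ha.comp (by fun_prop : Measurable fun x : ℝ × ℝ × ℝ => (x.1, x.2.1))
  · exact hb.comp (by fun_prop : Measurable fun x : ℝ × ℝ × ℝ => (ξ - x.1, x.2.2))

theorem integrable_mul_shift {a b : ℝ → ℝ → ℂ} (ha : Measurable fun p : ℝ × ℝ => a p.1 p.2)
    (hb : Measurable fun p : ℝ × ℝ => b p.1 p.2) (ha2 : ∫⁻ ξ, (∫⁻ σ, ‖a ξ σ‖ₑ) ^ 2 < ⊤)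
    (hb2 : ∫⁻ ξ, (∫⁻ σ, ‖b ξ σ‖ₑ) ^ 2 < ⊤) (ξ : ℝ) :
    Integrable fun x : ℝ × ℝ × ℝ => a x.1 x.2.1 * b (ξ - x.1) x.2.2 := by
  have hm := measurable_mul_shift ha hb ξ
  refine ⟨hm.aestronglyMeasurable, ?_⟩
  have a1 : Measurable fun η => ∫⁻ ρ, ‖a η ρ‖ₑ := Measurable.lintegral_prod_right' ha.enorm
  have a2 : Measurable fun η => ∫⁻ ρ, ‖b η ρ‖ₑ := Measurable.lintegral_prod_right' hb.enorm
  have e : ∫⁻ x : ℝ × ℝ × ℝ, ‖a x.1 x.2.1 * b (ξ - x.1) x.2.2‖ₑ =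
      ∫⁻ η, (∫⁻ ρ, ‖a η ρ‖ₑ) * ∫⁻ ρ, ‖b (ξ - η) ρ‖ₑ := by
    rw [Measure.volume_eq_prod, lintegral_prod _ hm.enorm.aemeasurable]
    apply lintegral_congr; intro η
    have n1 : Measurable fun ρ => a η ρ := ha.comp (by fun_prop : Measurable fun ρ : ℝ => (η, ρ))
    have n2 : Measurable fun ρ => b (ξ - η) ρ :=
      hb.comp (by fun_prop : Measurable fun ρ : ℝ => (ξ - η, ρ))
    simp_rw [enorm_mul]
    rw [Measure.volume_eq_prod]
    exact lintegral_prod_mul n1.enorm.aemeasurable n2.enorm.aemeasurable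
  unfold HasFiniteIntegral
  rw [e]
  have cs := lintegral_mul_sq_le (μ := volume) a1.aemeasurable
    (a2.comp (by fun_prop : Measurable fun η : ℝ => ξ - η)).aemeasurable
  simp only [Function.comp_apply] at cs
  rw [lintegral_comp_const_sub (fun η => (∫⁻ ρ, ‖b η ρ‖ₑ) ^ 2) ξ] at cs
  have fin := cs.trans_lt (ENNReal.mul_lt_top ha2 hb2)
  by_contra hcon
  rw [not_lt_top_iff] at hcon
  rw [hcon] at fin
  simp at fin

section Representation

variable {h₁ h₂ : ℝ → ℂ} {G₁ G₂ : ℝ → ℝ → ℂ} (hG₁ : IsSrc G₁) (hG₂ : IsSrc G₂)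
  (hm₁ : Measurable h₁) (hm₂ : Measurable h₂) (hs₁ : ∫⁻ ξ, ‖h₁ ξ‖ₑ ^ 2 < ⊤)
  (hs₂ : ∫⁻ ξ, ‖h₂ ξ‖ₑ ^ 2 < ⊤)
include hG₁ hG₂ hm₁ hm₂

theorem measurable_amp_mul_amp (ξ : ℝ) : Measurable fun x : ℝ × ℝ × ℝ =>
    amp h₁ G₁ x.1 x.2.1 * amp h₂ G₂ (ξ - x.1) x.2.2 :=
  measurable_mul_shift (hG₁.measurable_amp hm₁) (hG₂.measurable_amp hm₂) ξ

include hs₁ hs₂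

theorem integrable_amp_mul_amp (ξ : ℝ) : Integrable fun x : ℝ × ℝ × ℝ =>
    amp h₁ G₁ x.1 x.2.1 * amp h₂ G₂ (ξ - x.1) x.2.2 :=
  integrable_mul_shift (hG₁.measurable_amp hm₁) (hG₂.measurable_amp hm₂)
    (hG₁.lintegral_sq_lintegral_amp_lt_top hm₁ hs₁)
    (hG₂.lintegral_sq_lintegral_amp_lt_top hm₂ hs₂) ξ

theorem exp_mul_bil_prof {s : ℝ} (hs : 0 ≤ s) (ξ σ : ℝ) :
    Complex.exp ((-2 * π * (s * σ) : ℝ) * Complex.I) *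
      ((Real.exp (-s) : ℂ) * bil (prof h₁ G₁) (prof h₂ G₂) s ξ) =
    ∫ x : ℝ × ℝ × ℝ, Complex.exp ((1 - 2 * π * Complex.I *
      (σ + 3 * ξ * x.1 * (ξ - x.1) - x.2.1 - x.2.2 : ℝ)) * s) *
      (amp h₁ G₁ x.1 x.2.1 * amp h₂ G₂ (ξ - x.1) x.2.2) := by
  have hi := integrable_amp_mul_amp hG₁ hG₂ hm₁ hm₂ hs₁ hs₂ ξ
  have hi2 : Integrable fun x : ℝ × ℝ × ℝ => Complex.exp ((1 - 2 * π * Complex.I *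
      (σ + 3 * ξ * x.1 * (ξ - x.1) - x.2.1 - x.2.2 : ℝ)) * s) *
      (amp h₁ G₁ x.1 x.2.1 * amp h₂ G₂ (ξ - x.1) x.2.2) := by
    have := (integrable_phase_mul hi (φ := fun x : ℝ × ℝ × ℝ =>
      -2 * π * (σ + 3 * ξ * x.1 * (ξ - x.1) - x.2.1 - x.2.2) * s) (by fun_prop)).const_mul
      (Complex.exp s)
    refine this.congr (Filter.Eventually.of_forall fun x => ?_)
    dsimp only
    rw [← mul_assoc, ← Complex.exp_add]
    congr 2
    push_cast; ring
  rw [Measure.volume_eq_prod] at hi2 ⊢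
  rw [integral_prod _ hi2]
  unfold bil
  rw [← mul_assoc, ← integral_const_mul]
  congr 1; ext η
  rw [Measure.volume_eq_prod]
  have e1 := hG₁.integral_amp h₁ hs η
  have e2 := hG₂.integral_amp h₂ hs (ξ - η)
  have hexp : (Real.exp (-s) : ℂ) * Real.exp s = 1 := by
    rw [← Complex.ofReal_mul, ← Real.exp_add]; simp
  have hprod := integral_prod_mul (μ := volume) (ν := volume)
    (fun ρ : ℝ => amp h₁ G₁ η ρ * Complex.exp (2 * π * Complex.I * ρ * s))
    (fun ρ : ℝ => amp h₂ G₂ (ξ - η) ρ * Complex.exp (2 * π * Complex.I * ρ * s))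
  rw [e1, e2] at hprod
  calc _ = (Real.exp s : ℂ) * (Complex.exp ((-2 * π * (s * σ) : ℝ) * Complex.I) *
        Complex.exp ((-2 * π * s * (3 * ξ * η * (ξ - η)) : ℝ) * Complex.I)) *
        ((Real.exp (-s) : ℂ) * prof h₁ G₁ s η * ((Real.exp (-s) : ℂ) * prof h₂ G₂ s (ξ - η))) := by
        linear_combination (-(Complex.exp ((-2 * π * (s * σ) : ℝ) * Complex.I) *
        Complex.exp ((-2 * π * s * (3 * ξ * η * (ξ - η)) : ℝ) * Complex.I)) *
        (Real.exp (-s) : ℂ) * prof h₁ G₁ s η * prof h₂ G₂ s (ξ - η)) * hexp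
    _ = _ := by
        rw [← hprod, ← integral_const_mul]
        congr 1; ext z
        rw [Complex.ofReal_exp, ← Complex.exp_add, ← Complex.exp_add]
        rw [show ∀ c a x b y : ℂ, c * (a * x * (b * y)) = (c * x * y) * (a * b) by intros; ring,
          ← Complex.exp_add, ← Complex.exp_add]
        congr 2
        push_cast; ring

theorem enorm_gHat_bil_le {τ : ℝ} (hτ : τ ∈ Icc (0 : ℝ) 1) (ξ σ : ℝ) :
    ‖gHat (fun s ξ => (Icc (0 : ℝ) τ).indicator
      (fun s => bil (prof h₁ G₁) (prof h₂ G₂) s ξ) s) ξ σ‖ₑ ≤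
    8 * ∫⁻ η, ∫⁻ z : ℝ × ℝ, ‖amp h₁ G₁ η z.1‖ₑ * ‖amp h₂ G₂ (ξ - η) z.2‖ₑ *
      wt 1 (σ + 3 * ξ * η * (ξ - η) - z.1 - z.2) := by
  have hi := integrable_amp_mul_amp hG₁ hG₂ hm₁ hm₂ hs₁ hs₂ ξ
  have hm := measurable_amp_mul_amp hG₁ hG₂ hm₁ hm₂ ξ
  set M := fun x : ℝ × ℝ × ℝ => amp h₁ G₁ x.1 x.2.1 * amp h₂ G₂ (ξ - x.1) x.2.2
  set θ := fun x : ℝ × ℝ × ℝ => σ + 3 * ξ * x.1 * (ξ - x.1) - x.2.1 - x.2.2 with hθ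
  have mθ : Measurable θ := by fun_prop
  have e : gHat (fun s ξ => (Icc (0 : ℝ) τ).indicator
      (fun s => bil (prof h₁ G₁) (prof h₂ G₂) s ξ) s) ξ σ =
      ∫ x, (∫ s in Icc (0 : ℝ) τ, Complex.exp ((1 - 2 * π * Complex.I * θ x) * s)) * M x := by
    have e1 : gHat (fun s ξ => (Icc (0 : ℝ) τ).indicator
      (fun s => bil (prof h₁ G₁) (prof h₂ G₂) s ξ) s) ξ σ = ∫ s in Icc (0 : ℝ) τ,
        ∫ x, Complex.exp ((1 - 2 * π * Complex.I * θ x) * s) * M x := by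
      unfold gHat
      rw [Real.fourier_eq', ← integral_indicator measurableSet_Icc]
      congr 1; ext s
      dsimp only
      by_cases hs : s ∈ Icc (0 : ℝ) τ
      · rw [indicator_of_mem hs, indicator_of_mem hs,
          ← exp_mul_bil_prof hG₁ hG₂ hm₁ hm₂ hs₁ hs₂ hs.1, smul_eq_mul]
        simp only [RCLike.inner_apply, conj_trivial, mul_comm s σ]
      · rw [indicator_of_notMem hs, indicator_of_notMem hs, mul_zero, smul_zero]
    rw [e1]
    rw [integral_integral_swap]
    · congr 1; ext x
      rw [integral_mul_const]
    · have hc : Integrable (fun p : ℝ × ℝ × ℝ × ℝ => (Real.exp 1 : ℂ) * M p.2)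
          ((volume.restrict (Icc (0 : ℝ) τ)).prod volume) := by
        exact (hi.comp_snd (μ := volume.restrict (Icc (0 : ℝ) τ))).const_mul _
      refine hc.mono ?_ ?_
      · refine Measurable.aestronglyMeasurable ?_
        change Measurable fun p : ℝ × ℝ × ℝ × ℝ =>
          Complex.exp ((1 - 2 * π * Complex.I * θ p.2) * p.1) * M p.2
        fun_prop
      · have : ∀ᵐ p ∂((volume.restrict (Icc (0 : ℝ) τ)).prod (volume : Measure (ℝ × ℝ × ℝ))),
            p.1 ∈ Icc (0 : ℝ) τ :=
          Measure.quasiMeasurePreserving_fst.ae (ae_restrict_mem measurableSet_Icc)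
        filter_upwards [this] with p hp
        rw [Function.uncurry_apply_pair _ p.1 p.2]
        rw [norm_mul _ (M p.2), Complex.norm_exp, norm_mul _ (M p.2), Complex.norm_real, Real.norm_eq_abs,
          abs_of_pos (Real.exp_pos 1)]
        gcongr
        simp
        exact hp.2.trans hτ.2
  rw [e]
  refine (enorm_integral_le_lintegral_enorm _).trans ?_
  calc _ ≤ ∫⁻ x : ℝ × ℝ × ℝ, 8 * (‖amp h₁ G₁ x.1 x.2.1‖ₑ * ‖amp h₂ G₂ (ξ - x.1) x.2.2‖ₑ *
        wt 1 (σ + 3 * ξ * x.1 * (ξ - x.1) - x.2.1 - x.2.2)) := by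
        apply lintegral_mono; intro x
        dsimp only
        rw [enorm_mul]
        refine (mul_le_mul' (enorm_setIntegral_exp_le hτ _) le_rfl).trans_eq ?_
        simp only [M, hθ, enorm_mul]
        ring
    _ = _ := by
        have m8 : Measurable fun x : ℝ × ℝ × ℝ => ‖amp h₁ G₁ x.1 x.2.1‖ₑ *
            ‖amp h₂ G₂ (ξ - x.1) x.2.2‖ₑ *
            wt 1 (σ + 3 * ξ * x.1 * (ξ - x.1) - x.2.1 - x.2.2) := by
          have := hm.enorm
          simp only [M, enorm_mul] at this
          exact this.mul (by fun_prop)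
        rw [lintegral_const_mul _ m8, Measure.volume_eq_prod, lintegral_prod _ m8.aemeasurable]

end Representation

theorem lintegral_shear {Φ : ℝ × ℝ → ℝ × ℝ → ℝ≥0∞}
    (hΦ : Measurable fun x : (ℝ × ℝ) × (ℝ × ℝ) => Φ x.1 x.2) :
    ∫⁻ ξ, ∫⁻ η, ∫⁻ z : ℝ × ℝ, Φ (η, z.1) (ξ - η, z.2) = ∫⁻ p, ∫⁻ q, Φ p q := by
  have m1 : Measurable fun x : (ℝ × ℝ) × ℝ × ℝ => Φ (x.1.1, x.2.1) (x.1.2, x.2.2) :=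
    hΦ.comp (by fun_prop : Measurable fun x : (ℝ × ℝ) × ℝ × ℝ => ((x.1.1, x.2.1), (x.1.2, x.2.2)))
  have m2 : Measurable fun x : ℝ × ℝ => ∫⁻ z : ℝ × ℝ, Φ (x.1, z.1) (x.2, z.2) :=
    Measurable.lintegral_prod_right' m1
  have m3 : Measurable fun x : ℝ × ℝ => ∫⁻ z : ℝ × ℝ, Φ (x.2, z.1) (x.1 - x.2, z.2) :=
    m2.comp (by fun_prop : Measurable fun x : ℝ × ℝ => (x.2, x.1 - x.2))
  rw [lintegral_lintegral_swap m3.aemeasurable]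
  have e1 : ∀ η : ℝ, ∫⁻ ξ, ∫⁻ z : ℝ × ℝ, Φ (η, z.1) (ξ - η, z.2) =
      ∫⁻ ζ, ∫⁻ z : ℝ × ℝ, Φ (η, z.1) (ζ, z.2) := fun η =>
    lintegral_sub_right_eq_self (fun ζ => ∫⁻ z : ℝ × ℝ, Φ (η, z.1) (ζ, z.2)) η
  simp_rw [e1]
  have m4 : Measurable fun p => ∫⁻ q, Φ p q := Measurable.lintegral_prod_right' hΦ
  have e0 : ∫⁻ p, ∫⁻ q, Φ p q = ∫⁻ η, ∫⁻ y, ∫⁻ q, Φ (η, y) q :=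
    lintegral_prod (μ := volume) (ν := volume) (fun p => ∫⁻ q, Φ p q) m4.aemeasurable
  rw [e0]
  apply lintegral_congr; intro η
  have m5 : Measurable fun x : ℝ × ℝ × ℝ => Φ (η, x.1) x.2 :=
    hΦ.comp (by fun_prop : Measurable fun x : ℝ × ℝ × ℝ => ((η, x.1), x.2))
  have e2 : ∀ y : ℝ, ∫⁻ q, Φ (η, y) q = ∫⁻ ζ, ∫⁻ w, Φ (η, y) (ζ, w) := by
    intro y
    rw [Measure.volume_eq_prod, lintegral_prod]
    exact (m5.comp (by fun_prop : Measurable fun q : ℝ × ℝ => (y, q))).aemeasurable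
  simp_rw [e2]
  have m6 : Measurable fun x : ℝ × ℝ => ∫⁻ w, Φ (η, x.2) (x.1, w) := by
    refine Measurable.lintegral_prod_right' (f := fun v : (ℝ × ℝ) × ℝ =>
      Φ (η, v.1.2) (v.1.1, v.2)) ?_
    exact m5.comp (by fun_prop : Measurable fun v : (ℝ × ℝ) × ℝ => (v.1.2, (v.1.1, v.2)))
  have e3 : ∀ ζ : ℝ, ∫⁻ z : ℝ × ℝ, Φ (η, z.1) (ζ, z.2) = ∫⁻ y, ∫⁻ w, Φ (η, y) (ζ, w) := by
    intro ζ
    rw [Measure.volume_eq_prod, lintegral_prod]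
    exact (m5.comp (by fun_prop : Measurable fun z : ℝ × ℝ => (z.1, (ζ, z.2)))).aemeasurable
  simp_rw [e3]
  exact lintegral_lintegral_swap m6.aemeasurable

/-- The normalised amplitude. -/
def nAmp (a : ℝ × ℝ → ℝ≥0∞) (p : ℝ × ℝ) : ℝ≥0∞ :=
  ENNReal.ofReal (iw p.1)⁻¹ * wt (-(25 / 48)) p.2 * a p

/-- The smoothed dual function. -/
def smoothDual (D : ℝ × ℝ → ℝ≥0∞) (p : ℝ × ℝ) : ℝ≥0∞ :=
  wt (-(22 / 48)) p.2 * ∫⁻ σ, wt 1 (p.2 - σ) * (wt (23 / 48) σ * D (p.1, σ))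

@[fun_prop]
theorem measurable_nAmp {a : ℝ × ℝ → ℝ≥0∞} (ha : Measurable a) : Measurable (nAmp a) := by
  unfold nAmp; fun_prop

@[fun_prop]
theorem measurable_smoothDual {D : ℝ × ℝ → ℝ≥0∞} (hD : Measurable D) :
    Measurable (smoothDual D) := by
  unfold smoothDual
  refine Measurable.mul (by fun_prop) ?_
  exact Measurable.lintegral_prod_right' (f := fun v : (ℝ × ℝ) × ℝ =>
    wt 1 (v.1.2 - v.2) * (wt (23 / 48) v.2 * D (v.1.1, v.2))) (by fun_prop)

theorem iw_pos {x : ℝ} (hx : x ≠ 0) : 0 < iw x :=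
  mul_pos (Real.rpow_pos_of_pos (abs_pos.2 hx) _)
    (Real.rpow_pos_of_pos (one_pos.trans_le (one_le_mm hx)) _)

theorem lintegral_smoothDual_sq_le {D : ℝ × ℝ → ℝ≥0∞} (hD : Measurable D) :
    ∫⁻ p, smoothDual D p ^ 2 ≤ (ENNReal.ofReal (2 ^ (45 / 48 : ℝ)) * (4 * wtMass (1 + 1 / 48))) *
      (2 * wtMass (1 + 1 / 48)) * ∫⁻ p, D p ^ 2 := by
  have e : ∫⁻ p, D p ^ 2 = ∫⁻ ξ, ∫⁻ σ, D (ξ, σ) ^ 2 := by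
    rw [Measure.volume_eq_prod, lintegral_prod _ (by fun_prop)]
  rw [Measure.volume_eq_prod, lintegral_prod _ (by fun_prop), ← Measure.volume_eq_prod, e,
    ← lintegral_const_mul _ (Measurable.lintegral_prod_right' (f := fun p => D p ^ 2)
      (by fun_prop))]
  apply lintegral_mono; intro ξ
  exact lintegral_cutoff_le (D := fun σ => D (ξ, σ)) (by fun_prop)

theorem biKer_mul_cancel {η ζ y z : ℝ} (hη : η ≠ 0) (hζ : ζ ≠ 0) (a b E : ℝ≥0∞) :
    biKer (third (η, y) (ζ, z)) (η, y) (ζ, z) *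
      (wt (-(22 / 48)) (-(third (η, y) (ζ, z)).2) * E *
        (ENNReal.ofReal (iw η)⁻¹ * wt (-(25 / 48)) y * a) *
        (ENNReal.ofReal (iw ζ)⁻¹ * wt (-(25 / 48)) z * b)) =
    ENNReal.ofReal (|η + ζ| ^ (1 / 2 : ℝ)) * (a * b) * E := by
  have c1 : ∀ x : ℝ, x ≠ 0 → ENNReal.ofReal (iw x) * ENNReal.ofReal (iw x)⁻¹ = 1 := fun x hx => by
    rw [← ENNReal.ofReal_mul (iw_nonneg x), mul_inv_cancel₀ (iw_pos hx).ne', ENNReal.ofReal_one]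
  have c2 := wt_neg_mul_cancel (22 / 48) (third (η, y) (ζ, z)).2
  have c3 := wt_neg_mul_cancel (25 / 48) y
  have c4 := wt_neg_mul_cancel (25 / 48) z
  have e : |(third (η, y) (ζ, z)).1| = |η + ζ| := by
    rw [← abs_neg]; congr 1; simp [third]; ring
  unfold biKer
  rw [wt_neg, e, ENNReal.ofReal_mul (mul_nonneg (by positivity) (iw_nonneg _)),
    ENNReal.ofReal_mul (by positivity)]
  dsimp only
  set u := ENNReal.ofReal (iw η)
  set v := ENNReal.ofReal (iw ζ)
  calc _ = ENNReal.ofReal (|η + ζ| ^ (1 / 2 : ℝ)) * (a * b) * E * (u * ENNReal.ofReal (iw η)⁻¹) *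
        (v * ENNReal.ofReal (iw ζ)⁻¹) *
        (wt (-(22 / 48)) (third (η, y) (ζ, z)).2 * wt (22 / 48) (third (η, y) (ζ, z)).2) *
        (wt (-(25 / 48)) y * wt (25 / 48) y) * (wt (-(25 / 48)) z * wt (25 / 48) z) := by ring
    _ = _ := by rw [c1 η hη, c1 ζ hζ, c2, c3, c4]; simp

theorem lintegral_dual_fiber (ξ : ℝ) (r : ℝ≥0∞) {a b D : ℝ × ℝ → ℝ≥0∞} (ha : Measurable a)
    (hb : Measurable b) (hD : Measurable D) {E : ℝ → ℝ≥0∞}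
    (hE : E = fun s => ∫⁻ σ, wt 1 (s - σ) * (wt (23 / 48) σ * D (ξ, σ))) :
    ∫⁻ σ, D (ξ, σ) * (r * wt (23 / 48) σ *
      ∫⁻ η, ∫⁻ z : ℝ × ℝ, a (η, z.1) * b (ξ - η, z.2) *
        wt 1 (σ + 3 * ξ * η * (ξ - η) - z.1 - z.2)) =
      ∫⁻ η, ∫⁻ z : ℝ × ℝ, r *
        (a (η, z.1) * b (ξ - η, z.2)) * E (z.1 + z.2 - 3 * ξ * η * (ξ - η)) := by
  have mm1 : ∀ σ, Measurable fun x : ℝ × ℝ × ℝ => a (x.1, x.2.1) * b (ξ - x.1, x.2.2) *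
      wt 1 (σ + 3 * ξ * x.1 * (ξ - x.1) - x.2.1 - x.2.2) := fun σ => by fun_prop
  have mE : Measurable E := by
    rw [hE]
    refine Measurable.lintegral_prod_right' (f := fun v : ℝ × ℝ =>
      wt 1 (v.1 - v.2) * (wt (23 / 48) v.2 * D (ξ, v.2))) (by fun_prop)
  have p1 : ∀ σ, ∫⁻ η, ∫⁻ z : ℝ × ℝ, a (η, z.1) * b (ξ - η, z.2) *
      wt 1 (σ + 3 * ξ * η * (ξ - η) - z.1 - z.2) = ∫⁻ x : ℝ × ℝ × ℝ, a (x.1, x.2.1) *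
      b (ξ - x.1, x.2.2) * wt 1 (σ + 3 * ξ * x.1 * (ξ - x.1) - x.2.1 - x.2.2) := by
    intro σ
    conv_rhs => rw [Measure.volume_eq_prod, lintegral_prod _ (mm1 σ).aemeasurable]
  have mm2 : Measurable fun x : ℝ × ℝ × ℝ => r *
      (a (x.1, x.2.1) * b (ξ - x.1, x.2.2)) * E (x.2.1 + x.2.2 - 3 * ξ * x.1 * (ξ - x.1)) := by
    fun_prop
  have p2 : ∫⁻ η, ∫⁻ z : ℝ × ℝ, r *
      (a (η, z.1) * b (ξ - η, z.2)) * E (z.1 + z.2 - 3 * ξ * η * (ξ - η)) =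
      ∫⁻ x : ℝ × ℝ × ℝ, r *
      (a (x.1, x.2.1) * b (ξ - x.1, x.2.2)) *
        E (x.2.1 + x.2.2 - 3 * ξ * x.1 * (ξ - x.1)) := by
    conv_rhs => rw [Measure.volume_eq_prod, lintegral_prod _ mm2.aemeasurable]
  rw [p2]
  simp_rw [p1]
  have p3 : ∀ σ, D (ξ, σ) * (r * wt (23 / 48) σ *
      ∫⁻ x : ℝ × ℝ × ℝ, a (x.1, x.2.1) * b (ξ - x.1, x.2.2) *
        wt 1 (σ + 3 * ξ * x.1 * (ξ - x.1) - x.2.1 - x.2.2)) =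
      ∫⁻ x : ℝ × ℝ × ℝ, r *
      (a (x.1, x.2.1) * b (ξ - x.1, x.2.2)) *
        (wt 1 ((x.2.1 + x.2.2 - 3 * ξ * x.1 * (ξ - x.1)) - σ) * (wt (23 / 48) σ * D (ξ, σ))) := by
    intro σ
    rw [← mul_assoc, ← lintegral_const_mul _ (mm1 σ)]
    apply lintegral_congr; intro x
    rw [wt_sub_comm 1 _ σ, show σ - (x.2.1 + x.2.2 - 3 * ξ * x.1 * (ξ - x.1)) =
      σ + 3 * ξ * x.1 * (ξ - x.1) - x.2.1 - x.2.2 by ring]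
    ring
  simp_rw [p3]
  rw [lintegral_lintegral_swap (Measurable.aemeasurable (by unfold Function.uncurry; fun_prop))]
  apply lintegral_congr; intro x
  rw [lintegral_const_mul _ (by fun_prop), hE]

theorem measurable_comp_third {k : ℝ × ℝ → ℝ × ℝ → ℝ × ℝ → ℝ≥0∞}
    (hk : Measurable fun x : (ℝ × ℝ) × (ℝ × ℝ) × (ℝ × ℝ) => k x.1 x.2.1 x.2.2) :
    Measurable fun x : (ℝ × ℝ) × (ℝ × ℝ) => k (third x.1 x.2) x.1 x.2 :=
  hk.comp (by fun_prop : Measurable fun x : (ℝ × ℝ) × (ℝ × ℝ) => (third x.1 x.2, x.1, x.2))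

theorem triForm_add_shear {k : ℝ × ℝ → ℝ × ℝ → ℝ × ℝ → ℝ≥0∞}
    (hk : Measurable fun x : (ℝ × ℝ) × (ℝ × ℝ) => k (third x.1 x.2) x.1 x.2)
    {S A A' B B' : ℝ × ℝ → ℝ≥0∞} (hS : Measurable S) (hA : Measurable A) (hA' : Measurable A')
    (hB : Measurable B) (hB' : Measurable B') (c : ℝ≥0∞) :
    c * (triForm k S A' B + triForm k S A B') = ∫⁻ ξ, ∫⁻ η, ∫⁻ z : ℝ × ℝ,
      c * (k (third (η, z.1) (ξ - η, z.2)) (η, z.1) (ξ - η, z.2) *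
        (S (third (η, z.1) (ξ - η, z.2)) * A' (η, z.1) * B (ξ - η, z.2)) +
        k (third (η, z.1) (ξ - η, z.2)) (η, z.1) (ξ - η, z.2) *
        (S (third (η, z.1) (ξ - η, z.2)) * A (η, z.1) * B' (ξ - η, z.2))) := by
  set Φ₁ : ℝ × ℝ → ℝ × ℝ → ℝ≥0∞ := fun p q => k (third p q) p q *
    (S (third p q) * A' p * B q) with hΦ₁
  set Φ₂ : ℝ × ℝ → ℝ × ℝ → ℝ≥0∞ := fun p q => k (third p q) p q *
    (S (third p q) * A p * B' q) with hΦ₂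
  have m1 : Measurable fun x : (ℝ × ℝ) × (ℝ × ℝ) => Φ₁ x.1 x.2 := hk.mul (by fun_prop)
  have m2 : Measurable fun x : (ℝ × ℝ) × (ℝ × ℝ) => Φ₂ x.1 x.2 := hk.mul (by fun_prop)
  have e : c * (triForm k S A' B + triForm k S A B') = ∫⁻ p, ∫⁻ q, c * (Φ₁ p q + Φ₂ p q) := by
    have q1 : triForm k S A' B = ∫⁻ p, ∫⁻ q, Φ₁ p q := rfl
    have q2 : triForm k S A B' = ∫⁻ p, ∫⁻ q, Φ₂ p q := rfl
    have n1 : Measurable fun p => ∫⁻ q, Φ₁ p q := Measurable.lintegral_prod_right' m1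
    have n2 : Measurable fun p => ∫⁻ q, Φ₂ p q := Measurable.lintegral_prod_right' m2
    rw [q1, q2, ← lintegral_add_left n1, ← lintegral_const_mul _ (by fun_prop)]
    apply lintegral_congr; intro p
    have n1 : Measurable fun q => Φ₁ p q := m1.comp (by fun_prop : Measurable fun q => (p, q))
    have n2 : Measurable fun q => Φ₂ p q := m2.comp (by fun_prop : Measurable fun q => (p, q))
    rw [lintegral_const_mul _ (by fun_prop), lintegral_add_left n1]
  rw [e, ← lintegral_shear (Φ := fun p q => c * (Φ₁ p q + Φ₂ p q)) (by fun_prop)]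

theorem bilinear_duality_pointwise {r : ℝ → ℝ≥0∞} {c : ℝ≥0∞}
    (hrc : ∀ x y, r (x + y) ≤ c * (r x + r y)) {a b D : ℝ × ℝ → ℝ≥0∞} {ξ η y z : ℝ}
    (hη : η ≠ 0) (hζ : ξ - η ≠ 0) :
    r ξ * ENNReal.ofReal (|ξ| ^ (1 / 2 : ℝ)) * (a (η, y) * b (ξ - η, z)) *
      (∫⁻ σ, wt 1 (y + z - 3 * ξ * η * (ξ - η) - σ) * (wt (23 / 48) σ * D (ξ, σ))) ≤
    c * (biKer (third (η, y) (ξ - η, z)) (η, y) (ξ - η, z) *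
      (smoothDual D (-third (η, y) (ξ - η, z)) * (r η * nAmp a (η, y)) * nAmp b (ξ - η, z)) +
      biKer (third (η, y) (ξ - η, z)) (η, y) (ξ - η, z) *
      (smoothDual D (-third (η, y) (ξ - η, z)) * nAmp a (η, y) *
        (r (ξ - η) * nAmp b (ξ - η, z)))) := by
  set E := ∫⁻ σ, wt 1 (y + z - 3 * ξ * η * (ξ - η) - σ) * (wt (23 / 48) σ * D (ξ, σ)) with hE
  have k := biKer_mul_cancel (y := y) (z := z) hη hζ (a (η, y)) (b (ξ - η, z)) E
  rw [add_sub_cancel] at k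
  have t1 : (-third (η, y) (ξ - η, z)).1 = ξ := by simp [third]
  have t2 : (-third (η, y) (ξ - η, z)).2 = y + z - 3 * ξ * η * (ξ - η) := by
    simp [third]; ring
  have hS : smoothDual D (-third (η, y) (ξ - η, z)) =
      wt (-(22 / 48)) (-(third (η, y) (ξ - η, z)).2) * E := by
    unfold smoothDual
    rw [t1, t2, hE, ← t2, Prod.snd_neg]
  have hr' := hrc η (ξ - η)
  rw [add_sub_cancel] at hr'
  rw [hS]
  generalize biKer (third (η, y) (ξ - η, z)) (η, y) (ξ - η, z) = K at *
  calc _ = r ξ * (ENNReal.ofReal (|ξ| ^ (1 / 2 : ℝ)) * (a (η, y) * b (ξ - η, z)) * E) := by ring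
    _ ≤ c * (r η + r (ξ - η)) *
        (ENNReal.ofReal (|ξ| ^ (1 / 2 : ℝ)) * (a (η, y) * b (ξ - η, z)) * E) := by gcongr
    _ = _ := by
        rw [← k]
        simp only [nAmp]
        ring

theorem bilinear_duality {r : ℝ → ℝ≥0∞} (hr : Measurable r) {c : ℝ≥0∞}
    (hrc : ∀ x y, r (x + y) ≤ c * (r x + r y)) {a b D : ℝ × ℝ → ℝ≥0∞} (ha : Measurable a)
    (hb : Measurable b) (hD : Measurable D) :
    ∫⁻ ξ, ∫⁻ σ, D (ξ, σ) * (r ξ * ENNReal.ofReal (|ξ| ^ (1 / 2 : ℝ)) * wt (23 / 48) σ *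
      ∫⁻ η, ∫⁻ z : ℝ × ℝ, a (η, z.1) * b (ξ - η, z.2) *
        wt 1 (σ + 3 * ξ * η * (ξ - η) - z.1 - z.2)) ≤
    c * (triForm biKer (fun p => smoothDual D (-p)) (fun p => r p.1 * nAmp a p) (nAmp b) +
      triForm biKer (fun p => smoothDual D (-p)) (nAmp a) (fun p => r p.1 * nAmp b p)) := by
  have mS : Measurable fun p => smoothDual D (-p) := (measurable_smoothDual hD).comp measurable_neg
  have mk := measurable_comp_third measurable_biKer
  have mA := measurable_nAmp ha
  have mB := measurable_nAmp hb
  have mA' : Measurable fun p : ℝ × ℝ => r p.1 * nAmp a p := by fun_prop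
  have mB' : Measurable fun p : ℝ × ℝ => r p.1 * nAmp b p := by fun_prop
  refine le_of_le_of_eq ?_ (triForm_add_shear mk mS mA mA' mB mB' c).symm
  simp_rw [fun ξ => lintegral_dual_fiber ξ (r ξ * ENNReal.ofReal (|ξ| ^ (1 / 2 : ℝ))) ha hb hD rfl]
  apply lintegral_mono; intro ξ
  apply lintegral_mono_ae
  filter_upwards [compl_mem_ae_iff.2 (measure_singleton (0 : ℝ)),
    compl_mem_ae_iff.2 (measure_singleton ξ)] with η h0 h1
  have hη : η ≠ 0 := h0
  have hζ : ξ - η ≠ 0 := sub_ne_zero.2 (fun h => h1 h.symm)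
  apply lintegral_mono; intro z
  exact bilinear_duality_pointwise hrc hη hζ

/-- Weighted square norm of an initial value. -/
def hSq (r : ℝ → ℝ≥0∞) (h : ℝ → ℂ) : ℝ≥0∞ :=
  ∫⁻ ξ, (r ξ * ENNReal.ofReal (iw ξ)⁻¹ * ‖h ξ‖ₑ) ^ 2

/-- Weighted square norm of a profile. -/
def xSq (r : ℝ → ℝ≥0∞) (h : ℝ → ℂ) (G : ℝ → ℝ → ℂ) : ℝ≥0∞ :=
  ∫⁻ p : ℝ × ℝ, (r p.1 * nAmp (fun p => ‖amp h G p.1 p.2‖ₑ) p) ^ 2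

/-- Weighted square norm of a source. -/
def ySq (r : ℝ → ℝ≥0∞) (G : ℝ → ℝ → ℂ) : ℝ≥0∞ :=
  ∫⁻ p : ℝ × ℝ, (r p.1 * ENNReal.ofReal (|p.1| ^ (1 / 2 : ℝ)) * wt (23 / 48) p.2 *
    ‖gHat G p.1 p.2‖ₑ) ^ 2

theorem ofReal_inv_iw_mul_le (ξ : ℝ) :
    ENNReal.ofReal (iw ξ)⁻¹ * ‖ξ‖ₑ ≤ ENNReal.ofReal (|ξ| ^ (1 / 2 : ℝ)) := by
  rw [← ofReal_norm, Real.norm_eq_abs, ← ENNReal.ofReal_mul (inv_nonneg.2 (iw_nonneg _))]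
  apply ENNReal.ofReal_le_ofReal
  rcases eq_or_ne ξ 0 with rfl | h
  · simp
  have h1 : |ξ| ^ (1 / 2 : ℝ) ≤ iw ξ := by
    unfold iw
    exact le_mul_of_one_le_right (by positivity)
      (Real.one_le_rpow (one_le_mm h) (by norm_num))
  have h0 : 0 < |ξ| ^ (1 / 2 : ℝ) := Real.rpow_pos_of_pos (abs_pos.2 h) _
  rw [inv_mul_le_iff₀ (h0.trans_le h1)]
  calc |ξ| = |ξ| ^ (1 / 2 : ℝ) * |ξ| ^ (1 / 2 : ℝ) := by
        rw [← Real.rpow_add (abs_pos.2 h)]; norm_num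
    _ ≤ _ := by gcongr

theorem lintegral_prod_mul_self {f g : ℝ → ℝ≥0∞} (hf : Measurable f) (hg : Measurable g) :
    ∫⁻ p : ℝ × ℝ, f p.1 * g p.2 = (∫⁻ x, f x) * ∫⁻ y, g y := by
  rw [Measure.volume_eq_prod]
  exact lintegral_prod_mul hf.aemeasurable hg.aemeasurable

theorem exists_xSq_le : ∃ C : NNReal, ∀ {r : ℝ → ℝ≥0∞}, Measurable r → ∀ {h : ℝ → ℂ},
    Measurable h → ∀ {G}, IsSrc G → xSq r h G ≤ C * (hSq r h + ySq r G) := by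
  have hm := (wtMass_lt_top (q := 71 / 24) (by norm_num)).ne
  refine ⟨(128 * wtMass (71 / 24) + 8).toNNReal, fun {r} hr {h} hh {G} hG => ?_⟩
  rw [ENNReal.coe_toNNReal (by finiteness)]
  have mg := hG.measurable_gHat
  have key : ∀ p : ℝ × ℝ, (r p.1 * nAmp (fun p => ‖amp h G p.1 p.2‖ₑ) p) ^ 2 ≤
      128 * ((r p.1 * ENNReal.ofReal (iw p.1)⁻¹ * ‖h p.1‖ₑ) ^ 2 * wt (71 / 24) p.2) +
      8 * (r p.1 * ENNReal.ofReal (|p.1| ^ (1 / 2 : ℝ)) * wt (23 / 48) p.2 *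
        ‖gHat G p.1 p.2‖ₑ) ^ 2 := by
    intro p
    have e1 : wt (-(25 / 48)) p.2 * wt 2 p.2 = wt (71 / 48) p.2 := by rw [wt_mul_wt]; norm_num
    have e2 : wt (-(25 / 48)) p.2 * wt 1 p.2 = wt (23 / 48) p.2 := by rw [wt_mul_wt]; norm_num
    have e3 : wt (71 / 48) p.2 ^ 2 = wt (71 / 24) p.2 := by rw [sq, wt_mul_wt]; norm_num
    have h1 : r p.1 * nAmp (fun p => ‖amp h G p.1 p.2‖ₑ) p ≤
        8 * (r p.1 * ENNReal.ofReal (iw p.1)⁻¹ * ‖h p.1‖ₑ * wt (71 / 48) p.2) +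
        2 * (r p.1 * ENNReal.ofReal (|p.1| ^ (1 / 2 : ℝ)) * wt (23 / 48) p.2 *
        ‖gHat G p.1 p.2‖ₑ) := by
      unfold nAmp
      calc _ ≤ r p.1 * (ENNReal.ofReal (iw p.1)⁻¹ * wt (-(25 / 48)) p.2 *
            (8 * (wt 2 p.2 * ‖h p.1‖ₑ) + 2 * (wt 1 p.2 * (‖p.1‖ₑ * ‖gHat G p.1 p.2‖ₑ)))) := by
            gcongr
            exact IsSrc.enorm_amp_le h G p.1 p.2
        _ = 8 * (r p.1 * ENNReal.ofReal (iw p.1)⁻¹ * ‖h p.1‖ₑ *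
              (wt (-(25 / 48)) p.2 * wt 2 p.2)) +
            2 * (r p.1 * (ENNReal.ofReal (iw p.1)⁻¹ * ‖p.1‖ₑ) *
              (wt (-(25 / 48)) p.2 * wt 1 p.2) * ‖gHat G p.1 p.2‖ₑ) := by ring
        _ ≤ _ := by
            rw [e1, e2]
            gcongr
            exact ofReal_inv_iw_mul_le p.1
    refine (pow_le_pow_left' h1 2).trans ((add_sq_le_two_mul _ _).trans_eq ?_)
    rw [← e3]; ring
  unfold xSq
  refine (lintegral_mono key).trans ?_
  rw [lintegral_add_left (by fun_prop), lintegral_const_mul _ (by fun_prop),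
    lintegral_const_mul _ (by fun_prop), lintegral_prod_mul_self
      (f := fun ξ => (r ξ * ENNReal.ofReal (iw ξ)⁻¹ * ‖h ξ‖ₑ) ^ 2) (by fun_prop) (by fun_prop)]
  change 128 * (hSq r h * wtMass (71 / 24)) + 8 * ySq r G ≤ _
  calc _ ≤ 128 * (hSq r h * wtMass (71 / 24)) + 8 * ySq r G +
        (8 * hSq r h + 128 * wtMass (71 / 24) * ySq r G) := le_self_add
    _ = _ := by ring

theorem IsSrc.ySq_le {G : ℝ → ℝ → ℂ} (hG : IsSrc G) {r : ℝ → ℝ≥0∞} {R : ℝ≥0∞}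
    (hR : ∀ x, r x ≤ R) : ySq r G ≤ R ^ 2 * ∫⁻ ξ, ∫⁻ s, ‖ξ‖ₑ * ‖G s ξ‖ₑ ^ 2 := by
  have mg := hG.measurable_gHat
  have mG := hG.meas
  have mG' : Measurable fun p : ℝ × ℝ => G p.2 p.1 :=
    mG.comp (by fun_prop : Measurable fun p : ℝ × ℝ => (p.2, p.1))
  unfold ySq
  calc _ ≤ ∫⁻ p : ℝ × ℝ, R ^ 2 * (‖p.1‖ₑ * ‖gHat G p.1 p.2‖ₑ ^ 2) := by
        apply lintegral_mono; intro p
        have e : ENNReal.ofReal (|p.1| ^ (1 / 2 : ℝ)) ^ 2 = ‖p.1‖ₑ := by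
          rw [← ENNReal.ofReal_pow (by positivity), ← Real.rpow_natCast, ← Real.rpow_mul
            (abs_nonneg _), ← ofReal_norm, Real.norm_eq_abs]
          norm_num
        dsimp only
        rw [← e]
        calc _ ≤ (R * ENNReal.ofReal (|p.1| ^ (1 / 2 : ℝ)) * 1 * ‖gHat G p.1 p.2‖ₑ) ^ 2 := by
              gcongr
              · exact hR _
              · exact wt_le_one (by norm_num) _
          _ = _ := by ring
    _ = R ^ 2 * ∫⁻ ξ, ‖ξ‖ₑ * ∫⁻ σ, ‖gHat G ξ σ‖ₑ ^ 2 := by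
        have m : Measurable fun p : ℝ × ℝ => ‖p.1‖ₑ * ‖gHat G p.1 p.2‖ₑ ^ 2 := by fun_prop
        rw [lintegral_const_mul _ m, Measure.volume_eq_prod, lintegral_prod _ m.aemeasurable]
        congr 1
        apply lintegral_congr; intro ξ
        have mξ : Measurable fun σ => ‖gHat G ξ σ‖ₑ ^ 2 :=
          (hG.continuous_gHat ξ).measurable.enorm.pow_const 2
        dsimp only
        exact lintegral_const_mul _ mξ
    _ ≤ _ := by
        refine mul_le_mul' le_rfl (lintegral_mono fun ξ => ?_)
        have : Measurable fun s => G s ξ := measurable_slice_left mG ξ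
        have m2 : Measurable fun s => ‖G s ξ‖ₑ ^ 2 := this.enorm.pow_const 2
        dsimp only
        rw [lintegral_const_mul _ m2]
        exact mul_le_mul' le_rfl (hG.lintegral_gHat_sq_le ξ)

theorem IsSrc.ySq_lt_top {G : ℝ → ℝ → ℂ} (hG : IsSrc G) {r : ℝ → ℝ≥0∞} {R : ℝ≥0∞}
    (hR : ∀ x, r x ≤ R) (hR' : R ≠ ⊤) : ySq r G < ⊤ := by
  refine (hG.ySq_le hR).trans_lt (ENNReal.mul_lt_top (by finiteness) ?_)
  have mG' : Measurable fun p : ℝ × ℝ => G p.2 p.1 :=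
    hG.meas.comp (by fun_prop : Measurable fun p : ℝ × ℝ => (p.2, p.1))
  have m : ∀ ξ, Measurable fun s => G s ξ := measurable_slice_left hG.meas
  calc ∫⁻ ξ, ∫⁻ s, ‖ξ‖ₑ * ‖G s ξ‖ₑ ^ 2
      ≤ ∫⁻ ξ, ((∫⁻ s, ‖G s ξ‖ₑ ^ 2) + ∫⁻ s, (‖ξ‖ₑ * ‖G s ξ‖ₑ) ^ 2) := by
        apply lintegral_mono; intro ξ
        dsimp only
        have := m ξ
        rw [← lintegral_add_left (by fun_prop)]
        apply lintegral_mono; intro s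
        dsimp only
        have : ‖ξ‖ₑ ≤ 1 + ‖ξ‖ₑ ^ 2 := by
          rcases le_total ‖ξ‖ₑ 1 with h | h
          · exact h.trans le_self_add
          · calc ‖ξ‖ₑ = ‖ξ‖ₑ * 1 := (mul_one _).symm
              _ ≤ ‖ξ‖ₑ * ‖ξ‖ₑ := by gcongr
              _ = ‖ξ‖ₑ ^ 2 := (_root_.sq _).symm
              _ ≤ _ := le_add_self
        calc _ ≤ (1 + ‖ξ‖ₑ ^ 2) * ‖G s ξ‖ₑ ^ 2 := by gcongr
          _ = _ := by ring
    _ = (∫⁻ ξ, ∫⁻ s, ‖G s ξ‖ₑ ^ 2) + ∫⁻ ξ, ∫⁻ s, (‖ξ‖ₑ * ‖G s ξ‖ₑ) ^ 2 := by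
        rw [lintegral_add_left]
        exact Measurable.lintegral_prod_right' (f := fun p : ℝ × ℝ => ‖G p.2 p.1‖ₑ ^ 2)
          (mG'.enorm.pow_const 2)
    _ < ⊤ := ENNReal.add_lt_top.2 ⟨hG.sq, hG.wsq⟩

theorem IsSrc.ySq_add_le {G H : ℝ → ℝ → ℂ} (hG : IsSrc G) (hH : IsSrc H) {r : ℝ → ℝ≥0∞}
    (hr : Measurable r) :
    ySq r (fun s ξ => G s ξ + H s ξ) ≤ 2 * ySq r G + 2 * ySq r H := by
  have mg := hG.measurable_gHat
  have mh := hH.measurable_gHat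
  have e : ∀ ξ σ, gHat (fun s ξ => G s ξ + H s ξ) ξ σ = gHat G ξ σ + gHat H ξ σ := by
    intro ξ σ
    unfold gHat
    rw [← fourier_add_apply (hG.integrable_damped ξ) (hH.integrable_damped ξ)]
    simp_rw [mul_add]
  unfold ySq
  rw [← lintegral_const_mul _ (by fun_prop), ← lintegral_const_mul _ (by fun_prop),
    ← lintegral_add_left (by fun_prop)]
  apply lintegral_mono; intro p
  dsimp only
  rw [e]
  refine le_trans ?_ (add_sq_le_two_mul _ _)
  rw [← mul_add]
  gcongr
  exact enorm_add_le _ _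

theorem ySq_const_mul {G : ℝ → ℝ → ℂ} (hG : IsSrc G) {r : ℝ → ℝ≥0∞} (hr : Measurable r)
    (c : ℂ) : ySq r (fun s ξ => c * G s ξ) = ‖c‖ₑ ^ 2 * ySq r G := by
  have mg := hG.measurable_gHat
  have e : ∀ ξ σ, gHat (fun s ξ => c * G s ξ) ξ σ = c * gHat G ξ σ := by
    intro ξ σ
    have e0 : (fun s : ℝ => (Real.exp (-s) : ℂ) * (c * G s ξ)) =
        fun s : ℝ => c * ((Real.exp (-s) : ℂ) * G s ξ) := by
      ext s; ring
    unfold gHat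
    rw [e0, fourier_const_mul_apply]
  unfold ySq
  rw [← lintegral_const_mul _ (by fun_prop)]
  apply lintegral_congr; intro p
  rw [e, enorm_mul]; ring

theorem exists_lintegral_source_le : ∃ C : NNReal, ∀ {r : ℝ → ℝ≥0∞}, Measurable r → ∀ {G},
    IsSrc G → ∀ t ∈ Icc (0 : ℝ) 1,
    ∫⁻ ξ, (r ξ * ENNReal.ofReal (|ξ| ^ (1 / 2 : ℝ)) * ‖∫ s in Iic t, G s ξ‖ₑ) ^ 2 ≤
      C * ySq r G := by
  have hm := (wtMass_lt_top (q := 25 / 24) (by norm_num)).ne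
  refine ⟨(36 * wtMass (25 / 24)).toNNReal, fun {r} hr {G} hG t ht => ?_⟩
  rw [ENNReal.coe_toNNReal (by finiteness)]
  have mg := hG.measurable_gHat
  have key : ∀ ξ, ‖∫ s in Iic t, G s ξ‖ₑ ^ 2 ≤
      36 * wtMass (25 / 24) * ∫⁻ σ, (wt (23 / 48) σ * ‖gHat G ξ σ‖ₑ) ^ 2 := by
    intro ξ
    have mξ := (hG.continuous_gHat ξ).measurable
    have e := IsSrc.expAvg_damped (G := G) t ξ
    rw [expAvg_eq_integral (hG.integrable_damped ξ) (hG.lintegral_damped_sq_lt_top ξ)] at e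
    have e2 : ∫ s in Iic t, G s ξ = (Real.exp t : ℂ) * ((Real.exp (-t) : ℂ) *
        ∫ s in Iic t, G s ξ) := by
      rw [← mul_assoc, ← Complex.ofReal_mul, ← Real.exp_add]; simp
    have e3 : ‖(Real.exp t : ℂ)‖ₑ ≤ 3 := by
      rw [← ofReal_norm, Complex.norm_real, Real.norm_eq_abs, abs_of_pos (Real.exp_pos _),
        ← ENNReal.ofReal_ofNat]
      apply ENNReal.ofReal_le_ofReal
      have := Real.exp_one_lt_d9
      have : Real.exp t ≤ Real.exp 1 := Real.exp_le_exp.2 ht.2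
      linarith
    have h1 : ‖∫ s in Iic t, G s ξ‖ₑ ≤
        6 * ∫⁻ σ, wt (25 / 48) σ * (wt (23 / 48) σ * ‖gHat G ξ σ‖ₑ) := by
      rw [e2, ← e, enorm_mul]
      calc _ ≤ 3 * ∫⁻ σ : ℝ, ‖𝓕 (fun s : ℝ => (Real.exp (-s) : ℂ) * G s ξ) σ *
            (1 + 2 * π * Complex.I * σ)⁻¹ * Complex.exp (2 * π * Complex.I * σ * t)‖ₑ := by
            gcongr
            exact enorm_integral_le_lintegral_enorm _
        _ ≤ 3 * ∫⁻ σ : ℝ, 2 * (wt (25 / 48) σ * (wt (23 / 48) σ * ‖gHat G ξ σ‖ₑ)) := by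
            refine mul_le_mul' le_rfl (lintegral_mono fun σ => ?_)
            rw [enorm_mul, enorm_mul]
            have h2 := enorm_inv_le_wt (le_two_mul_norm_one_add σ)
            have h3 : ‖Complex.exp (2 * π * Complex.I * σ * t)‖ₑ = 1 := by
              rw [show (2 * π * Complex.I * σ * t : ℂ) = (2 * π * σ * t : ℝ) * Complex.I by
                push_cast; ring, ← ofReal_norm, Complex.norm_exp_ofReal_mul_I]
              simp
            rw [h3, mul_one]
            have h4 : wt 1 σ = wt (25 / 48) σ * wt (23 / 48) σ := by rw [wt_mul_wt]; norm_num
            calc _ ≤ ‖gHat G ξ σ‖ₑ * (2 * wt 1 σ) := mul_le_mul' le_rfl h2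
              _ = _ := by rw [h4]; ring
        _ = _ := by rw [lintegral_const_mul _ (by fun_prop)]; ring
    refine (pow_le_pow_left' h1 2).trans ?_
    rw [mul_pow]
    calc _ ≤ 6 ^ 2 * ((∫⁻ σ, wt (25 / 48) σ ^ 2) * ∫⁻ σ, (wt (23 / 48) σ * ‖gHat G ξ σ‖ₑ) ^ 2) := by
          gcongr
          exact lintegral_mul_sq_le (by fun_prop) (by fun_prop)
      _ = _ := by
          have : ∀ σ, wt (25 / 48) σ ^ 2 = wt (25 / 24) σ := fun σ => by
            rw [sq, wt_mul_wt]; norm_num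
          simp_rw [this]
          rw [wtMass]; ring
  unfold ySq
  rw [Measure.volume_eq_prod, lintegral_prod _ (by fun_prop), ← lintegral_const_mul _
    (Measurable.lintegral_prod_right' (f := fun p : ℝ × ℝ => (r p.1 *
      ENNReal.ofReal (|p.1| ^ (1 / 2 : ℝ)) * wt (23 / 48) p.2 * ‖gHat G p.1 p.2‖ₑ) ^ 2)
      (by fun_prop))]
  apply lintegral_mono; intro ξ
  have mξ := (hG.continuous_gHat ξ).measurable
  dsimp only
  rw [mul_pow]
  refine (mul_le_mul' le_rfl (key ξ)).trans_eq ?_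
  rw [mul_left_comm, ← lintegral_const_mul _ (by fun_prop)]
  congr 2; ext σ; ring

/-- The quadratic interaction restricted to the time interval `[0, τ]`. -/
def cutBil (τ : ℝ) (f g : ℝ → ℝ → ℂ) (s ξ : ℝ) : ℂ :=
  (Icc 0 τ).indicator (fun s => bil f g s ξ) s

theorem le_of_le_mul_sqrt {Y A K : ℝ≥0∞} (hY : Y ≠ ⊤) (h : Y ≤ A * (K * Y) ^ (1 / 2 : ℝ)) :
    Y ≤ A ^ 2 * K := by
  rcases eq_or_ne Y 0 with rfl | h0
  · simp
  have h1 : Y ^ 2 ≤ A ^ 2 * K * Y := by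
    calc Y ^ 2 ≤ (A * (K * Y) ^ (1 / 2 : ℝ)) ^ 2 := by gcongr
      _ = A ^ 2 * (K * Y) := by
        rw [mul_pow, ← ENNReal.rpow_natCast (_ ^ _), ← ENNReal.rpow_mul]; norm_num
      _ = _ := by ring
  rw [sq] at h1
  exact (ENNReal.mul_le_mul_iff_left h0 hY).1 h1

theorem exists_ySq_bil_le : ∃ C : NNReal, ∀ {r : ℝ → ℝ≥0∞}, Measurable r → ∀ {R : ℝ≥0∞},
    R ≠ ⊤ → (∀ x, r x ≤ R) → ∀ {c : ℝ≥0∞}, (∀ x y, r (x + y) ≤ c * (r x + r y)) →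
    ∀ {h₁ h₂ : ℝ → ℂ} {G₁ G₂ : ℝ → ℝ → ℂ}, IsSrc G₁ → IsSrc G₂ → Measurable h₁ → Measurable h₂ →
    ∫⁻ ξ, ‖h₁ ξ‖ₑ ^ 2 < ⊤ → ∫⁻ ξ, ‖h₂ ξ‖ₑ ^ 2 < ⊤ → ∀ {τ : ℝ}, τ ∈ Icc (0 : ℝ) 1 →
    IsSrc (cutBil τ (prof h₁ G₁) (prof h₂ G₂)) →
    ySq r (cutBil τ (prof h₁ G₁) (prof h₂ G₂)) ≤ C * c ^ 2 *
      (xSq r h₁ G₁ * xSq 1 h₂ G₂ + xSq 1 h₁ G₁ * xSq r h₂ G₂) := by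
  set S := (ENNReal.ofReal (2 ^ (45 / 48 : ℝ)) * (4 * wtMass (1 + 1 / 48))) *
      (2 * wtMass (1 + 1 / 48)) with hS
  have hm := (wtMass_lt_top (q := 1 + 1 / 48) (by norm_num)).ne
  have hSt : S ≠ ⊤ := by finiteness
  have hk := kerConst_lt_top.ne
  refine ⟨(48 ^ 2 * (kerConst * S)).toNNReal, ?_⟩
  intro r hr R hR hrR c hrc h₁ h₂ G₁ G₂ hG₁ hG₂ hm₁ hm₂ hs₁ hs₂ τ hτ hB
  rw [ENNReal.coe_toNNReal (by finiteness)]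
  set G := cutBil τ (prof h₁ G₁) (prof h₂ G₂) with hG
  have mg := hB.measurable_gHat
  set D : ℝ × ℝ → ℝ≥0∞ := fun p => r p.1 * ENNReal.ofReal (|p.1| ^ (1 / 2 : ℝ)) *
    wt (23 / 48) p.2 * ‖gHat G p.1 p.2‖ₑ with hD
  have mD : Measurable D := by rw [hD]; fun_prop
  set a : ℝ × ℝ → ℝ≥0∞ := fun p => ‖amp h₁ G₁ p.1 p.2‖ₑ with ha
  set b : ℝ × ℝ → ℝ≥0∞ := fun p => ‖amp h₂ G₂ p.1 p.2‖ₑ with hb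
  have ma : Measurable a := (hG₁.measurable_amp hm₁).enorm
  have mb : Measurable b := (hG₂.measurable_amp hm₂).enorm
  have hpt : ∀ ξ σ, ‖gHat G ξ σ‖ₑ ≤ 8 * ∫⁻ η, ∫⁻ z : ℝ × ℝ, a (η, z.1) * b (ξ - η, z.2) *
      wt 1 (σ + 3 * ξ * η * (ξ - η) - z.1 - z.2) := fun ξ σ =>
    enorm_gHat_bil_le hG₁ hG₂ hm₁ hm₂ hs₁ hs₂ hτ ξ σ
  set Y := ySq r G with hY
  have hYD : Y = ∫⁻ p, D p ^ 2 := rfl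
  have hYt : Y ≠ ⊤ := (hB.ySq_lt_top hrR hR).ne
  have mN := measurable_nAmp ma
  have mN' := measurable_nAmp mb
  have mS : Measurable fun p => smoothDual D (-p) := (measurable_smoothDual mD).comp measurable_neg
  have hSD : ∫⁻ p, smoothDual D (-p) ^ 2 ≤ S * Y := by
    rw [lintegral_neg_eq_self (μ := (volume : Measure (ℝ × ℝ))) (fun p => smoothDual D p ^ 2), hYD]
    exact lintegral_smoothDual_sq_le mD
  have x1 : ∫⁻ p, nAmp a p ^ 2 = xSq 1 h₁ G₁ := by simp [xSq, ha]
  have x2 : ∫⁻ p, nAmp b p ^ 2 = xSq 1 h₂ G₂ := by simp [xSq, hb]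
  set U₁ := xSq r h₁ G₁ * xSq 1 h₂ G₂ with hU₁
  set U₂ := xSq 1 h₁ G₁ * xSq r h₂ G₂ with hU₂
  have t1 : triForm biKer (fun p => smoothDual D (-p)) (fun p => r p.1 * nAmp a p) (nAmp b) ≤
      3 * (kerConst * S * (U₁ + U₂) * Y) ^ (1 / 2 : ℝ) := by
    refine (triForm_biKer_le (by fun_prop) mN' mS).trans ?_
    rw [x2]
    change 3 * (kerConst * (_ * xSq r h₁ G₁ * _)) ^ (1 / 2 : ℝ) ≤ _
    refine mul_le_mul' le_rfl (ENNReal.rpow_le_rpow ?_ (by norm_num))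
    calc _ ≤ kerConst * (S * Y * xSq r h₁ G₁ * xSq 1 h₂ G₂) :=
          mul_le_mul' le_rfl (mul_le_mul' (mul_le_mul' hSD le_rfl) le_rfl)
      _ = kerConst * S * U₁ * Y := by rw [hU₁]; ring
      _ ≤ _ := mul_le_mul' (mul_le_mul' le_rfl le_self_add) le_rfl
  have t2 : triForm biKer (fun p => smoothDual D (-p)) (nAmp a) (fun p => r p.1 * nAmp b p) ≤
      3 * (kerConst * S * (U₁ + U₂) * Y) ^ (1 / 2 : ℝ) := by
    refine (triForm_biKer_le mN (by fun_prop) mS).trans ?_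
    rw [x1]
    change 3 * (kerConst * (_ * _ * xSq r h₂ G₂)) ^ (1 / 2 : ℝ) ≤ _
    refine mul_le_mul' le_rfl (ENNReal.rpow_le_rpow ?_ (by norm_num))
    calc _ ≤ kerConst * (S * Y * xSq 1 h₁ G₁ * xSq r h₂ G₂) :=
          mul_le_mul' le_rfl (mul_le_mul' (mul_le_mul' hSD le_rfl) le_rfl)
      _ = kerConst * S * U₂ * Y := by rw [hU₂]; ring
      _ ≤ _ := mul_le_mul' (mul_le_mul' le_rfl le_add_self) le_rfl
  have main : Y ≤ 48 * c * (kerConst * S * (U₁ + U₂) * Y) ^ (1 / 2 : ℝ) := by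
    have dual := bilinear_duality hr hrc ma mb mD
    calc Y = ∫⁻ ξ, ∫⁻ σ, D (ξ, σ) ^ 2 := by
          rw [hYD, Measure.volume_eq_prod, lintegral_prod _ (by fun_prop)]
      _ ≤ ∫⁻ ξ, ∫⁻ σ, 8 * (D (ξ, σ) * (r ξ * ENNReal.ofReal (|ξ| ^ (1 / 2 : ℝ)) * wt (23 / 48) σ *
          ∫⁻ η, ∫⁻ z : ℝ × ℝ, a (η, z.1) * b (ξ - η, z.2) *
            wt 1 (σ + 3 * ξ * η * (ξ - η) - z.1 - z.2))) := by
          refine lintegral_mono fun ξ => lintegral_mono fun σ => ?_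
          refine (le_of_eq (_root_.sq _)).trans (le_trans ?_ (le_of_eq (mul_left_comm _ _ _)))
          refine mul_le_mul' le_rfl ?_
          calc D (ξ, σ) = r ξ * ENNReal.ofReal (|ξ| ^ (1 / 2 : ℝ)) * wt (23 / 48) σ *
                ‖gHat G ξ σ‖ₑ := rfl
            _ ≤ r ξ * ENNReal.ofReal (|ξ| ^ (1 / 2 : ℝ)) * wt (23 / 48) σ *
                (8 * ∫⁻ η, ∫⁻ z : ℝ × ℝ, a (η, z.1) * b (ξ - η, z.2) *
                  wt 1 (σ + 3 * ξ * η * (ξ - η) - z.1 - z.2)) := mul_le_mul' le_rfl (hpt ξ σ)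
            _ = _ := by ring
      _ = 8 * ∫⁻ ξ, ∫⁻ σ, (D (ξ, σ) * (r ξ * ENNReal.ofReal (|ξ| ^ (1 / 2 : ℝ)) * wt (23 / 48) σ *
          ∫⁻ η, ∫⁻ z : ℝ × ℝ, a (η, z.1) * b (ξ - η, z.2) *
            wt 1 (σ + 3 * ξ * η * (ξ - η) - z.1 - z.2))) := by
          simp_rw [lintegral_const_mul' 8 _ (by simp : (8 : ℝ≥0∞) ≠ ⊤)]
      _ ≤ 8 * (c * (3 * (kerConst * S * (U₁ + U₂) * Y) ^ (1 / 2 : ℝ) +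
          3 * (kerConst * S * (U₁ + U₂) * Y) ^ (1 / 2 : ℝ))) := by
          refine mul_le_mul' le_rfl (dual.trans (mul_le_mul' le_rfl (add_le_add t1 t2)))
      _ = _ := by ring
  refine (le_of_le_mul_sqrt hYt main).trans_eq ?_
  ring

/-- The weighted mass `∫ (1 + |ξ|)² |h|²`. -/
def wSq (h : ℝ → ℂ) : ℝ≥0∞ := ∫⁻ ξ, (wt (-1) ξ * ‖h ξ‖ₑ) ^ 2

theorem lintegral_sq_le_wSq (h : ℝ → ℂ) : ∫⁻ ξ, ‖h ξ‖ₑ ^ 2 ≤ wSq h := by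
  refine lintegral_mono fun ξ => ?_
  have : (1 : ℝ≥0∞) ≤ wt (-1) ξ := by rw [← wt_zero ξ]; exact wt_anti (by norm_num) ξ
  gcongr
  simpa using mul_le_mul' this (le_refl ‖h ξ‖ₑ)

theorem sq_lintegral_enorm_le_wSq {h : ℝ → ℂ} (hh : Measurable h) :
    (∫⁻ ξ, ‖h ξ‖ₑ) ^ 2 ≤ wtMass 2 * wSq h := by
  have := lintegral_wt_one_mul_sq_le (f := fun ξ => wt (-1) ξ * ‖h ξ‖ₑ) (by fun_prop)
  refine le_trans (le_of_eq ?_) this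
  congr 1
  apply lintegral_congr; intro ξ
  rw [← mul_assoc, mul_comm (wt 1 ξ), wt_neg_mul_cancel, one_mul]

/-- Young's inequality `L² * L¹ → L²`. -/
theorem lintegral_conv_sq_le {p q : ℝ → ℝ≥0∞} (hp : Measurable p) (hq : Measurable q) :
    ∫⁻ ξ, (∫⁻ η, p η * q (ξ - η)) ^ 2 ≤ (∫⁻ η, p η ^ 2) * (∫⁻ η, q η) ^ 2 := by
  have hs : ∀ x : ℝ≥0∞, x ^ (1 / 2 : ℝ) * x ^ (1 / 2 : ℝ) = x := fun x => by
    rw [← ENNReal.rpow_add_of_nonneg _ _ (by norm_num) (by norm_num)]; norm_num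
  have h1 : ∀ ξ, (∫⁻ η, p η * q (ξ - η)) ^ 2 ≤ (∫⁻ η, p η ^ 2 * q (ξ - η)) * ∫⁻ η, q η := by
    intro ξ
    have := lintegral_mul_sq_le (μ := volume) (f := fun η => p η * q (ξ - η) ^ (1 / 2 : ℝ))
      (g := fun η => q (ξ - η) ^ (1 / 2 : ℝ)) (by fun_prop) (by fun_prop)
    simp only [mul_assoc, hs, mul_pow, _root_.sq (q _ ^ (1 / 2 : ℝ))] at this
    rwa [lintegral_comp_const_sub q ξ] at this
  calc _ ≤ ∫⁻ ξ, (∫⁻ η, p η ^ 2 * q (ξ - η)) * ∫⁻ η, q η := lintegral_mono h1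
    _ = (∫⁻ ξ, ∫⁻ η, p η ^ 2 * q (ξ - η)) * ∫⁻ η, q η := by
      have : Measurable fun ξ => ∫⁻ η, p η ^ 2 * q (ξ - η) :=
        Measurable.lintegral_prod_right' (f := fun x : ℝ × ℝ => p x.2 ^ 2 * q (x.1 - x.2))
          (by fun_prop)
      rw [lintegral_mul_const _ this]
    _ = (∫⁻ η, ∫⁻ ξ, p η ^ 2 * q (ξ - η)) * ∫⁻ η, q η := by
      rw [lintegral_lintegral_swap (by fun_prop)]
    _ = _ := by
      have : ∀ η, ∫⁻ ξ, p η ^ 2 * q (ξ - η) = p η ^ 2 * ∫⁻ ξ, q ξ := fun η => by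
        rw [lintegral_const_mul _ (by fun_prop), lintegral_sub_right_eq_self]
      simp_rw [this]
      rw [lintegral_mul_const _ (by fun_prop)]
      ring

theorem enorm_bil_le (f g : ℝ → ℝ → ℂ) (s ξ : ℝ) :
    ‖bil f g s ξ‖ₑ ≤ ∫⁻ η, ‖f s η‖ₑ * ‖g s (ξ - η)‖ₑ := by
  refine (enorm_integral_le_lintegral_enorm _).trans_eq (lintegral_congr fun η => ?_)
  rw [enorm_mul, enorm_mul, ← ofReal_norm (Complex.exp _), Complex.norm_exp_ofReal_mul_I,
    ENNReal.ofReal_one, one_mul]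

theorem enorm_bil_sq_le {f g : ℝ → ℝ → ℂ} {s : ℝ} (hf : Measurable (f s)) (hg : Measurable (g s))
    (ξ : ℝ) : ‖bil f g s ξ‖ₑ ^ 2 ≤ wSq (f s) * wSq (g s) := by
  calc _ ≤ (∫⁻ η, ‖f s η‖ₑ * ‖g s (ξ - η)‖ₑ) ^ 2 := by gcongr; exact enorm_bil_le f g s ξ
    _ ≤ (∫⁻ η, ‖f s η‖ₑ ^ 2) * ∫⁻ η, ‖g s (ξ - η)‖ₑ ^ 2 :=
      lintegral_mul_sq_le (by fun_prop) (by fun_prop)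
    _ ≤ _ := by
      rw [lintegral_comp_const_sub (fun η => ‖g s η‖ₑ ^ 2) ξ]
      exact mul_le_mul' (lintegral_sq_le_wSq _) (lintegral_sq_le_wSq _)

theorem wSq_bil_le {f g : ℝ → ℝ → ℂ} {s : ℝ} (hf : Measurable (f s)) (hg : Measurable (g s)) :
    wSq (bil f g s) ≤ 16 * wtMass 2 * (wSq (f s) * wSq (g s)) := by
  set a : ℝ → ℝ≥0∞ := fun η => ‖f s η‖ₑ with ha
  set b : ℝ → ℝ≥0∞ := fun η => ‖g s η‖ₑ with hb
  have ma : Measurable a := hf.enorm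
  have mb : Measurable b := hg.enorm
  have h1 : ∀ ξ, (wt (-1) ξ * ‖bil f g s ξ‖ₑ) ^ 2 ≤
      8 * (∫⁻ η, wt (-1) η * a η * b (ξ - η)) ^ 2 +
      8 * (∫⁻ η, wt (-1) η * b η * a (ξ - η)) ^ 2 := by
    intro ξ
    have : wt (-1) ξ * ‖bil f g s ξ‖ₑ ≤ 2 * ((∫⁻ η, wt (-1) η * a η * b (ξ - η)) +
        ∫⁻ η, wt (-1) η * b η * a (ξ - η)) := by
      rw [← lintegral_comp_const_sub (fun η => wt (-1) η * b η * a (ξ - η)) ξ]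
      rw [← lintegral_add_left (by fun_prop), ← lintegral_const_mul _ (by fun_prop)]
      calc _ ≤ wt (-1) ξ * ∫⁻ η, a η * b (ξ - η) := mul_le_mul' le_rfl (enorm_bil_le f g s ξ)
        _ = ∫⁻ η, wt (-1) ξ * (a η * b (ξ - η)) := by rw [lintegral_const_mul _ (by fun_prop)]
        _ ≤ _ := by
          refine lintegral_mono fun η => ?_
          have h2 := wt_neg_le_add (zero_le_one' ℝ) ξ η
          calc _ ≤ ENNReal.ofReal (2 ^ (1 : ℝ)) * (wt (-1) η + wt (-1) (ξ - η)) *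
                (a η * b (ξ - η)) := mul_le_mul' h2 le_rfl
            _ = _ := by
              rw [Real.rpow_one, ENNReal.ofReal_ofNat, sub_sub_cancel]; ring
    calc _ ≤ (2 * ((∫⁻ η, wt (-1) η * a η * b (ξ - η)) +
        ∫⁻ η, wt (-1) η * b η * a (ξ - η))) ^ 2 := by gcongr
      _ ≤ 4 * (2 * (∫⁻ η, wt (-1) η * a η * b (ξ - η)) ^ 2 +
          2 * (∫⁻ η, wt (-1) η * b η * a (ξ - η)) ^ 2) := by
        rw [mul_pow]; norm_num
        gcongr
        exact add_sq_le_two_mul _ _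
      _ = _ := by ring
  calc wSq (bil f g s) ≤ ∫⁻ ξ, (8 * (∫⁻ η, wt (-1) η * a η * b (ξ - η)) ^ 2 +
      8 * (∫⁻ η, wt (-1) η * b η * a (ξ - η)) ^ 2) := lintegral_mono h1
    _ = 8 * (∫⁻ ξ, (∫⁻ η, wt (-1) η * a η * b (ξ - η)) ^ 2) +
      8 * (∫⁻ ξ, (∫⁻ η, wt (-1) η * b η * a (ξ - η)) ^ 2) := by
      have m1 : Measurable fun ξ => ∫⁻ η, wt (-1) η * a η * b (ξ - η) :=
        Measurable.lintegral_prod_right' (f := fun x : ℝ × ℝ => wt (-1) x.2 * a x.2 * b (x.1 - x.2))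
          (by fun_prop)
      have m2 : Measurable fun ξ => ∫⁻ η, wt (-1) η * b η * a (ξ - η) :=
        Measurable.lintegral_prod_right' (f := fun x : ℝ × ℝ => wt (-1) x.2 * b x.2 * a (x.1 - x.2))
          (by fun_prop)
      rw [lintegral_add_left (by fun_prop), lintegral_const_mul _ (by fun_prop),
        lintegral_const_mul _ (by fun_prop)]
    _ ≤ 8 * (wSq (f s) * (wtMass 2 * wSq (g s))) + 8 * (wSq (g s) * (wtMass 2 * wSq (f s))) := by
      gcongr
      · exact (lintegral_conv_sq_le (by fun_prop) mb).trans
          (mul_le_mul' le_rfl (sq_lintegral_enorm_le_wSq hg))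
      · exact (lintegral_conv_sq_le (by fun_prop) ma).trans
          (mul_le_mul' le_rfl (sq_lintegral_enorm_le_wSq hf))
    _ = _ := by ring

/-- Time-dependent frequency profiles with uniformly bounded weighted mass on `[0, 1]`. -/
structure IsReg (f : ℝ → ℝ → ℂ) (K : ℝ≥0∞) : Prop where
  meas : Measurable fun p : ℝ × ℝ => f p.1 p.2
  lt_top : K < ⊤
  le : ∀ t ∈ Icc (0 : ℝ) 1, wSq (f t) ≤ K

theorem measurable_slice_right {G : ℝ → ℝ → ℂ} (h : Measurable fun p : ℝ × ℝ => G p.1 p.2)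
    (s : ℝ) : Measurable (G s) :=
  h.comp (by fun_prop : Measurable fun ξ : ℝ => (s, ξ))

theorem measurable_bil {f g : ℝ → ℝ → ℂ} (hf : Measurable fun p : ℝ × ℝ => f p.1 p.2)
    (hg : Measurable fun p : ℝ × ℝ => g p.1 p.2) :
    Measurable fun p : ℝ × ℝ => bil f g p.1 p.2 := by
  have h1 : Measurable fun x : (ℝ × ℝ) × ℝ => f x.1.1 x.2 :=
    hf.comp (by fun_prop : Measurable fun x : (ℝ × ℝ) × ℝ => (x.1.1, x.2))
  have h2 : Measurable fun x : (ℝ × ℝ) × ℝ => g x.1.1 (x.1.2 - x.2) :=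
    hg.comp (by fun_prop : Measurable fun x : (ℝ × ℝ) × ℝ => (x.1.1, x.1.2 - x.2))
  have h3 : Measurable fun x : (ℝ × ℝ) × ℝ =>
      Complex.exp ((-2 * π * x.1.1 * (3 * x.1.2 * x.2 * (x.1.2 - x.2)) : ℝ) * Complex.I) := by
    fun_prop
  exact (h3.mul (h1.mul h2)).stronglyMeasurable.integral_prod_right'.measurable

/-- The quadratic interaction restricted to a set of times. -/
def bilOn (A : Set ℝ) (f g : ℝ → ℝ → ℂ) (s ξ : ℝ) : ℂ := A.indicator (fun s => bil f g s ξ) s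

theorem lintegral_bilOn_le {A : Set ℝ} (hA : MeasurableSet A) (hA1 : A ⊆ Icc 0 1)
    {f g : ℝ → ℝ → ℂ} {K L : ℝ≥0∞} (hf : IsReg f K) (hg : IsReg g L) :
    ∫⁻ ξ, ∫⁻ s, (wt (-1) ξ * ‖bilOn A f g s ξ‖ₑ) ^ 2 ≤
      16 * wtMass 2 * (K * L) * volume A := by
  have mb := measurable_bil hf.meas hg.meas
  have mA : Measurable fun p : ℝ × ℝ => A.indicator (fun _ => (1 : ℝ≥0∞)) p.2 :=
    (measurable_const.indicator hA).comp measurable_snd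
  have mb' : Measurable fun p : ℝ × ℝ => bil f g p.2 p.1 := mb.comp measurable_swap
  have e : ∀ ξ s, (wt (-1) ξ * ‖bilOn A f g s ξ‖ₑ) ^ 2 =
      A.indicator (fun _ => (1 : ℝ≥0∞)) s * (wt (-1) ξ * ‖bil f g s ξ‖ₑ) ^ 2 := fun ξ s => by
    by_cases hs : s ∈ A <;> simp [bilOn, hs]
  simp_rw [e]
  rw [lintegral_lintegral_swap (by fun_prop)]
  calc _ ≤ ∫⁻ s, 16 * wtMass 2 * (K * L) * A.indicator (fun _ => (1 : ℝ≥0∞)) s := by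
        refine lintegral_mono fun s => ?_
        have := measurable_slice_right mb s
        dsimp only
        rw [lintegral_const_mul _ (by fun_prop)]
        by_cases hs : s ∈ A
        · simp only [hs, indicator_of_mem, one_mul, mul_one]
          refine (wSq_bil_le (measurable_slice_right hf.meas s)
            (measurable_slice_right hg.meas s)).trans ?_
          exact mul_le_mul' le_rfl (mul_le_mul' (hf.le s (hA1 hs)) (hg.le s (hA1 hs)))
        · simp [hs]
    _ = _ := by
      rw [lintegral_const_mul _ (measurable_const.indicator hA), lintegral_indicator hA]
      simp

theorem isSrc_bilOn {A : Set ℝ} (hA : MeasurableSet A) (hA1 : A ⊆ Icc 0 1)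
    {f g : ℝ → ℝ → ℂ} {K L : ℝ≥0∞} (hf : IsReg f K) (hg : IsReg g L) : IsSrc (bilOn A f g) := by
  have hV : volume A ≠ ⊤ := measure_ne_top_of_subset hA1 (by simp)
  have hw := (wtMass_lt_top (q := 2) (by norm_num)).ne
  have hK := hf.lt_top.ne
  have hL := hg.lt_top.ne
  have key := lintegral_bilOn_le hA hA1 hf hg
  have fin : 16 * wtMass 2 * (K * L) * volume A < ⊤ := by finiteness
  refine ⟨?_, ?_, ?_, ?_, ?_⟩
  · have : (fun p : ℝ × ℝ => bilOn A f g p.1 p.2) =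
        (Prod.fst ⁻¹' A).indicator (fun p => bil f g p.1 p.2) := by
      ext p; by_cases hp : p.1 ∈ A <;> simp [bilOn, hp]
    rw [this]
    exact (measurable_bil hf.meas hg.meas).indicator (measurable_fst hA)
  · intro s ξ hs
    have : s ∉ A := fun h => hs (hA1 h)
    simp [bilOn, this]
  · refine ⟨((K * L) ^ (1 / 2 : ℝ)).toReal, fun s ξ => ?_⟩
    have fin2 : (K * L) ^ (1 / 2 : ℝ) ≠ ⊤ := by finiteness
    by_cases hs : s ∈ A
    · have := enorm_bil_sq_le (measurable_slice_right hf.meas s) (measurable_slice_right hg.meas s) ξ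
      have h2 : ‖bil f g s ξ‖ₑ ≤ (K * L) ^ (1 / 2 : ℝ) := by
        have h3 := this.trans (mul_le_mul' (hf.le s (hA1 hs)) (hg.le s (hA1 hs)))
        have h4 := ENNReal.rpow_le_rpow h3 (by norm_num : (0 : ℝ) ≤ 1 / 2)
        rwa [← ENNReal.rpow_natCast, ← ENNReal.rpow_mul, show ((2 : ℕ) : ℝ) * (1 / 2) = 1 by norm_num,
          ENNReal.rpow_one] at h4
      simp only [bilOn, hs, indicator_of_mem]
      rw [← toReal_enorm]
      exact ENNReal.toReal_mono fin2 h2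
    · simp [bilOn, hs]
  · refine (lintegral_mono fun ξ => lintegral_mono fun s => ?_).trans_lt (key.trans_lt fin)
    have : (1 : ℝ≥0∞) ≤ wt (-1) ξ := by rw [← wt_zero ξ]; exact wt_anti (by norm_num) ξ
    gcongr
    simpa using mul_le_mul' this (le_refl ‖bilOn A f g s ξ‖ₑ)
  · refine (lintegral_mono fun ξ => lintegral_mono fun s => ?_).trans_lt (key.trans_lt fin)
    have : ‖ξ‖ₑ ≤ wt (-1) ξ := by
      rw [← ofReal_norm]
      refine ENNReal.ofReal_le_ofReal ?_
      simp
    gcongr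

theorem ySq_one_bilOn_le {A : Set ℝ} (hA : MeasurableSet A) (hA1 : A ⊆ Icc 0 1)
    {f g : ℝ → ℝ → ℂ} {K L : ℝ≥0∞} (hf : IsReg f K) (hg : IsReg g L) :
    ySq 1 (bilOn A f g) ≤ 16 * wtMass 2 * (K * L) * volume A := by
  refine ((isSrc_bilOn hA hA1 hf hg).ySq_le (R := 1) (fun _ => le_rfl)).trans ?_
  rw [one_pow, one_mul]
  refine le_trans (lintegral_mono fun ξ => lintegral_mono fun s => ?_)
    (lintegral_bilOn_le hA hA1 hf hg)
  have h1 : (1 : ℝ≥0∞) ≤ wt (-1) ξ := by rw [← wt_zero ξ]; exact wt_anti (by norm_num) ξ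
  have h2 : ‖ξ‖ₑ ≤ wt (-1) ξ := by
    rw [← ofReal_norm]
    refine ENNReal.ofReal_le_ofReal ?_
    simp
  rw [mul_pow]
  gcongr
  rw [_root_.sq]
  simpa using mul_le_mul' h1 h2

theorem IsSrc.const_mul {G : ℝ → ℝ → ℂ} (hG : IsSrc G) (c : ℂ) : IsSrc fun s ξ => c * G s ξ := by
  obtain ⟨K, hK⟩ := hG.bdd
  refine ⟨hG.meas.const_mul c, fun s ξ hs => by simp [hG.supp s ξ hs], ⟨‖c‖ * K, fun s ξ => ?_⟩,
    ?_, ?_⟩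
  · rw [norm_mul]; exact mul_le_mul_of_nonneg_left (hK s ξ) (norm_nonneg c)
  · have e : ∀ s ξ, ‖c * G s ξ‖ₑ ^ 2 = ‖c‖ₑ ^ 2 * ‖G s ξ‖ₑ ^ 2 := fun s ξ => by
      rw [enorm_mul, mul_pow]
    simp_rw [e, lintegral_const_mul' (‖c‖ₑ ^ 2) _ (by finiteness)]
    have := hG.sq.ne
    finiteness
  · have e : ∀ s ξ, (‖ξ‖ₑ * ‖c * G s ξ‖ₑ) ^ 2 = ‖c‖ₑ ^ 2 * (‖ξ‖ₑ * ‖G s ξ‖ₑ) ^ 2 := fun s ξ => by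
      rw [enorm_mul]; ring
    simp_rw [e, lintegral_const_mul' (‖c‖ₑ ^ 2) _ (by finiteness)]
    have := hG.wsq.ne
    finiteness

theorem IsSrc.add {G H : ℝ → ℝ → ℂ} (hG : IsSrc G) (hH : IsSrc H) :
    IsSrc fun s ξ => G s ξ + H s ξ := by
  obtain ⟨K, hK⟩ := hG.bdd
  obtain ⟨L, hL⟩ := hH.bdd
  have mG : Measurable fun p : ℝ × ℝ => G p.2 p.1 := hG.meas.comp measurable_swap
  have mH : Measurable fun p : ℝ × ℝ => H p.2 p.1 := hH.meas.comp measurable_swap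
  have key : ∀ w : ℝ → ℝ≥0∞, Measurable w → ∫⁻ ξ, ∫⁻ s, (w ξ * ‖G s ξ + H s ξ‖ₑ) ^ 2 ≤
      2 * (∫⁻ ξ, ∫⁻ s, (w ξ * ‖G s ξ‖ₑ) ^ 2) + 2 * ∫⁻ ξ, ∫⁻ s, (w ξ * ‖H s ξ‖ₑ) ^ 2 := by
    intro w hw
    have m1 : Measurable fun p : ℝ × ℝ => (w p.1 * ‖G p.2 p.1‖ₑ) ^ 2 :=
      ((hw.comp measurable_fst).mul mG.enorm).pow_const 2
    have m2 : Measurable fun p : ℝ × ℝ => (w p.1 * ‖H p.2 p.1‖ₑ) ^ 2 :=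
      ((hw.comp measurable_fst).mul mH.enorm).pow_const 2
    rw [← lintegral_const_mul _ m1.lintegral_prod_right', ← lintegral_const_mul _
      m2.lintegral_prod_right', ← lintegral_add_left (m1.lintegral_prod_right'.const_mul 2)]
    refine lintegral_mono fun ξ => ?_
    have n1 : Measurable fun s => (w ξ * ‖G s ξ‖ₑ) ^ 2 :=
      m1.comp (by fun_prop : Measurable fun s : ℝ => (ξ, s))
    have n2 : Measurable fun s => (w ξ * ‖H s ξ‖ₑ) ^ 2 :=
      m2.comp (by fun_prop : Measurable fun s : ℝ => (ξ, s))
    dsimp only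
    rw [← lintegral_const_mul _ n1, ← lintegral_const_mul _ n2, ← lintegral_add_left
      (n1.const_mul 2)]
    refine lintegral_mono fun s => ?_
    refine le_trans ?_ (add_sq_le_two_mul _ _)
    rw [← mul_add]
    gcongr
    exact enorm_add_le _ _
  refine ⟨hG.meas.add hH.meas, fun s ξ hs => by simp [hG.supp s ξ hs, hH.supp s ξ hs],
    ⟨K + L, fun s ξ => (norm_add_le _ _).trans (add_le_add (hK s ξ) (hL s ξ))⟩, ?_, ?_⟩
  · have := key 1 measurable_one
    simp only [Pi.one_apply, one_mul] at this
    refine this.trans_lt ?_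
    have := hG.sq.ne
    have := hH.sq.ne
    finiteness
  · refine (key (fun ξ => ‖ξ‖ₑ) (by fun_prop)).trans_lt ?_
    have := hG.wsq.ne
    have := hH.wsq.ne
    finiteness

theorem IsReg.measurable_slice {f : ℝ → ℝ → ℂ} {K : ℝ≥0∞} (hf : IsReg f K) (t : ℝ) :
    Measurable (f t) := measurable_slice_right hf.meas t

theorem IsReg.sq_lt_top {f : ℝ → ℝ → ℂ} {K : ℝ≥0∞} (hf : IsReg f K) {t : ℝ}
    (ht : t ∈ Icc (0 : ℝ) 1) : ∫⁻ ξ, ‖f t ξ‖ₑ ^ 2 < ⊤ :=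
  ((lintegral_sq_le_wSq _).trans (hf.le t ht)).trans_lt hf.lt_top

theorem IsSrc.measurable_integral_Iic {G : ℝ → ℝ → ℂ} (hG : IsSrc G) (t : ℝ) :
    Measurable fun ξ => ∫ s in Iic t, G s ξ := by
  have : Measurable fun p : ℝ × ℝ => G p.2 p.1 := hG.meas.comp measurable_swap
  exact this.stronglyMeasurable.integral_prod_right'.measurable

theorem bil_congr {f g f' g' : ℝ → ℝ → ℂ} {s : ℝ} (hf : f s = f' s) (hg : g s = g' s) (ξ : ℝ) :
    bil f g s ξ = bil f' g' s ξ := by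
  unfold bil; rw [hf, hg]

theorem cutBil_eq_bilOn (τ : ℝ) (f g : ℝ → ℝ → ℂ) : cutBil τ f g = bilOn (Icc 0 τ) f g := rfl

theorem isSrc_cutBil {f g : ℝ → ℝ → ℂ} {K L : ℝ≥0∞} (hf : IsReg f K) (hg : IsReg g L) {τ : ℝ}
    (hτ : τ ≤ 1) : IsSrc (cutBil τ f g) := by
  rw [cutBil_eq_bilOn]
  exact isSrc_bilOn measurableSet_Icc (Icc_subset_Icc_right hτ) hf hg

/-- The bilinear estimate for functions given by profiles on `[0, τ]`. -/
theorem exists_ySq_cutBil_le : ∃ C : NNReal, ∀ {r : ℝ → ℝ≥0∞}, Measurable r → ∀ {R : ℝ≥0∞},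
    R ≠ ⊤ → (∀ x, r x ≤ R) → ∀ {c : ℝ≥0∞}, (∀ x y, r (x + y) ≤ c * (r x + r y)) →
    ∀ {f g : ℝ → ℝ → ℂ} {K L : ℝ≥0∞}, IsReg f K → IsReg g L →
    ∀ {G H : ℝ → ℝ → ℂ}, IsSrc G → IsSrc H → ∀ {τ : ℝ}, τ ∈ Icc (0 : ℝ) 1 →
    (∀ s ∈ Icc 0 τ, prof (f 0) G s = f s) → (∀ s ∈ Icc 0 τ, prof (g 0) H s = g s) →
    ySq r (cutBil τ f g) ≤ C * c ^ 2 *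
      ((hSq r (f 0) + ySq r G) * (hSq 1 (g 0) + ySq 1 H) +
        (hSq 1 (f 0) + ySq 1 G) * (hSq r (g 0) + ySq r H)) := by
  obtain ⟨C, hC⟩ := exists_ySq_bil_le
  obtain ⟨D, hD⟩ := exists_xSq_le
  refine ⟨C * D ^ 2, ?_⟩
  intro r hr R hR hrR c hrc f g K L hf hg G H hG hH τ hτ hfG hgH
  have e : cutBil τ f g = cutBil τ (prof (f 0) G) (prof (g 0) H) := by
    ext s ξ
    unfold cutBil
    by_cases hs : s ∈ Icc 0 τ
    · simp only [hs, indicator_of_mem]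
      exact bil_congr (hfG s hs).symm (hgH s hs).symm ξ
    · simp [hs]
  have hB := isSrc_cutBil hf hg hτ.2
  have h0 : (0 : ℝ) ∈ Icc (0 : ℝ) 1 := ⟨le_rfl, zero_le_one⟩
  have mf := hf.measurable_slice 0
  have mg := hg.measurable_slice 0
  have h := hC hr hR hrR hrc hG hH mf mg (hf.sq_lt_top h0) (hg.sq_lt_top h0) hτ (e ▸ hB)
  rw [← e] at h
  refine h.trans ?_
  calc _ ≤ (C : ℝ≥0∞) * c ^ 2 * ((D * (hSq r (f 0) + ySq r G)) * (D * (hSq 1 (g 0) + ySq 1 H)) +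
        (D * (hSq 1 (f 0) + ySq 1 G)) * (D * (hSq r (g 0) + ySq r H))) :=
      mul_le_mul' le_rfl (add_le_add
        (mul_le_mul' (hD hr mf hG) (hD measurable_one mg hH))
        (mul_le_mul' (hD measurable_one mf hG) (hD hr mg hH)))
    _ = _ := by push_cast; ring

/-- Solutions on `[0, 1]` of the interaction equation in Fourier variables. -/
structure IsSol (κ : ℝ) (F : ℝ → ℝ → ℂ) (K : ℝ≥0∞) (σ : ℝ) : Prop extends IsReg F K where
  abs_le : |κ| ≤ 1
  nonneg : 0 ≤ σ
  le_one : σ ≤ 1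
  eq : ∀ t ∈ Icc (0 : ℝ) σ, ∀ ξ,
    F t ξ = F 0 ξ + ξ * ∫ s in Icc 0 t, Complex.I * κ * bil F F s ξ

/-- The source of a solution up to time `τ`. -/
def solSrc (κ : ℝ) (F : ℝ → ℝ → ℂ) (τ s ξ : ℝ) : ℂ := Complex.I * κ * cutBil τ F F s ξ

namespace IsSol

variable {κ : ℝ} {F : ℝ → ℝ → ℂ} {K : ℝ≥0∞} {σ : ℝ} (hF : IsSol κ F K σ)
include hF

theorem enorm_kappa_le : ‖(Complex.I * κ : ℂ)‖ₑ ≤ 1 := by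
  have : ‖(Complex.I * κ : ℂ)‖ = |κ| := by simp
  rw [← ofReal_norm, this]
  simpa using hF.abs_le

theorem isSrc {τ : ℝ} (hτ : τ ≤ 1) : IsSrc (solSrc κ F τ) :=
  (isSrc_cutBil hF.toIsReg hF.toIsReg hτ).const_mul _

theorem prof_eq {τ : ℝ} (hτ : τ ≤ σ) : ∀ s ∈ Icc 0 τ, prof (F 0) (solSrc κ F τ) s = F s := by
  intro s hs
  ext ξ
  rw [hF.eq s ⟨hs.1, hs.2.trans hτ⟩ ξ, prof]
  congr 2
  have : ∀ s', solSrc κ F τ s' ξ =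
      (Icc 0 τ).indicator (fun s => Complex.I * κ * bil F F s ξ) s' := fun s' => by
    by_cases h : s' ∈ Icc 0 τ <;> simp [solSrc, cutBil, h]
  simp_rw [this]
  rw [setIntegral_indicator measurableSet_Icc]
  congr 2
  ext x
  simp only [mem_inter_iff, mem_Iic, mem_Icc]
  constructor
  · rintro ⟨h1, h2, -⟩; exact ⟨h2, h1⟩
  · rintro ⟨h1, h2⟩; exact ⟨h2, h1, h2.trans hs.2⟩

theorem ySq_solSrc_le {r : ℝ → ℝ≥0∞} (hr : Measurable r) {τ : ℝ} (hτ : τ ≤ 1) :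
    ySq r (solSrc κ F τ) ≤ ySq r (cutBil τ F F) := by
  have := ySq_const_mul (isSrc_cutBil hF.toIsReg hF.toIsReg hτ) hr (Complex.I * κ)
  refine this.trans_le ?_
  have h1 := pow_le_pow_left' hF.enorm_kappa_le 2
  rw [one_pow] at h1
  exact (mul_le_mul' h1 le_rfl).trans_eq (one_mul _)

theorem ySq_increment {τ τ' : ℝ} (h0 : 0 ≤ τ) (h : τ ≤ τ') (h1 : τ' ≤ 1) :
    ySq 1 (solSrc κ F τ') ≤ 2 * ySq 1 (solSrc κ F τ) +
      2 * (16 * wtMass 2 * (K * K) * ENNReal.ofReal (τ' - τ)) := by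
  have hs : Ioc τ τ' ⊆ Icc (0 : ℝ) 1 := fun x hx => ⟨h0.trans hx.1.le, hx.2.trans h1⟩
  have i1 := hF.isSrc (h.trans h1)
  have i2 := isSrc_bilOn measurableSet_Ioc hs hF.toIsReg hF.toIsReg
  have e : solSrc κ F τ' = fun s ξ => solSrc κ F τ s ξ +
      Complex.I * κ * bilOn (Ioc τ τ') F F s ξ := by
    ext s ξ
    unfold solSrc cutBil bilOn
    rw [← mul_add]
    congr 1
    rw [← Icc_union_Ioc_eq_Icc h0 h, indicator_union_of_disjoint]
    rw [Set.disjoint_left]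
    intro x hx hx2
    exact absurd hx.2 (not_le.2 hx2.1)
  rw [e]
  refine (i1.ySq_add_le (i2.const_mul _) measurable_one).trans ?_
  gcongr
  rw [ySq_const_mul i2 measurable_one]
  have h1 := pow_le_pow_left' hF.enorm_kappa_le 2
  rw [one_pow] at h1
  refine ((mul_le_mul' h1 le_rfl).trans_eq (one_mul _)).trans ?_
  refine (ySq_one_bilOn_le measurableSet_Ioc hs hF.toIsReg hF.toIsReg).trans_eq ?_
  rw [Real.volume_Ioc]

theorem ySq_solSrc_zero : ySq 1 (solSrc κ F 0) = 0 := by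
  rw [← nonpos_iff_eq_zero]
  refine (hF.ySq_solSrc_le measurable_one zero_le_one).trans ?_
  rw [cutBil_eq_bilOn]
  refine (ySq_one_bilOn_le measurableSet_Icc (Icc_subset_Icc_right zero_le_one)
    hF.toIsReg hF.toIsReg).trans_eq ?_
  simp

end IsSol

/-- Smallness of the initial value propagates to the source. -/
theorem exists_ySq_solSrc_le : ∃ c₀ : NNReal, 0 < c₀ ∧ ∀ {κ F K σ}, IsSol κ F K σ →
    ∀ {e : ℝ≥0∞}, 0 < e → e ≤ c₀ → hSq 1 (F 0) ≤ e → ySq 1 (solSrc κ F σ) ≤ e := by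
  obtain ⟨C, hC⟩ := exists_ySq_cutBil_le
  refine ⟨(200 * (C + 1))⁻¹, by positivity, ?_⟩
  intro κ F K σ hF e he0 he hFe
  have het : e ≠ ⊤ := (he.trans_lt ENNReal.coe_lt_top).ne
  have hCe : 200 * C * e ≤ 1 := by
    calc 200 * (C : ℝ≥0∞) * e ≤ 200 * (C + 1) * ((200 * (C + 1))⁻¹ : NNReal) := by
          gcongr; exact le_self_add
      _ = 1 := by
        rw [show (200 * ((C : ℝ≥0∞) + 1)) = ((200 * (C + 1) : NNReal) : ℝ≥0∞) by push_cast; rfl]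
        rw [← ENNReal.coe_mul, mul_inv_cancel₀ (by positivity), ENNReal.coe_one]
  have boot : ∀ τ ∈ Icc (0 : ℝ) σ, ySq 1 (solSrc κ F τ) ≤ 4 * e → ySq 1 (solSrc κ F τ) ≤ e := by
    intro τ hτ h4
    have i := hF.isSrc (hτ.2.trans hF.le_one)
    refine (hF.ySq_solSrc_le measurable_one (hτ.2.trans hF.le_one)).trans ?_
    refine (hC (c := 1) measurable_one ENNReal.one_ne_top (fun _ => le_rfl) (by simp)
      hF.toIsReg hF.toIsReg i i ⟨hτ.1, hτ.2.trans hF.le_one⟩ (hF.prof_eq hτ.2) (hF.prof_eq hτ.2)).trans ?_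
    calc _ ≤ (C : ℝ≥0∞) * 1 ^ 2 * ((e + 4 * e) * (e + 4 * e) + (e + 4 * e) * (e + 4 * e)) := by
          gcongr
      _ = 50 * C * e * e := by ring
      _ ≤ 200 * C * e * e := by gcongr; norm_num
      _ ≤ 1 * e := by gcongr
      _ = e := one_mul e
  set V := 2 * (16 * wtMass 2 * (K * K)) with hV
  have hVt : V ≠ ⊤ := by
    have := hF.lt_top.ne
    have := (wtMass_lt_top (q := 2) (by norm_num)).ne
    finiteness
  obtain ⟨N, hN⟩ : ∃ N : ℕ, V * ENNReal.ofReal ((N : ℝ) + 1)⁻¹ ≤ 2 * e := by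
    have ht : Filter.Tendsto (fun N : ℕ => V * ENNReal.ofReal ((N : ℝ) + 1)⁻¹) Filter.atTop
        (nhds (V * ENNReal.ofReal 0)) := by
      refine ENNReal.Tendsto.const_mul (ENNReal.tendsto_ofReal ?_) (Or.inr hVt)
      simpa using tendsto_one_div_add_atTop_nhds_zero_nat (𝕜 := ℝ)
    rw [ENNReal.ofReal_zero, mul_zero] at ht
    have : 0 < 2 * e := by simpa using he0
    exact ((ht.eventually_lt_const this).exists).imp fun N h => h.le
  have step : ∀ k : ℕ, k ≤ N + 1 → ySq 1 (solSrc κ F (k * ((N : ℝ) + 1)⁻¹ * σ)) ≤ e := by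
    intro k
    induction k with
    | zero => intro _; simp [hF.ySq_solSrc_zero]
    | succ k ih =>
      intro hk
      have hk' : (k : ℝ) + 1 ≤ N + 1 := by exact_mod_cast hk
      have hp : (0 : ℝ) < (N : ℝ) + 1 := by positivity
      have h1 : ((k + 1 : ℕ) : ℝ) * ((N : ℝ) + 1)⁻¹ ≤ 1 := by
        push_cast
        rw [← div_eq_mul_inv, div_le_one hp]; exact hk'
      have hσ := hF.nonneg
      have h1' := mul_le_of_le_one_left hσ h1
      refine boot _ ⟨by positivity, h1'⟩ ?_
      have h2 : (k : ℝ) * ((N : ℝ) + 1)⁻¹ ≤ ((k + 1 : ℕ) : ℝ) * ((N : ℝ) + 1)⁻¹ := by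
        push_cast; gcongr; linarith
      refine (hF.ySq_increment (by positivity) (mul_le_mul_of_nonneg_right h2 hσ)
        (h1'.trans hF.le_one)).trans ?_
      have h3 : ((k + 1 : ℕ) : ℝ) * ((N : ℝ) + 1)⁻¹ - k * ((N : ℝ) + 1)⁻¹ = ((N : ℝ) + 1)⁻¹ := by
        push_cast; ring
      have h4 : ((k + 1 : ℕ) : ℝ) * ((N : ℝ) + 1)⁻¹ * σ - k * ((N : ℝ) + 1)⁻¹ * σ ≤
          ((N : ℝ) + 1)⁻¹ := by
        rw [← sub_mul, h3]
        exact mul_le_of_le_one_right (by positivity) hF.le_one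
      calc _ ≤ 2 * e + 2 * e := by
            refine add_le_add (mul_le_mul' le_rfl (ih (by omega))) ?_
            rw [← mul_assoc]
            exact (mul_le_mul' le_rfl (ENNReal.ofReal_le_ofReal h4)).trans hN
        _ = 4 * e := by ring
  have := step (N + 1) le_rfl
  have e1 : ((N + 1 : ℕ) : ℝ) * ((N : ℝ) + 1)⁻¹ = 1 := by
    push_cast; exact mul_inv_cancel₀ (by positivity)
  rwa [e1, one_mul] at this

theorem le_of_le_half_add {Y A : ℝ≥0∞} (hY : Y ≠ ⊤) (h : Y ≤ A + 2⁻¹ * Y) : Y ≤ 2 * A := by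
  have h2 : 2⁻¹ * Y ≠ ⊤ := by finiteness
  have : Y = 2⁻¹ * Y + 2⁻¹ * Y := by
    rw [← add_mul, ENNReal.inv_two_add_inv_two, one_mul]
  have h3 : 2⁻¹ * Y ≤ A := by
    exact (ENNReal.add_le_add_iff_right h2).1 (this.symm.trans_le h)
  calc Y = 2 * (2⁻¹ * Y) := by
        rw [← mul_assoc, ENNReal.mul_inv_cancel (by norm_num) (by norm_num), one_mul]
    _ ≤ _ := by gcongr

/-- Truncated polynomial weight. -/
def rTrunc (Λ : ℕ) (ξ : ℝ) : ℝ≥0∞ := min (wt (-(3 / 2)) ξ) Λ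

theorem rTrunc_add_le (Λ : ℕ) (x y : ℝ) : rTrunc Λ (x + y) ≤ 4 * (rTrunc Λ x + rTrunc Λ y) := by
  have h := wt_neg_le_add (q := 3 / 2) (by norm_num) (x + y) x
  rw [add_sub_cancel_left] at h
  have h4 : ENNReal.ofReal (2 ^ (3 / 2 : ℝ)) ≤ 4 := by
    rw [← ENNReal.ofReal_ofNat]
    apply ENNReal.ofReal_le_ofReal
    calc (2 : ℝ) ^ (3 / 2 : ℝ) ≤ 2 ^ (2 : ℝ) :=
          Real.rpow_le_rpow_of_exponent_le (by norm_num) (by norm_num)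
      _ = 4 := by norm_num
  unfold rTrunc
  rcases le_total (wt (-(3 / 2)) x) Λ with hx | hx
  · rcases le_total (wt (-(3 / 2)) y) Λ with hy | hy
    · rw [min_eq_left hx, min_eq_left hy]
      exact (min_le_left _ _).trans (h.trans (mul_le_mul' h4 le_rfl))
    · rw [min_eq_right hy]
      refine (min_le_right _ _).trans ?_
      calc (Λ : ℝ≥0∞) ≤ 1 * (min (wt (-(3 / 2)) x) Λ + Λ) := by rw [one_mul]; exact le_add_self
        _ ≤ _ := by gcongr; norm_num
  · rw [min_eq_right hx]
    refine (min_le_right _ _).trans ?_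
    calc (Λ : ℝ≥0∞) ≤ 1 * (Λ + min (wt (-(3 / 2)) y) Λ) := by rw [one_mul]; exact le_self_add
      _ ≤ _ := by gcongr; norm_num

@[fun_prop]
theorem measurable_rTrunc (Λ : ℕ) : Measurable (rTrunc Λ) := by unfold rTrunc; fun_prop

theorem iw_inv_le (ξ : ℝ) : (iw ξ)⁻¹ ≤ |ξ| ^ (-(1 / 2) : ℝ) := by
  rcases eq_or_ne ξ 0 with rfl | h
  · simp [iw]
  rw [Real.rpow_neg (abs_nonneg ξ)]
  refine inv_anti₀ (Real.rpow_pos_of_pos (abs_pos.2 h) _) ?_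
  exact le_mul_of_one_le_right (by positivity) (Real.one_le_rpow (one_le_mm h) (by norm_num))

theorem hSq_rTrunc_le (Λ : ℕ) {h : ℝ → ℂ} (hh : Measurable h) :
    hSq (rTrunc Λ) h ≤ 8 * (hSq 1 h + wSq h) := by
  unfold hSq wSq
  rw [← lintegral_add_left (by fun_prop), ← lintegral_const_mul _ (by fun_prop)]
  refine lintegral_mono fun ξ => ?_
  have key : (wt (-(3 / 2)) ξ * ENNReal.ofReal (iw ξ)⁻¹) ^ 2 ≤
      8 * ((1 * ENNReal.ofReal (iw ξ)⁻¹) ^ 2 + wt (-1) ξ ^ 2) := by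
    unfold wt
    simp only [neg_neg, one_mul, Real.rpow_one]
    have i0 := inv_nonneg.2 (iw_nonneg ξ)
    rw [← ENNReal.ofReal_mul (by positivity), ← ENNReal.ofReal_pow (by positivity),
      ← ENNReal.ofReal_pow (by positivity), ← ENNReal.ofReal_pow (by positivity),
      ← ENNReal.ofReal_add (by positivity) (by positivity), ← ENNReal.ofReal_ofNat,
      ← ENNReal.ofReal_mul (by norm_num)]
    apply ENNReal.ofReal_le_ofReal
    have e : ((1 + |ξ|) ^ (3 / 2 : ℝ)) ^ 2 = (1 + |ξ|) ^ 3 := by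
      rw [← Real.rpow_natCast, ← Real.rpow_mul (by positivity), ← Real.rpow_natCast]
      norm_num
    rw [mul_pow, e]
    rcases le_total |ξ| 1 with h1 | h1
    · have : (1 + |ξ|) ^ 3 ≤ 8 := by
        calc (1 + |ξ|) ^ 3 ≤ (1 + 1) ^ 3 := by gcongr
          _ = 8 := by norm_num
      nlinarith [mul_le_mul_of_nonneg_right this (sq_nonneg (iw ξ)⁻¹), sq_nonneg (1 + |ξ|)]
    · have h2 : ((iw ξ)⁻¹) ^ 2 ≤ |ξ|⁻¹ := by
        calc ((iw ξ)⁻¹) ^ 2 ≤ (|ξ| ^ (-(1 / 2) : ℝ)) ^ 2 := by gcongr; exact iw_inv_le ξ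
          _ = |ξ|⁻¹ := by
            rw [← Real.rpow_natCast, ← Real.rpow_mul (abs_nonneg ξ), ← Real.rpow_neg_one]; norm_num
      have h0 : 0 < |ξ| := by linarith
      calc (1 + |ξ|) ^ 3 * ((iw ξ)⁻¹) ^ 2 ≤ (1 + |ξ|) ^ 3 * |ξ|⁻¹ := by gcongr
        _ = (1 + |ξ|) ^ 2 * ((1 + |ξ|) * |ξ|⁻¹) := by ring
        _ ≤ (1 + |ξ|) ^ 2 * 2 := by
          gcongr
          rw [← div_eq_mul_inv, div_le_iff₀ h0]; linarith
        _ ≤ _ := by nlinarith [sq_nonneg (iw ξ)⁻¹, sq_nonneg (1 + |ξ|)]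
  calc (rTrunc Λ ξ * ENNReal.ofReal (iw ξ)⁻¹ * ‖h ξ‖ₑ) ^ 2 ≤
        (wt (-(3 / 2)) ξ * ENNReal.ofReal (iw ξ)⁻¹ * ‖h ξ‖ₑ) ^ 2 := by
        gcongr; exact min_le_left _ _
    _ = (wt (-(3 / 2)) ξ * ENNReal.ofReal (iw ξ)⁻¹) ^ 2 * ‖h ξ‖ₑ ^ 2 := mul_pow _ _ _
    _ ≤ 8 * ((1 * ENNReal.ofReal (iw ξ)⁻¹) ^ 2 + wt (-1) ξ ^ 2) * ‖h ξ‖ₑ ^ 2 := by gcongr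
    _ = _ := by simp only [Pi.one_apply, mul_pow]; ring

theorem tendsto_lintegral_rTrunc {w : ℝ → ℝ≥0∞} (hw : Measurable w) :
    Filter.Tendsto (fun Λ : ℕ => ∫⁻ ξ, (rTrunc Λ ξ * w ξ) ^ 2) Filter.atTop
      (nhds (∫⁻ ξ, (wt (-(3 / 2)) ξ * w ξ) ^ 2)) := by
  refine lintegral_tendsto_of_tendsto_of_monotone (fun Λ => by fun_prop)
    (Filter.Eventually.of_forall fun ξ Λ Λ' h => ?_) (Filter.Eventually.of_forall fun ξ => ?_)
  · have : rTrunc Λ ξ ≤ rTrunc Λ' ξ := min_le_min le_rfl (by exact_mod_cast h)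
    dsimp only
    gcongr
  · obtain ⟨n, hn⟩ := ENNReal.exists_nat_gt (wt_ne_top (-(3 / 2)) ξ)
    refine tendsto_const_nhds.congr' ?_
    filter_upwards [Filter.eventually_ge_atTop n] with m hm
    rw [rTrunc, min_eq_left (hn.le.trans (by exact_mod_cast hm))]

/-- Persistence of regularity for solutions with small initial value. -/
theorem exists_wSq_le : ∃ C c₀ : NNReal, 0 < c₀ ∧ ∀ {κ F K σ}, IsSol κ F K σ →
    hSq 1 (F 0) ≤ c₀ → ∀ t ∈ Icc (0 : ℝ) σ, wSq (F t) ≤ C * (hSq 1 (F 0) + wSq (F 0)) := by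
  obtain ⟨B, hB⟩ := exists_ySq_cutBil_le
  obtain ⟨b, hb0, hb⟩ := exists_ySq_solSrc_le
  obtain ⟨D, hD⟩ := exists_lintegral_source_le
  set c₀ : NNReal := min b (128 * (B + 1))⁻¹ with hc₀
  have hc0 : 0 < c₀ := lt_min hb0 (by positivity)
  have hBc : 64 * (B : ℝ≥0∞) * c₀ ≤ 2⁻¹ := by
    have h1 : 64 * B * c₀ ≤ 2⁻¹ := by
      calc 64 * B * c₀ ≤ 64 * (B + 1) * (128 * (B + 1))⁻¹ := by
            gcongr
            · exact le_self_add
            · exact min_le_right _ _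
        _ = 2⁻¹ := by
          rw [mul_inv, show (128 : NNReal) = 64 * 2 by norm_num, mul_inv]
          have : (B + 1) ≠ 0 := by positivity
          field_simp
    have := ENNReal.coe_le_coe.2 h1
    push_cast at this
    exact this
  refine ⟨16 * D + 2, c₀, hc0, ?_⟩
  intro κ F K σ hF hsm t ht
  have i := hF.isSrc hF.le_one
  have h01 : σ ∈ Icc (0 : ℝ) 1 := ⟨hF.nonneg, hF.le_one⟩
  have mF := hF.measurable_slice 0
  have hy : ySq 1 (solSrc κ F σ) ≤ c₀ := hb hF (by exact_mod_cast hc0)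
    (by exact_mod_cast min_le_left _ _) hsm
  have hyr : ∀ Λ, ySq (rTrunc Λ) (solSrc κ F σ) ≤ hSq (rTrunc Λ) (F 0) := by
    intro Λ
    have fin := (i.ySq_lt_top (r := rTrunc Λ) (R := Λ) (fun x => min_le_right _ _)
      (ENNReal.natCast_ne_top Λ)).ne
    have h1 := (hF.ySq_solSrc_le (measurable_rTrunc Λ) hF.le_one).trans
      (hB (measurable_rTrunc Λ) (ENNReal.natCast_ne_top Λ) (fun x => min_le_right _ _)
      (rTrunc_add_le Λ) hF.toIsReg hF.toIsReg i i h01 (hF.prof_eq le_rfl) (hF.prof_eq le_rfl))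
    set Y := ySq (rTrunc Λ) (solSrc κ F σ)
    set H := hSq (rTrunc Λ) (F 0)
    have h2 : Y ≤ 2⁻¹ * H + 2⁻¹ * Y := by
      calc Y ≤ B * 4 ^ 2 * ((H + Y) * (c₀ + c₀) + (c₀ + c₀) * (H + Y)) := by
            refine h1.trans ?_
            gcongr
        _ = 64 * B * c₀ * (H + Y) := by ring
        _ ≤ 2⁻¹ * (H + Y) := by gcongr
        _ = _ := mul_add _ _ _
    refine (le_of_le_half_add fin h2).trans_eq ?_
    rw [← mul_assoc, ENNReal.mul_inv_cancel (by norm_num) (by norm_num), one_mul]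
  set E := 8 * (hSq 1 (F 0) + wSq (F 0)) with hE
  set S : ℝ → ℂ := fun ξ => ∫ s in Iic t, solSrc κ F σ s ξ with hS
  have mS : Measurable S := i.measurable_integral_Iic t
  have hΛ : ∀ Λ : ℕ, ∫⁻ ξ, (rTrunc Λ ξ * ENNReal.ofReal (|ξ| ^ (1 / 2 : ℝ)) * ‖S ξ‖ₑ) ^ 2 ≤
      D * E := fun Λ => (hD (measurable_rTrunc Λ) i t ⟨ht.1, ht.2.trans hF.le_one⟩).trans
    (mul_le_mul' le_rfl ((hyr Λ).trans (hSq_rTrunc_le Λ mF)))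
  have hlim : ∫⁻ ξ, (wt (-(3 / 2)) ξ * (ENNReal.ofReal (|ξ| ^ (1 / 2 : ℝ)) * ‖S ξ‖ₑ)) ^ 2 ≤
      D * E := by
    exact le_of_tendsto' (tendsto_lintegral_rTrunc
      (w := fun ξ => ENNReal.ofReal (|ξ| ^ (1 / 2 : ℝ)) * ‖S ξ‖ₑ) (by fun_prop)) fun Λ =>
      le_of_eq_of_le (by simp_rw [mul_assoc]) (hΛ Λ)
  have hpt : ∀ ξ, (wt (-1) ξ * ‖F t ξ‖ₑ) ^ 2 ≤ 2 * (wt (-1) ξ * ‖F 0 ξ‖ₑ) ^ 2 +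
      2 * (wt (-(3 / 2)) ξ * (ENNReal.ofReal (|ξ| ^ (1 / 2 : ℝ)) * ‖S ξ‖ₑ)) ^ 2 := by
    intro ξ
    refine le_trans ?_ (add_sq_le_two_mul _ _)
    have e : F t ξ = F 0 ξ + ξ * S ξ := by
      rw [← congrFun (hF.prof_eq le_rfl t ht) ξ]; rfl
    have hw : wt (-1) ξ * ‖(ξ : ℂ)‖ₑ ≤ wt (-(3 / 2)) ξ * ENNReal.ofReal (|ξ| ^ (1 / 2 : ℝ)) := by
      unfold wt
      rw [← ofReal_norm, ← ENNReal.ofReal_mul (by positivity), ← ENNReal.ofReal_mul (by positivity)]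
      apply ENNReal.ofReal_le_ofReal
      simp only [neg_neg, Real.rpow_one, Complex.norm_real, Real.norm_eq_abs]
      have e1 : |ξ| = |ξ| ^ (1 / 2 : ℝ) * |ξ| ^ (1 / 2 : ℝ) := by
        rw [← _root_.sq, ← Real.rpow_natCast, ← Real.rpow_mul (abs_nonneg ξ)]; norm_num
      have e2 : (1 + |ξ|) ^ (3 / 2 : ℝ) = (1 + |ξ|) * (1 + |ξ|) ^ (1 / 2 : ℝ) := by
        rw [← Real.rpow_one_add' (by positivity) (by norm_num)]; norm_num
      rw [e2]
      nth_rw 2 [e1]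
      rw [mul_assoc]
      gcongr
      linarith
    gcongr
    calc _ ≤ wt (-1) ξ * (‖F 0 ξ‖ₑ + ‖(ξ : ℂ)‖ₑ * ‖S ξ‖ₑ) := by
          rw [e, ← enorm_mul]; gcongr; exact enorm_add_le _ _
      _ = wt (-1) ξ * ‖F 0 ξ‖ₑ + wt (-1) ξ * ‖(ξ : ℂ)‖ₑ * ‖S ξ‖ₑ := by ring
      _ ≤ wt (-1) ξ * ‖F 0 ξ‖ₑ +
          wt (-(3 / 2)) ξ * ENNReal.ofReal (|ξ| ^ (1 / 2 : ℝ)) * ‖S ξ‖ₑ := by gcongr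
      _ = _ := by rw [mul_assoc (wt (-(3 / 2)) ξ)]
  calc wSq (F t) ≤ 2 * wSq (F 0) + 2 * (D * E) := by
        refine (lintegral_mono hpt).trans ?_
        rw [lintegral_add_left (by fun_prop), lintegral_const_mul _ (by fun_prop),
          lintegral_const_mul _ (by fun_prop)]
        exact add_le_add le_rfl (mul_le_mul' le_rfl hlim)
    _ = 16 * D * (hSq 1 (F 0) + wSq (F 0)) + 2 * wSq (F 0) := by rw [hE]; ring
    _ ≤ 16 * D * (hSq 1 (F 0) + wSq (F 0)) + 2 * (hSq 1 (F 0) + wSq (F 0)) := by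
      gcongr; exact le_add_self
    _ = _ := by push_cast; ring

theorem integrable_bil {f g : ℝ → ℝ → ℂ} {s : ℝ} (hf : Measurable (f s)) (hg : Measurable (g s))
    (hf2 : wSq (f s) < ⊤) (hg2 : wSq (g s) < ⊤) (ξ : ℝ) : Integrable fun η =>
    Complex.exp ((-2 * π * s * (3 * ξ * η * (ξ - η)) : ℝ) * Complex.I) * (f s η * g s (ξ - η)) := by
  refine integrable_phase_mul (φ := fun η => -2 * π * s * (3 * ξ * η * (ξ - η))) ⟨by fun_prop, ?_⟩
    (by fun_prop)
  have h1 := lintegral_mul_sq_le (μ := volume) (f := fun η => ‖f s η‖ₑ)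
    (g := fun η => ‖g s (ξ - η)‖ₑ) (by fun_prop) (by fun_prop)
  rw [lintegral_comp_const_sub (fun η => ‖g s η‖ₑ ^ 2) ξ] at h1
  have h2 : (∫⁻ η, ‖f s η‖ₑ * ‖g s (ξ - η)‖ₑ) ^ 2 < ⊤ :=
    h1.trans_lt (ENNReal.mul_lt_top ((lintegral_sq_le_wSq _).trans_lt hf2)
      ((lintegral_sq_le_wSq _).trans_lt hg2))
  rw [hasFiniteIntegral_iff_enorm]
  simp_rw [enorm_mul]
  exact (ENNReal.pow_lt_top_iff.1 h2).resolve_right (by norm_num)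

theorem bil_sub_bil {F₁ F₂ : ℝ → ℝ → ℂ} {s : ℝ} (h₁ : Measurable (F₁ s)) (h₂ : Measurable (F₂ s))
    (hw₁ : wSq (F₁ s) < ⊤) (hw₂ : wSq (F₂ s) < ⊤) (ξ : ℝ) :
    bil F₁ F₁ s ξ - bil F₂ F₂ s ξ = bil F₁ (fun t ξ => F₁ t ξ - F₂ t ξ) s ξ +
      bil (fun t ξ => F₁ t ξ - F₂ t ξ) F₂ s ξ := by
  have e1 : bil F₁ (fun t ξ => F₁ t ξ - F₂ t ξ) s ξ = bil F₁ F₁ s ξ - bil F₁ F₂ s ξ := by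
    unfold bil
    rw [← integral_sub (integrable_bil h₁ h₁ hw₁ hw₁ ξ) (integrable_bil h₁ h₂ hw₁ hw₂ ξ)]
    congr 1; ext η; ring
  have e2 : bil (fun t ξ => F₁ t ξ - F₂ t ξ) F₂ s ξ = bil F₁ F₂ s ξ - bil F₂ F₂ s ξ := by
    unfold bil
    rw [← integral_sub (integrable_bil h₁ h₂ hw₁ hw₂ ξ) (integrable_bil h₂ h₂ hw₂ hw₂ ξ)]
    congr 1; ext η; ring
  rw [e1, e2]; ring

theorem wSq_sub_le {f g : ℝ → ℂ} (hf : Measurable f) :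
    wSq (fun ξ => f ξ - g ξ) ≤ 2 * wSq f + 2 * wSq g := by
  unfold wSq
  rw [← lintegral_const_mul _ (by fun_prop), ← lintegral_const_mul' _ _ (by norm_num),
    ← lintegral_add_left (by fun_prop)]
  refine lintegral_mono fun ξ => ?_
  refine le_trans ?_ (add_sq_le_two_mul _ _)
  rw [← mul_add]
  gcongr
  exact enorm_sub_le

theorem IsReg.sub {f g : ℝ → ℝ → ℂ} {K L : ℝ≥0∞} (hf : IsReg f K) (hg : IsReg g L) :
    IsReg (fun t ξ => f t ξ - g t ξ) (2 * K + 2 * L) := by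
  have := hf.lt_top.ne
  have := hg.lt_top.ne
  refine ⟨hf.meas.sub hg.meas, by finiteness, fun t ht => ?_⟩
  refine (wSq_sub_le (hf.measurable_slice t)).trans ?_
  gcongr
  · exact hf.le t ht
  · exact hg.le t ht

theorem hSq_one_le (h : ℝ → ℂ) :
    hSq 1 h ≤ ∫⁻ ξ, (ENNReal.ofReal (|ξ| ^ (-(1 / 2) : ℝ)) * ‖h ξ‖ₑ) ^ 2 := by
  unfold hSq
  refine lintegral_mono fun ξ => ?_
  simp only [Pi.one_apply, one_mul]
  gcongr
  exact iw_inv_le ξ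

/-- The source of the difference of two solutions. -/
def diffSrc (κ₁ κ₂ : ℝ) (F₁ F₂ : ℝ → ℝ → ℂ) (s ξ : ℝ) : ℂ :=
  (Complex.I * κ₁ * cutBil 1 F₁ (fun t ξ => F₁ t ξ - F₂ t ξ) s ξ +
    Complex.I * κ₁ * cutBil 1 (fun t ξ => F₁ t ξ - F₂ t ξ) F₂ s ξ) +
    Complex.I * (κ₁ - κ₂ : ℝ) * cutBil 1 F₂ F₂ s ξ

theorem prof_diffSrc {κ₁ κ₂ F₁ F₂ K₁ K₂} (hF₁ : IsSol κ₁ F₁ K₁ 1) (hF₂ : IsSol κ₂ F₂ K₂ 1) :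
    ∀ s ∈ Icc (0 : ℝ) 1, prof (fun ξ => F₁ 0 ξ - F₂ 0 ξ) (diffSrc κ₁ κ₂ F₁ F₂) s =
      fun ξ => F₁ s ξ - F₂ s ξ := by
  have key : diffSrc κ₁ κ₂ F₁ F₂ = fun s ξ => solSrc κ₁ F₁ 1 s ξ - solSrc κ₂ F₂ 1 s ξ := by
    ext s ξ
    unfold diffSrc solSrc cutBil
    by_cases hs : s ∈ Icc (0 : ℝ) 1
    · simp only [hs, indicator_of_mem]
      have := bil_sub_bil (hF₁.measurable_slice s) (hF₂.measurable_slice s)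
        ((hF₁.le s hs).trans_lt hF₁.lt_top) ((hF₂.le s hs).trans_lt hF₂.lt_top) ξ
      rw [← mul_add, ← this]
      push_cast
      ring
    · simp [hs]
  intro s hs
  ext ξ
  have e1 := congrFun (hF₁.prof_eq le_rfl s hs) ξ
  have e2 := congrFun (hF₂.prof_eq le_rfl s hs) ξ
  rw [← e1, ← e2, key]
  unfold prof
  rw [integral_sub ((hF₁.isSrc le_rfl).integrable_source ξ).integrableOn
    ((hF₂.isSrc le_rfl).integrable_source ξ).integrableOn]
  ring

/-- Lipschitz dependence of solutions on initial value and coupling. -/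
theorem exists_lintegral_sub_sq_le : ∃ C c₀ : NNReal, 0 < c₀ ∧ ∀ {κ₁ κ₂ F₁ F₂ K₁ K₂},
    IsSol κ₁ F₁ K₁ 1 → IsSol κ₂ F₂ K₂ 1 → ∀ {e : ℝ≥0∞}, 0 < e → e ≤ c₀ →
    hSq 1 (F₁ 0) ≤ e → hSq 1 (F₂ 0) ≤ e →
    ∫⁻ ξ, (ENNReal.ofReal (|ξ| ^ (-(1 / 2) : ℝ)) * ‖F₁ 1 ξ - F₂ 1 ξ‖ₑ) ^ 2 ≤
      C * ((∫⁻ ξ, (ENNReal.ofReal (|ξ| ^ (-(1 / 2) : ℝ)) * ‖F₁ 0 ξ - F₂ 0 ξ‖ₑ) ^ 2) +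
        (ENNReal.ofReal |κ₁ - κ₂| * e) ^ 2) := by
  obtain ⟨B, hB⟩ := exists_ySq_cutBil_le
  obtain ⟨b, hb0, hb⟩ := exists_ySq_solSrc_le
  obtain ⟨D, hD⟩ := exists_lintegral_source_le
  set c₀ : NNReal := min b (64 * (B + 1))⁻¹ with hc₀
  have hc0 : 0 < c₀ := lt_min hb0 (by positivity)
  have hBc : 32 * (B : ℝ≥0∞) * c₀ ≤ 2⁻¹ := by
    have h1 : 32 * B * c₀ ≤ 2⁻¹ := by
      calc 32 * B * c₀ ≤ 32 * (B + 1) * (64 * (B + 1))⁻¹ := by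
            gcongr
            · exact le_self_add
            · exact min_le_right _ _
        _ = 2⁻¹ := by
          rw [mul_inv, show (64 : NNReal) = 32 * 2 by norm_num, mul_inv]
          have : (B + 1) ≠ 0 := by positivity
          field_simp
    have := ENNReal.coe_le_coe.2 h1
    push_cast at this
    exact this
  refine ⟨2 + 4 * D + 64 * D * B, c₀, hc0, ?_⟩
  intro κ₁ κ₂ F₁ F₂ K₁ K₂ hF₁ hF₂ e he0 he h1 h2
  set d : ℝ → ℝ → ℂ := fun t ξ => F₁ t ξ - F₂ t ξ with hd
  have rd := hF₁.toIsReg.sub hF₂.toIsReg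
  have p := prof_diffSrc hF₁ hF₂
  have h01 : (1 : ℝ) ∈ Icc (0 : ℝ) 1 := ⟨zero_le_one, le_rfl⟩
  have i₁ := hF₁.isSrc le_rfl
  have i₂ := hF₂.isSrc le_rfl
  have hbe : e ≤ b := he.trans (by exact_mod_cast min_le_left _ _)
  have y₁ : ySq 1 (solSrc κ₁ F₁ 1) ≤ e := hb hF₁ he0 hbe h1
  have y₂ : ySq 1 (solSrc κ₂ F₂ 1) ≤ e := hb hF₂ he0 hbe h2
  have s₁ := isSrc_cutBil hF₁.toIsReg rd le_rfl
  have s₂ := isSrc_cutBil rd hF₂.toIsReg le_rfl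
  have s₃ := isSrc_cutBil hF₂.toIsReg hF₂.toIsReg le_rfl
  have i : IsSrc (diffSrc κ₁ κ₂ F₁ F₂) :=
    ((s₁.const_mul _).add (s₂.const_mul _)).add (s₃.const_mul _)
  set Y := ySq 1 (diffSrc κ₁ κ₂ F₁ F₂) with hY
  set H := hSq 1 (d 0) with hH
  have b₁ : ySq 1 (cutBil 1 F₁ d) ≤ 4 * B * e * (H + Y) := by
    refine (hB (c := 1) measurable_one ENNReal.one_ne_top (fun _ => le_rfl) (by simp)
      hF₁.toIsReg rd i₁ i h01 (hF₁.prof_eq le_rfl) p).trans ?_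
    calc _ ≤ (B : ℝ≥0∞) * 1 ^ 2 * ((e + e) * (H + Y) + (e + e) * (H + Y)) := by gcongr
      _ = _ := by ring
  have b₂ : ySq 1 (cutBil 1 d F₂) ≤ 4 * B * e * (H + Y) := by
    refine (hB (c := 1) measurable_one ENNReal.one_ne_top (fun _ => le_rfl) (by simp)
      rd hF₂.toIsReg i i₂ h01 p (hF₂.prof_eq le_rfl)).trans ?_
    calc _ ≤ (B : ℝ≥0∞) * 1 ^ 2 * ((H + Y) * (e + e) + (H + Y) * (e + e)) := by gcongr
      _ = _ := by ring
  have b₃ : ySq 1 (cutBil 1 F₂ F₂) ≤ 8 * B * e ^ 2 := by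
    refine (hB (c := 1) measurable_one ENNReal.one_ne_top (fun _ => le_rfl) (by simp)
      hF₂.toIsReg hF₂.toIsReg i₂ i₂ h01 (hF₂.prof_eq le_rfl) (hF₂.prof_eq le_rfl)).trans ?_
    calc _ ≤ (B : ℝ≥0∞) * 1 ^ 2 * ((e + e) * (e + e) + (e + e) * (e + e)) := by gcongr
      _ = _ := by ring
  have hk1 := pow_le_pow_left' hF₁.enorm_kappa_le 2
  rw [one_pow] at hk1
  have hk3 : ‖(Complex.I * (κ₁ - κ₂ : ℝ) : ℂ)‖ₑ = ENNReal.ofReal |κ₁ - κ₂| := by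
    rw [← ofReal_norm]
    congr 1
    rw [norm_mul, Complex.norm_I, one_mul, Complex.norm_real, Real.norm_eq_abs]
  have hYle : Y ≤ (2⁻¹ * H + 16 * B * (ENNReal.ofReal |κ₁ - κ₂| * e) ^ 2) + 2⁻¹ * Y := by
    calc Y ≤ 2 * (2 * ySq 1 (cutBil 1 F₁ d) + 2 * ySq 1 (cutBil 1 d F₂)) +
          2 * (ENNReal.ofReal |κ₁ - κ₂| ^ 2 * ySq 1 (cutBil 1 F₂ F₂)) := by
          refine (((s₁.const_mul _).add (s₂.const_mul _)).ySq_add_le (s₃.const_mul _)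
            measurable_one).trans ?_
          refine add_le_add (mul_le_mul' le_rfl ?_) (mul_le_mul' le_rfl ?_)
          · refine ((s₁.const_mul _).ySq_add_le (s₂.const_mul _) measurable_one).trans ?_
            rw [ySq_const_mul s₁ measurable_one, ySq_const_mul s₂ measurable_one]
            exact add_le_add
              (mul_le_mul' le_rfl ((mul_le_mul' hk1 le_rfl).trans_eq (one_mul _)))
              (mul_le_mul' le_rfl ((mul_le_mul' hk1 le_rfl).trans_eq (one_mul _)))
          · rw [ySq_const_mul s₃ measurable_one, hk3]
      _ ≤ 2 * (2 * (4 * B * e * (H + Y)) + 2 * (4 * B * e * (H + Y))) +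
          2 * (ENNReal.ofReal |κ₁ - κ₂| ^ 2 * (8 * B * e ^ 2)) :=
        add_le_add (mul_le_mul' le_rfl (add_le_add (mul_le_mul' le_rfl b₁) (mul_le_mul' le_rfl b₂)))
          (mul_le_mul' le_rfl (mul_le_mul' le_rfl b₃))
      _ = 32 * B * e * (H + Y) + 16 * B * (ENNReal.ofReal |κ₁ - κ₂| * e) ^ 2 := by ring
      _ ≤ 2⁻¹ * (H + Y) + 16 * B * (ENNReal.ofReal |κ₁ - κ₂| * e) ^ 2 := by
        gcongr
        exact (mul_le_mul' le_rfl he).trans hBc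
      _ = _ := by ring
  have fin : Y ≠ ⊤ := (i.ySq_lt_top (r := 1) (R := 1) (fun _ => le_rfl) ENNReal.one_ne_top).ne
  have hY2 : Y ≤ H + 32 * B * (ENNReal.ofReal |κ₁ - κ₂| * e) ^ 2 := by
    refine (le_of_le_half_add fin hYle).trans_eq ?_
    rw [mul_add, ← mul_assoc 2 2⁻¹, ENNReal.mul_inv_cancel (by norm_num) (by norm_num), one_mul]
    ring
  set J := ∫⁻ ξ, (ENNReal.ofReal (|ξ| ^ (-(1 / 2) : ℝ)) * ‖F₁ 0 ξ - F₂ 0 ξ‖ₑ) ^ 2 with hJ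
  have hHJ : H ≤ J := hSq_one_le (d 0)
  set S : ℝ → ℂ := fun ξ => ∫ s in Iic 1, diffSrc κ₁ κ₂ F₁ F₂ s ξ with hS
  have mS : Measurable S := i.measurable_integral_Iic 1
  have hsup : ∫⁻ ξ, (ENNReal.ofReal (|ξ| ^ (1 / 2 : ℝ)) * ‖S ξ‖ₑ) ^ 2 ≤ D * Y := by
    have := hD measurable_one i 1 h01
    simpa only [Pi.one_apply, one_mul] using this
  have md := rd.measurable_slice 0
  have hpt : ∀ ξ, (ENNReal.ofReal (|ξ| ^ (-(1 / 2) : ℝ)) * ‖F₁ 1 ξ - F₂ 1 ξ‖ₑ) ^ 2 ≤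
      2 * (ENNReal.ofReal (|ξ| ^ (-(1 / 2) : ℝ)) * ‖d 0 ξ‖ₑ) ^ 2 +
      2 * (ENNReal.ofReal (|ξ| ^ (1 / 2 : ℝ)) * ‖S ξ‖ₑ) ^ 2 := by
    intro ξ
    refine le_trans ?_ (add_sq_le_two_mul _ _)
    have e1 : F₁ 1 ξ - F₂ 1 ξ = d 0 ξ + ξ * S ξ := (congrFun (p 1 h01) ξ).symm
    have e2 : ENNReal.ofReal (|ξ| ^ (-(1 / 2) : ℝ)) * ‖(ξ : ℂ)‖ₑ ≤
        ENNReal.ofReal (|ξ| ^ (1 / 2 : ℝ)) := by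
      rw [← ofReal_norm, ← ENNReal.ofReal_mul (by positivity), Complex.norm_real, Real.norm_eq_abs]
      apply ENNReal.ofReal_le_ofReal
      rcases eq_or_ne ξ 0 with rfl | h
      · simp
      · rw [← Real.rpow_add_one (abs_pos.2 h).ne']; norm_num
    gcongr
    rw [e1]
    calc _ ≤ ENNReal.ofReal (|ξ| ^ (-(1 / 2) : ℝ)) * (‖d 0 ξ‖ₑ + ‖(ξ : ℂ)‖ₑ * ‖S ξ‖ₑ) := by
          rw [← enorm_mul]; gcongr; exact enorm_add_le _ _
      _ = ENNReal.ofReal (|ξ| ^ (-(1 / 2) : ℝ)) * ‖d 0 ξ‖ₑ +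
          ENNReal.ofReal (|ξ| ^ (-(1 / 2) : ℝ)) * ‖(ξ : ℂ)‖ₑ * ‖S ξ‖ₑ := by ring
      _ ≤ _ := by gcongr
  refine (lintegral_mono hpt).trans ?_
  rw [lintegral_add_left (by fun_prop), lintegral_const_mul _ (by fun_prop),
    lintegral_const_mul _ (by fun_prop)]
  set k := (ENNReal.ofReal |κ₁ - κ₂| * e) ^ 2
  calc _ ≤ 2 * J + 2 * (D * (J + 32 * B * k)) := by
        refine add_le_add le_rfl (mul_le_mul' le_rfl (hsup.trans (mul_le_mul' le_rfl ?_)))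
        exact hY2.trans (add_le_add hHJ le_rfl)
    _ = (2 + 2 * D) * J + 64 * D * B * k := by ring
    _ ≤ (2 + 4 * D + 64 * D * B) * J + (2 + 4 * D + 64 * D * B) * k := by
      have a1 : (2 + 2 * D : ℝ≥0∞) ≤ 2 + 4 * D + 64 * D * B := by
        calc (2 + 2 * D : ℝ≥0∞) ≤ 2 + 4 * D := by gcongr; norm_num
          _ ≤ _ := le_self_add
      exact add_le_add (mul_le_mul' a1 le_rfl) (mul_le_mul' le_add_self le_rfl)
    _ = _ := by push_cast; ring

/-- A Schwartz-valued KdV evolution on `[0, T]`, frozen outside this interval. -/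
structure IsFlow (T : ℝ) (v : ℝ → 𝓢(ℝ, ℝ)) : Prop where
  pos : 0 < T
  cont : ∀ n : ℕ, Continuous fun p : ℝ × ℝ => iteratedDeriv n (v p.1) p.2
  evol : ∀ t ∈ Ioo 0 T, ∀ x, HasDerivAt (fun s => v s x)
    (-iteratedDeriv 3 (v t) x + 6 * v t x * deriv (v t) x) t
  left : ∀ t ≤ 0, v t = v 0
  right : ∀ t, T ≤ t → v t = v T

theorem exists_contDiffOn_iteratedDeriv {T : ℝ} (hT : 0 < T) {f : ℝ × ℝ → ℝ}
    (hf : ContDiffOn ℝ (⊤ : ℕ∞) f (Icc 0 T ×ˢ univ)) (n : ℕ) :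
    ∃ g : ℝ × ℝ → ℝ, ContDiffOn ℝ (⊤ : ℕ∞) g (Icc 0 T ×ˢ univ) ∧
      ∀ t ∈ Icc 0 T, iteratedDeriv n (fun x => f (t, x)) = fun x => g (t, x) := by
  have hu : UniqueDiffOn ℝ (Icc 0 T ×ˢ (univ : Set ℝ)) :=
    (uniqueDiffOn_Icc hT).prod uniqueDiffOn_univ
  induction n with
  | zero => exact ⟨f, hf, fun t _ => by simp⟩
  | succ n ih =>
    obtain ⟨g, hg, hge⟩ := ih
    refine ⟨fun p => fderivWithin ℝ g (Icc 0 T ×ˢ univ) p (0, 1),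
      (hg.fderivWithin hu (m := (⊤ : ℕ∞)) (by simp)).clm_apply contDiffOn_const, ?_⟩
    intro t ht
    ext x
    rw [iteratedDeriv_succ, hge t ht]
    have h1 : HasFDerivWithinAt g (fderivWithin ℝ g (Icc 0 T ×ˢ univ) (t, x))
        (Icc 0 T ×ˢ univ) (t, x) :=
      (hg.differentiableOn (by simp) (t, x) ⟨ht, mem_univ _⟩).hasFDerivWithinAt
    have h2 : HasDerivAt (fun y : ℝ => (t, y)) ((0 : ℝ), (1 : ℝ)) x :=
      (hasDerivAt_const x t).prodMk (hasDerivAt_id x)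
    exact (h1.comp_hasDerivAt x h2 (Filter.Eventually.of_forall fun y => ⟨ht, mem_univ _⟩)).deriv

theorem exists_isFlow {T : ℝ} (hT : 0 < T) {u : ℝ → ℝ → ℝ} (hu : IsKdVOn (Icc 0 T) u) :
    ∃ v : ℝ → 𝓢(ℝ, ℝ), IsFlow T v ∧ ∀ t ∈ Icc 0 T, ∀ x, u t x = v t x := by
  obtain ⟨h1, h2, h3⟩ := hu
  choose! f hf using h2
  set π₀ : ℝ → ℝ := fun t => projIcc 0 T hT.le t with hπ
  have hπm : ∀ t, π₀ t ∈ Icc 0 T := fun t => (projIcc 0 T hT.le t).2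
  have hπe : ∀ t ∈ Icc 0 T, π₀ t = t := fun t ht => by simp [hπ, projIcc_of_mem hT.le ht]
  have hfe : ∀ t ∈ Icc 0 T, (f t : ℝ → ℝ) = u t := fun t ht => funext fun x => (hf t ht x).symm
  refine ⟨fun t => f (π₀ t), ⟨hT, ?_, ?_, ?_, ?_⟩, ?_⟩
  · intro n
    obtain ⟨g, hg, hge⟩ := exists_contDiffOn_iteratedDeriv hT h1 n
    have e : (fun p : ℝ × ℝ => iteratedDeriv n (f (π₀ p.1)) p.2) =
        fun p => g (π₀ p.1, p.2) := by
      ext p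
      rw [hfe _ (hπm _)]
      exact congrFun (hge _ (hπm _)) p.2
    rw [e]
    refine hg.continuousOn.comp_continuous ?_ fun p => ⟨hπm _, mem_univ _⟩
    have : Continuous π₀ := continuous_subtype_val.comp continuous_projIcc
    fun_prop
  · intro t ht x
    have ht' : t ∈ Icc 0 T := Ioo_subset_Icc_self ht
    rw [hπe t ht', hfe t ht']
    have hev : (fun s => f (π₀ s) x) =ᶠ[nhds t] fun s => u s x := by
      filter_upwards [Ioo_mem_nhds ht.1 ht.2] with s hs
      have hs' : s ∈ Icc 0 T := Ioo_subset_Icc_self hs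
      rw [hπe s hs', ← hf s hs']
    refine HasDerivAt.congr_of_eventuallyEq ?_ hev
    have hd : DifferentiableAt ℝ (fun s => u s x) t := by
      have hS : Icc 0 T ×ˢ (univ : Set ℝ) ∈ nhds (t, x) :=
        prod_mem_nhds (Icc_mem_nhds ht.1 ht.2) Filter.univ_mem
      have := (h1.contDiffAt hS).differentiableAt (by simp)
      exact DifferentiableAt.comp (f := fun s : ℝ => (s, x)) t this (by fun_prop)
    have := hd.hasDerivAt
    convert this using 1
    linarith [h3 t ht' x]
  · intro t ht
    simp [hπ, projIcc_of_le_left hT.le ht]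
  · intro t ht
    simp [hπ, projIcc_of_right_le hT.le ht]
  · intro t ht x
    dsimp only
    rw [hπe t ht, hf t ht]

theorem integral_mul_sub_eq {a b : ℝ} (hab : a ≤ b) {G H : ℝ → ℝ → ℂ} {φ : ℝ → ℂ}
    (hG : Continuous fun p : ℝ × ℝ => G p.1 p.2) (hH : Continuous fun p : ℝ × ℝ => H p.1 p.2)
    (hφ : Continuous φ) (hc : HasCompactSupport φ)
    (hd : ∀ t ∈ Ioo a b, ∀ x, HasDerivAt (fun s => G s x) (H t x) t) :
    (∫ x, φ x * G b x) - ∫ x, φ x * G a x = ∫ t in Icc a b, ∫ x, φ x * H t x := by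
  have slice : ∀ {K : ℝ → ℝ → ℂ}, (Continuous fun p : ℝ × ℝ => K p.1 p.2) → ∀ t,
      Integrable fun x => φ x * K t x := fun {K} hK t => by
    refine Continuous.integrable_of_hasCompactSupport ?_ hc.mul_right
    exact hφ.mul (hK.comp (by fun_prop : Continuous fun x : ℝ => (t, x)))
  rw [← integral_sub (slice hG b) (slice hG a)]
  have ftc : ∀ x, φ x * G b x - φ x * G a x = ∫ t in Icc a b, φ x * H t x := by
    intro x
    rw [← mul_sub, integral_const_mul, integral_Icc_eq_integral_Ioc,
      ← intervalIntegral.integral_of_le hab]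
    congr 1
    symm
    refine intervalIntegral.integral_eq_sub_of_hasDerivAt_of_le hab ?_ (fun t ht => hd t ht x) ?_
    · exact (hG.comp (by fun_prop : Continuous fun s : ℝ => (s, x))).continuousOn
    · exact (hH.comp (by fun_prop : Continuous fun s : ℝ => (s, x))).intervalIntegrable _ _
  simp_rw [ftc]
  rw [integral_integral_swap]
  have hK : IsCompact (tsupport φ ×ˢ Icc a b) := IsCompact.prod hc isCompact_Icc
  have hcont : Continuous fun p : ℝ × ℝ => φ p.1 * H p.2 p.1 :=
    (hφ.comp continuous_fst).mul (hH.comp continuous_swap)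
  have h1 : IntegrableOn (fun p : ℝ × ℝ => φ p.1 * H p.2 p.1) (tsupport φ ×ˢ Icc a b) :=
    hcont.continuousOn.integrableOn_compact hK
  have e : (volume : Measure ℝ).prod (volume.restrict (Icc a b)) =
      (volume : Measure (ℝ × ℝ)).restrict (univ ×ˢ Icc a b) := by
    rw [Measure.volume_eq_prod, ← Measure.prod_restrict, Measure.restrict_univ]
  rw [e]
  change IntegrableOn _ _ _
  refine h1.of_forall_sdiff_eq_zero (MeasurableSet.univ.prod measurableSet_Icc) ?_
  rintro ⟨x, t⟩ ⟨⟨-, ht⟩, hn⟩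
  have : x ∉ tsupport φ := fun h => hn ⟨h, ht⟩
  simp [image_eq_zero_of_notMem_tsupport this]

/-- A fixed smooth cutoff. -/
def cutBump : ContDiffBump (0 : ℝ) := ⟨1, 2, one_pos, one_lt_two⟩

/-- Derivatives of the fixed cutoff. -/
def chi (n : ℕ) : ℝ → ℝ := iteratedDeriv n cutBump

theorem chi_contDiff (n : ℕ) : ContDiff ℝ (⊤ : ℕ∞) (chi n) := by
  unfold chi
  have : ContDiff ℝ (⊤ : ℕ∞) (cutBump : ℝ → ℝ) := cutBump.contDiff
  induction n with
  | zero => simpa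
  | succ n ih =>
    rw [iteratedDeriv_succ]
    exact ((contDiff_infty_iff_deriv (𝕜 := ℝ)).1 ih).2

theorem chi_hasDerivAt (n : ℕ) (x : ℝ) : HasDerivAt (chi n) (chi (n + 1) x) x := by
  have := ((chi_contDiff n).differentiable (by simp) x).hasDerivAt
  rwa [show deriv (chi n) = chi (n + 1) by unfold chi; rw [iteratedDeriv_succ]] at this

@[fun_prop]
theorem continuous_chi (n : ℕ) : Continuous (chi n) := (chi_contDiff n).continuous

theorem hasCompactSupport_chi (n : ℕ) : HasCompactSupport (chi n) := by
  unfold chi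
  induction n with
  | zero => simpa using cutBump.hasCompactSupport
  | succ n ih => rw [iteratedDeriv_succ]; exact ih.deriv

theorem hasCompactSupport_chi_comp (n : ℕ) {r : ℝ} (hr : 0 < r) :
    HasCompactSupport fun x => chi n (r * x) := by
  have h : HasCompactSupport fun x => chi n (r • x) :=
    (hasCompactSupport_chi n).comp_smul hr.ne'
  simpa only [smul_eq_mul] using h

theorem exists_abs_chi_le : ∃ B : ℝ, 1 ≤ B ∧ ∀ n ≤ 3, ∀ x, |chi n x| ≤ B := by
  choose c hc using fun n => (hasCompactSupport_chi n).exists_bound_of_continuous (continuous_chi n)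
  refine ⟨max 1 (max (max (c 0) (c 1)) (max (c 2) (c 3))), le_max_left _ _, fun n hn x => ?_⟩
  have := hc n x
  rw [Real.norm_eq_abs] at this
  refine this.trans ?_
  interval_cases n <;> simp

theorem chi_zero_eq_one {x : ℝ} (hx : |x| ≤ 1) : chi 0 x = 1 := by
  simp only [chi, iteratedDeriv_zero]
  exact cutBump.one_of_mem_closedBall (by simpa [cutBump] using hx)

theorem chi_zero_mem (x : ℝ) : 0 ≤ chi 0 x ∧ chi 0 x ≤ 1 := by
  simp only [chi, iteratedDeriv_zero]
  exact ⟨cutBump.nonneg, cutBump.le_one⟩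

theorem integral_test_slice {φ : ℕ → ℝ → ℂ} {w : ℕ → ℝ → ℝ} (z : ℂ)
    (hφ : ∀ n ≤ 2, ∀ x, HasDerivAt (φ n) (φ (n + 1) x) x)
    (hcont : ∀ n ≤ 3, Continuous (φ n)) (hsupp : ∀ n ≤ 3, HasCompactSupport (φ n))
    (hw : ∀ n x, HasDerivAt (w n) (w (n + 1) x) x) :
    ∫ x, φ 0 x * (-z * w 0 x - w 3 x + 6 * w 0 x * w 1 x) =
      ∫ x, ((φ 3 x - z * φ 0 x) * w 0 x - 3 * φ 1 x * (w 0 x : ℂ) ^ 2) := by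
  have cw : ∀ n, Continuous fun x => (w n x : ℂ) := fun n => Complex.continuous_ofReal.comp
    (continuous_iff_continuousAt.2 fun x => (hw n x).continuousAt)
  have h0 := hcont 0 (by norm_num)
  have h1 := hcont 1 (by norm_num)
  have h2 := hcont 2 (by norm_num)
  have h3 := hcont 3 (by norm_num)
  have s0 := hsupp 0 (by norm_num)
  have s1 := hsupp 1 (by norm_num)
  have s2 := hsupp 2 (by norm_num)
  have s3 := hsupp 3 (by norm_num)
  have w0 := cw 0
  have w1 := cw 1
  have w2 := cw 2
  have w3 := cw 3
  have i1 : Integrable fun x => φ 0 x * (-z * w 0 x - w 3 x + 6 * w 0 x * w 1 x) :=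
    Continuous.integrable_of_hasCompactSupport (by fun_prop) s0.mul_right
  have i2 : Integrable fun x => (φ 3 x - z * φ 0 x) * w 0 x - 3 * φ 1 x * (w 0 x : ℂ) ^ 2 := by
    refine Integrable.sub ?_ ?_
    · exact Continuous.integrable_of_hasCompactSupport (by fun_prop)
        (s3.sub (s0.mul_left)).mul_right
    · exact Continuous.integrable_of_hasCompactSupport (by fun_prop)
        (s1.mul_left).mul_right
  have i3 : Integrable fun x => -φ 0 x * w 2 x + φ 1 x * w 1 x - φ 2 x * w 0 x +
      3 * φ 0 x * (w 0 x : ℂ) ^ 2 := by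
    refine Integrable.add (Integrable.sub (Integrable.add ?_ ?_) ?_) ?_
    · exact Continuous.integrable_of_hasCompactSupport (by fun_prop) s0.neg.mul_right
    · exact Continuous.integrable_of_hasCompactSupport (by fun_prop) s1.mul_right
    · exact Continuous.integrable_of_hasCompactSupport (by fun_prop) s2.mul_right
    · exact Continuous.integrable_of_hasCompactSupport (by fun_prop) (s0.mul_left).mul_right
  rw [← sub_eq_zero, ← integral_sub i1 i2]
  refine integral_eq_zero_of_hasDerivAt_of_integrable (fun x => ?_) (i1.sub i2) i3
  have d : ∀ n x, HasDerivAt (fun y => (w n y : ℂ)) (w (n + 1) x : ℂ) x := fun n x =>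
    (hw n x).ofReal_comp
  have f0 := hφ 0 (by norm_num) x
  have f1 := hφ 1 (by norm_num) x
  have f2 := hφ 2 (by norm_num) x
  refine HasDerivAt.congr_deriv ((((f0.neg.mul (d 2 x)).add (f1.mul (d 1 x))).sub
    (f2.mul (d 0 x))).add ((f0.const_mul 3).mul ((d 0 x).pow 2))) ?_
  simp only [Pi.neg_apply]
  push_cast
  ring

namespace IsFlow

variable {T : ℝ} {v : ℝ → 𝓢(ℝ, ℝ)} (hv : IsFlow T v)
include hv

theorem continuous_uncurry : Continuous fun p : ℝ × ℝ => v p.1 p.2 := by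
  simpa using hv.cont 0

omit hv in
theorem hasDerivAt_iteratedDeriv (f : 𝓢(ℝ, ℝ)) (n : ℕ) (x : ℝ) :
    HasDerivAt (iteratedDeriv n f) (iteratedDeriv (n + 1) f x) x := by
  have h : ContDiff ℝ (n + 1 : ℕ) f := f.smooth _
  have := ((h.differentiable_iteratedDeriv n (by exact_mod_cast Nat.lt_succ_self n)) x).hasDerivAt
  rwa [iteratedDeriv_succ]

/-- Weak form of the equation against a compactly supported function. -/
theorem integral_test {a b : ℝ} (ha : 0 ≤ a) (hab : a ≤ b) (hb : b ≤ T) (c : ℝ)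
    {φ : ℕ → ℝ → ℂ} (hφ : ∀ n ≤ 2, ∀ x, HasDerivAt (φ n) (φ (n + 1) x) x)
    (hcont : ∀ n ≤ 3, Continuous (φ n)) (hsupp : ∀ n ≤ 3, HasCompactSupport (φ n)) :
    (∫ x, φ 0 x * (Complex.exp ((-c * b : ℝ) * Complex.I) * v b x)) -
      (∫ x, φ 0 x * (Complex.exp ((-c * a : ℝ) * Complex.I) * v a x)) =
    ∫ t in Icc a b, ∫ x, Complex.exp ((-c * t : ℝ) * Complex.I) *
      ((φ 3 x - Complex.I * c * φ 0 x) * v t x - 3 * φ 1 x * (v t x : ℂ) ^ 2) := by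
  have cv := hv.continuous_uncurry
  have c1 := hv.cont 1
  have c3 := hv.cont 3
  rw [integral_mul_sub_eq (G := fun t x => Complex.exp ((-c * t : ℝ) * Complex.I) * v t x)
    (H := fun t x => Complex.exp ((-c * t : ℝ) * Complex.I) * (-(Complex.I * c) * v t x -
      iteratedDeriv 3 (v t) x + 6 * v t x * iteratedDeriv 1 (v t) x)) hab (by fun_prop)
      (by fun_prop) (hcont 0 (by norm_num)) (hsupp 0 (by norm_num))]
  · refine setIntegral_congr_fun measurableSet_Icc fun t ht => ?_
    rw [integral_const_mul]
    simp_rw [mul_left_comm]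
    rw [integral_const_mul]
    congr 1
    have := integral_test_slice (w := fun n => iteratedDeriv n (v t)) (Complex.I * c) hφ hcont
      hsupp fun n x => hasDerivAt_iteratedDeriv (v t) n x
    simp only [iteratedDeriv_zero] at this
    exact this
  · intro t ht x
    have h1 := (hv.evol t ⟨ha.trans_lt ht.1, ht.2.trans_le hb⟩ x).ofReal_comp
    have h2 : HasDerivAt (fun s : ℝ => Complex.exp ((-c * s : ℝ) * Complex.I))
        (Complex.exp ((-c * t : ℝ) * Complex.I) * ((-c : ℝ) * Complex.I)) t := by
      have := (((hasDerivAt_id t).const_mul (-c)).ofReal_comp.mul_const Complex.I).cexp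
      simpa using this
    refine HasDerivAt.congr_deriv (h2.mul h1) ?_
    rw [iteratedDeriv_one]
    push_cast
    ring

end IsFlow

/-- Derivatives of the truncated character `χ(r x) exp(λ x)`. -/
def cutChar (r : ℝ) (l : ℂ) (n : ℕ) (x : ℝ) : ℂ :=
  ∑ k ∈ Finset.range (n + 1), (n.choose k : ℂ) * (r ^ k * chi k (r * x)) *
    (l ^ (n - k) * Complex.exp (l * x))

theorem cutChar_hasDerivAt (r : ℝ) (l : ℂ) {n : ℕ} (hn : n ≤ 2) (x : ℝ) :
    HasDerivAt (cutChar r l n) (cutChar r l (n + 1) x) x := by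
  have hc : ∀ k, HasDerivAt (fun x : ℝ => (chi k (r * x) : ℂ)) (r * chi (k + 1) (r * x)) x := by
    intro k
    have := ((chi_hasDerivAt k (r * x)).comp x ((hasDerivAt_id x).const_mul r)).ofReal_comp
    refine this.congr_deriv ?_
    push_cast
    ring
  have he : HasDerivAt (fun x : ℝ => Complex.exp (l * x)) (l * Complex.exp (l * x)) x := by
    have := ((hasDerivAt_id x).ofReal_comp.const_mul l).cexp
    refine this.congr_deriv ?_
    simp
    ring
  have : HasDerivAt (fun x => ∑ k ∈ Finset.range (n + 1),
      (n.choose k : ℂ) * (r ^ k * chi k (r * x)) * (l ^ (n - k) * Complex.exp (l * x)))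
      (∑ k ∈ Finset.range (n + 1), ((n.choose k : ℂ) * (r ^ k * (r * chi (k + 1) (r * x))) *
        (l ^ (n - k) * Complex.exp (l * x)) + (n.choose k : ℂ) * (r ^ k * chi k (r * x)) *
        (l ^ (n - k) * (l * Complex.exp (l * x))))) x :=
    HasDerivAt.fun_sum fun k _ => (((hc k).const_mul _).const_mul _).mul (he.const_mul _)
  refine this.congr_deriv ?_
  unfold cutChar
  interval_cases n
  · simp [Finset.sum_range_succ]; ring
  · simp [Finset.sum_range_succ]; ring
  · simp [Finset.sum_range_succ, Nat.choose]; ring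

@[fun_prop]
theorem continuous_cutChar (r : ℝ) (l : ℂ) (n : ℕ) : Continuous (cutChar r l n) := by
  unfold cutChar; fun_prop

theorem hasCompactSupport_cutChar {r : ℝ} (hr : 0 < r) (l : ℂ) (n : ℕ) :
    HasCompactSupport (cutChar r l n) := by
  have h : ∀ s : Finset ℕ, HasCompactSupport fun x => ∑ k ∈ s, (n.choose k : ℂ) *
      (r ^ k * chi k (r * x)) * (l ^ (n - k) * Complex.exp (l * x)) := by
    intro s
    induction s using Finset.induction_on with
    | empty => simp only [Finset.sum_empty]; exact HasCompactSupport.zero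
    | insert k s hk ih =>
      simp_rw [Finset.sum_insert hk]
      refine HasCompactSupport.add ?_ ih
      refine HasCompactSupport.mul_right (HasCompactSupport.mul_left (HasCompactSupport.mul_left ?_))
      exact (hasCompactSupport_chi_comp k hr).comp_left (g := fun y : ℝ => (y : ℂ)) (by simp)
  exact h _

theorem cutChar_zero (r : ℝ) (l : ℂ) (x : ℝ) :
    cutChar r l 0 x = chi 0 (r * x) * Complex.exp (l * x) := by
  simp [cutChar]

theorem cutChar_one (r : ℝ) (l : ℂ) (x : ℝ) :
    cutChar r l 1 x = (chi 0 (r * x) * l + r * chi 1 (r * x)) * Complex.exp (l * x) := by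
  simp [cutChar, Finset.sum_range_succ]
  ring

theorem cutChar_three (r : ℝ) (l : ℂ) (x : ℝ) :
    cutChar r l 3 x - l ^ 3 * cutChar r l 0 x = r * (3 * l ^ 2 * chi 1 (r * x) +
      3 * r * l * chi 2 (r * x) + r ^ 2 * chi 3 (r * x)) * Complex.exp (l * x) := by
  simp [cutChar, Finset.sum_range_succ, Nat.choose]
  ring

/-- Majorant of the cutoff errors. -/
def chiSum (x : ℝ) : ℝ := |chi 1 x| + |chi 2 x| + |chi 3 x|

theorem continuous_chiSum : Continuous chiSum := by unfold chiSum; fun_prop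

theorem chiSum_nonneg (x : ℝ) : 0 ≤ chiSum x := by unfold chiSum; positivity

theorem integrable_chiSum_sq : Integrable fun x => chiSum x ^ 2 := by
  have h := continuous_chiSum
  refine Continuous.integrable_of_hasCompactSupport (by fun_prop) ?_
  have : HasCompactSupport chiSum :=
    ((hasCompactSupport_chi 1).norm.add (hasCompactSupport_chi 2).norm).add
      (hasCompactSupport_chi 3).norm
  exact this.comp_left (g := fun y : ℝ => y ^ 2) (by simp)

theorem norm_cutChar_three_le {r : ℝ} (hr : 0 < r) (hr1 : r ≤ 1) {l : ℂ} (hl : l.re = 0) (x : ℝ) :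
    ‖cutChar r l 3 x - l ^ 3 * cutChar r l 0 x‖ ≤
      (3 * ‖l‖ ^ 2 + 3 * ‖l‖ + 1) * (r * chiSum (r * x)) := by
  have he : ‖Complex.exp (l * x)‖ = 1 := by simp [Complex.norm_exp, hl]
  rw [cutChar_three, norm_mul, norm_mul, he, mul_one, Complex.norm_real, Real.norm_of_nonneg hr.le]
  rw [mul_left_comm]
  refine mul_le_mul_of_nonneg_left ?_ hr.le
  refine (norm_add₃_le).trans ?_
  have e1 : ‖(3 * l ^ 2 * (chi 1 (r * x) : ℂ))‖ = 3 * ‖l‖ ^ 2 * |chi 1 (r * x)| := by simp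
  have e2 : ‖(3 * (r : ℂ) * l * (chi 2 (r * x) : ℂ))‖ = 3 * r * ‖l‖ * |chi 2 (r * x)| := by
    simp [abs_of_pos hr]
  have e3 : ‖((r : ℂ) ^ 2 * (chi 3 (r * x) : ℂ))‖ = r ^ 2 * |chi 3 (r * x)| := by simp
  rw [e1, e2, e3]
  unfold chiSum
  have h1 := abs_nonneg (chi 1 (r * x))
  have h2 := abs_nonneg (chi 2 (r * x))
  have h3 := abs_nonneg (chi 3 (r * x))
  have hl0 := norm_nonneg l
  have hr2 : r ^ 2 ≤ 1 := pow_le_one₀ hr.le hr1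
  calc _ ≤ 3 * ‖l‖ ^ 2 * |chi 1 (r * x)| + 3 * 1 * ‖l‖ * |chi 2 (r * x)| +
        1 * |chi 3 (r * x)| := by gcongr
    _ ≤ _ := by
      have := mul_nonneg hl0 h1
      have := mul_nonneg (sq_nonneg ‖l‖) h2
      have := mul_nonneg hl0 h3
      have := mul_nonneg (sq_nonneg ‖l‖) h3
      nlinarith

theorem exists_norm_cutChar_one_le : ∃ B : ℝ, 1 ≤ B ∧ ∀ {r : ℝ}, 0 < r → r ≤ 1 → ∀ {l : ℂ},
    l.re = 0 → ∀ x : ℝ, ‖cutChar r l 1 x‖ ≤ B * (‖l‖ + 1) ∧ chiSum x ≤ 3 * B := by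
  obtain ⟨B, hB1, hB⟩ := exists_abs_chi_le
  refine ⟨B, hB1, fun {r} hr hr1 {l} hl x => ⟨?_, ?_⟩⟩
  · have he : ‖Complex.exp (l * x)‖ = 1 := by simp [Complex.norm_exp, hl]
    rw [cutChar_one, norm_mul, he, mul_one]
    refine (norm_add_le _ _).trans ?_
    rw [norm_mul, norm_mul, Complex.norm_real, Complex.norm_real, Complex.norm_real,
      Real.norm_eq_abs, Real.norm_eq_abs, Real.norm_eq_abs, abs_of_pos hr]
    have := hB 0 (by norm_num) (r * x)
    have := hB 1 (by norm_num) (r * x)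
    calc _ ≤ B * ‖l‖ + 1 * B := by gcongr
      _ = _ := by ring
  · have := hB 1 (by norm_num) x
    have := hB 2 (by norm_num) x
    have := hB 3 (by norm_num) x
    unfold chiSum
    linarith

theorem FT_eq (u : ℝ → ℝ) (ξ : ℝ) :
    FT u ξ = ∫ x : ℝ, Complex.exp (((-2 * π * ξ : ℝ) * Complex.I) * x) * u x := by
  unfold FT
  rw [Real.fourier_eq']
  congr 1
  ext x
  simp only [RCLike.inner_apply, conj_trivial, smul_eq_mul]
  congr 2
  push_cast
  ring

theorem integrable_schwartz_sq (f : 𝓢(ℝ, ℝ)) : Integrable fun x => f x ^ 2 := by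
  have := (f.memLp 2 volume).integrable_sq
  exact this

/-- The contribution of a single time to the truncated Duhamel formula. -/
def cutTerm (l : ℂ) (f : ℝ → ℝ) (r : ℝ) : ℂ :=
  ∫ x, ((cutChar r l 3 x - l ^ 3 * cutChar r l 0 x) * f x - 3 * cutChar r l 1 x * (f x : ℂ) ^ 2)

theorem tendsto_chi_zero (x : ℝ) :
    Filter.Tendsto (fun n : ℕ => chi 0 (((n : ℝ) + 1)⁻¹ * x)) Filter.atTop (nhds 1) := by
  have h : Filter.Tendsto (fun n : ℕ => ((n : ℝ) + 1)⁻¹ * x) Filter.atTop (nhds (0 * x)) := by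
    refine Filter.Tendsto.mul_const _ ?_
    simpa using tendsto_one_div_add_atTop_nhds_zero_nat (𝕜 := ℝ)
  have := ((continuous_chi 0).tendsto (0 * x)).comp h
  rwa [zero_mul, chi_zero_eq_one (by simp)] at this

theorem inv_succ_mem (n : ℕ) : 0 < ((n : ℝ) + 1)⁻¹ ∧ ((n : ℝ) + 1)⁻¹ ≤ 1 :=
  ⟨by positivity, inv_le_one_of_one_le₀ (by linarith [n.cast_nonneg (α := ℝ)])⟩

theorem tendsto_cutTerm {l : ℂ} (hl : l.re = 0) {f : ℝ → ℝ} (hf : Integrable f)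
    (hf2 : Integrable fun x => f x ^ 2) :
    Filter.Tendsto (fun n : ℕ => cutTerm l f ((n : ℝ) + 1)⁻¹) Filter.atTop
      (nhds (∫ x : ℝ, -3 * l * Complex.exp (l * x) * (f x : ℂ) ^ 2)) := by
  obtain ⟨B, hB1, hB⟩ := exists_norm_cutChar_one_le
  set D := (3 * ‖l‖ ^ 2 + 3 * ‖l‖ + 1) with hD
  have hD0 : 0 ≤ D := by positivity
  have mf : AEStronglyMeasurable (fun x => (f x : ℂ)) :=
    Complex.continuous_ofReal.comp_aestronglyMeasurable hf.1
  refine tendsto_integral_of_dominated_convergence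
    (fun x => D * (3 * B) * |f x| + 3 * (B * (‖l‖ + 1)) * f x ^ 2) ?_ ?_ ?_ ?_
  · intro n
    refine AEStronglyMeasurable.sub (AEStronglyMeasurable.mul ?_ mf)
      (AEStronglyMeasurable.mul ?_ (mf.pow 2))
    · exact Continuous.aestronglyMeasurable (by fun_prop)
    · exact Continuous.aestronglyMeasurable (by fun_prop)
  · exact (hf.abs.const_mul _).add (hf2.const_mul _)
  · intro n
    obtain ⟨h0, h1⟩ := inv_succ_mem n
    refine Filter.Eventually.of_forall fun x => ?_
    refine (norm_sub_le _ _).trans ?_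
    rw [norm_mul, norm_mul, norm_mul, norm_pow, Complex.norm_real, Real.norm_eq_abs, sq_abs,
      Complex.norm_ofNat]
    have a1 := norm_cutChar_three_le h0 h1 hl x
    have a2 := (hB h0 h1 hl x).1
    have a3 := (hB h0 h1 hl (((n : ℝ) + 1)⁻¹ * x)).2
    have a4 : ((n : ℝ) + 1)⁻¹ * chiSum (((n : ℝ) + 1)⁻¹ * x) ≤ 3 * B :=
      (mul_le_of_le_one_left (chiSum_nonneg _) h1).trans a3
    gcongr
    exact a1.trans (by gcongr)
  · refine Filter.Eventually.of_forall fun x => ?_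
    have hr : Filter.Tendsto (fun n : ℕ => ((n : ℝ) + 1)⁻¹) Filter.atTop (nhds 0) := by
      simpa using tendsto_one_div_add_atTop_nhds_zero_nat (𝕜 := ℝ)
    have t1 : Filter.Tendsto (fun n : ℕ => cutChar ((n : ℝ) + 1)⁻¹ l 3 x -
        l ^ 3 * cutChar ((n : ℝ) + 1)⁻¹ l 0 x) Filter.atTop (nhds 0) := by
      refine squeeze_zero_norm (a := fun n : ℕ => D * (((n : ℝ) + 1)⁻¹ * (3 * B))) (fun n => ?_) ?_
      · obtain ⟨h0, h1⟩ := inv_succ_mem n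
        refine (norm_cutChar_three_le h0 h1 hl x).trans ?_
        gcongr
        exact (hB h0 h1 hl _).2
      · have := (hr.mul_const (3 * B)).const_mul D
        simpa using this
    have t2 : Filter.Tendsto (fun n : ℕ => cutChar ((n : ℝ) + 1)⁻¹ l 1 x) Filter.atTop
        (nhds (l * Complex.exp (l * x))) := by
      simp_rw [cutChar_one]
      refine Filter.Tendsto.mul_const _ ?_
      have s1 : Filter.Tendsto (fun n : ℕ => (chi 0 (((n : ℝ) + 1)⁻¹ * x) : ℂ) * l) Filter.atTop
          (nhds (((1 : ℝ) : ℂ) * l)) :=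
        ((Complex.continuous_ofReal.tendsto 1).comp (tendsto_chi_zero x)).mul_const l
      have s2 : Filter.Tendsto (fun n : ℕ => (((((n : ℝ) + 1)⁻¹ : ℝ) : ℂ) *
          (chi 1 (((n : ℝ) + 1)⁻¹ * x) : ℂ))) Filter.atTop
          (nhds (((0 : ℝ) : ℂ) * (chi 1 (0 * x) : ℂ))) := by
        refine ((Complex.continuous_ofReal.tendsto 0).comp hr).mul ?_
        exact ((Complex.continuous_ofReal.comp (continuous_chi 1)).tendsto _).comp
          (hr.mul_const x)
      simpa using s1.add s2
    have := (t1.mul_const (f x : ℂ)).sub ((t2.const_mul 3).mul_const ((f x : ℂ) ^ 2))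
    convert this using 2
    ring

theorem exists_norm_cutTerm_le {l : ℂ} (hl : l.re = 0) : ∃ A : ℝ, ∀ {r : ℝ}, 0 < r → r ≤ 1 →
    ∀ {f : ℝ → ℝ}, (Integrable fun x => f x ^ 2) → ‖cutTerm l f r‖ ≤ A * (1 + ∫ x, f x ^ 2) := by
  obtain ⟨B, hB1, hB⟩ := exists_norm_cutChar_one_le
  set D := (3 * ‖l‖ ^ 2 + 3 * ‖l‖ + 1) with hD
  have hD0 : 0 ≤ D := by positivity
  set M := ∫ x, chiSum x ^ 2 with hM
  have hM0 : 0 ≤ M := integral_nonneg fun x => sq_nonneg _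
  refine ⟨D * M + D + 3 * (B * (‖l‖ + 1)), fun {r} h0 h1 {f} hf => ?_⟩
  have i1 : Integrable fun x => chiSum (r * x) ^ 2 :=
    integrable_chiSum_sq.comp_mul_left' h0.ne'
  have i2 : Integrable fun x => D * (r ^ 2 * chiSum (r * x) ^ 2) +
      (D + 3 * (B * (‖l‖ + 1))) * f x ^ 2 := ((i1.const_mul _).const_mul _).add (hf.const_mul _)
  have hle : ‖cutTerm l f r‖ ≤ ∫ x, (D * (r ^ 2 * chiSum (r * x) ^ 2) +
      (D + 3 * (B * (‖l‖ + 1))) * f x ^ 2) := by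
    refine norm_integral_le_of_norm_le i2 (Filter.Eventually.of_forall fun x => ?_)
    refine (norm_sub_le _ _).trans ?_
    rw [norm_mul, norm_mul, norm_mul, norm_pow, Complex.norm_real, Real.norm_eq_abs, sq_abs,
      Complex.norm_ofNat]
    have a1 := norm_cutChar_three_le h0 h1 hl x
    have a2 := (hB h0 h1 hl x).1
    have a3 : r * chiSum (r * x) * |f x| ≤ r ^ 2 * chiSum (r * x) ^ 2 + f x ^ 2 := by
      rw [← sq_abs (f x)]
      nlinarith [sq_nonneg (r * chiSum (r * x) - |f x|), sq_nonneg (r * chiSum (r * x)),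
        sq_nonneg |f x|]
    calc _ ≤ D * (r * chiSum (r * x)) * |f x| + 3 * (B * (‖l‖ + 1)) * f x ^ 2 := by gcongr
      _ = D * (r * chiSum (r * x) * |f x|) + 3 * (B * (‖l‖ + 1)) * f x ^ 2 := by ring
      _ ≤ D * (r ^ 2 * chiSum (r * x) ^ 2 + f x ^ 2) + 3 * (B * (‖l‖ + 1)) * f x ^ 2 := by gcongr
      _ = _ := by ring
  have hF0 : 0 ≤ ∫ x, f x ^ 2 := integral_nonneg fun x => sq_nonneg _
  have e1 : ∫ x, chiSum (r * x) ^ 2 = r⁻¹ * M := by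
    rw [Measure.integral_comp_mul_left (fun x => chiSum x ^ 2) r, abs_of_pos (inv_pos.2 h0),
      smul_eq_mul]
  rw [integral_add ((i1.const_mul _).const_mul _) (hf.const_mul _), integral_const_mul,
    integral_const_mul, integral_const_mul, e1] at hle
  refine hle.trans ?_
  have e2 : r ^ 2 * (r⁻¹ * M) ≤ M := by
    calc r ^ 2 * (r⁻¹ * M) = r * M := by field_simp
      _ ≤ M := mul_le_of_le_one_left hM0 h1
  have hB0 : 0 ≤ B * (‖l‖ + 1) := by positivity
  have := mul_nonneg (mul_nonneg hD0 hM0) hF0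
  have := mul_le_mul_of_nonneg_left e2 hD0
  nlinarith

namespace IsFlow

variable {T : ℝ} {v : ℝ → 𝓢(ℝ, ℝ)} (hv : IsFlow T v)
include hv

/-- Duhamel formula on the Fourier side. -/
theorem duhamel {a b : ℝ} (ha : 0 ≤ a) (hab : a ≤ b) (hb : b ≤ T) {K : ℝ}
    (hK : ∀ t ∈ Icc a b, ∫ x, v t x ^ 2 ≤ K) (ξ : ℝ) :
    Complex.exp ((-(8 * π ^ 3 * ξ ^ 3) * b : ℝ) * Complex.I) * FT (v b) ξ -
      Complex.exp ((-(8 * π ^ 3 * ξ ^ 3) * a : ℝ) * Complex.I) * FT (v a) ξ =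
    ∫ t in Icc a b, Complex.exp ((-(8 * π ^ 3 * ξ ^ 3) * t : ℝ) * Complex.I) *
      (6 * π * ξ * Complex.I * FT (fun x => v t x ^ 2) ξ) := by
  set c := 8 * π ^ 3 * ξ ^ 3 with hc
  set l : ℂ := (-2 * π * ξ : ℝ) * Complex.I with hl
  have hlr : l.re = 0 := by simp [hl]
  have hlc : l ^ 3 = Complex.I * c := by
    rw [hl, hc, mul_pow, Complex.I_pow_three]
    push_cast
    ring
  have cv := hv.continuous_uncurry
  have key : ∀ n : ℕ, (∫ x, cutChar ((n : ℝ) + 1)⁻¹ l 0 x *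
        (Complex.exp ((-c * b : ℝ) * Complex.I) * v b x)) -
      (∫ x, cutChar ((n : ℝ) + 1)⁻¹ l 0 x * (Complex.exp ((-c * a : ℝ) * Complex.I) * v a x)) =
      ∫ t in Icc a b, Complex.exp ((-c * t : ℝ) * Complex.I) * cutTerm l (v t) ((n : ℝ) + 1)⁻¹ := by
    intro n
    obtain ⟨h0, h1⟩ := inv_succ_mem n
    rw [hv.integral_test ha hab hb c (φ := cutChar ((n : ℝ) + 1)⁻¹ l)
      (fun k hk x => cutChar_hasDerivAt _ l hk x) (fun k _ => continuous_cutChar _ _ _)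
      (fun k _ => hasCompactSupport_cutChar h0 l k)]
    simp_rw [integral_const_mul, ← hlc]
    rfl
  have lim0 : ∀ t, Filter.Tendsto (fun n : ℕ => ∫ x, cutChar ((n : ℝ) + 1)⁻¹ l 0 x *
      (Complex.exp ((-c * t : ℝ) * Complex.I) * v t x)) Filter.atTop
      (nhds (Complex.exp ((-c * t : ℝ) * Complex.I) * FT (v t) ξ)) := by
    intro t
    have e : Complex.exp ((-c * t : ℝ) * Complex.I) * FT (v t) ξ =
        ∫ x : ℝ, Complex.exp (l * x) * (Complex.exp ((-c * t : ℝ) * Complex.I) * v t x) := by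
      rw [FT_eq, ← integral_const_mul]
      congr 1
      ext x
      ring
    rw [e]
    have iv := (v t).integrable (μ := volume)
    refine tendsto_integral_of_dominated_convergence (fun x => |v t x|) (fun n => ?_) iv.abs
      (fun n => Filter.Eventually.of_forall fun x => ?_) (Filter.Eventually.of_forall fun x => ?_)
    · have : Continuous (v t) := (v t).continuous
      exact Continuous.aestronglyMeasurable (by fun_prop)
    · rw [cutChar_zero, norm_mul, norm_mul, norm_mul, Complex.norm_real, Complex.norm_real,
        Complex.norm_exp_ofReal_mul_I, one_mul, Real.norm_eq_abs, Real.norm_eq_abs]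
      have he : ‖Complex.exp (l * x)‖ = 1 := by simp [Complex.norm_exp, hlr]
      rw [he, mul_one, abs_of_nonneg (chi_zero_mem _).1]
      exact mul_le_of_le_one_left (abs_nonneg _) (chi_zero_mem _).2
    · simp_rw [cutChar_zero]
      have := (Complex.continuous_ofReal.tendsto 1).comp (tendsto_chi_zero x)
      have := (this.mul_const (Complex.exp (l * x))).mul_const
        (Complex.exp ((-c * t : ℝ) * Complex.I) * v t x)
      simpa using this
  obtain ⟨A, hA⟩ := exists_norm_cutTerm_le hlr
  have lim1 : Filter.Tendsto (fun n : ℕ => ∫ t in Icc a b,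
      Complex.exp ((-c * t : ℝ) * Complex.I) * cutTerm l (v t) ((n : ℝ) + 1)⁻¹) Filter.atTop
      (nhds (∫ t in Icc a b, Complex.exp ((-c * t : ℝ) * Complex.I) *
      (6 * π * ξ * Complex.I * FT (fun x => v t x ^ 2) ξ))) := by
    refine tendsto_integral_of_dominated_convergence (fun t => |A| * (1 + |K|)) (fun n => ?_)
      (integrable_const _) (fun n => ?_) (Filter.Eventually.of_forall fun t => ?_)
    · refine AEStronglyMeasurable.mul (Continuous.aestronglyMeasurable (by fun_prop)) ?_
      refine StronglyMeasurable.aestronglyMeasurable ?_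
      refine StronglyMeasurable.integral_prod_right' (f := fun p : ℝ × ℝ =>
        (cutChar ((n : ℝ) + 1)⁻¹ l 3 p.2 - l ^ 3 * cutChar ((n : ℝ) + 1)⁻¹ l 0 p.2) * v p.1 p.2 -
          3 * cutChar ((n : ℝ) + 1)⁻¹ l 1 p.2 * (v p.1 p.2 : ℂ) ^ 2) ?_
      exact Continuous.stronglyMeasurable (by fun_prop)
    · obtain ⟨h0, h1⟩ := inv_succ_mem n
      refine (ae_restrict_mem measurableSet_Icc).mono fun t ht => ?_
      rw [norm_mul, Complex.norm_exp_ofReal_mul_I, one_mul]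
      refine (hA h0 h1 (integrable_schwartz_sq (v t))).trans ?_
      have h2 : 0 ≤ ∫ x, v t x ^ 2 := integral_nonneg fun x => sq_nonneg _
      have := (hK t ht).trans (le_abs_self K)
      gcongr
      exact le_abs_self A
    · refine Filter.Tendsto.const_mul _ ?_
      have := tendsto_cutTerm hlr ((v t).integrable) (integrable_schwartz_sq (v t))
      convert this using 2
      rw [FT_eq, ← integral_const_mul]
      congr 1
      ext x
      rw [hl]
      push_cast
      ring
  have := tendsto_nhds_unique (((lim0 b).sub (lim0 a)).congr key) lim1
  exact this

end IsFlow

theorem exists_schwartz_iteratedDeriv (f : 𝓢(ℝ, ℝ)) (n : ℕ) :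
    ∃ g : 𝓢(ℝ, ℝ), (g : ℝ → ℝ) = iteratedDeriv n f := by
  induction n with
  | zero => exact ⟨f, by simp⟩
  | succ n ih =>
    obtain ⟨g, hg⟩ := ih
    refine ⟨derivCLM ℝ ℝ g, ?_⟩
    ext x
    rw [iteratedDeriv_succ, ← hg]
    exact derivCLM_apply ℝ g x

theorem integrable_iteratedDeriv_sq (f : 𝓢(ℝ, ℝ)) (n : ℕ) :
    Integrable fun x => iteratedDeriv n f x ^ 2 := by
  obtain ⟨g, hg⟩ := exists_schwartz_iteratedDeriv f n
  rw [← hg]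
  exact integrable_schwartz_sq g

/-- The squared `H¹` norm. -/
def hOne (f : ℝ → ℝ) : ℝ := ∫ x, (f x ^ 2 + iteratedDeriv 1 f x ^ 2)

theorem integrable_hOne (f : 𝓢(ℝ, ℝ)) : Integrable fun x => f x ^ 2 + iteratedDeriv 1 f x ^ 2 :=
  (integrable_schwartz_sq f).add (integrable_iteratedDeriv_sq f 1)

theorem hOne_nonneg (f : ℝ → ℝ) : 0 ≤ hOne f := integral_nonneg fun x => by positivity

theorem sq_le_hOne (f : 𝓢(ℝ, ℝ)) (x : ℝ) : f x ^ 2 ≤ hOne f := by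
  have hd : ∀ y, HasDerivAt (fun y => f y ^ 2) (2 * f y * iteratedDeriv 1 f y) y := by
    intro y
    have := IsFlow.hasDerivAt_iteratedDeriv f 0 y
    rw [iteratedDeriv_zero] at this
    refine (this.pow 2).congr_deriv ?_
    ring
  have hle : ∀ y, |2 * f y * iteratedDeriv 1 f y| ≤ f y ^ 2 + iteratedDeriv 1 f y ^ 2 := by
    intro y
    rw [abs_le]
    constructor
    · nlinarith [sq_nonneg (f y + iteratedDeriv 1 f y)]
    · nlinarith [sq_nonneg (f y - iteratedDeriv 1 f y)]
  have hi := integrable_hOne f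
  have hi2 : Integrable fun y => 2 * f y * iteratedDeriv 1 f y := by
    refine hi.mono' ?_ (Filter.Eventually.of_forall hle)
    obtain ⟨g, hg⟩ := exists_schwartz_iteratedDeriv f 1
    rw [← hg]
    have := f.continuous
    have := g.continuous
    exact Continuous.aestronglyMeasurable (by fun_prop)
  have h0 := tendsto_zero_of_hasDerivAt_of_integrableOn_Iic (a := x) (fun y _ => hd y)
    hi2.integrableOn (integrable_schwartz_sq f).integrableOn
  have h1 := integral_Iic_of_hasDerivAt_of_tendsto' (a := x) (fun y _ => hd y) hi2.integrableOn h0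
  rw [sub_zero] at h1
  rw [← h1]
  calc _ ≤ ∫ y in Iic x, (f y ^ 2 + iteratedDeriv 1 f y ^ 2) :=
        setIntegral_mono hi2.integrableOn hi.integrableOn fun y => (le_abs_self _).trans (hle y)
    _ ≤ _ := setIntegral_le_integral hi (Filter.Eventually.of_forall fun y => by positivity)

theorem integral_energy_slice {φ w : ℕ → ℝ → ℝ}
    (hφ : ∀ n ≤ 2, ∀ x, HasDerivAt (φ n) (φ (n + 1) x) x)
    (hcont : ∀ n, Continuous (φ n)) (hsupp : ∀ n, HasCompactSupport (φ n))
    (hw : ∀ n x, HasDerivAt (w n) (w (n + 1) x) x) :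
    ∫ x, φ 0 x * (2 * w 0 x * (-w 3 x + 6 * w 0 x * w 1 x)) =
      ∫ x, (φ 3 x * w 0 x ^ 2 - φ 1 x * (3 * w 1 x ^ 2 + 4 * w 0 x ^ 3)) := by
  have cw : ∀ n, Continuous (w n) := fun n =>
    continuous_iff_continuousAt.2 fun x => (hw n x).continuousAt
  have h0 := hcont 0
  have h1 := hcont 1
  have h2 := hcont 2
  have h3 := hcont 3
  have w0 := cw 0
  have w1 := cw 1
  have w2 := cw 2
  have w3 := cw 3
  have i1 : Integrable fun x => φ 0 x * (2 * w 0 x * (-w 3 x + 6 * w 0 x * w 1 x)) :=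
    Continuous.integrable_of_hasCompactSupport (by fun_prop) (hsupp 0).mul_right
  have i2 : Integrable fun x => φ 3 x * w 0 x ^ 2 - φ 1 x * (3 * w 1 x ^ 2 + 4 * w 0 x ^ 3) :=
    (Continuous.integrable_of_hasCompactSupport (by fun_prop) (hsupp 3).mul_right).sub
      (Continuous.integrable_of_hasCompactSupport (by fun_prop) (hsupp 1).mul_right)
  have i3 : Integrable fun x => φ 0 x * (-2 * w 0 x * w 2 x + w 1 x ^ 2 + 4 * w 0 x ^ 3) +
      φ 1 x * (2 * w 0 x * w 1 x) - φ 2 x * w 0 x ^ 2 :=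
    ((Continuous.integrable_of_hasCompactSupport (by fun_prop) (hsupp 0).mul_right).add
      (Continuous.integrable_of_hasCompactSupport (by fun_prop) (hsupp 1).mul_right)).sub
      (Continuous.integrable_of_hasCompactSupport (by fun_prop) (hsupp 2).mul_right)
  rw [← sub_eq_zero, ← integral_sub i1 i2]
  refine integral_eq_zero_of_hasDerivAt_of_integrable (fun x => ?_) (i1.sub i2) i3
  have f0 := hφ 0 (by norm_num) x
  have f1 := hφ 1 (by norm_num) x
  have f2 := hφ 2 (by norm_num) x
  have d0 := hw 0 x
  have d1 := hw 1 x
  have d2 := hw 2 x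
  refine HasDerivAt.congr_deriv (((f0.mul ((((d0.const_mul (-2)).mul d2).add (d1.pow 2)).add
    ((d0.pow 3).const_mul 4))).add (f1.mul ((d0.const_mul 2).mul d1))).sub (f2.mul (d0.pow 2))) ?_
  simp only [Pi.add_apply, Pi.mul_apply, Pi.pow_apply]
  push_cast
  ring

namespace IsFlow

variable {T : ℝ} {v : ℝ → 𝓢(ℝ, ℝ)} (hv : IsFlow T v)
include hv

/-- Conservation of the `L²` norm as long as the `H¹` norm is bounded. -/
theorem integral_sq_eq {a b : ℝ} (ha : 0 ≤ a) (hab : a ≤ b) (hb : b ≤ T) {K : ℝ}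
    (hK : ∀ t ∈ Icc a b, hOne (v t) ≤ K) : ∫ x, v b x ^ 2 = ∫ x, v a x ^ 2 := by
  obtain ⟨B, hB1, hB⟩ := exists_abs_chi_le
  have cv := hv.continuous_uncurry
  have c1 := hv.cont 1
  have c3 := hv.cont 3
  set E : ℕ → ℝ → ℝ := fun n t => ∫ x, chi 0 (((n : ℝ) + 1)⁻¹ * x) * v t x ^ 2 with hE
  have lim0 : ∀ t, Filter.Tendsto (fun n => E n t) Filter.atTop (nhds (∫ x, v t x ^ 2)) := by
    intro t
    refine tendsto_integral_of_dominated_convergence (fun x => v t x ^ 2) (fun n => ?_)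
      (integrable_schwartz_sq _)
      (fun n => Filter.Eventually.of_forall fun x => ?_) (Filter.Eventually.of_forall fun x => ?_)
    · have : Continuous (v t) := (v t).continuous
      exact Continuous.aestronglyMeasurable (by fun_prop)
    · rw [norm_mul, Real.norm_of_nonneg (chi_zero_mem _).1, Real.norm_of_nonneg (sq_nonneg _)]
      exact mul_le_of_le_one_left (sq_nonneg _) (chi_zero_mem _).2
    · have := (tendsto_chi_zero x).mul_const (v t x ^ 2)
      simpa using this
  have key : ∀ n, |E n b - E n a| ≤ ((n : ℝ) + 1)⁻¹ * (B * (8 + 4 * K) * K * (b - a)) := by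
    intro n
    obtain ⟨h0, h1⟩ := inv_succ_mem n
    set r := ((n : ℝ) + 1)⁻¹ with hr
    have hd : ∀ k ≤ 2, ∀ x, HasDerivAt (fun x => r ^ k * chi k (r * x))
        (r ^ (k + 1) * chi (k + 1) (r * x)) x := by
      intro k _ x
      have := ((chi_hasDerivAt k (r * x)).comp x ((hasDerivAt_id x).const_mul r)).const_mul (r ^ k)
      refine this.congr_deriv ?_
      ring
    have hslice : ∀ t, ∫ x, chi 0 (r * x) * (2 * v t x * (-iteratedDeriv 3 (v t) x +
        6 * v t x * iteratedDeriv 1 (v t) x)) = ∫ x, (r ^ 3 * chi 3 (r * x) * v t x ^ 2 -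
        r * chi 1 (r * x) * (3 * iteratedDeriv 1 (v t) x ^ 2 + 4 * v t x ^ 3)) := by
      intro t
      have := integral_energy_slice (φ := fun k x => r ^ k * chi k (r * x))
        (w := fun k => iteratedDeriv k (v t)) hd (fun k => by fun_prop)
        (fun k => (hasCompactSupport_chi_comp k h0).mul_left)
        (fun k x => hasDerivAt_iteratedDeriv (v t) k x)
      simpa only [pow_zero, one_mul, pow_one, iteratedDeriv_zero] using this
    have hbound : ∀ t ∈ Icc a b, ‖∫ x, chi 0 (r * x) * (2 * v t x * (-iteratedDeriv 3 (v t) x +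
        6 * v t x * iteratedDeriv 1 (v t) x))‖ ≤ r * (B * (8 + 4 * K) * K) := by
      intro t ht
      have hKt := hK t ht
      have hK0 : 0 ≤ K := (hOne_nonneg _).trans hKt
      rw [hslice t]
      calc _ ≤ ∫ x, r * (B * (8 + 4 * K)) * (v t x ^ 2 + iteratedDeriv 1 (v t) x ^ 2) := by
            refine norm_integral_le_of_norm_le ((integrable_hOne (v t)).const_mul _)
              (Filter.Eventually.of_forall fun x => ?_)
            have a1 := hB 1 (by norm_num) (r * x)
            have a3 := hB 3 (by norm_num) (r * x)
            have b1 : |v t x| ≤ 1 + K := by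
              have := (sq_le_hOne (v t) x).trans hKt
              rw [← sq_abs] at this
              nlinarith [abs_nonneg (v t x), sq_nonneg (|v t x| - 1)]
            have b2 : |v t x ^ 3| ≤ (1 + K) * v t x ^ 2 := by
              rw [abs_pow, pow_succ, sq_abs, mul_comm]
              gcongr
            have b3 : r ^ 3 ≤ r := by
              calc r ^ 3 ≤ r ^ 1 := pow_le_pow_of_le_one h0.le h1 (by norm_num)
                _ = r := pow_one r
            refine (norm_sub_le _ _).trans ?_
            rw [norm_mul, norm_mul, norm_mul, norm_mul, Real.norm_of_nonneg (sq_nonneg (v t x)),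
              Real.norm_of_nonneg (pow_nonneg h0.le 3), Real.norm_of_nonneg h0.le,
              Real.norm_eq_abs, Real.norm_eq_abs]
            have b4 : ‖3 * iteratedDeriv 1 (v t) x ^ 2 + 4 * v t x ^ 3‖ ≤
                3 * iteratedDeriv 1 (v t) x ^ 2 + 4 * ((1 + K) * v t x ^ 2) := by
              refine (norm_add_le _ _).trans ?_
              rw [Real.norm_of_nonneg (by positivity), norm_mul, Real.norm_of_nonneg (by norm_num),
                Real.norm_eq_abs]
              gcongr
            calc _ ≤ r * B * v t x ^ 2 + r * B *
                  (3 * iteratedDeriv 1 (v t) x ^ 2 + 4 * ((1 + K) * v t x ^ 2)) := by gcongr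
              _ = r * B * (v t x ^ 2 + 3 * iteratedDeriv 1 (v t) x ^ 2 +
                  4 * ((1 + K) * v t x ^ 2)) := by ring
              _ ≤ r * B * ((8 + 4 * K) * (v t x ^ 2 + iteratedDeriv 1 (v t) x ^ 2)) := by
                refine mul_le_mul_of_nonneg_left ?_ (by positivity)
                nlinarith [sq_nonneg (v t x), mul_nonneg hK0 (sq_nonneg (iteratedDeriv 1 (v t) x)),
                  sq_nonneg (iteratedDeriv 1 (v t) x)]
              _ = _ := by ring
        _ = r * (B * (8 + 4 * K)) * hOne (v t) := by rw [integral_const_mul]; rfl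
        _ ≤ r * (B * (8 + 4 * K)) * K := by gcongr
        _ = _ := by ring
    have hsc : HasCompactSupport fun x => (chi 0 (r * x) : ℂ) :=
      (hasCompactSupport_chi_comp 0 h0).comp_left (g := fun y : ℝ => (y : ℂ)) (by simp)
    have ti := integral_mul_sub_eq (G := fun t x => (v t x : ℂ) ^ 2)
      (H := fun t x => ((2 * v t x * (-iteratedDeriv 3 (v t) x +
        6 * v t x * iteratedDeriv 1 (v t) x) : ℝ) : ℂ)) hab (by fun_prop) (by fun_prop)
        (by fun_prop) hsc (fun t ht x => by
          have := hv.evol t ⟨ha.trans_lt ht.1, ht.2.trans_le hb⟩ x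
          refine HasDerivAt.congr_deriv (this.ofReal_comp.pow 2) ?_
          rw [iteratedDeriv_one]
          push_cast
          ring)
    have e : ((E n b - E n a : ℝ) : ℂ) = ∫ t in Icc a b, ((∫ x, chi 0 (r * x) *
        (2 * v t x * (-iteratedDeriv 3 (v t) x + 6 * v t x * iteratedDeriv 1 (v t) x)) : ℝ) : ℂ) := by
      simp_rw [← integral_complex_ofReal]
      push_cast
      simp_rw [hE, ← integral_complex_ofReal]
      push_cast
      push_cast at ti
      exact ti
    rw [integral_complex_ofReal, Complex.ofReal_inj] at e
    rw [e, ← Real.norm_eq_abs]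
    refine (norm_setIntegral_le_of_norm_le_const (by simp) hbound).trans_eq ?_
    rw [Real.volume_real_Icc_of_le hab]
    ring
  have hr : Filter.Tendsto (fun n : ℕ => ((n : ℝ) + 1)⁻¹) Filter.atTop (nhds 0) := by
    simpa using tendsto_one_div_add_atTop_nhds_zero_nat (𝕜 := ℝ)
  have l1 := ((lim0 b).sub (lim0 a)).abs
  have l2 := hr.mul_const (B * (8 + 4 * K) * K * (b - a))
  rw [zero_mul] at l2
  have := le_of_tendsto_of_tendsto' l1 l2 key
  linarith [abs_nonpos_iff.1 this]

end IsFlow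

/-- A real Schwartz function viewed as a complex-valued one. -/
def cx (f : 𝓢(ℝ, ℝ)) : 𝓢(ℝ, ℂ) := postcompCLM Complex.ofRealCLM f

theorem cx_apply (f : 𝓢(ℝ, ℝ)) (x : ℝ) : cx f x = f x := rfl

theorem FT_eq_fourier_cx (f : 𝓢(ℝ, ℝ)) : FT f = 𝓕 (cx f) := by
  rw [fourier_coe]
  rfl

theorem continuous_FT_schwartz (f : 𝓢(ℝ, ℝ)) : Continuous (FT f) := by
  rw [FT_eq_fourier_cx]
  exact (𝓕 (cx f)).continuous

theorem integral_norm_sq_FT (f : 𝓢(ℝ, ℝ)) : ∫ ξ, ‖FT f ξ‖ ^ 2 = ∫ x, f x ^ 2 := by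
  rw [FT_eq_fourier_cx, integral_norm_sq_fourier]
  simp [cx_apply]

theorem integrable_norm_sq_schwartz (f : 𝓢(ℝ, ℂ)) : Integrable fun ξ => ‖f ξ‖ ^ 2 :=
  (memLp_two_iff_integrable_sq_norm f.continuous.aestronglyMeasurable).1 (f.memLp 2)

theorem integrable_norm_sq_FT (f : 𝓢(ℝ, ℝ)) : Integrable fun ξ => ‖FT f ξ‖ ^ 2 := by
  rw [FT_eq_fourier_cx]
  exact integrable_norm_sq_schwartz _

theorem enorm_sq_eq_ofReal (z : ℂ) : ‖z‖ₑ ^ 2 = ENNReal.ofReal (‖z‖ ^ 2) := by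
  rw [← ofReal_norm, ENNReal.ofReal_pow (norm_nonneg z)]

theorem lintegral_enorm_sq_FT (f : 𝓢(ℝ, ℝ)) :
    ∫⁻ ξ, ‖FT f ξ‖ₑ ^ 2 = ENNReal.ofReal (∫ x, f x ^ 2) := by
  simp_rw [enorm_sq_eq_ofReal]
  rw [← integral_norm_sq_FT, ofReal_integral_eq_lintegral_ofReal (integrable_norm_sq_FT f)
    (Filter.Eventually.of_forall fun _ => by positivity)]

theorem FT_iteratedDeriv (f : 𝓢(ℝ, ℝ)) (n : ℕ) (ξ : ℝ) :
    FT (iteratedDeriv n f) ξ = (2 * π * Complex.I * ξ) ^ n * FT f ξ := by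
  induction n with
  | zero => simp
  | succ n ih =>
    obtain ⟨g, hg⟩ := exists_schwartz_iteratedDeriv f n
    obtain ⟨k, hk⟩ := exists_schwartz_iteratedDeriv f (n + 1)
    have e : deriv (fun x => (cx g x)) = fun x => (k x : ℂ) := by
      ext x
      rw [hk, iteratedDeriv_succ, ← hg]
      exact (g.differentiableAt.hasDerivAt.ofReal_comp).deriv
    have := congrFun (Real.fourier_deriv (f := cx g) (cx g).integrable (cx g).differentiable
      (by rw [e]; exact (cx k).integrable)) ξ
    rw [e] at this
    rw [← hk]
    refine this.trans ?_
    have e2 : 𝓕 (cx g : ℝ → ℂ) ξ = FT (iteratedDeriv n f) ξ := by rw [← hg]; rfl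
    rw [e2, ih, smul_eq_mul]
    ring

theorem ofReal_hOne_eq (f : 𝓢(ℝ, ℝ)) : ENNReal.ofReal (hOne f) =
    ∫⁻ ξ, ENNReal.ofReal ((1 + (2 * π) ^ 2 * |ξ| ^ 2) * ‖FT f ξ‖ ^ 2) := by
  obtain ⟨g, hg⟩ := exists_schwartz_iteratedDeriv f 1
  have h1 : ∀ ξ, (1 + (2 * π) ^ 2 * |ξ| ^ 2) * ‖FT f ξ‖ ^ 2 = ‖FT f ξ‖ ^ 2 + ‖FT g ξ‖ ^ 2 := by
    intro ξ
    have : ‖FT g ξ‖ = 2 * π * |ξ| * ‖FT f ξ‖ := by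
      rw [hg, FT_iteratedDeriv]
      simp [abs_of_pos pi_pos]
    rw [this]
    ring
  have i : Integrable fun ξ => ‖FT f ξ‖ ^ 2 + ‖FT g ξ‖ ^ 2 :=
    (integrable_norm_sq_FT f).add (integrable_norm_sq_FT g)
  simp_rw [h1]
  rw [← ofReal_integral_eq_lintegral_ofReal i
    (Filter.Eventually.of_forall fun ξ => add_nonneg (sq_nonneg _) (sq_nonneg _)),
    integral_add (integrable_norm_sq_FT f) (integrable_norm_sq_FT g), integral_norm_sq_FT,
    integral_norm_sq_FT, hg]
  unfold hOne
  rw [integral_add (integrable_schwartz_sq f) (integrable_iteratedDeriv_sq f 1)]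

theorem wSq_FT_le (f : 𝓢(ℝ, ℝ)) : wSq (FT f) ≤ 2 * ENNReal.ofReal (hOne f) := by
  rw [ofReal_hOne_eq, ← lintegral_const_mul' _ _ (by norm_num)]
  refine lintegral_mono fun ξ => ?_
  rw [← ofReal_norm, wt, ← ENNReal.ofReal_mul (by positivity), ← ENNReal.ofReal_pow (by positivity),
    neg_neg, Real.rpow_one]
  rw [show (2 : ℝ≥0∞) = ENNReal.ofReal 2 by simp, ← ENNReal.ofReal_mul (by norm_num)]
  refine ENNReal.ofReal_le_ofReal ?_
  have hp : 1 ≤ (2 * π) ^ 2 := by nlinarith [pi_gt_three]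
  have : (1 + |ξ|) ^ 2 ≤ 2 * (1 + (2 * π) ^ 2 * |ξ| ^ 2) := by
    nlinarith [sq_nonneg (|ξ| - 1), sq_nonneg |ξ|]
  calc ((1 + |ξ|) * ‖FT f ξ‖) ^ 2 = (1 + |ξ|) ^ 2 * ‖FT f ξ‖ ^ 2 := by ring
    _ ≤ 2 * (1 + (2 * π) ^ 2 * |ξ| ^ 2) * ‖FT f ξ‖ ^ 2 := by gcongr
    _ = 2 * ((1 + (2 * π) ^ 2 * |ξ| ^ 2) * ‖FT f ξ‖ ^ 2) := by ring

theorem hOne_le_wSq_FT (f : 𝓢(ℝ, ℝ)) : ENNReal.ofReal (hOne f) ≤ 65 * wSq (FT f) := by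
  rw [ofReal_hOne_eq, wSq, ← lintegral_const_mul' _ _ (by norm_num)]
  refine lintegral_mono fun ξ => ?_
  rw [← ofReal_norm, wt, ← ENNReal.ofReal_mul (by positivity), ← ENNReal.ofReal_pow (by positivity),
    neg_neg, Real.rpow_one]
  rw [show (65 : ℝ≥0∞) = ENNReal.ofReal 65 by simp, ← ENNReal.ofReal_mul (by norm_num)]
  refine ENNReal.ofReal_le_ofReal ?_
  have hp : (2 * π) ^ 2 ≤ 64 := by nlinarith [pi_le_four, pi_pos]
  have : 1 + (2 * π) ^ 2 * |ξ| ^ 2 ≤ 65 * (1 + |ξ|) ^ 2 := by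
    nlinarith [abs_nonneg ξ, sq_nonneg |ξ|]
  calc (1 + (2 * π) ^ 2 * |ξ| ^ 2) * ‖FT f ξ‖ ^ 2
      ≤ 65 * (1 + |ξ|) ^ 2 * ‖FT f ξ‖ ^ 2 := by gcongr
    _ = _ := by ring

open Convolution in
theorem FT_sq_eq (f : 𝓢(ℝ, ℝ)) (ξ : ℝ) :
    FT (fun x => f x ^ 2) ξ = ∫ η, FT f η * FT f (ξ - η) := by
  set g : 𝓢(ℝ, ℂ) := 𝓕 (cx f) with hg
  have e1 : ∀ x, 𝓕⁻ (convolution (ContinuousLinearMap.mul ℂ ℂ) g g) x = ((f x ^ 2 : ℝ) : ℂ) := by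
    intro x
    have i1 : ∀ h : 𝓢(ℝ, ℂ), 𝓕⁻ h x = 𝓕 h (-x) := fun h => by
      rw [fourierInv_coe, fourier_coe, Real.fourierInv_eq_fourier_neg]
    rw [i1, fourier_convolution]
    rw [pairing_apply_apply, ← i1, hg, FourierTransform.fourierInv_fourier_eq]
    simp [cx_apply, _root_.sq]
  have e2 : FT (fun x => f x ^ 2) =
      𝓕 (𝓕⁻ (convolution (ContinuousLinearMap.mul ℂ ℂ) g g)) := by
    rw [fourier_coe]
    unfold FT
    congr 1
    ext x
    exact (e1 x).symm
  rw [e2, FourierTransform.fourier_fourierInv_eq, convolution_apply, FT_eq_fourier_cx]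
  rfl

theorem lintegral_comp_div {g : ℝ → ℝ≥0∞} (hg : Measurable g) {ν : ℝ} (hν : ν ≠ 0) :
    ∫⁻ ζ, g (ζ / ν) = ENNReal.ofReal |ν| * ∫⁻ ξ, g ξ := by
  have h := Real.map_volume_mul_left (inv_ne_zero hν)
  rw [inv_inv] at h
  rw [← smul_eq_mul, ← lintegral_smul_measure, ← h, lintegral_map hg (by fun_prop)]
  simp_rw [div_eq_inv_mul]

theorem wSq_dilate_le {h w : ℝ → ℂ} (hw : Measurable w) {A ν : ℝ} (hA : 0 ≤ A) (hν : ν ≠ 0)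
    (he : ∀ ζ, ‖h ζ‖ₑ = ENNReal.ofReal A * ‖w (ζ / ν)‖ₑ) :
    wSq h ≤ ENNReal.ofReal (A ^ 2 * |ν| * (1 + |ν|) ^ 2) * wSq w := by
  have hm := hw.enorm
  calc wSq h = ∫⁻ ζ, (fun ξ => (wt (-1) (ν * ξ) * (ENNReal.ofReal A * ‖w ξ‖ₑ)) ^ 2) (ζ / ν) := by
        unfold wSq
        refine lintegral_congr fun ζ => ?_
        simp only [he, mul_div_cancel₀ ζ hν]
    _ = ENNReal.ofReal |ν| * ∫⁻ ξ, (wt (-1) (ν * ξ) * (ENNReal.ofReal A * ‖w ξ‖ₑ)) ^ 2 :=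
        lintegral_comp_div (g := fun ξ => (wt (-1) (ν * ξ) * (ENNReal.ofReal A * ‖w ξ‖ₑ)) ^ 2)
          (by fun_prop) hν
    _ ≤ ENNReal.ofReal |ν| * ∫⁻ ξ, ENNReal.ofReal ((1 + |ν|) * A) ^ 2 *
          (wt (-1) ξ * ‖w ξ‖ₑ) ^ 2 := by
        refine mul_le_mul' le_rfl (lintegral_mono fun ξ => ?_)
        have : wt (-1) (ν * ξ) ≤ ENNReal.ofReal (1 + |ν|) * wt (-1) ξ := by
          unfold wt
          rw [← ENNReal.ofReal_mul (by positivity), neg_neg, Real.rpow_one, Real.rpow_one, abs_mul]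
          refine ENNReal.ofReal_le_ofReal ?_
          nlinarith [abs_nonneg ν, abs_nonneg ξ]
        calc (wt (-1) (ν * ξ) * (ENNReal.ofReal A * ‖w ξ‖ₑ)) ^ 2
            ≤ (ENNReal.ofReal (1 + |ν|) * wt (-1) ξ * (ENNReal.ofReal A * ‖w ξ‖ₑ)) ^ 2 := by
              gcongr
          _ = _ := by
              rw [ENNReal.ofReal_mul (by positivity)]
              ring
    _ = _ := by
        rw [lintegral_const_mul _ (by fun_prop), ← mul_assoc, ← ENNReal.ofReal_pow (by positivity),
          ← ENNReal.ofReal_mul (by positivity), wSq]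
        congr 2
        ring

theorem le_wSq_dilate {h w : ℝ → ℂ} (hw : Measurable w) {A ν : ℝ} (hA : 0 ≤ A) (hν : ν ≠ 0)
    (hν1 : |ν| ≤ 1) (he : ∀ ζ, ‖h ζ‖ₑ = ENNReal.ofReal A * ‖w (ζ / ν)‖ₑ) :
    ENNReal.ofReal (A ^ 2 * |ν| ^ 3) * wSq w ≤ wSq h := by
  have hm := hw.enorm
  have e : wSq h = ENNReal.ofReal |ν| *
      ∫⁻ ξ, (wt (-1) (ν * ξ) * (ENNReal.ofReal A * ‖w ξ‖ₑ)) ^ 2 := by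
    rw [← lintegral_comp_div (by fun_prop) hν]
    unfold wSq
    refine lintegral_congr fun ζ => ?_
    simp only [he, mul_div_cancel₀ ζ hν]
  calc ENNReal.ofReal (A ^ 2 * |ν| ^ 3) * wSq w
      = ENNReal.ofReal |ν| * ∫⁻ ξ, ENNReal.ofReal (|ν| * A) ^ 2 * (wt (-1) ξ * ‖w ξ‖ₑ) ^ 2 := by
        rw [lintegral_const_mul _ (by fun_prop), ← mul_assoc, ← ENNReal.ofReal_pow (by positivity),
          ← ENNReal.ofReal_mul (by positivity), wSq]
        congr 2
        ring
    _ ≤ ENNReal.ofReal |ν| * ∫⁻ ξ, (wt (-1) (ν * ξ) * (ENNReal.ofReal A * ‖w ξ‖ₑ)) ^ 2 := by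
        refine mul_le_mul' le_rfl (lintegral_mono fun ξ => ?_)
        have : ENNReal.ofReal |ν| * wt (-1) ξ ≤ wt (-1) (ν * ξ) := by
          unfold wt
          rw [← ENNReal.ofReal_mul (by positivity), neg_neg, Real.rpow_one, Real.rpow_one, abs_mul]
          refine ENNReal.ofReal_le_ofReal ?_
          nlinarith [abs_nonneg ν, abs_nonneg ξ]
        calc _ = (ENNReal.ofReal |ν| * wt (-1) ξ * (ENNReal.ofReal A * ‖w ξ‖ₑ)) ^ 2 := by
              rw [ENNReal.ofReal_mul (by positivity)]
              ring
          _ ≤ _ := by gcongr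
    _ = wSq h := e.symm

theorem hSq_dilate_eq {h w : ℝ → ℂ} (hw : Measurable w) {A ν : ℝ} (hν : ν ≠ 0)
    (he : ∀ ζ, ‖h ζ‖ₑ = ENNReal.ofReal A * ‖w (ζ / ν)‖ₑ) :
    hSq 1 h = ENNReal.ofReal |ν| *
      ∫⁻ ξ, (ENNReal.ofReal (iw (ν * ξ))⁻¹ * (ENNReal.ofReal A * ‖w ξ‖ₑ)) ^ 2 := by
  have hm := hw.enorm
  have hi := measurable_iw
  rw [← lintegral_comp_div (by fun_prop) hν]
  unfold hSq
  refine lintegral_congr fun ζ => ?_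
  simp only [he, mul_div_cancel₀ ζ hν, Pi.one_apply, one_mul]

theorem mm_mul_ge {ν : ℝ} (hν : ν ≠ 0) (hν1 : |ν| ≤ 1) (ξ : ℝ) : |ν| * mm ξ ≤ mm (ν * ξ) := by
  have h0 := abs_pos.2 hν
  unfold mm
  rw [mul_max_of_nonneg _ _ h0.le, abs_mul, mul_inv]
  refine max_le_max le_rfl (mul_le_mul_of_nonneg_right ?_ (by positivity))
  exact hν1.trans ((one_le_inv₀ h0).2 hν1)

theorem hSq_dilate_le {h w : ℝ → ℂ} (hw : Measurable w) {ν : ℝ} (hν : ν ≠ 0) (hν1 : |ν| ≤ 1)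
    (he : ∀ ζ, ‖h ζ‖ₑ = ENNReal.ofReal |ν| * ‖w (ζ / ν)‖ₑ) :
    hSq 1 h ≤ ENNReal.ofReal |ν| * hSq 1 w := by
  have hm := hw.enorm
  have hi := measurable_iw
  have h0 := abs_pos.2 hν
  rw [hSq_dilate_eq hw hν he]
  unfold hSq
  refine mul_le_mul' le_rfl (lintegral_mono fun ξ => ?_)
  rw [← mul_assoc, ← ENNReal.ofReal_mul (inv_nonneg.2 (iw_nonneg _)), Pi.one_apply, one_mul]
  gcongr
  rcases eq_or_ne ξ 0 with rfl | hξ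
  · simp [iw]
  have hpos : 0 < iw ξ := iw_pos hξ
  have hpos2 : 0 < iw (ν * ξ) := iw_pos (mul_ne_zero hν hξ)
  rw [inv_mul_eq_div, div_le_iff₀ hpos2, ← div_eq_inv_mul, le_div_iff₀ hpos]
  refine le_of_sq_le_sq ?_ hpos2.le
  rw [mul_pow, iw_sq, iw_sq, abs_mul]
  have hmm := one_le_mm hξ
  have h2 : mm ξ ^ (1 / 24 : ℝ) * |ν| ≤ mm (ν * ξ) ^ (1 / 24 : ℝ) := by
    calc mm ξ ^ (1 / 24 : ℝ) * |ν| ≤ mm ξ ^ (1 / 24 : ℝ) * |ν| ^ (1 / 24 : ℝ) := by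
          gcongr
          calc |ν| = |ν| ^ (1 : ℝ) := (Real.rpow_one _).symm
            _ ≤ _ := Real.rpow_le_rpow_of_exponent_ge h0 hν1 (by norm_num)
      _ = (|ν| * mm ξ) ^ (1 / 24 : ℝ) := by
          rw [Real.mul_rpow h0.le (mm_nonneg ξ), mul_comm]
      _ ≤ _ := Real.rpow_le_rpow (mul_nonneg h0.le (mm_nonneg ξ)) (mm_mul_ge hν hν1 ξ)
        (by norm_num)
  calc |ν| ^ 2 * (|ξ| * mm ξ ^ (1 / 24 : ℝ)) = |ν| * |ξ| * (mm ξ ^ (1 / 24 : ℝ) * |ν|) := by ring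
    _ ≤ _ := by gcongr

theorem norm_FT_sq_le (f : 𝓢(ℝ, ℝ)) (ξ : ℝ) :
    ‖FT (fun x => f x ^ 2) ξ‖ ≤ ∫ x, f x ^ 2 := by
  refine (norm_fourier_le _ ξ).trans_eq ?_
  refine integral_congr_ae (Filter.Eventually.of_forall fun x => ?_)
  simp

namespace IsFlow

variable {T : ℝ} {v : ℝ → 𝓢(ℝ, ℝ)} (hv : IsFlow T v)
include hv

theorem measurable_FT : Measurable fun p : ℝ × ℝ => FT (v p.1) p.2 := by
  have hc := hv.continuous_uncurry
  have h2 : Continuous fun q : (ℝ × ℝ) × ℝ => v q.1.1 q.2 :=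
    hc.comp (f := fun q : (ℝ × ℝ) × ℝ => (q.1.1, q.2)) (by fun_prop)
  simp_rw [FT_eq]
  refine StronglyMeasurable.measurable (StronglyMeasurable.integral_prod_right'
    (f := fun q : (ℝ × ℝ) × ℝ => Complex.exp (((-2 * π * q.1.2 : ℝ) * Complex.I) * q.2) *
      v q.1.1 q.2) ?_)
  refine Continuous.stronglyMeasurable ?_
  fun_prop

theorem duhamel_signed {a b : ℝ} (ha : a ∈ Icc 0 T) (hb : b ∈ Icc 0 T) {K : ℝ}
    (hK : ∀ t ∈ uIcc a b, ∫ x, v t x ^ 2 ≤ K) (ξ : ℝ) :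
    Complex.exp ((-(8 * π ^ 3 * ξ ^ 3) * b : ℝ) * Complex.I) * FT (v b) ξ -
      Complex.exp ((-(8 * π ^ 3 * ξ ^ 3) * a : ℝ) * Complex.I) * FT (v a) ξ =
    ∫ t in a..b, Complex.exp ((-(8 * π ^ 3 * ξ ^ 3) * t : ℝ) * Complex.I) *
      (6 * π * ξ * Complex.I * FT (fun x => v t x ^ 2) ξ) := by
  rcases le_total a b with h | h
  · rw [uIcc_of_le h] at hK
    rw [intervalIntegral.integral_of_le h, ← integral_Icc_eq_integral_Ioc]
    exact hv.duhamel ha.1 h hb.2 hK ξ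
  · rw [uIcc_of_ge h] at hK
    rw [intervalIntegral.integral_of_ge h, ← integral_Icc_eq_integral_Ioc,
      ← hv.duhamel hb.1 h ha.2 hK ξ]
    ring

end IsFlow

/-- The rescaled profile of a flow: frequency dilated by `ν`, time running from `s` and stopped at
rescaled time `σ`. -/
def resc (v : ℝ → 𝓢(ℝ, ℝ)) (A ν s σ τ ζ : ℝ) : ℂ :=
  A * FT (v (s + ν ^ 3 / (4 * π ^ 2) * min τ σ)) (ζ / ν) *
    Complex.exp ((-2 * π * (min τ σ * ζ ^ 3) : ℝ) * Complex.I)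

theorem enorm_resc {A : ℝ} (hA : 0 ≤ A) (v : ℝ → 𝓢(ℝ, ℝ)) (ν s σ τ ζ : ℝ) :
    ‖resc v A ν s σ τ ζ‖ₑ =
      ENNReal.ofReal A * ‖FT (v (s + ν ^ 3 / (4 * π ^ 2) * min τ σ)) (ζ / ν)‖ₑ := by
  unfold resc
  rw [enorm_mul, enorm_mul]
  have : ‖Complex.exp ((-2 * π * (min τ σ * ζ ^ 3) : ℝ) * Complex.I)‖ₑ = 1 := by
    rw [← ofReal_norm, Complex.norm_exp_ofReal_mul_I, ENNReal.ofReal_one]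
  rw [this, mul_one, ← ofReal_norm, Complex.norm_real, Real.norm_of_nonneg hA]

theorem bil_resc {A ν s σ : ℝ} (hν : ν ≠ 0) (v : ℝ → 𝓢(ℝ, ℝ)) {τ : ℝ} (hτ : τ ≤ σ) (ζ : ℝ) :
    bil (resc v A ν s σ) (resc v A ν s σ) τ ζ =
      A ^ 2 * |ν| * (Complex.exp ((-2 * π * (τ * ζ ^ 3) : ℝ) * Complex.I) *
        FT (fun x => v (s + ν ^ 3 / (4 * π ^ 2) * τ) x ^ 2) (ζ / ν)) := by
  rw [FT_sq_eq]
  set w := FT (v (s + ν ^ 3 / (4 * π ^ 2) * τ)) with hw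
  have e := Measure.integral_comp_mul_left (fun η => w (η / ν) * w ((ζ - η) / ν)) ν
  have e2 : ∀ η, w (ν * η / ν) * w ((ζ - ν * η) / ν) = w η * w (ζ / ν - η) := fun η => by
    rw [mul_div_cancel_left₀ _ hν, sub_div, mul_div_cancel_left₀ _ hν]
  simp_rw [e2] at e
  have e3 : ∫ η, w (η / ν) * w ((ζ - η) / ν) = |ν| * ∫ η, w η * w (ζ / ν - η) := by
    rw [e, Complex.real_smul, ← mul_assoc, abs_inv, ← Complex.ofReal_mul,
      mul_inv_cancel₀ (abs_ne_zero.2 hν)]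
    simp
  unfold bil
  calc _ = ∫ η, A ^ 2 * Complex.exp ((-2 * π * (τ * ζ ^ 3) : ℝ) * Complex.I) *
        (w (η / ν) * w ((ζ - η) / ν)) := by
        refine integral_congr_ae (Filter.Eventually.of_forall fun η => ?_)
        simp only [resc, min_eq_left hτ, ← hw]
        have : Complex.exp ((-2 * π * (τ * ζ ^ 3) : ℝ) * Complex.I) =
            Complex.exp ((-2 * π * τ * (3 * ζ * η * (ζ - η)) : ℝ) * Complex.I) *
            (Complex.exp ((-2 * π * (τ * η ^ 3) : ℝ) * Complex.I) *
            Complex.exp ((-2 * π * (τ * (ζ - η) ^ 3) : ℝ) * Complex.I)) := by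
          rw [← Complex.exp_add, ← Complex.exp_add]
          congr 1
          push_cast
          ring
        rw [this]
        ring
    _ = _ := by
        rw [integral_const_mul, e3]
        ring

theorem IsFlow.isSol_resc {T : ℝ} {v : ℝ → 𝓢(ℝ, ℝ)} (hv : IsFlow T v) {A ν s σ K : ℝ} (hA : 0 < A)
    (hν : ν ≠ 0) (hνA : |ν| ≤ A) (hσ : σ ∈ Icc (0 : ℝ) 1) (hs : s ∈ Icc 0 T)
    (hs' : s + ν ^ 3 / (4 * π ^ 2) * σ ∈ Icc 0 T)
    (hK : ∀ t ∈ uIcc s (s + ν ^ 3 / (4 * π ^ 2) * σ), hOne (v t) ≤ K) :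
    ∃ K', IsSol (3 * |ν| / (2 * π * A)) (resc v A ν s σ) K' σ := by
  set c := ν ^ 3 / (4 * π ^ 2) with hc
  have hmem : ∀ τ, τ ∈ Icc 0 σ → s + c * τ ∈ uIcc s (s + c * σ) := by
    intro τ hτ
    rcases le_total 0 c with h | h
    · rw [uIcc_of_le (by nlinarith [hτ.1, hτ.2])]
      exact ⟨by nlinarith [hτ.1], by nlinarith [hτ.2]⟩
    · rw [uIcc_of_ge (by nlinarith [hτ.1, hτ.2])]
      exact ⟨by nlinarith [hτ.2], by nlinarith [hτ.1]⟩
  have hL2 : ∀ t ∈ uIcc s (s + c * σ), ∫ x, v t x ^ 2 ≤ K := fun t ht => by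
    refine le_trans ?_ (hK t ht)
    exact integral_mono (integrable_schwartz_sq _) (integrable_hOne _) fun x =>
      le_add_of_nonneg_right (sq_nonneg _)
  have hsub : uIcc s (s + c * σ) ⊆ Icc 0 T := by
    intro t ht
    exact ⟨(le_inf hs.1 hs'.1).trans ht.1, ht.2.trans (sup_le hs.2 hs'.2)⟩
  refine ⟨ENNReal.ofReal (A ^ 2 * |ν| * (1 + |ν|) ^ 2) * (2 * ENNReal.ofReal K), ?_⟩
  refine { meas := ?_, lt_top := ?_, le := ?_, abs_le := ?_, nonneg := hσ.1, le_one := hσ.2,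
           eq := ?_ }
  · unfold resc
    have h1 : Measurable fun p : ℝ × ℝ => FT (v (s + ν ^ 3 / (4 * π ^ 2) * min p.1 σ)) (p.2 / ν) :=
      hv.measurable_FT.comp
        (g := fun q : ℝ × ℝ => FT (v q.1) q.2)
        (f := fun p : ℝ × ℝ => (s + ν ^ 3 / (4 * π ^ 2) * min p.1 σ, p.2 / ν)) (by fun_prop)
    fun_prop
  · finiteness
  · intro τ hτ
    refine (wSq_dilate_le (continuous_FT_schwartz _).measurable hA.le hν
      (enorm_resc hA.le v ν s σ τ)).trans ?_
    gcongr
    refine (wSq_FT_le _).trans ?_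
    gcongr
    exact hK _ (hmem _ ⟨le_min hτ.1 hσ.1, min_le_right _ _⟩)
  · rw [abs_of_nonneg (by positivity), div_le_one (by positivity)]
    nlinarith [pi_gt_three]
  · intro τ hτ ζ
    have hd := hv.duhamel_signed hs (hsub (hmem τ hτ)) (K := K) (fun t ht => hL2 t
      (uIcc_subset_uIcc left_mem_uIcc (hmem τ hτ) ht)) (ζ / ν)
    have hph : ∀ r : ℝ, Complex.exp ((-(8 * π ^ 3 * (ζ / ν) ^ 3) * (s + c * r) : ℝ) * Complex.I) =
        Complex.exp ((-(8 * π ^ 3 * (ζ / ν) ^ 3) * s : ℝ) * Complex.I) *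
        Complex.exp ((-2 * π * (r * ζ ^ 3) : ℝ) * Complex.I) := fun r => by
      rw [← Complex.exp_add, ← add_mul, ← Complex.ofReal_add]
      congr 3
      rw [hc]
      field_simp
      ring
    set E := Complex.exp ((-(8 * π ^ 3 * (ζ / ν) ^ 3) * s : ℝ) * Complex.I) with hE
    have hE0 : E ≠ 0 := Complex.exp_ne_zero _
    have hsubst := intervalIntegral.smul_integral_comp_add_mul (a := 0) (b := τ)
      (fun t => Complex.exp ((-(8 * π ^ 3 * (ζ / ν) ^ 3) * t : ℝ) * Complex.I) *
      (6 * π * (ζ / ν : ℝ) * Complex.I * FT (fun x => v t x ^ 2) (ζ / ν))) c s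
    rw [mul_zero, add_zero] at hsubst
    rw [← hsubst] at hd
    simp_rw [hph] at hd
    have hmin0 : min (0 : ℝ) σ = 0 := min_eq_left hσ.1
    rw [integral_Icc_eq_integral_Ioc, ← intervalIntegral.integral_of_le hτ.1]
    have hb : ∫ r in (0 : ℝ)..τ, Complex.I * ((3 * |ν| / (2 * π * A) : ℝ) : ℂ) *
        bil (resc v A ν s σ) (resc v A ν s σ) r ζ =
        ∫ r in (0 : ℝ)..τ, (Complex.I * ((3 * |ν| / (2 * π * A) : ℝ) : ℂ) * (A ^ 2 * |ν|)) *
        (Complex.exp ((-2 * π * (r * ζ ^ 3) : ℝ) * Complex.I) *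
        FT (fun x => v (s + c * r) x ^ 2) (ζ / ν)) := by
      refine intervalIntegral.integral_congr fun r hr => ?_
      rw [uIcc_of_le hτ.1] at hr
      rw [bil_resc hν v (hr.2.trans hτ.2)]
      ring
    rw [hb, intervalIntegral.integral_const_mul]
    have hd2 : ∫ r in (0 : ℝ)..τ, E * Complex.exp ((-2 * π * (r * ζ ^ 3) : ℝ) * Complex.I) *
        (6 * π * (ζ / ν : ℝ) * Complex.I * FT (fun x => v (s + c * r) x ^ 2) (ζ / ν)) =
        (E * (6 * π * (ζ / ν : ℝ) * Complex.I)) *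
        ∫ r in (0 : ℝ)..τ, Complex.exp ((-2 * π * (r * ζ ^ 3) : ℝ) * Complex.I) *
          FT (fun x => v (s + c * r) x ^ 2) (ζ / ν) := by
      rw [← intervalIntegral.integral_const_mul]
      refine intervalIntegral.integral_congr fun r hr => ?_
      ring
    rw [hd2] at hd
    set J := ∫ r in (0 : ℝ)..τ, Complex.exp ((-2 * π * (r * ζ ^ 3) : ℝ) * Complex.I) *
          FT (fun x => v (s + c * r) x ^ 2) (ζ / ν)
    unfold resc
    rw [hmin0, min_eq_left hτ.2, ← hc, mul_zero, add_zero, zero_mul, mul_zero, Complex.ofReal_zero,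
      zero_mul, Complex.exp_zero, mul_one]
    have hd3 : Complex.exp ((-2 * π * (τ * ζ ^ 3) : ℝ) * Complex.I) * FT (v (s + c * τ)) (ζ / ν) -
        FT (v s) (ζ / ν) = c * (6 * π * (ζ / ν : ℝ) * Complex.I * J) := by
      refine mul_left_cancel₀ hE0 ?_
      rw [Complex.real_smul] at hd
      linear_combination hd
    have hk : (ζ : ℂ) * (Complex.I * ((3 * |ν| / (2 * π * A) : ℝ) : ℂ) * (A ^ 2 * |ν|) * J) =
        A * (c * (6 * π * (ζ / ν : ℝ) * Complex.I * J)) := by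
      have : 3 * |ν| / (2 * π * A) * (A ^ 2 * |ν|) = A * (c * (6 * π / ν)) := by
        rw [hc]
        have h2 : |ν| * |ν| = ν * ν := abs_mul_abs_self ν
        field_simp
        linear_combination 12 * h2
      have h3 := congrArg (fun r : ℝ => (r : ℂ)) this
      push_cast at h3 ⊢
      linear_combination (ζ * Complex.I * J) * h3
    rw [hk, ← hd3]
    ring

theorem iw_inv_sq_le (ξ : ℝ) : ENNReal.ofReal (iw ξ)⁻¹ ^ 2 ≤
    (Metric.ball (0 : ℝ) 1).indicator (fun ξ => ENNReal.ofReal (|ξ| ^ (-(23 / 24) : ℝ))) ξ + 1 := by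
  rcases eq_or_ne ξ 0 with rfl | hξ
  · simp [iw]
  have h0 := abs_pos.2 hξ
  rw [← ENNReal.ofReal_pow (inv_nonneg.2 (iw_nonneg _)), inv_pow, iw_sq]
  by_cases h : |ξ| < 1
  · rw [indicator_of_mem (by simpa using h)]
    refine le_add_right (ENNReal.ofReal_le_ofReal ?_)
    have hm : mm ξ = |ξ|⁻¹ := max_eq_right (h.le.trans ((one_le_inv₀ h0).2 h.le))
    rw [hm, Real.inv_rpow h0.le, ← Real.rpow_neg h0.le, ← Real.rpow_neg_one]
    nth_rewrite 1 [← Real.rpow_one |ξ|]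
    rw [← Real.rpow_add h0, ← Real.rpow_mul h0.le]
    norm_num
  · rw [indicator_of_notMem (by simpa using h), zero_add]
    refine (ENNReal.ofReal_le_ofReal (inv_le_one_of_one_le₀ ?_)).trans_eq ENNReal.ofReal_one
    exact one_le_mul_of_one_le_of_one_le (not_lt.1 h) (Real.one_le_rpow (one_le_mm hξ) (by norm_num))

/-- A weighted norm with a mild low-frequency singularity is controlled by low-frequency bounds
and the `L²` norm. -/
theorem exists_hSq_one_le : ∃ C : NNReal, ∀ {h : ℝ → ℂ}, Measurable h → ∀ {D : ℝ≥0∞},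
    (∀ ξ, |ξ| < 1 → ‖h ξ‖ₑ ≤ D) → hSq 1 h ≤ C * D ^ 2 + ∫⁻ ξ, ‖h ξ‖ₑ ^ 2 := by
  have hi : IntegrableOn (fun x : ℝ => |x| ^ (-(23 / 24) : ℝ)) (Metric.ball 0 1) :=
    integrableOn_ball_of_norm_le_rpow (C := 1) (α := 23 / 24) (by simp) (by simp; norm_num)
      (Filter.Eventually.of_forall fun x => by
        rw [Real.norm_of_nonneg (by positivity), one_mul, Real.norm_eq_abs])
      (Measurable.pow_const (by fun_prop) _).aestronglyMeasurable
  have hfin := hi.lintegral_lt_top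
  lift (∫⁻ x in Metric.ball (0 : ℝ) 1, ENNReal.ofReal (|x| ^ (-(23 / 24) : ℝ))) to NNReal
    using hfin.ne with C hC
  refine ⟨C, fun {h} hh {D} hD => ?_⟩
  have hm := hh.enorm
  have hmI : Measurable ((Metric.ball (0 : ℝ) 1).indicator
      (fun ξ => ENNReal.ofReal (|ξ| ^ (-(23 / 24) : ℝ)))) :=
    Measurable.indicator (by fun_prop) Metric.isOpen_ball.measurableSet
  calc hSq 1 h ≤ ∫⁻ ξ, ((Metric.ball (0 : ℝ) 1).indicator
        (fun ξ => ENNReal.ofReal (|ξ| ^ (-(23 / 24) : ℝ))) ξ * D ^ 2 + ‖h ξ‖ₑ ^ 2) := by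
        refine lintegral_mono fun ξ => ?_
        rw [Pi.one_apply, one_mul, mul_pow]
        refine (mul_le_mul' (iw_inv_sq_le ξ) le_rfl).trans ?_
        rw [add_mul, one_mul]
        gcongr ?_ + _
        by_cases hξ : ξ ∈ Metric.ball (0 : ℝ) 1
        · gcongr
          exact hD ξ (by simpa using hξ)
        · rw [indicator_of_notMem hξ, zero_mul, zero_mul]
    _ = _ := by
        rw [lintegral_add_left (by fun_prop), lintegral_mul_const _ hmI,
          lintegral_indicator Metric.isOpen_ball.measurableSet, hC]

/-- Local propagation of `H¹` bounds on a time scale depending only on the size of a weighted norm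
of the data. -/
theorem exists_wSq_FT_le (A : NNReal) : ∃ C : NNReal, ∃ δ : ℝ, 0 < δ ∧
    ∀ {T : ℝ} {v : ℝ → 𝓢(ℝ, ℝ)}, IsFlow T v → ∀ s ∈ Icc 0 T, ∀ t ∈ Icc 0 T, |t - s| ≤ δ →
    (∃ K, ∀ r ∈ uIcc s t, hOne (v r) ≤ K) → hSq 1 (FT (v s)) ≤ A →
    wSq (FT (v t)) ≤ C * (A + wSq (FT (v s))) := by
  obtain ⟨C, c₀, hc₀, h⟩ := exists_wSq_le
  set ν₀ : ℝ := min 1 (c₀ / (A + 1)) with hν₀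
  have hpos : 0 < ν₀ := lt_min one_pos (by positivity)
  have h1 : ν₀ ≤ 1 := min_le_left _ _
  have hνA : ν₀ * A ≤ c₀ := by
    have : ν₀ ≤ c₀ / (A + 1) := min_le_right _ _
    rw [le_div_iff₀ (by positivity)] at this
    nlinarith [A.2]
  refine ⟨(ν₀ ^ 5)⁻¹.toNNReal * (C * 4), ν₀ ^ 3 / (4 * π ^ 2), by positivity, ?_⟩
  intro T v hv s hs t ht hst hK hA
  obtain ⟨K, hK⟩ := hK
  set δ := ν₀ ^ 3 / (4 * π ^ 2) with hδ
  have hδ0 : 0 < δ := by positivity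
  obtain ⟨ν, hν, he⟩ : ∃ ν : ℝ, |ν| = ν₀ ∧ s + ν ^ 3 / (4 * π ^ 2) * (|t - s| / δ) = t := by
    rcases le_total s t with h | h
    · refine ⟨ν₀, abs_of_pos hpos, ?_⟩
      rw [← hδ, mul_div_cancel₀ _ hδ0.ne', abs_of_nonneg (by linarith)]
      ring
    · refine ⟨-ν₀, by rw [abs_neg, abs_of_pos hpos], ?_⟩
      rw [show (-ν₀) ^ 3 / (4 * π ^ 2) = -δ by rw [hδ]; ring, neg_mul,
        mul_div_cancel₀ _ hδ0.ne', abs_of_nonpos (by linarith)]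
      ring
  have hν0 : ν ≠ 0 := abs_pos.1 (hν ▸ hpos)
  have hσ : |t - s| / δ ∈ Icc (0 : ℝ) 1 := ⟨by positivity, (div_le_one hδ0).2 hst⟩
  obtain ⟨K', hsol⟩ := hv.isSol_resc (A := ν₀) (σ := |t - s| / δ) hpos hν0 hν.le hσ hs
    (by rw [he]; exact ht) (by rw [he]; exact hK)
  have hmeas : ∀ r, Measurable (FT (v r)) := fun r => (continuous_FT_schwartz _).measurable
  have hen0 : ∀ ζ, ‖resc v ν₀ ν s (|t - s| / δ) 0 ζ‖ₑ =
      ENNReal.ofReal ν₀ * ‖FT (v s) (ζ / ν)‖ₑ := fun ζ => by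
    rw [enorm_resc hpos.le, min_eq_left hσ.1, mul_zero, add_zero]
  have hen1 : ∀ ζ, ‖resc v ν₀ ν s (|t - s| / δ) (|t - s| / δ) ζ‖ₑ =
      ENNReal.ofReal ν₀ * ‖FT (v t) (ζ / ν)‖ₑ := fun ζ => by
    rw [enorm_resc hpos.le, min_self, he]
  have hS : hSq 1 (resc v ν₀ ν s (|t - s| / δ) 0) ≤ ENNReal.ofReal ν₀ * A := by
    have := hSq_dilate_le (hmeas s) hν0 (hν.le.trans h1) (by rw [hν]; exact hen0)
    rw [hν] at this
    exact this.trans (mul_le_mul' le_rfl hA)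
  have hS1 : hSq 1 (resc v ν₀ ν s (|t - s| / δ) 0) ≤ c₀ := by
    refine hS.trans ?_
    rw [← ENNReal.ofReal_coe_nnreal (p := A), ← ENNReal.ofReal_mul hpos.le,
      ← ENNReal.ofReal_coe_nnreal (p := c₀)]
    exact ENNReal.ofReal_le_ofReal hνA
  have hS2 : hSq 1 (resc v ν₀ ν s (|t - s| / δ) 0) ≤ 4 * A := by
    refine hS.trans (mul_le_mul' ?_ le_rfl)
    refine (ENNReal.ofReal_le_ofReal h1).trans ?_
    norm_num
  have hW0 : wSq (resc v ν₀ ν s (|t - s| / δ) 0) ≤ 4 * wSq (FT (v s)) := by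
    refine (wSq_dilate_le (hmeas s) hpos.le hν0 hen0).trans (mul_le_mul' ?_ le_rfl)
    rw [hν, show (4 : ℝ≥0∞) = ENNReal.ofReal 4 by simp]
    refine ENNReal.ofReal_le_ofReal ?_
    calc ν₀ ^ 2 * ν₀ * (1 + ν₀) ^ 2 ≤ 1 ^ 2 * 1 * (1 + 1) ^ 2 := by gcongr
      _ = 4 := by norm_num
  have hW1 := le_wSq_dilate (hmeas t) hpos.le hν0 (hν.le.trans h1) hen1
  have key := h hsol hS1 (|t - s| / δ) ⟨hσ.1, le_rfl⟩
  have h5 : ENNReal.ofReal (ν₀ ^ 5) * wSq (FT (v t)) ≤ C * 4 * (A + wSq (FT (v s))) := by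
    rw [hν, ← pow_add] at hW1
    refine (hW1.trans key).trans ?_
    calc _ ≤ (C : ℝ≥0∞) * (4 * A + 4 * wSq (FT (v s))) := by gcongr
      _ = _ := by ring
  have hp5 : 0 < ν₀ ^ 5 := by positivity
  calc wSq (FT (v t)) = ENNReal.ofReal (ν₀ ^ 5)⁻¹ * (ENNReal.ofReal (ν₀ ^ 5) * wSq (FT (v t))) := by
        rw [← mul_assoc, ← ENNReal.ofReal_mul (by positivity), inv_mul_cancel₀ hp5.ne',
          ENNReal.ofReal_one, one_mul]
    _ ≤ ENNReal.ofReal (ν₀ ^ 5)⁻¹ * (C * 4 * (A + wSq (FT (v s)))) := by gcongr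
    _ = _ := by
        rw [← mul_assoc, ENNReal.ofReal]
        push_cast
        rfl

open Filter Topology in
/-- The flow is bounded in `H¹` near the time `t`. -/
def LocBdd (v : ℝ → 𝓢(ℝ, ℝ)) (t : ℝ) : Prop := ∃ K, ∀ᶠ r in 𝓝 t, hOne (v r) ≤ K

theorem exists_hOne_le_of_locBdd {v : ℝ → 𝓢(ℝ, ℝ)} {S : Set ℝ} (hS : IsCompact S)
    (h : ∀ r ∈ S, LocBdd v r) : ∃ K, ∀ r ∈ S, hOne (v r) ≤ K := by
  refine hS.induction_on (p := fun S => ∃ K, ∀ r ∈ S, hOne (v r) ≤ K) ⟨0, by simp⟩ ?_ ?_ ?_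
  · rintro s t hst ⟨K, hK⟩
    exact ⟨K, fun r hr => hK r (hst hr)⟩
  · rintro s t ⟨K, hK⟩ ⟨L, hL⟩
    refine ⟨max K L, fun r hr => ?_⟩
    rcases hr with hr | hr
    · exact (hK r hr).trans (le_max_left _ _)
    · exact (hL r hr).trans (le_max_right _ _)
  · intro x hx
    obtain ⟨K, hK⟩ := h x hx
    exact ⟨_, mem_nhdsWithin_of_mem_nhds hK, K, fun r hr => hr⟩

/-- A lower semicontinuous quantity controlling the mass and the `H¹` norm. -/
def massH (f : ℝ → ℝ) : ℝ≥0∞ :=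
  ∫⁻ x, ENNReal.ofReal (|f x| + f x ^ 2 + iteratedDeriv 1 f x ^ 2)

theorem massH_lt_top (f : 𝓢(ℝ, ℝ)) : massH f < ∞ := by
  have i1 : Integrable fun x => |f x| := f.integrable.abs
  have i : Integrable fun x => |f x| + f x ^ 2 + iteratedDeriv 1 f x ^ 2 :=
    (i1.add (integrable_schwartz_sq f)).add (integrable_iteratedDeriv_sq f 1)
  exact i.lintegral_lt_top

theorem ofReal_hOne_le_massH (f : 𝓢(ℝ, ℝ)) : ENNReal.ofReal (hOne f) ≤ massH f := by
  unfold hOne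
  rw [ofReal_integral_eq_lintegral_ofReal (integrable_hOne f)
    (Filter.Eventually.of_forall fun x => add_nonneg (sq_nonneg _) (sq_nonneg _))]
  refine lintegral_mono fun x => ENNReal.ofReal_le_ofReal ?_
  linarith [abs_nonneg (f x)]

theorem enorm_FT_le_massH (f : 𝓢(ℝ, ℝ)) (ξ : ℝ) : ‖FT f ξ‖ₑ ≤ massH f := by
  rw [← ofReal_norm]
  refine (ENNReal.ofReal_le_ofReal (norm_fourier_le _ ξ)).trans ?_
  have i1 : Integrable fun x => ‖(f x : ℂ)‖ := (f.integrable.ofReal (𝕜 := ℂ)).norm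
  rw [ofReal_integral_eq_lintegral_ofReal i1 (Filter.Eventually.of_forall fun x => norm_nonneg _)]
  refine lintegral_mono fun x => ENNReal.ofReal_le_ofReal ?_
  rw [Complex.norm_real, Real.norm_eq_abs]
  linarith [sq_nonneg (f x), sq_nonneg (iteratedDeriv 1 f x)]

theorem hOne_le_of_wSq_le {f : 𝓢(ℝ, ℝ)} {W : NNReal} (h : wSq (FT f) ≤ W) : hOne f ≤ 65 * W := by
  have := (hOne_le_wSq_FT f).trans (mul_le_mul' le_rfl h)
  refine (ENNReal.ofReal_le_ofReal_iff (by positivity)).1 (this.trans_eq ?_)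
  rw [ENNReal.ofReal_mul (by norm_num), ENNReal.ofReal_coe_nnreal]
  simp

theorem integral_sq_le_hOne (f : 𝓢(ℝ, ℝ)) : ∫ x, f x ^ 2 ≤ hOne f :=
  integral_mono (integrable_schwartz_sq _) (integrable_hOne _) fun _ =>
    le_add_of_nonneg_right (sq_nonneg _)

theorem wSq_FT_lt_top (f : 𝓢(ℝ, ℝ)) : wSq (FT f) < ∞ :=
  (wSq_FT_le f).trans_lt (by finiteness)

namespace IsFlow
variable {T : ℝ} {v : ℝ → 𝓢(ℝ, ℝ)} (hv : IsFlow T v)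
include hv

theorem integral_sq_eq_uIcc {a b : ℝ} (ha : a ∈ Icc 0 T) (hb : b ∈ Icc 0 T) {K : ℝ}
    (hK : ∀ t ∈ uIcc a b, hOne (v t) ≤ K) : ∫ x, v a x ^ 2 = ∫ x, v b x ^ 2 := by
  rcases le_total a b with h | h
  · rw [uIcc_of_le h] at hK
    exact (hv.integral_sq_eq ha.1 h hb.2 hK).symm
  · rw [uIcc_of_ge h] at hK
    exact hv.integral_sq_eq hb.1 h ha.2 hK

theorem norm_FT_le {a b : ℝ} (ha : a ∈ Icc 0 T) (hb : b ∈ Icc 0 T) {K : ℝ}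
    (hK : ∀ t ∈ uIcc a b, hOne (v t) ≤ K) (ξ : ℝ) :
    ‖FT (v b) ξ‖ ≤ ‖FT (v a) ξ‖ + 6 * π * |ξ| * (∫ x, v a x ^ 2) * |b - a| := by
  have hd := hv.duhamel_signed ha hb (fun t ht => (integral_sq_le_hOne (v t)).trans (hK t ht)) ξ
  have hI : ‖∫ t in a..b, Complex.exp ((-(8 * π ^ 3 * ξ ^ 3) * t : ℝ) * Complex.I) *
      (6 * π * ξ * Complex.I * FT (fun x => v t x ^ 2) ξ)‖ ≤
      (6 * π * |ξ| * (∫ x, v a x ^ 2)) * |b - a| := by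
    refine intervalIntegral.norm_integral_le_of_norm_le_const fun t ht => ?_
    have ht' : t ∈ uIcc a b := uIoc_subset_uIcc ht
    have hsub : uIcc a b ⊆ Icc 0 T := (convex_Icc 0 T).ordConnected.uIcc_subset ha hb
    rw [norm_mul, Complex.norm_exp_ofReal_mul_I, one_mul, norm_mul]
    have e : ‖(6 * π * ξ * Complex.I : ℂ)‖ = 6 * π * |ξ| := by
      simp [abs_of_pos Real.pi_pos]
    rw [e]
    gcongr
    refine (norm_FT_sq_le (v t) ξ).trans_eq ?_
    exact hv.integral_sq_eq_uIcc (hsub ht') ha (K := K) fun r hr =>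
      hK r (uIcc_subset_uIcc ht' left_mem_uIcc hr)
  rw [← hd] at hI
  have e1 : ∀ c (z : ℂ), ‖Complex.exp ((c : ℝ) * Complex.I) * z‖ = ‖z‖ := fun c z => by
    rw [norm_mul, Complex.norm_exp_ofReal_mul_I, one_mul]
  have h3 := norm_le_insert'
    (Complex.exp ((-(8 * π ^ 3 * ξ ^ 3) * b : ℝ) * Complex.I) * FT (v b) ξ)
    (Complex.exp ((-(8 * π ^ 3 * ξ ^ 3) * a : ℝ) * Complex.I) * FT (v a) ξ)
  rw [e1, e1] at h3
  linarith

theorem exists_hOne_le_uIcc {s t : ℝ} (hs : s ∈ Icc 0 T) (ht : t ∈ Icc 0 T)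
    (h : ∀ r ∈ uIcc s t, r ≠ s → LocBdd v r) : ∃ K, ∀ r ∈ uIcc s t, hOne (v r) ≤ K := by
  have hsub : uIcc s t ⊆ Icc 0 T := (convex_Icc 0 T).ordConnected.uIcc_subset hs ht
  rcases eq_or_ne s t with rfl | hst
  · refine ⟨hOne (v s), fun r hr => ?_⟩
    rw [uIcc_self] at hr
    rw [hr]
  have hK : ∀ {r}, r ∈ uIcc s t → r ≠ s → ∃ K, ∀ q ∈ uIcc r t, hOne (v q) ≤ K := by
    intro r hr hrs
    refine exists_hOne_le_of_locBdd isCompact_uIcc fun q hq => ?_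
    refine h q (uIcc_subset_uIcc hr right_mem_uIcc hq) ?_
    rintro rfl
    rcases mem_uIcc.1 hr with h1 | h1 <;> rcases mem_uIcc.1 hq with h2 | h2 <;>
      exact hrs (le_antisymm (by linarith) (by linarith))
  obtain ⟨C, hC⟩ := exists_hSq_one_le
  set P := ∫ x, v t x ^ 2 with hP
  have hP0 : 0 ≤ P := integral_nonneg fun x => sq_nonneg _
  set D : ℝ := (∫ x, ‖((v t x : ℝ) : ℂ)‖) + 6 * π * 1 * P * |t - s| with hD
  have hD0 : 0 ≤ ∫ x, ‖((v t x : ℝ) : ℂ)‖ := integral_nonneg fun x => norm_nonneg _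
  set A : NNReal := C * D.toNNReal ^ 2 + P.toNNReal with hA
  have hSA : ∀ {r}, r ∈ uIcc s t → r ≠ s → hSq 1 (FT (v r)) ≤ A := by
    intro r hr hrs
    obtain ⟨K, hK'⟩ := hK hr hrs
    refine (hC (continuous_FT_schwartz (v r)).measurable (D := ENNReal.ofReal D)
      fun ξ hξ => ?_).trans ?_
    · rw [← ofReal_norm]
      refine ENNReal.ofReal_le_ofReal ?_
      refine (hv.norm_FT_le ht (hsub hr) (K := K) (by rwa [uIcc_comm]) ξ).trans ?_
      have h1 := norm_fourier_le (fun x => (v t x : ℂ)) ξ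
      have h2 : |r - t| ≤ |t - s| := by
        rw [abs_sub_comm]
        exact abs_sub_right_of_mem_uIcc hr
      exact add_le_add h1 (by gcongr)
    · rw [lintegral_enorm_sq_FT, hv.integral_sq_eq_uIcc (hsub hr) ht hK', hA]
      push_cast
      rfl
  obtain ⟨C', δ, hδ, hY⟩ := exists_wSq_FT_le A
  set t₁ := s + min 1 (δ / |t - s|) * (t - s) with ht₁
  have habs : 0 < |t - s| := abs_pos.2 (sub_ne_zero.2 hst.symm)
  have hθ : 0 < min 1 (δ / |t - s|) := lt_min one_pos (by positivity)
  have h1 : t₁ ∈ uIcc s t := by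
    have hθ1 : min 1 (δ / |t - s|) ≤ 1 := min_le_left _ _
    rcases le_total s t with h' | h'
    · rw [uIcc_of_le h']
      constructor <;> nlinarith
    · rw [uIcc_of_ge h']
      constructor <;> nlinarith
  have h2 : t₁ ≠ s := by
    rw [ht₁, Ne, add_eq_left]
    exact mul_ne_zero hθ.ne' (sub_ne_zero.2 hst.symm)
  have h3 : |t₁ - s| ≤ δ := by
    rw [ht₁, add_sub_cancel_left, abs_mul, abs_of_pos hθ, ← le_div_iff₀ habs]
    exact min_le_right _ _
  obtain ⟨K, hK1⟩ := hK h1 h2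
  lift wSq (FT (v t₁)) to NNReal using (wSq_FT_lt_top (v t₁)).ne with W hW
  refine ⟨max K (max (hOne (v s)) (65 * (C' * (A + W) : NNReal))), fun r hr => ?_⟩
  rcases eq_or_ne r s with rfl | hrs
  · exact (le_max_left _ _).trans (le_max_right _ _)
  rcases uIcc_subset_uIcc_union_uIcc (b := t₁) hr with hr1 | hr1
  · refine le_trans ?_ ((le_max_right _ _).trans (le_max_right _ _))
    refine hOne_le_of_wSq_le ?_
    push_cast
    rw [hW]
    refine hY hv t₁ (hsub h1) r (hsub hr) ?_ ?_ (hSA h1 h2)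
    · refine le_trans ?_ h3
      rw [abs_sub_comm]
      exact abs_sub_right_of_mem_uIcc hr1
    · obtain ⟨L, hL⟩ := hK hr hrs
      refine ⟨L, fun q hq => hL q (uIcc_subset_uIcc ?_ left_mem_uIcc hq)⟩
      rw [mem_uIcc] at hr1 h1 ⊢
      rcases hr1 with a | a <;> rcases h1 with b | b
      · left; constructor <;> linarith
      · right; constructor <;> linarith
      · left; constructor <;> linarith
      · right; constructor <;> linarith
  · exact (hK1 r hr1).trans (le_max_left _ _)

end IsFlow

theorem exists_hOne_le_of_massH_le (n : NNReal) : ∃ δ K : ℝ, 0 < δ ∧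
    ∀ {T : ℝ} {v : ℝ → 𝓢(ℝ, ℝ)}, IsFlow T v → ∀ s ∈ Icc 0 T, ∀ t ∈ Icc 0 T, |t - s| ≤ δ →
    massH (v s) ≤ n → (∀ r ∈ uIcc s t, r ≠ s → LocBdd v r) → hOne (v t) ≤ K := by
  obtain ⟨C, hC⟩ := exists_hSq_one_le
  obtain ⟨C', δ, hδ, hY⟩ := exists_wSq_FT_le (C * n ^ 2 + n)
  refine ⟨δ, 65 * (C' * (C * n ^ 2 + n + 2 * n) : NNReal), hδ, ?_⟩
  intro T v hv s hs t ht hst hn h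
  have h1 : ENNReal.ofReal (hOne (v s)) ≤ n := (ofReal_hOne_le_massH _).trans hn
  have hw : wSq (FT (v s)) ≤ 2 * n := (wSq_FT_le _).trans (mul_le_mul' le_rfl h1)
  refine hOne_le_of_wSq_le ?_
  push_cast
  refine (hY hv s hs t ht hst (hv.exists_hOne_le_uIcc hs ht h) ?_).trans ?_
  · refine (hC (continuous_FT_schwartz (v s)).measurable (D := n)
      fun ξ _ => (enorm_FT_le_massH _ ξ).trans hn).trans ?_
    push_cast
    gcongr
    rw [lintegral_enorm_sq_FT]
    exact (ENNReal.ofReal_le_ofReal (integral_sq_le_hOne _)).trans h1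
  · push_cast
    gcongr

open Filter Topology in
theorem isClosed_lintegral_le {G : ℝ × ℝ → ℝ≥0∞} (hc : Continuous G) (n : ℝ≥0∞) :
    IsClosed {t | ∫⁻ x, G (t, x) ≤ n} := by
  refine IsSeqClosed.isClosed fun s t hs hst => ?_
  have hp : ∀ x, Tendsto (fun k => G (s k, x)) atTop (𝓝 (G (t, x))) := fun x =>
    (hc.tendsto (t, x)).comp (hst.prodMk_nhds tendsto_const_nhds)
  calc ∫⁻ x, G (t, x) = ∫⁻ x, liminf (fun k => G (s k, x)) atTop :=
        lintegral_congr fun x => (hp x).liminf_eq.symm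
    _ ≤ liminf (fun k => ∫⁻ x, G (s k, x)) atTop :=
        lintegral_liminf_le fun k => (hc.comp (by fun_prop)).measurable
    _ ≤ n := liminf_le_of_le (by isBoundedDefault) fun b hb => by
        obtain ⟨k, hk⟩ := hb.exists
        exact hk.trans (hs k)

namespace IsFlow
variable {T : ℝ} {v : ℝ → 𝓢(ℝ, ℝ)} (hv : IsFlow T v)
include hv

theorem isClosed_massH_le (n : ℝ≥0∞) : IsClosed {t | massH (v t) ≤ n} := by
  have hc : Continuous fun p : ℝ × ℝ => ENNReal.ofReal
      (|v p.1 p.2| + v p.1 p.2 ^ 2 + iteratedDeriv 1 (v p.1) p.2 ^ 2) := by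
    have h0 := hv.continuous_uncurry
    have h1 := hv.cont 1
    exact ENNReal.continuous_ofReal.comp (by fun_prop)
  exact isClosed_lintegral_le hc n

open Filter Topology in
theorem locBdd (t : ℝ) : LocBdd v t := by
  by_contra ht
  set F := {t | ¬ LocBdd v t} with hF
  have hFc : IsClosed F := by
    rw [← isOpen_compl_iff, isOpen_iff_mem_nhds]
    intro r hr
    obtain ⟨K, hK⟩ := not_not.1 hr
    filter_upwards [hK.eventually_nhds] with q hq
    exact not_not.2 ⟨K, hq⟩
  have hFT : F ⊆ Icc 0 T := by
    intro r hr
    by_contra hr'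
    rw [mem_Icc, not_and_or, not_le, not_le] at hr'
    refine hr ?_
    rcases hr' with h | h
    · refine ⟨hOne (v 0), ?_⟩
      filter_upwards [Iio_mem_nhds h] with q hq
      rw [hv.left q (le_of_lt hq)]
    · refine ⟨hOne (v T), ?_⟩
      filter_upwards [Ioi_mem_nhds h] with q hq
      rw [hv.right q (le_of_lt hq)]
  have : CompleteSpace F := hFc.completeSpace_coe
  have : Nonempty F := ⟨⟨t, ht⟩⟩
  obtain ⟨n, hn⟩ := nonempty_interior_of_iUnion_of_closed
    (f := fun n : ℕ => {r : F | massH (v r) ≤ (n : NNReal)})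
    (fun n => (hv.isClosed_massH_le _).preimage continuous_subtype_val) (by
      ext r
      simp only [mem_iUnion, mem_ofPred_eq, mem_univ, iff_true]
      obtain ⟨k, hk⟩ := ENNReal.exists_nat_gt (massH_lt_top (v r)).ne
      exact ⟨k, by simpa using hk.le⟩)
  obtain ⟨t₀, ht₀⟩ := hn
  rw [mem_interior_iff_mem_nhds, Metric.mem_nhds_iff] at ht₀
  obtain ⟨ρ, hρ, hball⟩ := ht₀
  obtain ⟨δ, K, hδ, hZ⟩ := exists_hOne_le_of_massH_le n
  have ht₀T := hFT t₀.2
  refine t₀.2 ⟨K, ?_⟩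
  filter_upwards [Metric.ball_mem_nhds (t₀ : ℝ) (lt_min hρ hδ)] with r hr
  rw [Metric.mem_ball, Real.dist_eq] at hr
  obtain ⟨τ, hτ, hvτ, hτr⟩ : ∃ τ ∈ Icc 0 T, v r = v τ ∧ |τ - t₀| ≤ |r - t₀| := by
    rcases le_total r 0 with h | h
    · refine ⟨0, ⟨le_rfl, hv.pos.le⟩, hv.left r h, ?_⟩
      rw [abs_of_nonpos (by linarith [ht₀T.1]), abs_of_nonpos (by linarith [ht₀T.1])]
      linarith
    rcases le_total T r with h' | h'
    · refine ⟨T, ⟨hv.pos.le, le_rfl⟩, hv.right r h', ?_⟩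
      rw [abs_of_nonneg (by linarith [ht₀T.2]), abs_of_nonneg (by linarith [ht₀T.2])]
      linarith
    · exact ⟨r, ⟨h, h'⟩, rfl, le_rfl⟩
  rw [hvτ]
  obtain ⟨s, hs, hmin⟩ := (isCompact_uIcc.inter_right hFc :
    IsCompact (uIcc (t₀ : ℝ) τ ∩ F)).exists_isMinOn ⟨t₀, left_mem_uIcc, t₀.2⟩
    (f := fun q => |q - τ|) (by fun_prop)
  have hst : |s - t₀| ≤ |τ - t₀| := abs_sub_left_of_mem_uIcc hs.1
  have hsτ : |τ - s| ≤ |τ - t₀| := abs_sub_right_of_mem_uIcc hs.1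
  refine hZ hv s (hFT hs.2) τ hτ (hsτ.trans (hτr.trans (hr.le.trans (min_le_right _ _)))) ?_ ?_
  · have hb : (⟨s, hs.2⟩ : F) ∈ Metric.ball t₀ ρ := by
      rw [Metric.mem_ball, Subtype.dist_eq, Real.dist_eq]
      exact (hst.trans hτr).trans_lt (hr.trans_le (min_le_left _ _))
    exact hball hb
  · intro q hq hqs
    by_contra hqF
    have h1 : |s - τ| ≤ |q - τ| := hmin ⟨uIcc_subset_uIcc hs.1 right_mem_uIcc hq, hqF⟩
    rw [abs_sub_comm, abs_sub_comm q] at h1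
    refine hqs ?_
    rcases mem_uIcc.1 hq with h | h
    · rw [abs_of_nonneg (by linarith), abs_of_nonneg (by linarith)] at h1
      linarith
    · rw [abs_of_nonpos (by linarith), abs_of_nonpos (by linarith)] at h1
      linarith

theorem exists_hOne_le : ∃ K, ∀ t ∈ Icc 0 T, hOne (v t) ≤ K :=
  exists_hOne_le_of_locBdd isCompact_Icc fun t _ => hv.locBdd t

end IsFlow

/-- The dyadic frequency shell of index `j`. -/
def shell (j : ℤ) : Set ℝ := {ξ : ℝ | (2 : ℝ) ^ j ≤ |ξ| ∧ |ξ| < (2 : ℝ) ^ (j + 1)}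

theorem measurableSet_shell (j : ℤ) : MeasurableSet (shell j) := by
  have : shell j = (fun ξ : ℝ => |ξ|) ⁻¹' Ico (2 ^ j) (2 ^ (j + 1)) := rfl
  rw [this]
  exact measurableSet_Ico.preimage (by fun_prop)

theorem exists_mem_shell {ξ : ℝ} (hξ : ξ ≠ 0) : ∃ j, ξ ∈ shell j := by
  obtain ⟨j, hj⟩ := exists_mem_Ico_zpow (abs_pos.2 hξ) (one_lt_two (α := ℝ))
  exact ⟨j, hj.1, hj.2⟩

theorem rpow_half_mul_sq (j : ℤ) {a : ℝ} (ha : 0 ≤ a) :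
    ((2 : ℝ) ^ (-(j : ℝ) / 2) * a ^ (1 / 2 : ℝ)) ^ 2 = ((2 : ℝ) ^ j)⁻¹ * a := by
  rw [mul_pow, ← Real.rpow_natCast, ← Real.rpow_natCast, ← Real.rpow_mul (by norm_num),
    ← Real.rpow_mul ha, ← Real.rpow_intCast, ← Real.rpow_neg (by norm_num)]
  norm_num

theorem besovNorm_nonneg (f : ℝ → ℝ) : 0 ≤ BesovNorm f :=
  Real.iSup_nonneg fun _ => mul_nonneg (by positivity)
    (Real.rpow_nonneg (integral_nonneg fun _ => by positivity) _)

theorem hsNorm_nonneg (s : ℝ) (f : ℝ → ℝ) : 0 ≤ HsNorm s f :=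
  Real.rpow_nonneg (integral_nonneg fun _ => by positivity) _

theorem setIntegral_shell_le (f : 𝓢(ℝ, ℝ)) (j : ℤ) :
    ∫ ξ in shell j, ‖FT f ξ‖ ^ 2 ≤ 2 ^ j * BesovNorm f ^ 2 := by
  have h0 : ∀ j, 0 ≤ ∫ ξ in shell j, ‖FT f ξ‖ ^ 2 := fun j =>
    integral_nonneg fun _ => by positivity
  set S := ∫ x, ‖(f x : ℂ)‖ with hS
  have hS0 : 0 ≤ S := integral_nonneg fun _ => norm_nonneg _
  have hbdd : BddAbove (range fun j : ℤ => (2 : ℝ) ^ (-(j : ℝ) / 2) *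
      (∫ ξ in shell j, ‖FT f ξ‖ ^ 2) ^ (1 / 2 : ℝ)) := by
    refine ⟨2 * S, ?_⟩
    rintro _ ⟨j, rfl⟩
    refine abs_le_of_sq_le_sq' ?_ (by positivity) |>.2
    rw [rpow_half_mul_sq j (h0 j)]
    have hvol : volume (shell j) ≤ ENNReal.ofReal (4 * 2 ^ j) := by
      refine (measure_mono (t := Icc (-(2 : ℝ) ^ (j + 1)) (2 ^ (j + 1))) fun ξ hξ =>
        abs_le.1 hξ.2.le).trans_eq ?_
      rw [Real.volume_Icc, zpow_add₀ (by norm_num)]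
      congr 1
      ring
    have h1 := norm_setIntegral_le_of_norm_le_const (μ := volume) (s := shell j)
      (f := fun ξ => ‖FT f ξ‖ ^ 2) (C := S ^ 2) (hvol.trans_lt ENNReal.ofReal_lt_top)
      fun ξ _ => by
        rw [Real.norm_of_nonneg (by positivity)]
        have := norm_fourier_le (fun x => (f x : ℂ)) ξ
        gcongr
        exact this
    rw [Real.norm_of_nonneg (h0 j)] at h1
    have h2 : volume.real (shell j) ≤ 4 * 2 ^ j :=
      ENNReal.toReal_le_of_le_ofReal (by positivity) hvol
    have hp : (0 : ℝ) < 2 ^ j := by positivity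
    rw [inv_mul_le_iff₀ hp]
    calc _ ≤ S ^ 2 * volume.real (shell j) := h1
      _ ≤ S ^ 2 * (4 * 2 ^ j) := by gcongr
      _ = _ := by ring
  have hle : (2 : ℝ) ^ (-(j : ℝ) / 2) * (∫ ξ in shell j, ‖FT f ξ‖ ^ 2) ^ (1 / 2 : ℝ) ≤
      BesovNorm f := le_ciSup hbdd j
  have h3 := pow_le_pow_left₀ (mul_nonneg (by positivity) (Real.rpow_nonneg (h0 j) _)) hle 2
  rw [rpow_half_mul_sq j (h0 j), inv_mul_le_iff₀ (by positivity)] at h3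
  exact h3

theorem setLIntegral_shell_le (f : 𝓢(ℝ, ℝ)) (j : ℤ) :
    ∫⁻ ξ in shell j, ‖FT f ξ‖ₑ ^ 2 ≤ ENNReal.ofReal (2 ^ j * BesovNorm f ^ 2) := by
  simp_rw [enorm_sq_eq_ofReal]
  rw [← ofReal_integral_eq_lintegral_ofReal (integrable_norm_sq_FT f).integrableOn
    (Filter.Eventually.of_forall fun _ => by positivity)]
  exact ENNReal.ofReal_le_ofReal (setIntegral_shell_le f j)

/-- The ratio in the geometric series bounding a dyadic sum. -/
def dyadicRatio : ℝ := 2 ^ (-(1 / 24) : ℝ)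

theorem dyadicRatio_pos : 0 < dyadicRatio := by unfold dyadicRatio; positivity

theorem dyadicRatio_lt_one : dyadicRatio < 1 :=
  Real.rpow_lt_one_of_one_lt_of_neg (by norm_num) (by norm_num)

theorem summable_dyadicRatio : Summable fun i : ℤ => dyadicRatio ^ i.natAbs := by
  have h := summable_geometric_of_lt_one dyadicRatio_pos.le dyadicRatio_lt_one
  exact Summable.of_nat_of_neg (by simpa using h) (by simpa using h)

theorem mm_rpow_le {ν ξ : ℝ} {j k : ℤ} (hν : 0 < ν) (h1 : (2 : ℝ) ^ k ≤ ν⁻¹)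
    (h2 : ν⁻¹ < 2 ^ (k + 1)) (hξ : ξ ∈ shell j) :
    mm (ν * ξ) ^ (-(1 / 24) : ℝ) ≤ 2 * dyadicRatio ^ (j - k).natAbs := by
  have hk : (0 : ℝ) < 2 ^ k := by positivity
  have hj : (0 : ℝ) < 2 ^ j := by positivity
  have hξ0 : 0 < |ξ| := hj.trans_le hξ.1
  have hxa : |ν * ξ| = ν * |ξ| := by rw [abs_mul, abs_of_pos hν]
  obtain ⟨hl, hu⟩ := hξ
  rw [zpow_add₀ (by norm_num), zpow_one] at h2 hu
  have hν1 : ν * 2 ^ k ≤ 1 := by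
    rwa [le_inv_comm₀ hk hν, ← one_div, le_div_iff₀ hk] at h1
  have hν2 : 1 ≤ ν * (2 ^ k * 2) := by
    have := h2.le
    rw [inv_le_iff_one_le_mul₀ hν] at this
    linarith
  have key : (2 : ℝ) ^ (j - k).natAbs / 2 ≤ mm (ν * ξ) := by
    unfold mm
    rw [hxa]
    rcases le_total k j with h | h
    · refine le_trans ?_ (le_max_left _ _)
      rw [← zpow_natCast, Int.natCast_natAbs, abs_of_nonneg (by omega), zpow_sub₀ (by norm_num),
        div_div, div_le_iff₀ (by positivity)]
      nlinarith
    · refine le_trans ?_ (le_max_right _ _)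
      rw [← zpow_natCast, Int.natCast_natAbs, abs_of_nonpos (by omega), neg_sub,
        zpow_sub₀ (by norm_num), div_div, ← one_div, div_le_div_iff₀ (by positivity)
        (by positivity)]
      nlinarith
  calc mm (ν * ξ) ^ (-(1 / 24) : ℝ) ≤ ((2 : ℝ) ^ (j - k).natAbs / 2) ^ (-(1 / 24) : ℝ) :=
        Real.rpow_le_rpow_of_nonpos (by positivity) key (by norm_num)
    _ = 2 ^ (1 / 24 : ℝ) * dyadicRatio ^ (j - k).natAbs := by
        rw [div_eq_mul_inv, Real.mul_rpow (by positivity) (by positivity), Real.inv_rpow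
          (by norm_num), ← Real.rpow_neg (by norm_num), neg_neg, mul_comm, dyadicRatio,
          ← Real.rpow_natCast, ← Real.rpow_natCast, ← Real.rpow_mul (by norm_num),
          ← Real.rpow_mul (by norm_num), mul_comm (((j - k).natAbs : ℝ))]
    _ ≤ _ := by
        gcongr
        · exact pow_nonneg dyadicRatio_pos.le _
        · calc (2 : ℝ) ^ (1 / 24 : ℝ) ≤ 2 ^ (1 : ℝ) :=
              Real.rpow_le_rpow_of_exponent_le (by norm_num) (by norm_num)
            _ = 2 := by norm_num

theorem setLIntegral_iw_FT_le (f : 𝓢(ℝ, ℝ)) {ν : ℝ} (hν : 0 < ν) {k : ℤ}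
    (hk1 : (2 : ℝ) ^ k ≤ ν⁻¹) (hk2 : ν⁻¹ < 2 ^ (k + 1)) (j : ℤ) :
    ∫⁻ ξ in shell j, (ENNReal.ofReal (iw (ν * ξ))⁻¹ * ‖FT f ξ‖ₑ) ^ 2 ≤
      ENNReal.ofReal (ν⁻¹ * (2 * dyadicRatio ^ (j - k).natAbs) * BesovNorm f ^ 2) := by
  have hj : (0 : ℝ) < 2 ^ j := by positivity
  have hr := dyadicRatio_pos
  have hm := (continuous_FT_schwartz f).measurable
  calc ∫⁻ ξ in shell j, (ENNReal.ofReal (iw (ν * ξ))⁻¹ * ‖FT f ξ‖ₑ) ^ 2 ≤ ∫⁻ ξ in shell j,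
        ENNReal.ofReal (ν⁻¹ * (2 ^ j)⁻¹ * (2 * dyadicRatio ^ (j - k).natAbs)) *
          ‖FT f ξ‖ₑ ^ 2 := by
        refine setLIntegral_mono_ae' (measurableSet_shell j)
          (Filter.Eventually.of_forall fun ξ hξ => ?_)
        rw [mul_pow, ← ENNReal.ofReal_pow (inv_nonneg.2 (iw_nonneg _)), inv_pow, iw_sq, mul_inv]
        refine mul_le_mul' (ENNReal.ofReal_le_ofReal ?_) le_rfl
        have h1 := mm_rpow_le hν hk1 hk2 hξ
        rw [Real.rpow_neg (mm_nonneg _)] at h1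
        have h2 : |ν * ξ|⁻¹ ≤ ν⁻¹ * (2 ^ j)⁻¹ := by
          rw [abs_mul, abs_of_pos hν, mul_inv]
          have := hξ.1
          gcongr
        exact mul_le_mul h2 h1 (inv_nonneg.2 (Real.rpow_nonneg (mm_nonneg _) _)) (by positivity)
    _ = ENNReal.ofReal (ν⁻¹ * (2 ^ j)⁻¹ * (2 * dyadicRatio ^ (j - k).natAbs)) *
          ∫⁻ ξ in shell j, ‖FT f ξ‖ₑ ^ 2 := by
        rw [lintegral_const_mul _ (by fun_prop)]
    _ ≤ ENNReal.ofReal (ν⁻¹ * (2 ^ j)⁻¹ * (2 * dyadicRatio ^ (j - k).natAbs)) *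
          ENNReal.ofReal (2 ^ j * BesovNorm f ^ 2) :=
        mul_le_mul' le_rfl (setLIntegral_shell_le f j)
    _ = _ := by
        rw [← ENNReal.ofReal_mul (by positivity)]
        congr 1
        field_simp

theorem lintegral_le_tsum_shell (g : ℝ → ℝ≥0∞) :
    ∫⁻ ξ, g ξ ≤ ∑' j : ℤ, ∫⁻ ξ in shell j, g ξ := by
  calc ∫⁻ ξ, g ξ = ∫⁻ ξ in {0}ᶜ, g ξ := by
        rw [Measure.restrict_eq_self_of_ae_mem]
        exact compl_mem_ae_iff.2 (by simp)
    _ ≤ ∫⁻ ξ in ⋃ j, shell j, g ξ := lintegral_mono_set fun ξ hξ =>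
        mem_iUnion.2 (exists_mem_shell hξ)
    _ ≤ _ := lintegral_iUnion_le _ _

theorem tsum_int_sub (f : ℤ → ℝ) (k : ℤ) : ∑' j, f (j - k) = ∑' j, f j :=
  (Equiv.subRight k).tsum_eq f

theorem summable_int_sub {f : ℤ → ℝ} (hf : Summable f) (k : ℤ) : Summable fun j => f (j - k) :=
  (Equiv.subRight k).summable_iff.2 hf

theorem exists_lintegral_iw_FT_le : ∃ C : NNReal, ∀ (f : 𝓢(ℝ, ℝ)) {ν : ℝ}, 0 < ν →
    ENNReal.ofReal ν * ∫⁻ ξ, (ENNReal.ofReal (iw (ν * ξ))⁻¹ * ‖FT f ξ‖ₑ) ^ 2 ≤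
      C * ENNReal.ofReal (BesovNorm f ^ 2) := by
  obtain ⟨S, hS⟩ : ∃ S, S = ∑' i : ℤ, dyadicRatio ^ i.natAbs := ⟨_, rfl⟩
  have hr := dyadicRatio_pos
  have hS0 : 0 ≤ S := by
    rw [hS]
    exact tsum_nonneg fun i => by positivity
  refine ⟨(2 * S).toNNReal, fun f {ν} hν => ?_⟩
  obtain ⟨k, hk⟩ := exists_mem_Ico_zpow (inv_pos.2 hν) (one_lt_two (α := ℝ))
  have hsum : Summable fun j : ℤ => dyadicRatio ^ (j - k).natAbs :=
    summable_int_sub summable_dyadicRatio k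
  have hshift : ∑' j : ℤ, dyadicRatio ^ (j - k).natAbs = S := by
    rw [hS]
    exact tsum_int_sub (fun i : ℤ => dyadicRatio ^ i.natAbs) k
  calc _ ≤ ENNReal.ofReal ν * ∑' j : ℤ,
        ENNReal.ofReal (ν⁻¹ * (2 * dyadicRatio ^ (j - k).natAbs) * BesovNorm f ^ 2) :=
        mul_le_mul' le_rfl ((lintegral_le_tsum_shell _).trans
          (ENNReal.tsum_le_tsum fun j => setLIntegral_iw_FT_le f hν hk.1 hk.2 j))
    _ = ENNReal.ofReal (2 * S * BesovNorm f ^ 2) := by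
        rw [← ENNReal.ofReal_tsum_of_nonneg (fun j => by positivity)
          (((hsum.mul_left 2).mul_left ν⁻¹).mul_right _), tsum_mul_right, tsum_mul_left,
          tsum_mul_left, hshift, ← ENNReal.ofReal_mul hν.le]
        congr 1
        field_simp
    _ = _ := by
        rw [ENNReal.ofReal_mul (by positivity), ENNReal.ofReal]

theorem exists_schwartz_id_mul (f : 𝓢(ℝ, ℝ)) : ∃ g : 𝓢(ℝ, ℝ), (g : ℝ → ℝ) = fun x => x * f x :=
  ⟨smulLeftCLM ℝ (fun x : ℝ => x) f, by
    ext x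
    rw [smulLeftCLM_apply_apply (by fun_prop), smul_eq_mul]⟩

theorem hasDerivAt_FT (f : 𝓢(ℝ, ℝ)) (ξ : ℝ) :
    HasDerivAt (FT f) (-2 * π * Complex.I * FT (fun x => x * f x) ξ) ξ := by
  obtain ⟨g, hg⟩ := exists_schwartz_id_mul f
  have h1 : Integrable fun x => (f x : ℂ) := f.integrable.ofReal
  have h2 : Integrable fun x : ℝ => x • (f x : ℂ) := by
    have : Integrable fun x => (g x : ℂ) := g.integrable.ofReal
    refine this.congr (Filter.Eventually.of_forall fun x => ?_)
    simp [hg]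
  refine (Real.hasDerivAt_fourier h1 h2 ξ).congr_deriv ?_
  unfold FT
  rw [Real.fourier_real_eq, Real.fourier_real_eq, ← integral_const_mul]
  refine integral_congr_ae (Filter.Eventually.of_forall fun x => ?_)
  simp only [smul_eq_mul, Circle.smul_def]
  push_cast
  ring

theorem integrable_abs_mul_norm_sq (g : 𝓢(ℝ, ℂ)) : Integrable fun ξ => |ξ| * ‖g ξ‖ ^ 2 := by
  have h1 := g.integrable_pow_mul volume 1
  obtain ⟨B, hB⟩ := g.decay 0 0
  have hB' : ∀ x, ‖g x‖ ≤ B := fun x => by simpa using hB.2 x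
  refine (h1.mul_const B).mono' (by have := g.continuous; fun_prop)
    (Filter.Eventually.of_forall fun x => ?_)
  rw [Real.norm_of_nonneg (by positivity), pow_one, Real.norm_eq_abs, mul_assoc]
  rw [_root_.sq]
  gcongr
  exact hB' x

theorem lintegral_abs_mul_enorm_sq_FT (f : 𝓢(ℝ, ℝ)) :
    ∫⁻ ξ, ENNReal.ofReal |ξ| * ‖FT f ξ‖ₑ ^ 2 = ENNReal.ofReal (HsNorm (1 / 2) f ^ 2) := by
  have hi : Integrable fun ξ => |ξ| * ‖FT f ξ‖ ^ 2 := by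
    rw [FT_eq_fourier_cx]
    exact integrable_abs_mul_norm_sq (𝓕 (cx f))
  have h0 : 0 ≤ ∫ ξ, |ξ| * ‖FT f ξ‖ ^ 2 := integral_nonneg fun _ => by positivity
  have e : HsNorm (1 / 2) f ^ 2 = ∫ ξ, |ξ| * ‖FT f ξ‖ ^ 2 := by
    unfold HsNorm
    norm_num only [mul_one_div_cancel, Real.rpow_one]
    rw [← Real.rpow_natCast, ← Real.rpow_mul h0]
    norm_num
  rw [e, ofReal_integral_eq_lintegral_ofReal hi (Filter.Eventually.of_forall fun _ => by positivity)]
  refine lintegral_congr fun ξ => ?_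
  rw [ENNReal.ofReal_mul (abs_nonneg _), enorm_sq_eq_ofReal]

theorem ofReal_rpow_neg_half_sq_mul (ζ : ℝ) :
    ENNReal.ofReal (|ζ| ^ (-(1 / 2) : ℝ)) ^ 2 * ‖ζ‖ₑ ^ 2 = ENNReal.ofReal |ζ| := by
  rw [← ofReal_norm, Real.norm_eq_abs, ← ENNReal.ofReal_pow (by positivity),
    ← ENNReal.ofReal_pow (by positivity), ← ENNReal.ofReal_mul (by positivity)]
  congr 1
  rcases eq_or_ne ζ 0 with rfl | h
  · simp
  have h0 : 0 < |ζ| := abs_pos.2 h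
  rw [← Real.rpow_natCast, ← Real.rpow_mul h0.le, ← Real.rpow_natCast |ζ| 2, ← Real.rpow_add h0]
  norm_num

theorem lintegral_dilate_sub_sq_le {W W' : ℝ → ℂ} (hW : ∀ ξ, HasDerivAt W (W' ξ) ξ)
    (hc : Continuous W') {a b : ℝ} (ha : 0 < a) (hab : a ≤ b) :
    ∫⁻ ζ, (ENNReal.ofReal (|ζ| ^ (-(1 / 2) : ℝ)) * ‖W (ζ * b) - W (ζ * a)‖ₑ) ^ 2 ≤
      ENNReal.ofReal ((b - a) ^ 2 / a ^ 2) * ∫⁻ ξ, ENNReal.ofReal |ξ| * ‖W' ξ‖ₑ ^ 2 := by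
  have h1 : ∀ ζ, ‖W (ζ * b) - W (ζ * a)‖ₑ ^ 2 ≤
      ENNReal.ofReal (b - a) * ∫⁻ s in Ioc a b, ‖ζ‖ₑ ^ 2 * ‖W' (ζ * s)‖ₑ ^ 2 := by
    intro ζ
    have hd : ∀ s ∈ uIcc a b, HasDerivAt (fun s => W (ζ * s)) (ζ * W' (ζ * s)) s := fun s _ => by
      have h : HasDerivAt (fun s => W (ζ * s)) ((ζ * 1) • W' (ζ * s)) s :=
        HasDerivAt.scomp (h := fun s => ζ * s) s (hW (ζ * s)) ((hasDerivAt_id s).const_mul ζ)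
      exact h.congr_deriv (by simp)
    have hF := intervalIntegral.integral_eq_sub_of_hasDerivAt hd
      (Continuous.intervalIntegrable (by fun_prop) _ _)
    rw [← hF, intervalIntegral.integral_of_le hab]
    have hm : Measurable fun s => ‖(ζ * W' (ζ * s) : ℂ)‖ₑ :=
      (by fun_prop : Continuous fun s => (ζ * W' (ζ * s) : ℂ)).measurable.enorm
    have hcs := lintegral_mul_sq_le (μ := volume.restrict (Ioc a b)) (f := fun _ => 1)
      (g := fun s => ‖(ζ * W' (ζ * s) : ℂ)‖ₑ) (by fun_prop) hm.aemeasurable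
    simp only [one_mul, one_pow, lintegral_one, Measure.restrict_apply_univ, Real.volume_Ioc] at hcs
    refine (pow_le_pow_left' (enorm_integral_le_lintegral_enorm _) 2).trans (hcs.trans_eq ?_)
    congr 1
    refine lintegral_congr fun s => ?_
    rw [enorm_mul, mul_pow, ← ofReal_norm (ζ : ℂ), Complex.norm_real, ofReal_norm]
  have hmW : Measurable W' := hc.measurable
  set G : ℝ → ℝ≥0∞ := fun ξ => ENNReal.ofReal |ξ| * ‖W' ξ‖ₑ ^ 2 with hG
  have h2 : ∀ s ∈ Ioc a b, ∫⁻ ζ, ENNReal.ofReal |ζ| * ‖W' (ζ * s)‖ₑ ^ 2 ≤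
      ENNReal.ofReal (a ^ 2)⁻¹ * ∫⁻ ξ, G ξ := by
    intro s hs
    have hs0 : 0 < s := ha.trans hs.1
    have e : ∀ ζ : ℝ, ENNReal.ofReal |ζ| * ‖W' (ζ * s)‖ₑ ^ 2 =
        ENNReal.ofReal s⁻¹ * G (ζ / s⁻¹) := fun ζ => by
      rw [hG]
      dsimp only
      rw [div_inv_eq_mul, ← mul_assoc, ← ENNReal.ofReal_mul (by positivity), abs_mul,
        abs_of_pos hs0]
      congr 2
      field_simp
    have hmG : Measurable G := by fun_prop
    simp_rw [e]
    rw [lintegral_const_mul _ (by fun_prop), lintegral_comp_div hmG (inv_ne_zero hs0.ne'),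
      ← mul_assoc, ← ENNReal.ofReal_mul (by positivity), abs_of_pos (inv_pos.2 hs0), ← mul_inv,
      ← _root_.sq]
    have := hs.1.le
    gcongr
  calc _ ≤ ∫⁻ ζ, ENNReal.ofReal (b - a) * ∫⁻ s in Ioc a b,
        ENNReal.ofReal |ζ| * ‖W' (ζ * s)‖ₑ ^ 2 := by
        refine lintegral_mono fun ζ => ?_
        dsimp only
        rw [mul_pow]
        refine (mul_le_mul' le_rfl (h1 ζ)).trans_eq ?_
        rw [mul_left_comm, ← lintegral_const_mul _ (by fun_prop)]
        congr 1
        refine lintegral_congr fun s => ?_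
        rw [← mul_assoc, ofReal_rpow_neg_half_sq_mul]
    _ = ENNReal.ofReal (b - a) * ∫⁻ s in Ioc a b, ∫⁻ ζ,
        ENNReal.ofReal |ζ| * ‖W' (ζ * s)‖ₑ ^ 2 := by
        rw [lintegral_const_mul' _ _ ENNReal.ofReal_ne_top, lintegral_lintegral_swap]
        have : Measurable fun p : ℝ × ℝ => ENNReal.ofReal |p.1| * ‖W' (p.1 * p.2)‖ₑ ^ 2 := by
          fun_prop
        exact this.aemeasurable
    _ ≤ ENNReal.ofReal (b - a) * ∫⁻ s in Ioc a b, ENNReal.ofReal (a ^ 2)⁻¹ * ∫⁻ ξ, G ξ :=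
        mul_le_mul' le_rfl (setLIntegral_mono_ae' measurableSet_Ioc
          (Filter.Eventually.of_forall h2))
    _ = _ := by
        rw [setLIntegral_const, Real.volume_Ioc, mul_comm _ (ENNReal.ofReal (b - a)), ← mul_assoc,
          ← mul_assoc, ← ENNReal.ofReal_mul (by linarith), ← ENNReal.ofReal_mul
          (mul_nonneg (by linarith) (by linarith))]
        congr 2
        ring

theorem integrable_cexp_mul {f : ℝ → ℝ} (hf : Integrable f) (ξ : ℝ) :
    Integrable fun x : ℝ => Complex.exp (((-2 * π * ξ : ℝ) * Complex.I) * x) * f x := by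
  refine hf.ofReal.bdd_mul (c := 1) (by fun_prop) (Filter.Eventually.of_forall fun x => ?_)
  rw [mul_right_comm, ← Complex.ofReal_mul, Complex.norm_exp_ofReal_mul_I]

theorem continuous_FT {f : ℝ → ℝ} (hf : Integrable f) : Continuous (FT f) := by
  have e : FT f = fun ξ => ∫ x : ℝ, Complex.exp (((-2 * π * ξ : ℝ) * Complex.I) * x) * f x :=
    funext fun ξ => FT_eq f ξ
  rw [e]
  refine continuous_of_dominated (fun ξ => (integrable_cexp_mul hf ξ).aestronglyMeasurable)
    (fun ξ => Filter.Eventually.of_forall fun x => ?_) hf.norm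
    (Filter.Eventually.of_forall fun x => by fun_prop)
  rw [norm_mul, mul_right_comm, ← Complex.ofReal_mul, Complex.norm_exp_ofReal_mul_I,
    Complex.norm_real, one_mul]

theorem FT_add {f g : ℝ → ℝ} (hf : Integrable f) (hg : Integrable g) (ξ : ℝ) :
    FT (fun x => f x + g x) ξ = FT f ξ + FT g ξ := by
  rw [FT_eq, FT_eq, FT_eq, ← integral_add (integrable_cexp_mul hf ξ) (integrable_cexp_mul hg ξ)]
  refine integral_congr_ae (Filter.Eventually.of_forall fun x => ?_)
  simp only [Complex.ofReal_add, mul_add]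

theorem FT_const_mul (a : ℝ) (f : ℝ → ℝ) (ξ : ℝ) :
    FT (fun x => a * f x) ξ = a * FT f ξ := by
  rw [FT_eq, FT_eq, ← integral_const_mul]
  refine integral_congr_ae (Filter.Eventually.of_forall fun x => ?_)
  simp only [Complex.ofReal_mul]
  ring

theorem norm_FT_sub_le {f g : ℝ → ℝ} (hf : Integrable f) (hg : Integrable g) (ξ : ℝ) :
    ‖FT f ξ - FT g ξ‖ ≤ ∫ x, |f x - g x| := by
  rw [FT_eq, FT_eq, ← integral_sub (integrable_cexp_mul hf ξ) (integrable_cexp_mul hg ξ)]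
  refine (norm_integral_le_integral_norm _).trans_eq ?_
  refine integral_congr_ae (Filter.Eventually.of_forall fun x => ?_)
  simp only
  rw [← mul_sub, norm_mul, mul_right_comm, ← Complex.ofReal_mul, Complex.norm_exp_ofReal_mul_I,
    ← Complex.ofReal_sub, Complex.norm_real, one_mul, Real.norm_eq_abs]

namespace IsFlow

variable {T : ℝ} {v : ℝ → 𝓢(ℝ, ℝ)} (hv : IsFlow T v)
include hv

theorem integral_sq_const (r t : ℝ) : ∫ x, v r x ^ 2 = ∫ x, v t x ^ 2 := by
  obtain ⟨K, hK⟩ := hv.exists_hOne_le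
  have h0 : (0 : ℝ) ∈ Icc 0 T := ⟨le_rfl, hv.pos.le⟩
  have key : ∀ t, ∫ x, v t x ^ 2 = ∫ x, v 0 x ^ 2 := fun t => by
    have h : ∀ s ∈ Icc 0 T, ∫ x, v s x ^ 2 = ∫ x, v 0 x ^ 2 := fun s hs =>
      hv.integral_sq_eq_uIcc hs h0
        fun q hq => hK q ((convex_Icc 0 T).ordConnected.uIcc_subset hs h0 hq)
    rcases le_total t 0 with h1 | h1
    · rw [hv.left t h1]
    · rcases le_total T t with h2 | h2
      · rw [hv.right t h2]
        exact h T ⟨hv.pos.le, le_rfl⟩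
      · exact h t ⟨h1, h2⟩
  rw [key r, key t]

theorem tendsto_integral_abs_sq_sub (t : ℝ) :
    Filter.Tendsto (fun r => ∫ x, |v r x ^ 2 - v t x ^ 2|) (nhds t) (nhds 0) := by
  have hc := hv.continuous_uncurry
  have h1 : Filter.Tendsto (fun r => ∫ x, min (v r x ^ 2) (v t x ^ 2)) (nhds t)
      (nhds (∫ x, v t x ^ 2)) := by
    refine tendsto_integral_filter_of_dominated_convergence (fun x => v t x ^ 2)
      (Filter.Eventually.of_forall fun r => ?_)
      (Filter.Eventually.of_forall fun r => Filter.Eventually.of_forall fun x => ?_)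
      (integrable_schwartz_sq _) (Filter.Eventually.of_forall fun x => ?_)
    · have := (v r).continuous
      have := (v t).continuous
      exact (by fun_prop : Continuous _).aestronglyMeasurable
    · rw [Real.norm_of_nonneg (le_min (sq_nonneg _) (sq_nonneg _))]
      exact min_le_right _ _
    · have : Continuous fun r => min (v r x ^ 2) (v t x ^ 2) := by
        have : Continuous fun r => v r x :=
          hc.comp (f := fun r : ℝ => (r, x)) (by fun_prop)
        fun_prop
      simpa using this.tendsto t
  have e : ∀ r, ∫ x, |v r x ^ 2 - v t x ^ 2| =
      2 * (∫ x, v t x ^ 2) - 2 * ∫ x, min (v r x ^ 2) (v t x ^ 2) := fun r => by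
    have ha := integrable_schwartz_sq (v r)
    have hb := integrable_schwartz_sq (v t)
    have hm : Integrable fun x => min (v r x ^ 2) (v t x ^ 2) := ha.inf hb
    have hs : Integrable fun x => v r x ^ 2 + v t x ^ 2 := ha.add hb
    calc _ = ∫ x, ((v r x ^ 2 + v t x ^ 2) - 2 * min (v r x ^ 2) (v t x ^ 2)) := by
          refine integral_congr_ae (Filter.Eventually.of_forall fun x => ?_)
          have := min_add_max (v r x ^ 2) (v t x ^ 2)
          have := max_sub_min_eq_abs (v r x ^ 2) (v t x ^ 2)
          simp only
          rw [abs_sub_comm]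
          linarith
      _ = _ := by
          rw [integral_sub hs (hm.const_mul 2), integral_add ha hb, integral_const_mul,
            hv.integral_sq_const r t]
          ring
  simp_rw [e]
  have h2 := (h1.const_mul 2).const_sub (2 * ∫ x, v t x ^ 2)
  rwa [sub_self] at h2

theorem continuous_FT_sq : Continuous fun p : ℝ × ℝ => FT (fun x => v p.1 x ^ 2) p.2 := by
  refine continuous_iff_continuousAt.2 fun p => ?_
  have h1 : Continuous fun ξ => FT (fun x => v p.1 x ^ 2) ξ :=
    continuous_FT (integrable_schwartz_sq (v p.1))
  have h2 : Filter.Tendsto (fun q : ℝ × ℝ => ∫ x, |v q.1 x ^ 2 - v p.1 x ^ 2|) (nhds p)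
      (nhds 0) :=
    (hv.tendsto_integral_abs_sq_sub p.1).comp continuous_fst.continuousAt
  have h3 : Filter.Tendsto (fun q : ℝ × ℝ => FT (fun x => v q.1 x ^ 2) q.2 -
      FT (fun x => v p.1 x ^ 2) q.2) (nhds p) (nhds 0) :=
    squeeze_zero_norm (fun q => norm_FT_sub_le (integrable_schwartz_sq _)
      (integrable_schwartz_sq _) _) h2
  have h4 : Filter.Tendsto (fun q : ℝ × ℝ => FT (fun x => v p.1 x ^ 2) q.2) (nhds p)
      (nhds (FT (fun x => v p.1 x ^ 2) p.2)) :=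
    (h1.comp continuous_snd).continuousAt
  simpa [ContinuousAt] using h3.add h4

end IsFlow

theorem FT_LNL (t : ℝ) (f : 𝓢(ℝ, ℝ)) (ξ : ℝ) :
    FT (LNL t f) ξ = FT (fun x => x * f x) ξ + 12 * π ^ 2 * t * ξ ^ 2 * FT f ξ +
      9 * t * FT (fun x => f x ^ 2) ξ := by
  obtain ⟨g, hg⟩ := exists_schwartz_id_mul f
  obtain ⟨k, hk⟩ := exists_schwartz_iteratedDeriv f 2
  have ig : Integrable fun x => x * f x := hg ▸ g.integrable
  have ik : Integrable fun x => -3 * t * iteratedDeriv 2 f x := (hk ▸ k.integrable).const_mul _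
  have is : Integrable fun x => 9 * t * f x ^ 2 := (integrable_schwartz_sq f).const_mul _
  have igk : Integrable fun x => x * f x + -3 * t * iteratedDeriv 2 f x := ig.add ik
  have e : LNL t f = fun x => (x * f x + -3 * t * iteratedDeriv 2 f x) + 9 * t * f x ^ 2 := by
    funext x
    unfold LNL
    ring
  rw [e, FT_add igk is, FT_add ig ik, FT_const_mul (-3 * t), FT_const_mul (9 * t),
    FT_iteratedDeriv]
  push_cast
  linear_combination (-12 * π ^ 2 * t * ξ ^ 2 * FT f ξ) * Complex.I_sq

theorem integrable_LNL (t : ℝ) (f : 𝓢(ℝ, ℝ)) : Integrable (LNL t f) := by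
  obtain ⟨g, hg⟩ := exists_schwartz_id_mul f
  obtain ⟨k, hk⟩ := exists_schwartz_iteratedDeriv f 2
  have ig : Integrable fun x => x * f x := hg ▸ g.integrable
  have ik : Integrable fun x => 3 * t * iteratedDeriv 2 f x := (hk ▸ k.integrable).const_mul _
  have is : Integrable fun x => 9 * t * f x ^ 2 := (integrable_schwartz_sq f).const_mul _
  exact (ig.sub ik).add is

theorem exists_continuous_integral_eq {G : ℝ → ℝ → ℂ} (hG : Continuous fun p : ℝ × ℝ => G p.1 p.2)
    (b : ℝ) : ∃ H : ℝ → ℝ → ℂ, (Continuous fun p : ℝ × ℝ => H p.1 p.2) ∧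
      (∀ a ξ, ∫ t in a..b, G t ξ = (b - a : ℝ) * H a ξ) ∧ ∀ ξ, H b ξ = G b ξ := by
  refine ⟨fun a ξ => ∫ s in (0 : ℝ)..1, G (a + (b - a) * s) ξ, ?_, fun a ξ => ?_, fun ξ => ?_⟩
  · refine intervalIntegral.continuous_parametric_intervalIntegral_of_continuous'
      (f := fun (p : ℝ × ℝ) s => G (p.1 + (b - p.1) * s) p.2) ?_ 0 1
    exact hG.comp (f := fun q : (ℝ × ℝ) × ℝ => (q.1.1 + (b - q.1.1) * q.2, q.1.2)) (by fun_prop)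
  · have := intervalIntegral.smul_integral_comp_add_mul (fun t => G t ξ) (b - a) a
      (a := 0) (b := 1)
    rw [Complex.real_smul] at this
    rw [this]
    norm_num
  · simp

theorem hasDerivAt_twisted_FT (f : 𝓢(ℝ, ℝ)) (t ξ : ℝ) :
    HasDerivAt (fun ξ : ℝ => Complex.exp ((-(8 * π ^ 3 * ξ ^ 3) * t : ℝ) * Complex.I) * FT f ξ)
      (-2 * π * Complex.I * (Complex.exp ((-(8 * π ^ 3 * ξ ^ 3) * t : ℝ) * Complex.I) *
        (FT (fun x => x * f x) ξ + 12 * π ^ 2 * t * ξ ^ 2 * FT f ξ))) ξ := by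
  have h1 : HasDerivAt (fun ξ : ℝ => -(8 * π ^ 3 * ξ ^ 3) * t) (-(24 * π ^ 3 * ξ ^ 2) * t) ξ := by
    refine ((((hasDerivAt_id ξ).pow 3).const_mul (8 * π ^ 3)).neg.mul_const t).congr_deriv ?_
    simp only [id_eq, Nat.cast_ofNat, Nat.reduceSub, mul_one]
    ring
  have h2 := ((h1.ofReal_comp.mul_const Complex.I).cexp).mul (hasDerivAt_FT f ξ)
  refine h2.congr_deriv ?_
  push_cast
  ring

theorem hasDerivAt_ofReal_mul_of_eq_zero {g : ℝ → ℝ} {h : ℝ → ℂ} {g' x : ℝ}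
    (hg : HasDerivAt g g' x) (h0 : g x = 0) (hc : ContinuousAt h x) :
    HasDerivAt (fun y => (g y : ℂ) * h y) (g' * h x) x := by
  rw [hasDerivAt_iff_tendsto_slope] at hg ⊢
  have h1 := ((Complex.continuous_ofReal.tendsto _).comp hg).mul
    (hc.tendsto.mono_left nhdsWithin_le_nhds : Filter.Tendsto h (nhdsWithin x {x}ᶜ) _)
  refine h1.congr fun y => ?_
  simp only [slope_def_field, slope_def_module, Function.comp, h0, Complex.real_smul]
  push_cast
  ring

theorem resc_eq_of_duhamel {v : ℝ → 𝓢(ℝ, ℝ)} {A ν : ℝ} (hν : ν ≠ 0) (ζ : ℝ) :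
    resc v A ν 0 1 1 ζ = A * (Complex.exp
      ((-(8 * π ^ 3 * (ζ / ν) ^ 3) * (ν ^ 3 / (4 * π ^ 2)) : ℝ) * Complex.I) *
        FT (v (ν ^ 3 / (4 * π ^ 2))) (ζ / ν)) := by
  unfold resc
  have : -(8 * π ^ 3 * (ζ / ν) ^ 3) * (ν ^ 3 / (4 * π ^ 2)) = -2 * π * (min 1 1 * ζ ^ 3) := by
    rw [min_self]
    have := Real.pi_ne_zero
    field_simp
    ring
  rw [this, min_self, mul_one, zero_add]
  ring

namespace IsFlow

variable {T : ℝ} {v : ℝ → 𝓢(ℝ, ℝ)} (hv : IsFlow T v)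
include hv

theorem hasDerivWithinAt_resc {ν₀ : ℝ} (h0 : 0 < ν₀) (hT : ν₀ ^ 3 / (4 * π ^ 2) ≤ T) (ζ : ℝ) :
    HasDerivWithinAt (fun ν => resc v ν₀ ν 0 1 1 ζ)
      (Complex.exp ((-(8 * π ^ 3 * (ζ / ν₀) ^ 3) * (ν₀ ^ 3 / (4 * π ^ 2)) : ℝ) * Complex.I) *
        (2 * π * Complex.I * (ζ / ν₀ : ℝ) *
          FT (LNL (ν₀ ^ 3 / (4 * π ^ 2)) (v (ν₀ ^ 3 / (4 * π ^ 2)))) (ζ / ν₀)))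
      (Ioc 0 ν₀) ν₀ := by
  have hmem : ∀ ν ∈ Ioc 0 ν₀, ν ^ 3 / (4 * π ^ 2) ∈ Icc 0 T := fun ν hν =>
    ⟨by have := hν.1; positivity, le_trans (by have := hν.1.le; have := hν.2; gcongr) hT⟩
  have hν₀ : ν₀ ∈ Ioc 0 ν₀ := ⟨h0, le_rfl⟩
  have hb := hmem ν₀ hν₀
  obtain ⟨b, hbe⟩ : ∃ b, b = ν₀ ^ 3 / (4 * π ^ 2) := ⟨_, rfl⟩
  rw [← hbe] at hb ⊢
  obtain ⟨H, hH, hGH, hHb⟩ := exists_continuous_integral_eq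
    (G := fun t ξ => Complex.exp ((-(8 * π ^ 3 * ξ ^ 3) * t : ℝ) * Complex.I) *
      (6 * π * ξ * Complex.I * FT (fun x => v t x ^ 2) ξ))
    (by have := hv.continuous_FT_sq; fun_prop) b
  have hinv : HasDerivAt (fun ν : ℝ => ζ / ν) (-ζ / ν₀ ^ 2) ν₀ := by
    refine ((hasDerivAt_inv h0.ne').const_mul ζ).congr_deriv ?_
    ring
  have d1 := HasDerivAt.scomp (h := fun ν : ℝ => ζ / ν) ν₀ (hasDerivAt_twisted_FT (v b) b (ζ / ν₀))
    hinv
  have d2 : HasDerivAt (fun ν : ℝ => ((b - ν ^ 3 / (4 * π ^ 2) : ℝ) : ℂ) *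
      H (ν ^ 3 / (4 * π ^ 2)) (ζ / ν)) (-(3 * ν₀ ^ 2 / (4 * π ^ 2) : ℝ) * H b (ζ / ν₀)) ν₀ := by
    have hg : HasDerivAt (fun ν : ℝ => b - ν ^ 3 / (4 * π ^ 2)) (-(3 * ν₀ ^ 2 / (4 * π ^ 2))) ν₀ := by
      refine ((((hasDerivAt_id ν₀).pow 3).div_const (4 * π ^ 2)).const_sub b).congr_deriv ?_
      simp
    have hc : ContinuousAt (fun ν : ℝ => H (ν ^ 3 / (4 * π ^ 2)) (ζ / ν)) ν₀ :=
      ContinuousAt.comp (f := fun ν : ℝ => (ν ^ 3 / (4 * π ^ 2), ζ / ν)) hH.continuousAt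
        (by have := hinv.continuousAt; fun_prop)
    have hd := hasDerivAt_ofReal_mul_of_eq_zero hg (by rw [hbe, sub_self]) hc
    rw [← hbe, Complex.ofReal_neg] at hd
    exact hd
  have d3 := (d1.sub d2).const_mul (ν₀ : ℂ)
  have hval : ∀ ν ∈ Ioc 0 ν₀, resc v ν₀ ν 0 1 1 ζ = ν₀ * (Complex.exp
      ((-(8 * π ^ 3 * (ζ / ν) ^ 3) * b : ℝ) * Complex.I) * FT (v b) (ζ / ν) -
        ((b - ν ^ 3 / (4 * π ^ 2) : ℝ) : ℂ) * H (ν ^ 3 / (4 * π ^ 2)) (ζ / ν)) := fun ν hν => by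
    obtain ⟨K, hK⟩ := hv.exists_hOne_le
    rw [resc_eq_of_duhamel hν.1.ne', ← hGH, ← hv.duhamel_signed (hmem ν hν) hb fun t ht =>
      (integral_sq_le_hOne _).trans
        (hK t ((convex_Icc 0 T).ordConnected.uIcc_subset (hmem ν hν) hb ht)), sub_sub_cancel]
  refine HasDerivWithinAt.congr_deriv (HasDerivWithinAt.congr d3.hasDerivWithinAt
    (fun ν hν => ?_) ?_) ?_
  · exact hval ν hν
  · exact hval ν₀ hν₀
  · rw [hHb, Complex.real_smul, FT_LNL]
    have e1 : -ζ / ν₀ ^ 2 = -(ζ / ν₀) / ν₀ := by field_simp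
    have e2 : 3 * ν₀ ^ 2 / (4 * π ^ 2) = 3 * b / ν₀ := by rw [hbe]; field_simp
    rw [e1, e2]
    have : (ν₀ : ℂ) ≠ 0 := Complex.ofReal_ne_zero.2 h0.ne'
    push_cast
    field_simp
    ring

end IsFlow

theorem lintegral_abs_mul_enorm_sq_FT_id_mul (f : 𝓢(ℝ, ℝ)) :
    ∫⁻ ξ, ENNReal.ofReal |ξ| * ‖-2 * π * Complex.I * FT (fun x => x * f x) ξ‖ₑ ^ 2 =
      ENNReal.ofReal (4 * π ^ 2 * HsNorm (1 / 2) (fun x => x * f x) ^ 2) := by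
  obtain ⟨g, hg⟩ := exists_schwartz_id_mul f
  rw [← hg, ENNReal.ofReal_mul (by positivity), ← lintegral_abs_mul_enorm_sq_FT,
    ← lintegral_const_mul' _ _ ENNReal.ofReal_ne_top]
  refine lintegral_congr fun ξ => ?_
  have : ‖-2 * π * Complex.I‖ₑ ^ 2 = ENNReal.ofReal (4 * π ^ 2) := by
    rw [enorm_sq_eq_ofReal]
    congr 1
    simp [abs_of_pos Real.pi_pos]
    ring
  rw [enorm_mul, mul_pow, this]
  ring

theorem resc_zero_time (v : ℝ → 𝓢(ℝ, ℝ)) (A ν ζ : ℝ) :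
    resc v A ν 0 1 0 ζ = A * FT (v 0) (ζ * (1 / ν)) := by
  unfold resc
  rw [min_eq_left zero_le_one, mul_zero, add_zero, mul_one_div]
  simp

theorem exists_hSq_resc_le : ∃ C : ℝ, 0 < C ∧ ∀ (v : ℝ → 𝓢(ℝ, ℝ)) {A ν ε : ℝ}, 0 < A → 0 < ν →
    BesovNorm (v 0) ≤ ε → hSq 1 (resc v A ν 0 1 0) ≤ ENNReal.ofReal (C * (A * ε) ^ 2) := by
  obtain ⟨C, hC⟩ := exists_lintegral_iw_FT_le
  refine ⟨C + 1, by positivity, fun v A ν ε hA hν hε => ?_⟩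
  have hb0 := besovNorm_nonneg (v 0)
  rw [hSq_dilate_eq (w := FT (v 0)) (continuous_FT_schwartz _).measurable hν.ne' (A := A) fun ζ => by
    rw [enorm_resc hA.le, min_eq_left zero_le_one, mul_zero, add_zero]]
  rw [abs_of_pos hν]
  calc _ = ENNReal.ofReal A ^ 2 * (ENNReal.ofReal ν *
        ∫⁻ ξ, (ENNReal.ofReal (iw (ν * ξ))⁻¹ * ‖FT (v 0) ξ‖ₑ) ^ 2) := by
        rw [mul_left_comm]
        congr 1
        rw [← lintegral_const_mul' _ _ (by finiteness)]
        refine lintegral_congr fun ξ => ?_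
        ring
    _ ≤ ENNReal.ofReal A ^ 2 * (C * ENNReal.ofReal (BesovNorm (v 0) ^ 2)) :=
        mul_le_mul' le_rfl (hC (v 0) hν)
    _ = ENNReal.ofReal (C * (A * BesovNorm (v 0)) ^ 2) := by
        rw [← ENNReal.ofReal_pow hA.le, ← ENNReal.ofReal_coe_nnreal,
          ← ENNReal.ofReal_mul (by positivity), ← ENNReal.ofReal_mul (by positivity)]
        congr 1
        ring
    _ ≤ _ := by
        refine ENNReal.ofReal_le_ofReal ?_
        gcongr
        linarith

theorem lintegral_resc_zero_sub_le (v : ℝ → 𝓢(ℝ, ℝ)) {ν₀ ν ε : ℝ} (h0 : 0 < ν₀)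
    (hν : ν₀ / 2 ≤ ν) (hν' : ν ≤ ν₀) (hε : HsNorm (1 / 2) (fun x => x * v 0 x) ≤ ε) :
    ∫⁻ ζ, (ENNReal.ofReal (|ζ| ^ (-(1 / 2) : ℝ)) *
      ‖resc v ν₀ ν 0 1 0 ζ - resc v ν₀ ν₀ 0 1 0 ζ‖ₑ) ^ 2 ≤
      ENNReal.ofReal (16 * π ^ 2 * ((ν₀ - ν) * ε) ^ 2) := by
  have hνp : 0 < ν := by linarith
  have hn := hsNorm_nonneg (1 / 2) (fun x => x * v 0 x)
  have hW := lintegral_dilate_sub_sq_le (W := FT (v 0)) (a := 1 / ν₀) (b := 1 / ν)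
    (hasDerivAt_FT (v 0))
    (by
      obtain ⟨g, hg⟩ := exists_schwartz_id_mul (v 0)
      have := continuous_FT_schwartz g
      rw [hg] at this
      fun_prop) (by positivity) (by gcongr)
  rw [lintegral_abs_mul_enorm_sq_FT_id_mul, ← ENNReal.ofReal_mul (by positivity)] at hW
  calc _ = ENNReal.ofReal (ν₀ ^ 2) * ∫⁻ ζ, (ENNReal.ofReal (|ζ| ^ (-(1 / 2) : ℝ)) *
        ‖FT (v 0) (ζ * (1 / ν)) - FT (v 0) (ζ * (1 / ν₀))‖ₑ) ^ 2 := by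
        rw [← lintegral_const_mul' _ _ ENNReal.ofReal_ne_top]
        refine lintegral_congr fun ζ => ?_
        rw [resc_zero_time, resc_zero_time, ← mul_sub, enorm_mul, ← ofReal_norm (ν₀ : ℂ),
          Complex.norm_real, Real.norm_of_nonneg h0.le, ENNReal.ofReal_pow h0.le]
        ring
    _ ≤ _ := mul_le_mul' le_rfl hW
    _ ≤ _ := by
        rw [← ENNReal.ofReal_mul (by positivity)]
        refine ENNReal.ofReal_le_ofReal ?_
        have e : ν₀ ^ 2 * ((1 / ν - 1 / ν₀) ^ 2 / (1 / ν₀) ^ 2 *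
            (4 * π ^ 2 * HsNorm (1 / 2) (fun x => x * v 0 x) ^ 2)) =
            (ν₀ / ν) ^ 2 * (4 * π ^ 2 * ((ν₀ - ν) * HsNorm (1 / 2) (fun x => x * v 0 x)) ^ 2) := by
          field_simp
        rw [e]
        have h2 : ν₀ / ν ≤ 2 := by
          rw [div_le_iff₀ hνp]
          linarith
        calc _ ≤ 2 ^ 2 * (4 * π ^ 2 * ((ν₀ - ν) * ε) ^ 2) := by
              have : 0 ≤ ν₀ - ν := by linarith
              gcongr
          _ = _ := by ring

theorem exists_lintegral_resc_sub_le : ∃ C c : ℝ, 0 < C ∧ 0 < c ∧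
    ∀ {T : ℝ} {v : ℝ → 𝓢(ℝ, ℝ)}, IsFlow T v → ∀ {ν₀ ν ε : ℝ}, 0 < ν₀ → 0 < ε →
    ν₀ ^ 3 / (4 * π ^ 2) ≤ T → BesovNorm (v 0) ≤ ε →
    HsNorm (1 / 2) (fun x => x * v 0 x) ≤ ε → ν₀ * ε ≤ c → ν₀ / 2 ≤ ν → ν ≤ ν₀ →
    ∫⁻ ζ, (ENNReal.ofReal (|ζ| ^ (-(1 / 2) : ℝ)) *
      ‖resc v ν₀ ν 0 1 1 ζ - resc v ν₀ ν₀ 0 1 1 ζ‖ₑ) ^ 2 ≤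
      ENNReal.ofReal (C * ((ν₀ - ν) * ε) ^ 2) := by
  obtain ⟨B, hB0, hB⟩ := exists_hSq_resc_le
  obtain ⟨D, c₀, hc₀, hD⟩ := exists_lintegral_sub_sq_le
  have hc₀' : (0 : ℝ) < c₀ := hc₀
  refine ⟨(D + 1) * (16 * π ^ 2 + B ^ 2), min 1 (c₀ / B), by positivity, by positivity,
    fun {T v} hv {ν₀ ν ε} h0 hε hT hbes hhs hsm hν hν' => ?_⟩
  have hνp : 0 < ν := by linarith
  obtain ⟨K, hK⟩ := hv.exists_hOne_le
  have hsol : ∀ {μ}, 0 < μ → μ ≤ ν₀ → ∃ K', IsSol (3 * μ / (2 * π * ν₀)) (resc v ν₀ μ 0 1) K' 1 := by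
    intro μ hμ hμ'
    have hz : (0 : ℝ) ∈ Icc 0 T := ⟨le_rfl, hv.pos.le⟩
    have hmem : 0 + μ ^ 3 / (4 * π ^ 2) * 1 ∈ Icc 0 T := by
      rw [zero_add, mul_one]
      exact ⟨by positivity, le_trans (by gcongr) hT⟩
    have := hv.isSol_resc (A := ν₀) (ν := μ) (s := 0) (σ := 1) h0 hμ.ne' (by rwa [abs_of_pos hμ])
      ⟨zero_le_one, le_rfl⟩ hz hmem
      fun t ht => hK t ((convex_Icc 0 T).ordConnected.uIcc_subset hz hmem ht)
    rwa [abs_of_pos hμ] at this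
  obtain ⟨K₁, hs₁⟩ := hsol hνp hν'
  obtain ⟨K₂, hs₂⟩ := hsol h0 le_rfl
  have h1 : ν₀ * ε ≤ 1 := hsm.trans (min_le_left _ _)
  have h2 : B * (ν₀ * ε) ≤ c₀ := by
    have := hsm.trans (min_le_right _ _)
    rw [le_div_iff₀ hB0] at this
    linarith
  have hx : 0 < ν₀ * ε := by positivity
  have he : ENNReal.ofReal (B * (ν₀ * ε) ^ 2) ≤ c₀ := by
    rw [← ENNReal.ofReal_coe_nnreal]
    refine ENNReal.ofReal_le_ofReal ?_
    nlinarith [mul_le_mul_of_nonneg_left h1 (mul_pos hB0 hx).le]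
  have key := hD hs₁ hs₂ (e := ENNReal.ofReal (B * (ν₀ * ε) ^ 2))
    (ENNReal.ofReal_pos.2 (by positivity)) he (hB v h0 hνp hbes) (hB v h0 h0 hbes)
  refine key.trans ?_
  have hκ : ENNReal.ofReal |3 * ν / (2 * π * ν₀) - 3 * ν₀ / (2 * π * ν₀)| *
      ENNReal.ofReal (B * (ν₀ * ε) ^ 2) ≤ ENNReal.ofReal (B * ((ν₀ - ν) * ε)) := by
    rw [← ENNReal.ofReal_mul (abs_nonneg _)]
    refine ENNReal.ofReal_le_ofReal ?_
    have hd : 0 ≤ ν₀ - ν := by linarith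
    have e : |3 * ν / (2 * π * ν₀) - 3 * ν₀ / (2 * π * ν₀)| = 3 / (2 * π) * (ν₀ - ν) / ν₀ := by
      rw [← sub_div, ← mul_sub, abs_div, abs_mul, abs_sub_comm, abs_of_nonneg hd,
        abs_of_pos (by positivity : 0 < 2 * π * ν₀), abs_of_pos (by norm_num : (0 : ℝ) < 3)]
      field_simp
    have h3 : 3 / (2 * π) ≤ 1 := by
      rw [div_le_one (by positivity)]
      linarith [Real.pi_gt_three]
    rw [e]
    calc _ = 3 / (2 * π) * (B * ((ν₀ - ν) * ε)) * (ν₀ * ε) := by field_simp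
      _ ≤ 1 * (B * ((ν₀ - ν) * ε)) * 1 := by gcongr
      _ = _ := by ring
  calc _ ≤ (D : ℝ≥0∞) * (ENNReal.ofReal (16 * π ^ 2 * ((ν₀ - ν) * ε) ^ 2) +
        ENNReal.ofReal (B * ((ν₀ - ν) * ε)) ^ 2) :=
        mul_le_mul' le_rfl (add_le_add (lintegral_resc_zero_sub_le v h0 hν hν' hhs)
          (pow_le_pow_left' hκ 2))
    _ = ENNReal.ofReal (D * (16 * π ^ 2 * ((ν₀ - ν) * ε) ^ 2 + (B * ((ν₀ - ν) * ε)) ^ 2)) := by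
        have hd : 0 ≤ ν₀ - ν := by linarith
        rw [← ENNReal.ofReal_pow (by positivity), ← ENNReal.ofReal_add (by positivity)
          (by positivity), ← ENNReal.ofReal_coe_nnreal, ← ENNReal.ofReal_mul (by positivity)]
    _ ≤ _ := by
        refine ENNReal.ofReal_le_ofReal ?_
        have : 0 ≤ (16 * π ^ 2 + B ^ 2) * ((ν₀ - ν) * ε) ^ 2 := by positivity
        linarith

theorem measurable_resc (v : ℝ → 𝓢(ℝ, ℝ)) (A ν s σ τ : ℝ) : Measurable (resc v A ν s σ τ) := by
  unfold resc
  have := continuous_FT_schwartz (v (s + ν ^ 3 / (4 * π ^ 2) * min τ σ))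
  fun_prop

theorem hsNorm_half_le {f : ℝ → ℝ} (hf : Integrable f) {C ε : ℝ} (hC : 0 ≤ C) (hε : 0 ≤ ε)
    (h : ∫⁻ ξ, ENNReal.ofReal |ξ| * ‖FT f ξ‖ₑ ^ 2 ≤ ENNReal.ofReal (C * ε ^ 2)) :
    HsNorm (1 / 2) f ≤ √C * ε := by
  have hc := continuous_FT hf
  have e : ∫ ξ, |ξ| * ‖FT f ξ‖ ^ 2 ≤ C * ε ^ 2 := by
    rw [integral_eq_lintegral_of_nonneg_ae (Filter.Eventually.of_forall fun _ => by positivity)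
      (by fun_prop)]
    refine ENNReal.toReal_le_of_le_ofReal (by positivity) (le_trans (le_of_eq ?_) h)
    refine lintegral_congr fun ξ => ?_
    rw [ENNReal.ofReal_mul (abs_nonneg _), enorm_sq_eq_ofReal]
  unfold HsNorm
  norm_num only [mul_one_div_cancel, Real.rpow_one]
  rw [← Real.sqrt_eq_rpow]
  calc _ ≤ √(C * ε ^ 2) := Real.sqrt_le_sqrt e
    _ = _ := by rw [Real.sqrt_mul hC, Real.sqrt_sq hε]

theorem lintegral_rpow_neg_half_mul_dilate (w : ℝ → ℂ) (hw : Measurable w) {ν : ℝ} (hν : 0 < ν) :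
    ∫⁻ ζ, (ENNReal.ofReal (|ζ| ^ (-(1 / 2) : ℝ)) * (‖ζ / ν‖ₑ * ‖w (ζ / ν)‖ₑ)) ^ 2 =
      ∫⁻ ξ, ENNReal.ofReal |ξ| * ‖w ξ‖ₑ ^ 2 := by
  have e : ∀ ζ, (ENNReal.ofReal (|ζ| ^ (-(1 / 2) : ℝ)) * (‖ζ / ν‖ₑ * ‖w (ζ / ν)‖ₑ)) ^ 2 =
      ENNReal.ofReal ν⁻¹ * (ENNReal.ofReal |ζ / ν| * ‖w (ζ / ν)‖ₑ ^ 2) := fun ζ => by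
    have h1 : ‖ζ / ν‖ₑ ^ 2 = ‖ζ‖ₑ ^ 2 * ENNReal.ofReal (ν⁻¹ ^ 2) := by
      rw [div_eq_mul_inv, enorm_mul, mul_pow, Real.enorm_of_nonneg (inv_nonneg.2 hν.le),
        ENNReal.ofReal_pow (inv_nonneg.2 hν.le)]
    rw [mul_pow, mul_pow, h1, ← mul_assoc, ← mul_assoc, ofReal_rpow_neg_half_sq_mul, ← mul_assoc,
      ← ENNReal.ofReal_mul (abs_nonneg _), ← ENNReal.ofReal_mul (inv_nonneg.2 hν.le), abs_div,
      abs_of_pos hν]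
    congr 2
    field_simp
  simp_rw [e]
  rw [lintegral_const_mul' _ _ ENNReal.ofReal_ne_top,
    lintegral_comp_div (g := fun ξ => ENNReal.ofReal |ξ| * ‖w ξ‖ₑ ^ 2) (by fun_prop) hν.ne',
    ← mul_assoc, abs_of_pos hν, ← ENNReal.ofReal_mul (inv_nonneg.2 hν.le),
    inv_mul_cancel₀ hν.ne', ENNReal.ofReal_one, one_mul]

theorem enorm_mul_enorm_le (a y : ℝ) (z : ℂ) :
    ‖y‖ₑ * ‖z‖ₑ ≤ ‖Complex.exp (a * Complex.I) * (2 * π * Complex.I * y * z)‖ₑ := by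
  rw [← ofReal_norm y, ← ofReal_norm z, ← ofReal_norm, ← ENNReal.ofReal_mul (norm_nonneg _)]
  refine ENNReal.ofReal_le_ofReal ?_
  rw [norm_mul, Complex.norm_exp_ofReal_mul_I, one_mul, norm_mul, norm_mul, Complex.norm_real]
  have h : 1 ≤ ‖2 * (π : ℂ) * Complex.I‖ := by
    simp only [norm_mul, Complex.norm_real, Complex.norm_I, RCLike.norm_ofNat,
      Real.norm_of_nonneg Real.pi_pos.le]
    linarith [Real.pi_gt_three]
  have h0 : 0 ≤ ‖y‖ * ‖z‖ := by positivity
  nlinarith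

theorem exists_hsNorm_LNL_le : ∃ C c : ℝ, 0 < C ∧ 0 < c ∧
    ∀ {T : ℝ} {v : ℝ → 𝓢(ℝ, ℝ)}, IsFlow T v → ∀ {ν₀ ε : ℝ}, 0 < ν₀ → 0 < ε →
    ν₀ ^ 3 / (4 * π ^ 2) ≤ T → BesovNorm (v 0) ≤ ε →
    HsNorm (1 / 2) (fun x => x * v 0 x) ≤ ε → ν₀ * ε ≤ c →
    HsNorm (1 / 2) (LNL (ν₀ ^ 3 / (4 * π ^ 2)) (v (ν₀ ^ 3 / (4 * π ^ 2)))) ≤ C * ε := by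
  obtain ⟨C, c, hC, hc, h⟩ := exists_lintegral_resc_sub_le
  refine ⟨√C, c, Real.sqrt_pos.2 hC, hc, fun {T v} hv {ν₀ ε} h0 hε hT hbes hhs hsm => ?_⟩
  have hd := hv.hasDerivWithinAt_resc h0 hT
  have hli := integrable_LNL (ν₀ ^ 3 / (4 * π ^ 2)) (v (ν₀ ^ 3 / (4 * π ^ 2)))
  refine hsNorm_half_le hli hC.le hε.le ?_
  set w := FT (LNL (ν₀ ^ 3 / (4 * π ^ 2)) (v (ν₀ ^ 3 / (4 * π ^ 2)))) with hw
  have hwm : Measurable w := (continuous_FT hli).measurable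
  rw [← lintegral_rpow_neg_half_mul_dilate w hwm h0]
  set x : ℕ → ℝ := fun k => ν₀ - ν₀ / ((k : ℝ) + 2) with hx
  have hx1 : ∀ k, x k < ν₀ := fun k => by
    have : 0 < ν₀ / ((k : ℝ) + 2) := by positivity
    simp only [hx]
    linarith
  have hx2 : ∀ k, ν₀ / 2 ≤ x k := fun k => by
    have : ν₀ / ((k : ℝ) + 2) ≤ ν₀ / 2 := by
      gcongr
      linarith [(Nat.cast_nonneg k : (0 : ℝ) ≤ k)]
    simp only [hx]
    linarith
  have hxt : Filter.Tendsto x Filter.atTop (nhdsWithin ν₀ (Ioc 0 ν₀ \ {ν₀})) := by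
    refine tendsto_nhdsWithin_iff.2 ⟨?_, Filter.Eventually.of_forall fun k =>
      ⟨⟨by linarith [hx2 k], (hx1 k).le⟩, (hx1 k).ne⟩⟩
    have h1 : Filter.Tendsto (fun k : ℕ => ν₀ / ((k : ℝ) + 2)) Filter.atTop (nhds 0) :=
      (Filter.tendsto_atTop_add_const_right _ _ tendsto_natCast_atTop_atTop).const_div_atTop ν₀
    simpa using h1.const_sub ν₀
  have hlim : ∀ ζ, Filter.Tendsto (fun k => (ENNReal.ofReal (|ζ| ^ (-(1 / 2) : ℝ)) *
      ‖slope (fun ν => resc v ν₀ ν 0 1 1 ζ) ν₀ (x k)‖ₑ) ^ 2) Filter.atTop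
      (nhds ((ENNReal.ofReal (|ζ| ^ (-(1 / 2) : ℝ)) *
        ‖Complex.exp ((-(8 * π ^ 3 * (ζ / ν₀) ^ 3) * (ν₀ ^ 3 / (4 * π ^ 2)) : ℝ) * Complex.I) *
          (2 * π * Complex.I * (ζ / ν₀ : ℝ) * w (ζ / ν₀))‖ₑ) ^ 2)) := fun ζ => by
    have h1 := (hasDerivWithinAt_iff_tendsto_slope.1 (hd ζ)).comp hxt
    exact (ENNReal.continuous_pow 2).tendsto _ |>.comp
      (ENNReal.Tendsto.const_mul h1.enorm (Or.inr ENNReal.ofReal_ne_top))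
  calc _ ≤ ∫⁻ ζ, (ENNReal.ofReal (|ζ| ^ (-(1 / 2) : ℝ)) *
        ‖Complex.exp ((-(8 * π ^ 3 * (ζ / ν₀) ^ 3) * (ν₀ ^ 3 / (4 * π ^ 2)) : ℝ) * Complex.I) *
          (2 * π * Complex.I * (ζ / ν₀ : ℝ) * w (ζ / ν₀))‖ₑ) ^ 2 := by
        refine lintegral_mono fun ζ => pow_le_pow_left' (mul_le_mul' le_rfl ?_) 2
        exact enorm_mul_enorm_le _ _ _
    _ = ∫⁻ ζ, Filter.liminf (fun k => (ENNReal.ofReal (|ζ| ^ (-(1 / 2) : ℝ)) *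
          ‖slope (fun ν => resc v ν₀ ν 0 1 1 ζ) ν₀ (x k)‖ₑ) ^ 2) Filter.atTop :=
        lintegral_congr fun ζ => (hlim ζ).liminf_eq.symm
    _ ≤ Filter.liminf (fun k => ∫⁻ ζ, (ENNReal.ofReal (|ζ| ^ (-(1 / 2) : ℝ)) *
          ‖slope (fun ν => resc v ν₀ ν 0 1 1 ζ) ν₀ (x k)‖ₑ) ^ 2) Filter.atTop := by
        refine lintegral_liminf_le fun k => ?_
        have m1 := measurable_resc v ν₀ (x k) 0 1 1
        have m2 := measurable_resc v ν₀ ν₀ 0 1 1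
        simp only [slope_def_module]
        fun_prop
    _ ≤ _ := by
        refine Filter.liminf_le_of_frequently_le' (Filter.Frequently.of_forall fun k => ?_)
        have hk : 0 < ν₀ - x k := by linarith [hx1 k]
        have e : ∀ ζ, (ENNReal.ofReal (|ζ| ^ (-(1 / 2) : ℝ)) *
            ‖slope (fun ν => resc v ν₀ ν 0 1 1 ζ) ν₀ (x k)‖ₑ) ^ 2 =
            ENNReal.ofReal ((ν₀ - x k)⁻¹ ^ 2) * (ENNReal.ofReal (|ζ| ^ (-(1 / 2) : ℝ)) *
              ‖resc v ν₀ (x k) 0 1 1 ζ - resc v ν₀ ν₀ 0 1 1 ζ‖ₑ) ^ 2 := fun ζ => by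
          rw [slope_def_module, enorm_smul, ← enorm_neg, ← inv_neg, neg_sub,
            Real.enorm_of_nonneg (by positivity), ENNReal.ofReal_pow (by positivity)]
          ring
        simp_rw [e]
        rw [lintegral_const_mul' _ _ ENNReal.ofReal_ne_top]
        refine (mul_le_mul' le_rfl (h hv h0 hε hT hbes hhs hsm (hx2 k) (hx1 k).le)).trans_eq ?_
        rw [← ENNReal.ofReal_mul (by positivity)]
        congr 1
        field_simp

/-- Uniform `Ḣ^{1/2}` bounds for `L^{NL}u` on the quartic time scale. -/
theorem LNL_H_half_bound :
    ∃ C ε₀ : ℝ, 0 < C ∧ 0 < ε₀ ∧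
      ∀ M : ℝ, 1 ≤ M → ∃ c : ℝ, 0 < c ∧
      ∀ ε : ℝ, 0 < ε → ε ≤ ε₀ → ∀ T : ℝ, 0 < T → T ≤ c * ε ^ (-(3:ℝ)) →
      ∀ u : ℝ → ℝ → ℝ, IsKdVOn (Set.Icc 0 T) u →
        BesovNorm (u 0) + HsNorm ((1:ℝ)/2) (fun x => x * u 0 x) ≤ ε →
        (∀ t : ℝ, 0 < t → t ≤ T → Bootstrap M ε t (u t)) →
        ∀ t : ℝ, 0 < t → t ≤ T → HsNorm ((1:ℝ)/2) (LNL t (u t)) ≤ C * ε := by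
  obtain ⟨C, c, hC, hc, h⟩ := exists_hsNorm_LNL_le
  refine ⟨C, 1, hC, one_pos, fun M _ => ⟨c ^ 3 / (4 * π ^ 2), by positivity, ?_⟩⟩
  intro ε hε _ T hT hTε u hu hdata _ t ht htT
  obtain ⟨v, hv, huv⟩ := exists_isFlow hT hu
  have hu0 : u 0 = v 0 := funext (huv 0 ⟨le_rfl, hT.le⟩)
  have hut : u t = v t := funext (huv t ⟨ht.le, htT⟩)
  rw [hu0] at hdata
  have hb := besovNorm_nonneg (v 0)
  have hs := hsNorm_nonneg (1 / 2) (fun x => x * v 0 x)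
  have hp : 0 < 4 * π ^ 2 * t := by positivity
  set ν := (4 * π ^ 2 * t) ^ (1 / 3 : ℝ) with hν
  have hν0 : 0 < ν := by positivity
  have hν3 : ν ^ 3 = 4 * π ^ 2 * t := by
    rw [hν, ← Real.rpow_natCast, ← Real.rpow_mul hp.le]
    norm_num
  have hνt : ν ^ 3 / (4 * π ^ 2) = t := by
    rw [hν3]
    field_simp
  have hsm : ν * ε ≤ c := by
    refine le_of_pow_le_pow_left₀ (n := 3) (by norm_num) hc.le ?_
    have h1 := htT.trans hTε
    have h2 : ε ^ (-(3 : ℝ)) = (ε ^ 3)⁻¹ := by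
      rw [Real.rpow_neg hε.le]
      norm_cast
    rw [h2, ← div_eq_mul_inv, div_div, le_div_iff₀ (by positivity)] at h1
    rw [mul_pow, hν3]
    linarith
  have := h hv hν0 hε (hνt.trans_le htT) (by linarith) (by linarith) hsm
  rwa [hνt, ← hut] at this
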